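/- For every Δ ∈ ℕ and all 0 < α, ν < 1, there exist ξ, η > 0 and n₀ ∈ ℕ such that the following holds for all n ≥ n₀. Suppose G is an n-vertex graph such that d_G(v) = (α ± ξ)n for all vertices v ∈ V(G) except at most ξn vertices, and the bi-independence number satisfies ᾶ(G) ≤ ηn. Then any collection 𝒯 of trees T satisfying (i) |T| ≤ (1−ν)n and Δ(T) ≤ Δ for all T ∈ 𝒯, and (ii) e(𝒯) ≤ (1−ν)e(G), packs into G. -/

import Mathlib

open SimpleGraph

namespace ApproxDecomp

/-- The degree of a vertex, as the cardinality of its neighbour set. -/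
noncomputable def deg {V : Type*} (G : SimpleGraph V) (v : V) : ℕ :=
  (G.neighborSet v).ncard

/-- An `(s,t)`-bipartite hole: two disjoint vertex sets of sizes `s`, `t`
with no edges between them. -/
def HasBipartiteHole {V : Type*} (G : SimpleGraph V) (s t : ℕ) : Prop :=
  ∃ S T : Finset V, Disjoint S T ∧ S.card = s ∧ T.card = t ∧
    ∀ a ∈ S, ∀ b ∈ T, ¬ G.Adj a b

/-- The bi-independence number: the largest `r` such that `G` has an
`(s,t)`-bipartite hole for every `s + t = r`. -/
noncomputable def biIndep {V : Type*} (G : SimpleGraph V) : ℕ :=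
  sSup {r : ℕ | ∀ s t : ℕ, s + t = r → HasBipartiteHole G s t}

/-- A collection of graphs `T i` packs into `G`: there are embeddings whose
edge images are pairwise disjoint. -/
def PacksInto {V : Type*} {τ : ℕ} {m : Fin τ → ℕ}
    (T : ∀ i, SimpleGraph (Fin (m i))) (G : SimpleGraph V) : Prop :=
  ∃ φ : ∀ i, Fin (m i) → V,
    (∀ i, Function.Injective (φ i)) ∧
    (∀ i a b, (T i).Adj a b → G.Adj (φ i a) (φ i b)) ∧
    (∀ i j, i ≠ j → ∀ e ∈ (T i).edgeSet, ∀ f ∈ (T j).edgeSet,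
      Sym2.map (φ i) e ≠ Sym2.map (φ j) f)

section

/-- Rooted tree on `{0,…,m-1}` with parents preceding children. -/
structure PTree (Δ : ℕ) where
  m : ℕ
  p : ℕ → ℕ
  hm : 1 ≤ m
  hp : ∀ v, 1 ≤ v → p v < v
  hch : ∀ u, ((Finset.range m).filter (fun v => 1 ≤ v ∧ p v = u)).card ≤ Δ

theorem tree_to_pt {Δ m : ℕ} (T : SimpleGraph (Fin m)) (hT : T.IsTree) (hΔ : ∀ v, deg T v ≤ Δ) :
    ∃ P : PTree Δ, P.m = m ∧ ∃ g : Fin m → ℕ, Function.Injective g ∧ (∀ a, g a < m) ∧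
      ∀ a b, T.Adj a b → (1 ≤ g a ∧ P.p (g a) = g b) ∨ (1 ≤ g b ∧ P.p (g b) = g a) := by
  classical
  obtain ⟨r⟩ := hT.1.nonempty
  have hm : 1 ≤ m := by have := r.2; omega
  let f : Fin m → ℕ := fun a => T.dist r a
  let σ := Tuple.sort f
  have hmono : Monotone (f ∘ σ) := Tuple.monotone_sort f
  have hlt : ∀ a b, f a < f b → σ.symm a < σ.symm b := by
    intro a b hab
    by_contra hc
    push Not at hc
    have := hmono hc
    simp at this
    omega
  have hpar : ∀ a, a ≠ r → ∃ b, T.Adj a b ∧ f a = f b + 1 := by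
    intro a ha
    obtain ⟨w, hw⟩ := hT.1.exists_walk_length_eq_dist a r
    cases w with
    | nil => exact absurd rfl ha
    | @cons _ b _ hab w =>
      refine ⟨b, hab, ?_⟩
      have h1 : T.dist b r ≤ w.length := SimpleGraph.dist_le w
      have h2 : T.dist a r = w.length + 1 := by rw [← hw]; simp
      have h3 := hT.dist_eq_dist_add_one_of_adj r hab
      simp only [f]
      rw [SimpleGraph.dist_comm] at h1 h2
      omega
  have hpar' : ∀ a, ∃ b, a ≠ r → T.Adj a b ∧ f a = f b + 1 := by
    intro a
    by_cases ha : a = r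
    · exact ⟨r, fun h => absurd ha h⟩
    · obtain ⟨b, hb⟩ := hpar a ha; exact ⟨b, fun _ => hb⟩
  choose par hpar2 using hpar'
  have hr0 : σ.symm r = ⟨0, hm⟩ := by
    have h1 : (⟨0, hm⟩ : Fin m) ≤ σ.symm r := Nat.zero_le _
    have h2 := hmono h1
    simp only [Function.comp_apply, Equiv.apply_symm_apply] at h2
    have h3 : f r = 0 := by simp [f]
    rw [h3] at h2
    have h4 : σ ⟨0, hm⟩ = r := by
      have h5 : T.dist r (σ ⟨0, hm⟩) = 0 := Nat.le_zero.mp h2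
      rw [hT.1.dist_eq_zero_iff] at h5
      exact h5.symm
    rw [← h4]; simp
  have hne : ∀ v (h : v < m), 1 ≤ v → σ ⟨v, h⟩ ≠ r := by
    intro v h hv he
    have : σ.symm r = ⟨v, h⟩ := by rw [← he]; simp
    rw [hr0] at this
    simp at this; omega
  let p : ℕ → ℕ := fun v => if h : v < m ∧ 1 ≤ v then (σ.symm (par (σ ⟨v, h.1⟩)) : ℕ) else 0
  have hpdef : ∀ a, a ≠ r → p (σ.symm a) = σ.symm (par a) := by
    intro a ha
    have h1 : 1 ≤ (σ.symm a : ℕ) := by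
      by_contra hc
      apply ha
      have h2 : σ.symm a = σ.symm r := by rw [hr0]; ext; simp; omega
      exact σ.symm.injective h2
    simp only [p]
    rw [dif_pos ⟨(σ.symm a).2, h1⟩]
    simp
  have hgr : ∀ a, a ≠ r → 1 ≤ (σ.symm a : ℕ) := by
    intro a ha
    by_contra hc
    apply ha
    have h2 : σ.symm a = σ.symm r := by rw [hr0]; ext; simp; omega
    exact σ.symm.injective h2
  refine ⟨⟨m, p, hm, ?_, ?_⟩, rfl, fun a => (σ.symm a : ℕ), ?_, ?_, ?_⟩
  · intro v hv
    by_cases h : v < m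
    · have h1 := hpdef (σ ⟨v, h⟩) (hne v h hv)
      simp only [Equiv.symm_apply_apply] at h1
      rw [h1]
      have h2 := hpar2 (σ ⟨v, h⟩) (hne v h hv)
      have h3 := hlt (par (σ ⟨v, h⟩)) (σ ⟨v, h⟩) (by omega)
      simp only [Equiv.symm_apply_apply] at h3
      exact h3
    · simp only [p]
      rw [dif_neg (fun h' => h h'.1)]; omega
  · intro u
    by_cases hu : u < m
    · refine le_trans ?_ (hΔ (σ ⟨u, hu⟩))
      unfold deg
      rw [Set.ncard_eq_toFinset_card']
      refine Finset.card_le_card_of_injOn (fun v => if h : v < m then σ ⟨v, h⟩ else r) ?_ ?_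
      · intro v hv
        simp only [Finset.coe_filter, Finset.mem_range, Set.mem_ofPred_eq] at hv
        obtain ⟨h1, h2, h3⟩ := hv
        simp only [dif_pos h1]
        have h4 := hpdef (σ ⟨v, h1⟩) (hne v h1 h2)
        simp only [Equiv.symm_apply_apply] at h4
        rw [h4] at h3
        have h5 := (hpar2 (σ ⟨v, h1⟩) (hne v h1 h2)).1
        have h6 : par (σ ⟨v, h1⟩) = σ ⟨u, hu⟩ := by
          apply σ.symm.injective
          simp only [Equiv.symm_apply_apply]
          ext; exact h3
        rw [h6] at h5
        simpa using h5.symm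
      · intro v hv v' hv' he
        simp only [Finset.coe_filter, Finset.mem_range, Set.mem_ofPred_eq] at hv hv'
        simp only [dif_pos hv.1, dif_pos hv'.1] at he
        have := σ.injective he
        simpa using this
    · rw [Finset.card_eq_zero.mpr]
      · exact Nat.zero_le _
      · apply Finset.filter_eq_empty_iff.mpr
        rintro v hv ⟨h1, h2⟩
        simp only [Finset.mem_range] at hv
        have h4 := hpdef (σ ⟨v, hv⟩) (hne v hv h1)
        simp only [Equiv.symm_apply_apply] at h4
        rw [h4] at h2
        have := (σ.symm (par (σ ⟨v, hv⟩))).2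
        omega
  · intro a b h
    simp only at h
    exact σ.symm.injective (Fin.ext h)
  · intro a; exact (σ.symm a).2
  · -- all edges are parent edges
    have himg : (Finset.univ.erase r).image (fun a => s(a, par a)) = T.edgeFinset := by
      apply Finset.eq_of_subset_of_card_le
      · intro e he
        simp only [Finset.mem_image, Finset.mem_erase, Finset.mem_univ, and_true] at he
        obtain ⟨a, ha, rfl⟩ := he
        simpa using (hpar2 a ha).1
      · rw [Finset.card_image_of_injOn]
        · have := hT.card_edgeFinset
          simp only [Fintype.card_fin] at this
          rw [Finset.card_erase_of_mem (Finset.mem_univ r)]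
          simp only [Finset.card_univ, Fintype.card_fin]
          omega
        · intro a ha b hb hab
          simp only [Finset.coe_erase, Finset.coe_univ, Set.mem_sdiff, Set.mem_univ, true_and, Set.mem_singleton_iff] at ha hb
          simp only [Sym2.eq_iff] at hab
          rcases hab with h | h
          · exact h.1
          · have h1 := (hpar2 a ha).2
            have h2 := (hpar2 b hb).2
            rw [h.2] at h1
            rw [← h.1] at h2
            omega
    intro a b hab
    have he : s(a, b) ∈ (Finset.univ.erase r).image (fun a => s(a, par a)) := by
      rw [himg]; simpa using hab
    simp only [Finset.mem_image, Finset.mem_erase, Finset.mem_univ, and_true, Sym2.eq_iff] at he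
    obtain ⟨c, hc, h | h⟩ := he
    · left
      obtain ⟨rfl, rfl⟩ := h
      exact ⟨hgr c hc, hpdef c hc⟩
    · right
      obtain ⟨rfl, rfl⟩ := h
      exact ⟨hgr c hc, hpdef c hc⟩

end

section

/-- Glue the root of `Q` onto the last vertex of `P`. -/
def glue {Δ : ℕ} (P Q : PTree Δ) : PTree Δ where
  m := P.m + Q.m - 1
  p := fun v => if v < P.m then P.p v else (P.m - 1) + Q.p (v - (P.m - 1))
  hm := by have := P.hm; have := Q.hm; omega
  hp := by
    intro v hv
    split_ifs with h
    · exact P.hp v hv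
    · have h1 := P.hm
      have := Q.hp (v - (P.m - 1)) (by omega)
      omega
  hch := by
    intro u
    have hPm := P.hm
    by_cases hu : u < P.m - 1
    · refine le_trans (Finset.card_le_card ?_) (P.hch u)
      intro v hv
      simp only [Finset.mem_filter, Finset.mem_range] at hv ⊢
      obtain ⟨h1, h2, h3⟩ := hv
      split_ifs at h3 with h
      · exact ⟨h, h2, h3⟩
      · omega
    · refine le_trans ?_ (Q.hch (u - (P.m - 1)))
      refine Finset.card_le_card_of_injOn (fun v => v - (P.m - 1)) ?_ ?_
      · intro v hv
        simp only [Finset.coe_filter, Finset.mem_range, Set.mem_ofPred_eq] at hv ⊢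
        obtain ⟨h1, h2, h3⟩ := hv
        split_ifs at h3 with h
        · have := P.hp v h2; omega
        · refine ⟨by omega, by omega, by omega⟩
      · intro v hv v' hv' he
        simp only [Finset.coe_filter, Finset.mem_range, Set.mem_ofPred_eq] at hv hv' he
        obtain ⟨h1, h2, h3⟩ := hv
        obtain ⟨h1', h2', h3'⟩ := hv'
        split_ifs at h3 with h
        · have := P.hp v h2; omega
        · split_ifs at h3' with h'
          · have := P.hp v' h2'; omega
          · omega

/-- Grouping data. -/
def Grouping {Δ τ : ℕ} (P : Fin τ → PTree Δ) (q : ℕ) (S : Finset ℕ) : Prop :=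
  ∃ (P' : ℕ → PTree Δ) (gr off : Fin τ → ℕ),
    (∀ i, gr i ∈ S ∧ off i + (P i).m ≤ (P' (gr i)).m ∧
      ∀ v, 1 ≤ v → v < (P i).m → (P' (gr i)).p (off i + v) = off i + (P i).p v) ∧
    (∀ i i', i ≠ i' → gr i = gr i' → ∀ v v', 1 ≤ v → v < (P i).m → 1 ≤ v' → v' < (P i').m →
      off i + v ≠ off i' + v') ∧
    (∑ j ∈ S, ((P' j).m - 1) = ∑ i, ((P i).m - 1)) ∧
    (∀ j ∈ S, (P' j).m - 1 ≤ q)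

theorem grouping_merge {Δ τ : ℕ} {P : Fin τ → PTree Δ} {q : ℕ} {S : Finset ℕ}
    {P' : ℕ → PTree Δ} {gr off : Fin τ → ℕ}
    (h1 : ∀ i, gr i ∈ S ∧ off i + (P i).m ≤ (P' (gr i)).m ∧
      ∀ v, 1 ≤ v → v < (P i).m → (P' (gr i)).p (off i + v) = off i + (P i).p v)
    (h2 : ∀ i i', i ≠ i' → gr i = gr i' → ∀ v v', 1 ≤ v → v < (P i).m → 1 ≤ v' → v' < (P i').m →
      off i + v ≠ off i' + v')
    (h3 : ∑ j ∈ S, ((P' j).m - 1) = ∑ i, ((P i).m - 1))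
    (h4 : ∀ j ∈ S, (P' j).m - 1 ≤ q) {a b : ℕ} (ha : a ∈ S) (hb : b ∈ S) (hab : a ≠ b)
    (hq : (P' a).m - 1 + ((P' b).m - 1) ≤ q) : Grouping P q (S.erase b) := by
  classical
  have hma := (P' a).hm
  have hmb := (P' b).hm
  refine ⟨Function.update P' a (glue (P' a) (P' b)), fun i => if gr i = b then a else gr i,
    fun i => if gr i = b then (P' a).m - 1 + off i else off i, ?_, ?_, ?_, ?_⟩
  · intro i
    obtain ⟨g1, g2, g3⟩ := h1 i
    have hmi := (P i).hm
    by_cases hi : gr i = b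
    · simp only [hi, if_true, Function.update_self]
      rw [hi] at g2 g3
      refine ⟨Finset.mem_erase.mpr ⟨hab, ha⟩, ?_, ?_⟩
      · simp only [glue]; omega
      · intro v hv hv'
        simp only [glue]
        rw [if_neg (by omega)]
        have : (P' a).m - 1 + off i + v - ((P' a).m - 1) = off i + v := by omega
        rw [this, g3 v hv hv']; omega
    · simp only [hi, if_false]
      refine ⟨Finset.mem_erase.mpr ⟨hi, g1⟩, ?_, ?_⟩
      · by_cases hi2 : gr i = a
        · rw [hi2] at g2 ⊢
          simp only [Function.update_self, glue]; omega
        · rw [Function.update_of_ne hi2]; exact g2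
      · intro v hv hv'
        by_cases hi2 : gr i = a
        · rw [hi2] at g2 g3 ⊢
          simp only [Function.update_self, glue]
          rw [if_pos (by omega)]
          exact g3 v hv hv'
        · rw [Function.update_of_ne hi2]; exact g3 v hv hv'
  · intro i i' hii hgr v v' hv hvm hv' hvm'
    obtain ⟨g1, g2, g3⟩ := h1 i
    obtain ⟨g1', g2', g3'⟩ := h1 i'
    by_cases hi : gr i = b <;> by_cases hi' : gr i' = b
    · have := h2 i i' hii (by rw [hi, hi']) v v' hv hvm hv' hvm'
      simp only [hi, hi', if_true]; omega
    · simp only [hi, hi', if_true, if_false] at hgr ⊢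
      rw [← hgr] at g2'
      omega
    · simp only [hi, hi', if_true, if_false] at hgr ⊢
      rw [hgr] at g2
      omega
    · simp only [hi, hi', if_false] at hgr ⊢
      exact h2 i i' hii hgr v v' hv hvm hv' hvm'
  · have e1 := Finset.add_sum_erase S (fun j => (P' j).m - 1) hb
    have ha' : a ∈ S.erase b := Finset.mem_erase.mpr ⟨hab, ha⟩
    have e2 := Finset.add_sum_erase (S.erase b) (fun j => (P' j).m - 1) ha'
    have e3 := Finset.add_sum_erase (S.erase b)
      (fun j => ((Function.update P' a (glue (P' a) (P' b))) j).m - 1) ha'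
    have e4 : ∑ j ∈ (S.erase b).erase a, (((Function.update P' a (glue (P' a) (P' b))) j).m - 1)
        = ∑ j ∈ (S.erase b).erase a, ((P' j).m - 1) := by
      apply Finset.sum_congr rfl
      intro j hj
      rw [Function.update_of_ne (Finset.ne_of_mem_erase hj)]
    simp only [Function.update_self] at e3
    have e5 : (glue (P' a) (P' b)).m = (P' a).m + (P' b).m - 1 := rfl
    rw [e5] at e3
    rw [← h3]
    omega
  · intro j hj
    by_cases hja : j = a
    · subst hja
      simp only [Function.update_self, glue]; omega
    · rw [Function.update_of_ne hja]; exact h4 j (Finset.mem_of_mem_erase hj)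

/-- Grouping lemma. -/
theorem grouping {Δ τ : ℕ} (P : Fin τ → PTree Δ) (q : ℕ) (hq : ∀ i, (P i).m - 1 ≤ q) :
    ∃ (τ' : ℕ) (P' : Fin τ' → PTree Δ) (gr : Fin τ → Fin τ') (off : Fin τ → ℕ),
    (∀ i, off i + (P i).m ≤ (P' (gr i)).m ∧
      ∀ v, 1 ≤ v → v < (P i).m → (P' (gr i)).p (off i + v) = off i + (P i).p v) ∧
    (∀ i i', i ≠ i' → gr i = gr i' → ∀ v v', 1 ≤ v → v < (P i).m → 1 ≤ v' → v' < (P i').m →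
      off i + v ≠ off i' + v') ∧
    (∑ j, ((P' j).m - 1) = ∑ i, ((P i).m - 1)) ∧
    (∀ j, (P' j).m - 1 ≤ q) ∧
    τ' * q ≤ 2 * ∑ i, ((P i).m - 1) + q := by
  classical
  have hex : ∃ k, ∃ S, S.card = k ∧ Grouping P q S := by
    by_cases hτ : 0 < τ
    · refine ⟨_, Finset.range τ, rfl, fun j => if h : j < τ then P ⟨j, h⟩ else P ⟨0, hτ⟩, fun i => i.1, fun _ => 0, ?_, ?_, ?_, ?_⟩
      · intro i
        refine ⟨by simp, ?_, ?_⟩ <;> simp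
      · intro i i' h h'
        exact absurd (Fin.ext h') h
      · rw [Finset.sum_range]
        apply Finset.sum_congr rfl
        intro i _
        simp
      · intro j hj
        simp only [Finset.mem_range] at hj
        simp only [dif_pos hj]
        exact hq _
    · have : τ = 0 := by omega
      subst this
      refine ⟨0, ∅, rfl, fun _ => ⟨1, fun _ => 0, le_rfl, fun v hv => hv, fun u => ?_⟩, fun _ => 0, fun _ => 0,
        fun i => i.elim0, fun i => i.elim0, by simp, by simp⟩
      rw [Finset.card_eq_zero.mpr]
      · exact Nat.zero_le _
      · apply Finset.filter_eq_empty_iff.mpr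
        intro v hv
        simp only [Finset.mem_range] at hv
        omega
  obtain ⟨S, hS, hG⟩ := Nat.find_spec hex
  have hmin : ∀ S', Grouping P q S' → S.card ≤ S'.card := by
    intro S' h'
    rw [hS]
    exact Nat.find_min' hex ⟨S', rfl, h'⟩
  obtain ⟨P', gr, off, h1, h2, h3, h4⟩ := hG
  have hpair : ∀ a ∈ S, ∀ b ∈ S, a ≠ b → q ≤ (P' a).m - 1 + ((P' b).m - 1) := by
    intro a ha b hb hab
    by_contra hc
    have := hmin _ (grouping_merge h1 h2 h3 h4 ha hb hab (by omega))
    rw [Finset.card_erase_of_mem hb] at this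
    have : 0 < S.card := Finset.card_pos.mpr ⟨b, hb⟩
    omega
  let e := S.equivFin
  refine ⟨S.card, fun j => P' (e.symm j), fun i => e ⟨gr i, (h1 i).1⟩, off, ?_, ?_, ?_, ?_, ?_⟩
  · intro i
    simp only [Equiv.symm_apply_apply]
    exact (h1 i).2
  · intro i i' hi hgr
    have hg : gr i = gr i' := by
      have := e.injective hgr
      simpa using this
    exact h2 i i' hi hg
  · rw [← h3, ← Finset.sum_coe_sort S]
    exact Equiv.sum_comp e.symm (fun j => (P' j).m - 1)
  · intro j; exact h4 _ (e.symm j).2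
  · rw [← h3]
    by_cases hS1 : S.card ≤ 1
    · have : S.card * q ≤ 1 * q := Nat.mul_le_mul_right _ hS1
      omega
    · have hall : ∃ a ∈ S, ∀ b ∈ S, b ≠ a → q ≤ 2 * ((P' b).m - 1) := by
        obtain ⟨a, ha, hmn⟩ := Finset.exists_min_image S (fun a => (P' a).m - 1) (Finset.card_pos.mp (by omega))
        refine ⟨a, ha, fun b hb hba => ?_⟩
        have := hpair a ha b hb hba.symm
        have := hmn b hb
        omega
      obtain ⟨a, ha, hb⟩ := hall
      have e1 := Finset.add_sum_erase S (fun j => (P' j).m - 1) ha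
      have e2 : (S.erase a).card * q ≤ ∑ j ∈ S.erase a, 2 * ((P' j).m - 1) := by
        rw [← smul_eq_mul]
        apply Finset.card_nsmul_le_sum
        intro b hb'
        exact hb b (Finset.mem_of_mem_erase hb') (Finset.ne_of_mem_erase hb')
      rw [← Finset.mul_sum] at e2
      have e3 := Finset.card_erase_of_mem ha
      have e4 : S.card = (S.erase a).card + 1 := by omega
      rw [e4, add_mul]
      omega

end

section

theorem konig_regular {ι : Type*} [Fintype ι] [DecidableEq ι] :
    ∀ (D : ℕ) (M : ι → ι → ℕ), (∀ x, ∑ y, M x y = D) → (∀ y, ∑ x, M x y = D) →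
    ∃ σ : Fin D → Equiv.Perm ι, ∀ x y, (Finset.univ.filter (fun j => σ j x = y)).card = M x y := by
  intro D
  induction D with
  | zero =>
    intro M hr _
    refine ⟨fun j => 1, fun x y => ?_⟩
    have h := hr x
    rw [Finset.sum_eq_zero_iff] at h
    rw [h y (Finset.mem_univ y)]
    simp
  | succ D ih =>
    intro M hr hc
    obtain ⟨f, hf, hf2⟩ : ∃ f : ι → ι, Function.Injective f ∧
        ∀ x, f x ∈ Finset.univ.filter (fun y => 0 < M x y) := by
      rw [← Finset.all_card_le_biUnion_card_iff_exists_injective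
        (fun x => Finset.univ.filter (fun y => 0 < M x y))]
      intro s
      have h1 : (D + 1) * s.card ≤ (D + 1) *
          (s.biUnion (fun x => Finset.univ.filter (fun y => 0 < M x y))).card := by
        calc (D + 1) * s.card = ∑ x ∈ s, ∑ y, M x y := by
              rw [Finset.sum_congr rfl (fun x _ => hr x)]; simp [mul_comm]
          _ = ∑ x ∈ s, ∑ y ∈ s.biUnion (fun x => Finset.univ.filter (fun y => 0 < M x y)), M x y := by
              apply Finset.sum_congr rfl
              intro x hx
              symm
              apply Finset.sum_subset (Finset.subset_univ _)
              intro y _ hy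
              by_contra hne
              apply hy
              simp only [Finset.mem_biUnion, Finset.mem_filter, Finset.mem_univ, true_and]
              exact ⟨x, hx, Nat.pos_of_ne_zero hne⟩
          _ ≤ ∑ x, ∑ y ∈ s.biUnion (fun x => Finset.univ.filter (fun y => 0 < M x y)), M x y :=
              Finset.sum_le_sum_of_subset (Finset.subset_univ _)
          _ = ∑ y ∈ s.biUnion (fun x => Finset.univ.filter (fun y => 0 < M x y)), (D + 1) := by
              rw [Finset.sum_comm]; exact Finset.sum_congr rfl (fun y _ => hc y)
          _ = _ := by simp [mul_comm]
      exact Nat.le_of_mul_le_mul_left h1 (Nat.succ_pos D)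
    have hfb : Function.Bijective f := Finite.injective_iff_bijective.mp hf
    let π : Equiv.Perm ι := Equiv.ofBijective f hfb
    have hπ : ∀ x, 0 < M x (π x) := fun x => by
      have := hf2 x
      simp only [Finset.mem_filter, Finset.mem_univ, true_and] at this
      exact this
    have key := ih (fun x y => M x y - if π x = y then 1 else 0)
    refine Exists.elim (key ?_ ?_) ?_
    rotate_left 2
    · rintro σ hσ
      refine ⟨Fin.cons π σ, fun x y => ?_⟩
      have := hσ x y
      have h3 := hπ x
      rw [Finset.card_filter] at this ⊢
      rw [Fin.sum_univ_succ]
      simp only [Fin.cons_zero, Fin.cons_succ]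
      rw [this]
      split_ifs with h
      · subst h; omega
      · omega
    · intro x
      have h1 : ∑ y, (M x y - if π x = y then 1 else 0) + ∑ y, (if π x = y then 1 else 0) = ∑ y, M x y := by
        rw [← Finset.sum_add_distrib]
        apply Finset.sum_congr rfl
        intro y _
        split_ifs with h
        · subst h; have := hπ x; omega
        · omega
      rw [hr x] at h1
      simp at h1
      omega
    · intro y
      have h1 : ∑ x, (M x y - if π x = y then 1 else 0) + ∑ x, (if π x = y then 1 else 0) = ∑ x, M x y := by
        rw [← Finset.sum_add_distrib]
        apply Finset.sum_congr rfl
        intro x _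
        split_ifs with h
        · subst h; have := hπ x; omega
        · omega
      rw [hc y] at h1
      have h2 : ∑ x, (if π x = y then 1 else 0) = 1 := by
        rw [Finset.sum_eq_single (π.symm y)]
        · simp
        · intro b _ hb
          rw [if_neg]
          rintro rfl
          simp at hb
        · simp
      rw [h2] at h1
      omega

theorem konig_complete {ι : Type*} [Fintype ι] [DecidableEq ι] (D : ℕ) :
    ∀ (k : ℕ) (M : ι → ι → ℕ), (∀ x, ∑ y, M x y ≤ D) → (∀ y, ∑ x, M x y ≤ D) →
    D * Fintype.card ι ≤ ∑ x, ∑ y, M x y + k →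
    ∃ M' : ι → ι → ℕ, (∀ x y, M x y ≤ M' x y) ∧ (∀ x, ∑ y, M' x y = D) ∧ (∀ y, ∑ x, M' x y = D) := by
  intro k
  induction k with
  | zero =>
    intro M hr hc ht
    refine ⟨M, fun _ _ => le_rfl, ?_, ?_⟩
    · have h1 : ∑ x, ∑ y, M x y = ∑ x : ι, D := by
        apply le_antisymm
        · exact Finset.sum_le_sum fun x _ => hr x
        · simpa [mul_comm] using ht
      rw [Finset.sum_eq_sum_iff_of_le (fun x _ => hr x)] at h1
      exact fun x => h1 x (Finset.mem_univ x)
    · have h1 : ∑ y, ∑ x, M x y = ∑ x : ι, D := by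
        apply le_antisymm
        · exact Finset.sum_le_sum fun x _ => hc x
        · rw [Finset.sum_comm]; simpa [mul_comm] using ht
      rw [Finset.sum_eq_sum_iff_of_le (fun x _ => hc x)] at h1
      exact fun x => h1 x (Finset.mem_univ x)
  | succ k ih =>
    intro M hr hc ht
    by_cases hk : D * Fintype.card ι ≤ ∑ x, ∑ y, M x y + k
    · exact ih M hr hc hk
    have hlt : ∑ x, ∑ y, M x y < ∑ x : ι, D := by
      simp only [Finset.sum_const, Finset.card_univ, smul_eq_mul]
      rw [mul_comm]; omega
    obtain ⟨x0, _, hx0⟩ := Finset.exists_lt_of_sum_lt hlt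
    have hlt2 : ∑ y, ∑ x, M x y < ∑ x : ι, D := by rw [Finset.sum_comm]; exact hlt
    obtain ⟨y0, _, hy0⟩ := Finset.exists_lt_of_sum_lt hlt2
    have key := ih (fun x y => M x y + if x = x0 ∧ y = y0 then 1 else 0)
    refine Exists.elim (key ?_ ?_ ?_) ?_
    rotate_left 3
    · rintro M' ⟨h1, h2, h3⟩
      exact ⟨M', fun x y => le_trans (Nat.le_add_right _ _) (h1 x y), h2, h3⟩
    · intro x
      rw [Finset.sum_add_distrib]
      by_cases h : x = x0
      · subst h; simp; omega
      · simp [h]; exact hr x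
    · intro y
      rw [Finset.sum_add_distrib]
      by_cases h : y = y0
      · subst h; simp; omega
      · simp [h]; exact hc y
    · have : ∑ x, ∑ y, (if x = x0 ∧ y = y0 then 1 else 0) = 1 := by
        rw [Finset.sum_eq_single x0]
        · simp
        · intro b _ hb; simp [hb]
        · simp
      simp only [Finset.sum_add_distrib]
      rw [this]; omega

/-- Koenig: a nonnegative integer matrix with line sums at most `D` decomposes into `D` partial permutations. -/
theorem konig {ι : Type*} [Fintype ι] [DecidableEq ι] (D : ℕ) (M : ι → ι → ℕ)
    (hr : ∀ x, ∑ y, M x y ≤ D) (hc : ∀ y, ∑ x, M x y ≤ D) :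
    ∃ (σ : Fin D → Equiv.Perm ι) (R : Fin D → Finset ι),
      ∀ x y, (Finset.univ.filter (fun j => x ∈ R j ∧ σ j x = y)).card = M x y := by
  classical
  obtain ⟨M', h1, h2, h3⟩ := konig_complete D (D * Fintype.card ι) M hr hc (by omega)
  obtain ⟨σ, hσ⟩ := konig_regular D M' h2 h3
  have hS : ∀ x y, ∃ S ⊆ Finset.univ.filter (fun j => σ j x = y), S.card = M x y := fun x y =>
    Finset.exists_subset_card_eq (by rw [hσ]; exact h1 x y)
  choose S hS1 hS2 using hS
  refine ⟨σ, fun j => Finset.univ.filter (fun x => j ∈ S x (σ j x)), fun x y => ?_⟩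
  rw [← hS2 x y]
  congr 1
  ext j
  simp only [Finset.mem_filter, Finset.mem_univ, true_and]
  constructor
  · rintro ⟨h, rfl⟩; exact h
  · intro h
    have := hS1 x y h
    simp only [Finset.mem_filter, Finset.mem_univ, true_and] at this
    subst this
    exact ⟨h, rfl⟩

/-- Number of fake entries in the Koenig decomposition. -/
theorem konig_fakes {ι : Type*} [Fintype ι] [DecidableEq ι] {D : ℕ} {M : ι → ι → ℕ}
    {σ : Fin D → Equiv.Perm ι} {R : Fin D → Finset ι}
    (h : ∀ x y, (Finset.univ.filter (fun j => x ∈ R j ∧ σ j x = y)).card = M x y) :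
    ∑ j, (R j).card = ∑ x, ∑ y, M x y := by
  classical
  have h1 : ∀ x, ∑ y, M x y = (Finset.univ.filter (fun j => x ∈ R j)).card := by
    intro x
    rw [Finset.card_eq_sum_card_fiberwise (f := fun j => σ j x) (t := Finset.univ) (by simp [Set.MapsTo])]
    apply Finset.sum_congr rfl
    intro y _
    rw [← h x y, Finset.filter_filter]
  simp_rw [h1, Finset.card_filter]
  rw [Finset.sum_comm]
  apply Finset.sum_congr rfl
  intro j _
  rw [← Finset.card_filter]
  congr 1
  ext x; simp

end

section

/-- Recursion along the parent function (existence form). -/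
theorem exists_prec {Δ : ℕ} (P : PTree Δ) {X : Type*} (base : ℕ → X) (step : ℕ → X → X)
    (haltAt : ℕ → Prop) :
    ∃ f : ℕ → X, ∀ v, ((v = 0 ∨ haltAt v) → f v = base v) ∧
      (¬ (v = 0 ∨ haltAt v) → f v = step v (f (P.p v))) := by
  classical
  let f : ℕ → X := WellFounded.fix (C := fun _ => X) Nat.lt_wfRel.wf
    (fun v ih => if h : v = 0 ∨ haltAt v then base v
      else step v (ih (P.p v) (P.hp v (by
        by_contra hc
        exact h (Or.inl (by omega))))))
  refine ⟨f, fun v => ⟨fun h => ?_, fun h => ?_⟩⟩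
  · simp only [f]; rw [WellFounded.fix_eq, dif_pos h]
  · simp only [f]; rw [WellFounded.fix_eq, dif_neg h]

theorem exists_dep {Δ : ℕ} (P : PTree Δ) :
    ∃ dep : ℕ → ℕ, dep 0 = 0 ∧ ∀ v, 1 ≤ v → dep v = dep (P.p v) + 1 := by
  obtain ⟨f, hf⟩ := exists_prec P (fun _ => 0) (fun _ x => x + 1) (fun _ => False)
  refine ⟨f, (hf 0).1 (Or.inl rfl), fun v hv => (hf v).2 ?_⟩
  rintro (h | h)
  · omega
  · exact h

theorem exists_rank {Δ : ℕ} (P : PTree Δ) :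
    ∃ rk : ℕ → ℕ, (∀ v, 1 ≤ v → v < P.m → rk v < Δ) ∧
      ∀ v v', 1 ≤ v → v < P.m → 1 ≤ v' → v' < P.m → P.p v = P.p v' → rk v = rk v' → v = v' := by
  classical
  refine ⟨fun v => ((Finset.range v).filter (fun w => 1 ≤ w ∧ P.p w = P.p v)).card, ?_, ?_⟩
  · intro v hv hm
    refine lt_of_lt_of_le ?_ (P.hch (P.p v))
    apply Finset.card_lt_card
    rw [Finset.ssubset_iff_of_subset]
    · exact ⟨v, by simp [hm, hv], by simp⟩
    · intro w hw
      simp only [Finset.mem_filter, Finset.mem_range] at hw ⊢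
      exact ⟨by omega, hw.2⟩
  · have key : ∀ v v', 1 ≤ v → P.p v = P.p v' → v < v' →
        ((Finset.range v).filter (fun w => 1 ≤ w ∧ P.p w = P.p v)).card <
        ((Finset.range v').filter (fun w => 1 ≤ w ∧ P.p w = P.p v')).card := by
      intro v v' hv hp hlt
      apply Finset.card_lt_card
      rw [Finset.ssubset_iff_of_subset]
      · exact ⟨v, by simp [hlt, hv, hp], by simp⟩
      · intro w hw
        simp only [Finset.mem_filter, Finset.mem_range] at hw ⊢
        exact ⟨by omega, hw.2.1, by rw [hw.2.2, hp]⟩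
    intro v v' hv _ hv' _ hp hrk
    simp only at hrk
    rcases lt_trichotomy v v' with h | h | h
    · have := key v v' hv hp h; omega
    · exact h
    · have := key v' v hv' hp.symm h; omega

/-- Splitting a rooted tree at depths congruent to `j` mod `h`. -/
theorem exists_split {Δ : ℕ} (P : PTree Δ) (dep : ℕ → ℕ) (hdep : ∀ v, 1 ≤ v → dep v = dep (P.p v) + 1)
    (h j : ℕ) (hj : j < h) :
    ∃ rt ad : ℕ → ℕ,
      (∀ v, (v = 0 ∨ dep (P.p v) % h = j) → rt v = v ∧ ad v = 0) ∧
      (∀ v, ¬ (v = 0 ∨ dep (P.p v) % h = j) → rt v = rt (P.p v)) ∧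
      (∀ v, v < P.m → ¬ (v = 0 ∨ dep (P.p v) % h = j) → 1 ≤ ad v ∧ (ad v - 1) / Δ = ad (P.p v)) ∧
      (∀ v, v < P.m → ad v < (Δ + 1) ^ h) ∧
      (∀ v v', v < P.m → v' < P.m → rt v = rt v' → ad v = ad v' → v = v') ∧
      (∀ v, rt v ≤ v) ∧ (∀ v, rt (rt v) = rt v) := by
  obtain ⟨rk, hrk1, hrk2⟩ := exists_rank P
  obtain ⟨rt, hrt⟩ := exists_prec P (fun v => v) (fun _ x => x) (fun v => dep (P.p v) % h = j)
  obtain ⟨ad, had⟩ := exists_prec P (fun _ => 0) (fun v x => x * Δ + rk v + 1) (fun v => dep (P.p v) % h = j)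
  have hdiv : ∀ v, v < P.m → ¬ (v = 0 ∨ dep (P.p v) % h = j) → 1 ≤ ad v ∧ (ad v - 1) / Δ = ad (P.p v) := by
    intro v hm hv
    have h1 : 1 ≤ v := by
      by_contra hc
      exact hv (Or.inl (by omega))
    have h2 := hrk1 v h1 hm
    rw [(had v).2 hv]
    refine ⟨by omega, ?_⟩
    rw [Nat.add_sub_cancel, mul_comm, Nat.mul_add_div (by omega), Nat.div_eq_of_lt h2, add_zero]
  have hle : ∀ v, rt v ≤ v := by
    intro v
    induction v using Nat.strong_induction_on with
    | _ v ih =>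
      by_cases hv : v = 0 ∨ dep (P.p v) % h = j
      · rw [(hrt v).1 hv]
      · have h1 : 1 ≤ v := by
          by_contra hc
          exact hv (Or.inl (by omega))
        rw [(hrt v).2 hv]
        have := ih _ (P.hp v h1)
        have := P.hp v h1
        omega
  refine ⟨rt, ad, fun v hv => ⟨(hrt v).1 hv, (had v).1 hv⟩, fun v hv => (hrt v).2 hv, hdiv, ?_, ?_, hle, ?_⟩
  · have key : ∀ v, v < P.m → ad v + 1 ≤ (Δ + 1) ^ ((dep v + h - 1 - j) % h) := by
      intro v
      induction v using Nat.strong_induction_on with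
      | _ v ih =>
        intro hm
        by_cases hv : v = 0 ∨ dep (P.p v) % h = j
        · rw [(had v).1 hv]
          exact Nat.one_le_pow _ _ (by omega)
        · have h1 : 1 ≤ v := by
            by_contra hc
            exact hv (Or.inl (by omega))
          have h2 := hrk1 v h1 hm
          have h3 := P.hp v h1
          have h4 := ih _ h3 (by omega)
          have h5 : dep (P.p v) % h ≠ j := fun hc => hv (Or.inr hc)
          rw [(had v).2 hv, hdep v h1]
          have h6 : (dep (P.p v) + 1 + h - 1 - j) % h = (dep (P.p v) + h - 1 - j) % h + 1 := by
            have e1 : dep (P.p v) + 1 + h - 1 - j = (dep (P.p v) + h - 1 - j) + 1 := by omega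
            rw [e1, Nat.add_mod]
            have e2 : (dep (P.p v) + h - 1 - j) % h < h := Nat.mod_lt _ (by omega)
            have e3 : (dep (P.p v) + h - 1 - j) % h ≠ h - 1 := by
              intro hc
              apply h5
              have e4 : dep (P.p v) + h - 1 - j = h * ((dep (P.p v) + h - 1 - j) / h) + (h - 1) := by
                conv_lhs => rw [← Nat.div_add_mod (dep (P.p v) + h - 1 - j) h, hc]
              have e5 : dep (P.p v) = h * ((dep (P.p v) + h - 1 - j) / h) + j := by omega
              rw [e5, Nat.mul_add_mod, Nat.mod_eq_of_lt hj]
            by_cases hh : h = 1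
            · omega
            · rw [Nat.mod_eq_of_lt (a := 1) (by omega), Nat.mod_eq_of_lt (by omega)]
          rw [h6, pow_succ]
          calc ad (P.p v) * Δ + rk v + 1 + 1 ≤ (ad (P.p v) + 1) * (Δ + 1) := by nlinarith
            _ ≤ _ := Nat.mul_le_mul_right _ h4
    intro v hv
    have h1 := key v hv
    have h2 : (dep v + h - 1 - j) % h < h := Nat.mod_lt _ (by omega)
    have h3 : (Δ + 1) ^ ((dep v + h - 1 - j) % h) ≤ (Δ + 1) ^ h := Nat.pow_le_pow_right (by omega) h2.le
    omega
  · intro v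
    induction v using Nat.strong_induction_on with
    | _ v ih =>
      intro v' hm hm' hr ha
      by_cases hv : v = 0 ∨ dep (P.p v) % h = j
      · by_cases hv' : v' = 0 ∨ dep (P.p v') % h = j
        · rw [(hrt v).1 hv, (hrt v').1 hv'] at hr
          exact hr
        · rw [(had v).1 hv, (had v').2 hv'] at ha
          omega
      · by_cases hv' : v' = 0 ∨ dep (P.p v') % h = j
        · rw [(had v').1 hv', (had v).2 hv] at ha
          omega
        · have h1 : 1 ≤ v := by
            by_contra hc
            exact hv (Or.inl (by omega))
          have h1' : 1 ≤ v' := by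
            by_contra hc
            exact hv' (Or.inl (by omega))
          have d1 := hdiv v hm hv
          have d2 := hdiv v' hm' hv'
          have e1 : ad (P.p v) = ad (P.p v') := by rw [← d1.2, ← d2.2, ha]
          rw [(hrt v).2 hv, (hrt v').2 hv'] at hr
          rw [(had v).2 hv, (had v').2 hv', e1] at ha
          have q1 := P.hp v h1
          have q2 := P.hp v' h1'
          have e2 := ih _ q1 _ (by omega) (by omega) hr e1
          exact hrk2 v v' h1 hm h1' hm' e2 (by omega)
  · intro v
    induction v using Nat.strong_induction_on with
    | _ v ih =>
      by_cases hv : v = 0 ∨ dep (P.p v) % h = j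
      · rw [(hrt v).1 hv, (hrt v).1 hv]
      · have h1 : 1 ≤ v := by
          by_contra hc
          exact hv (Or.inl (by omega))
        rw [(hrt v).2 hv]
        exact ih _ (P.hp v h1)

/-- Greedy bin assignment. -/
theorem binning {𝔹 : Type*} [Fintype 𝔹] [DecidableEq 𝔹] (x y c : ℕ → ℕ) (B cap scap : ℕ)
    (S : Finset ℕ) (hB : ∀ r ∈ S, x r + y r ≤ B ∧ c r ≤ B)
    (hcap : (∑ r ∈ S, (x r + y r)) * scap + (∑ r ∈ S, c r) * cap < Fintype.card 𝔹 * (cap * scap)) :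
    ∃ (β : ℕ → 𝔹) (o : ℕ → Bool), ∀ b,
      2 * (∑ r ∈ S.filter (fun r => β r = b), (if o r then x r else y r)) ≤ cap + 2 * B ∧
      2 * (∑ r ∈ S.filter (fun r => β r = b), (if o r then y r else x r)) ≤ cap + 2 * B ∧
      ∑ r ∈ S.filter (fun r => β r = b), c r ≤ scap + B := by
  classical
  suffices H : ∃ (β : ℕ → 𝔹) (o : ℕ → Bool), ∀ b,
      (∑ r ∈ S.filter (fun r => β r = b), (if o r then x r else y r)) +
      (∑ r ∈ S.filter (fun r => β r = b), (if o r then y r else x r)) ≤ cap + B ∧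
      (∑ r ∈ S.filter (fun r => β r = b), (if o r then x r else y r)) ≤
      (∑ r ∈ S.filter (fun r => β r = b), (if o r then y r else x r)) + B ∧
      (∑ r ∈ S.filter (fun r => β r = b), (if o r then y r else x r)) ≤
      (∑ r ∈ S.filter (fun r => β r = b), (if o r then x r else y r)) + B ∧
      ∑ r ∈ S.filter (fun r => β r = b), c r ≤ scap + B by
    obtain ⟨β, o, H⟩ := H
    refine ⟨β, o, fun b => ?_⟩
    obtain ⟨h1, h2, h3, h4⟩ := H b
    exact ⟨by omega, by omega, h4⟩
  induction S using Finset.induction_on with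
  | empty =>
    have hne : 0 < Fintype.card 𝔹 := by
      by_contra hc
      have : Fintype.card 𝔹 = 0 := by omega
      rw [this] at hcap
      omega
    obtain ⟨b0⟩ := Fintype.card_pos_iff.mp hne
    exact ⟨fun _ => b0, fun _ => true, fun b => by simp⟩
  | insert a S ha ih =>
    have hcap' := hcap
    rw [Finset.sum_insert ha, Finset.sum_insert ha] at hcap'
    have hcap2 : (∑ r ∈ S, (x r + y r)) * scap + (∑ r ∈ S, c r) * cap < Fintype.card 𝔹 * (cap * scap) := by
      refine lt_of_le_of_lt ?_ hcap'
      gcongr <;> omega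
    obtain ⟨β, o, H⟩ := ih (fun r hr => hB r (Finset.mem_insert_of_mem hr)) hcap2
    obtain ⟨hBa, hBc⟩ := hB a (Finset.mem_insert_self a S)
    -- find a bin
    have hbin : ∃ b, ∑ r ∈ S.filter (fun r => β r = b), (x r + y r) < cap ∧
        ∑ r ∈ S.filter (fun r => β r = b), c r < scap := by
      by_contra hc
      push Not at hc
      have h1 : ∀ b, cap * scap ≤ (∑ r ∈ S.filter (fun r => β r = b), (x r + y r)) * scap +
          (∑ r ∈ S.filter (fun r => β r = b), c r) * cap := by
        intro b
        by_cases h : ∑ r ∈ S.filter (fun r => β r = b), (x r + y r) < cap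
        · have := Nat.mul_le_mul_right cap (hc b h)
          rw [mul_comm cap]; omega
        · have := Nat.mul_le_mul_right scap (Nat.le_of_not_lt h)
          omega
      have h2 := Finset.sum_le_sum (s := Finset.univ) (fun b _ => h1 b)
      rw [Finset.sum_add_distrib, ← Finset.sum_mul (f := fun b => ∑ r ∈ S.filter (fun r => β r = b), (x r + y r)),
        ← Finset.sum_mul (f := fun b => ∑ r ∈ S.filter (fun r => β r = b), c r),
        Finset.sum_fiberwise, Finset.sum_fiberwise] at h2
      simp only [Finset.sum_const, Finset.card_univ, smul_eq_mul] at h2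
      omega
    obtain ⟨b, hb1, hb2⟩ := hbin
    obtain ⟨H1, H2, H3, H4⟩ := H b
    have hxy : (∑ r ∈ S.filter (fun r => β r = b), (if o r then x r else y r)) +
      (∑ r ∈ S.filter (fun r => β r = b), (if o r then y r else x r)) =
      ∑ r ∈ S.filter (fun r => β r = b), (x r + y r) := by
      rw [← Finset.sum_add_distrib]
      apply Finset.sum_congr rfl
      intro r _
      split_ifs <;> omega
    set X := ∑ r ∈ S.filter (fun r => β r = b), (if o r then x r else y r) with hX
    set Y := ∑ r ∈ S.filter (fun r => β r = b), (if o r then y r else x r) with hY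
    -- orientation
    obtain ⟨oo, h5, h6⟩ : ∃ oo : Bool, X + (if oo then x a else y a) ≤ Y + (if oo then y a else x a) + B ∧
        Y + (if oo then y a else x a) ≤ X + (if oo then x a else y a) + B := by
      by_cases h1 : X ≤ Y
      · by_cases h2 : y a ≤ x a
        · exact ⟨true, by simp; omega, by simp; omega⟩
        · exact ⟨false, by simp; omega, by simp; omega⟩
      · by_cases h2 : y a ≤ x a
        · exact ⟨false, by simp; omega, by simp; omega⟩
        · exact ⟨true, by simp; omega, by simp; omega⟩
    have hfil : ∀ b', (insert a S).filter (fun r => Function.update β a b r = b') =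
        if b' = b then insert a (S.filter (fun r => β r = b')) else S.filter (fun r => β r = b') := by
      intro b'
      rw [Finset.filter_insert]
      have e : S.filter (fun r => Function.update β a b r = b') = S.filter (fun r => β r = b') := by
        apply Finset.filter_congr
        intro r hr
        rw [Function.update_of_ne (fun h : r = a => ha (h ▸ hr))]
      rw [e]
      simp only [Function.update_self, eq_comm]
    have hs1 : ∀ b', ∑ r ∈ S.filter (fun r => β r = b'), (if Function.update o a oo r then x r else y r) =
        ∑ r ∈ S.filter (fun r => β r = b'), (if o r then x r else y r) := by
      intro b'
      apply Finset.sum_congr rfl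
      intro r hr
      rw [Function.update_of_ne (fun h : r = a => ha (h ▸ (Finset.mem_filter.mp hr).1))]
    have hs2 : ∀ b', ∑ r ∈ S.filter (fun r => β r = b'), (if Function.update o a oo r then y r else x r) =
        ∑ r ∈ S.filter (fun r => β r = b'), (if o r then y r else x r) := by
      intro b'
      apply Finset.sum_congr rfl
      intro r hr
      rw [Function.update_of_ne (fun h : r = a => ha (h ▸ (Finset.mem_filter.mp hr).1))]
    refine ⟨Function.update β a b, Function.update o a oo, fun b' => ?_⟩
    rw [hfil b']
    by_cases hbb : b' = b
    · subst hbb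
      have hna : a ∉ S.filter (fun r => β r = b') := fun h => ha (Finset.mem_filter.mp h).1
      rw [if_pos rfl, Finset.sum_insert hna, Finset.sum_insert hna, Finset.sum_insert hna,
        hs1 b', hs2 b', Function.update_self, ← hX, ← hY]
      have h7 : (if oo then x a else y a) + (if oo then y a else x a) = x a + y a := by
        split_ifs <;> omega
      refine ⟨by omega, by omega, by omega, by omega⟩
    · rw [if_neg hbb, hs1 b', hs2 b']
      exact H b'

end

section

/-- Tree decomposition data. -/
structure TD {Δ : ℕ} (P : PTree Δ) (K : ℕ) (𝔹 : Type) where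
  cut : ℕ → Prop
  spc : ℕ → Prop
  tp : ℕ → ℕ
  ad : ℕ → ℕ
  bin : ℕ → 𝔹
  side : ℕ → Bool
  cut0 : ¬ cut 0
  cutp : ∀ v, 1 ≤ v → cut v → ¬ cut (P.p v)
  spc_cut : ∀ v, spc v → cut v
  top : ∀ v, (v = 0 ∨ cut (P.p v)) → tp v = v ∧ ad v = 0
  ntop_tp : ∀ v, 1 ≤ v → ¬ cut (P.p v) → tp v = tp (P.p v)
  ntop_ad : ∀ v, 1 ≤ v → v < P.m → ¬ cut (P.p v) → 1 ≤ ad v ∧ (ad v - 1) / Δ = ad (P.p v)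
  ad_lt : ∀ v, v < P.m → ad v < K
  inj : ∀ v v', v < P.m → v' < P.m → tp v = tp v' → ad v = ad v' → v = v'
  tp_le : ∀ v, tp v ≤ v
  tp_top : ∀ v, tp v = 0 ∨ cut (P.p (tp v))
  bin_eq : ∀ v, 1 ≤ v → ¬ spc (P.p v) → bin v = bin (P.p v)
  side_eq : ∀ v, 1 ≤ v → ¬ spc (P.p v) → side v = !side (P.p v)

theorem exists_residue (m h : ℕ) (f : ℕ → ℕ) (S : Finset ℕ) (hS : ∀ v ∈ S, f v < h) (hm : S.card ≤ m) (hh : 0 < h) :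
    ∃ j < h, (S.filter (fun v => f v = j)).card * h ≤ m := by
  by_contra hc
  push Not at hc
  have h1 : S.card = ∑ j ∈ Finset.range h, (S.filter (fun v => f v = j)).card :=
    Finset.card_eq_sum_card_fiberwise (fun v hv => by simpa using hS v hv)
  have h2 : ∑ j ∈ Finset.range h, m < ∑ j ∈ Finset.range h, (S.filter (fun v => f v = j)).card * h := by
    apply Finset.sum_lt_sum_of_nonempty
    · exact ⟨0, by simpa using hh⟩
    · intro j hj
      exact hc j (by simpa using hj)
  rw [← Finset.sum_mul, ← h1] at h2
  simp only [Finset.sum_const, Finset.card_range, smul_eq_mul] at h2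
  have := Nat.mul_le_mul_right h hm
  rw [mul_comm h m] at h2
  omega

theorem mod_step (h j x : ℕ) (hj : j < h) (hx : x < h) (hne : x ≠ j) :
    (j + h - x) % h = (j + h - (x + 1) % h) % h + 1 := by
  by_cases hq : x + 1 < h
  · rw [Nat.mod_eq_of_lt hq]
    by_cases hq2 : x < j
    · have e1 : j + h - x = (j - x) + h := by omega
      have e2 : j + h - (x + 1) = (j - (x + 1)) + h := by omega
      rw [e1, e2, Nat.add_mod_right, Nat.add_mod_right, Nat.mod_eq_of_lt (by omega),
        Nat.mod_eq_of_lt (by omega)]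
      omega
    · rw [Nat.mod_eq_of_lt (by omega), Nat.mod_eq_of_lt (by omega)]
      omega
  · have e0 : x + 1 = h := by omega
    rw [e0, Nat.mod_self, Nat.sub_zero, Nat.add_mod_right, Nat.mod_eq_of_lt hj,
      Nat.mod_eq_of_lt (by omega)]
    omega

theorem mod_pos (h j x : ℕ) (hj : j < h) (hx : x < h) (hne : x ≠ j) :
    1 ≤ (j + h - x) % h := by
  rw [Nat.one_le_iff_ne_zero]
  intro h0
  by_cases hq2 : x < j
  · have e1 : j + h - x = (j - x) + h := by omega
    rw [e1, Nat.add_mod_right, Nat.mod_eq_of_lt (by omega)] at h0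
    omega
  · rw [Nat.mod_eq_of_lt (by omega)] at h0
    omega

theorem exists_descrec {X : Type*} (m : ℕ) (d : X) (F : ℕ → (ℕ → X) → X) :
    ∃ f : ℕ → X, ∀ v, f v = F v (fun c => if v < c ∧ c < m then f c else d) := by
  classical
  let f : ℕ → X := (measure (fun v => m - v)).wf.fix (C := fun _ => X)
    (fun v ih => F v (fun c => if h : v < c ∧ c < m then ih c (by
      change m - c < m - v
      omega) else d))
  refine ⟨f, fun v => ?_⟩
  simp only [f]
  rw [WellFounded.fix_eq]
  congr 1

/-- Choice of few special vertices among the cut vertices so that the components are small. -/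
theorem exists_special {Δ : ℕ} (P : PTree Δ) (dep : ℕ → ℕ) (hdep : ∀ v, 1 ≤ v → dep v = dep (P.p v) + 1)
    (h j : ℕ) (hj : j < h) (B0 : ℕ) :
    ∃ (sp : ℕ → Prop) (rt : ℕ → ℕ), (∀ v, sp v → dep v % h = j) ∧
      (∀ v, ¬ (v = 0 ∨ sp (P.p v)) → rt v = rt (P.p v)) ∧ (∀ v, rt v ≤ v) ∧
      (∀ r, ((Finset.range P.m).filter (fun v => rt v = r)).card ≤ (B0 + 1) * (Δ + 1) ^ h) ∧
      (∀ S ⊆ Finset.range P.m, (∀ v ∈ S, sp v) → S.card * B0 ≤ P.m) := by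
  classical
  let ch : ℕ → Finset ℕ := fun v => (Finset.range P.m).filter (fun c => 1 ≤ c ∧ P.p c = v)
  have hch : ∀ v c, c ∈ ch v → v < c ∧ c < P.m ∧ 1 ≤ c ∧ P.p c = v := by
    intro v c hc
    simp only [ch, Finset.mem_filter, Finset.mem_range] at hc
    have := P.hp c hc.2.1
    exact ⟨by omega, hc.1, hc.2⟩
  obtain ⟨w, hw⟩ := exists_descrec P.m 0 (fun v g => 1 + if (dep v % h = j ∧ B0 ≤ ∑ c ∈ ch v, g c) then 0
    else ∑ c ∈ ch v, g c)
  have hsum : ∀ v, ∑ c ∈ ch v, (if v < c ∧ c < P.m then w c else 0) = ∑ c ∈ ch v, w c := by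
    intro v
    apply Finset.sum_congr rfl
    intro c hc
    have := hch v c hc
    rw [if_pos ⟨this.1, this.2.1⟩]
  have hw' : ∀ v, w v = 1 + if (dep v % h = j ∧ B0 ≤ ∑ c ∈ ch v, w c) then 0 else ∑ c ∈ ch v, w c := by
    intro v
    have := hw v
    simp only [hsum] at this
    exact this
  let sp : ℕ → Prop := fun v => dep v % h = j ∧ B0 ≤ ∑ c ∈ ch v, w c
  obtain ⟨ds, hds⟩ := exists_descrec P.m (∅ : Finset ℕ) (fun v g => insert v (if sp v then ∅
    else (ch v).biUnion g))
  have hbu : ∀ v, (ch v).biUnion (fun c => if v < c ∧ c < P.m then ds c else ∅) = (ch v).biUnion ds := by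
    intro v
    apply Finset.biUnion_congr rfl
    intro c hc
    have := hch v c hc
    rw [if_pos ⟨this.1, this.2.1⟩]
  have hds' : ∀ v, ds v = insert v (if sp v then ∅ else (ch v).biUnion ds) := by
    intro v
    have := hds v
    rw [hbu] at this
    exact this
  obtain ⟨rt, hrt⟩ := exists_prec P (fun v => v) (fun _ x => x) (fun v => sp (P.p v))
  have hle : ∀ v, rt v ≤ v := by
    intro v
    induction v using Nat.strong_induction_on with
    | _ v ih =>
      by_cases hv : v = 0 ∨ sp (P.p v)
      · rw [(hrt v).1 hv]
      · have h1 : 1 ≤ v := by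
          by_contra hc
          exact hv (Or.inl (by omega))
        rw [(hrt v).2 hv]
        have := ih _ (P.hp v h1)
        have := P.hp v h1
        omega
  -- descending induction for sizes
  have hdown : ∀ k v, P.m - v = k → (ds v).card ≤ w v ∧
      w v ≤ (B0 + 1) * (Δ + 1) ^ ((j + h - dep v % h) % h) := by
    intro k
    induction k using Nat.strong_induction_on with
    | _ k ih =>
      intro v hv
      have ihc : ∀ c ∈ ch v, (ds c).card ≤ w c ∧ w c ≤ (B0 + 1) * (Δ + 1) ^ ((j + h - dep c % h) % h) := by
        intro c hc
        have := hch v c hc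
        exact ih (P.m - c) (by omega) c rfl
      constructor
      · rw [hds' v, hw' v]
        refine le_trans (Finset.card_insert_le _ _) ?_
        rw [add_comm]
        gcongr
        by_cases hs : sp v
        · rw [if_pos hs]; simp
        · rw [if_neg hs, if_neg hs]
          refine le_trans Finset.card_biUnion_le ?_
          exact Finset.sum_le_sum (fun c hc => (ihc c hc).1)
      · have hpow : ∀ e, B0 + 1 ≤ (B0 + 1) * (Δ + 1) ^ e := fun e =>
          Nat.le_mul_of_pos_right _ (by positivity)
        rw [hw' v]
        by_cases hs : dep v % h = j ∧ B0 ≤ ∑ c ∈ ch v, w c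
        · rw [if_pos hs]
          exact le_trans (by omega) (hpow _)
        · rw [if_neg hs]
          by_cases hcut : dep v % h = j
          · have : ¬ B0 ≤ ∑ c ∈ ch v, w c := fun h' => hs ⟨hcut, h'⟩
            exact le_trans (by omega) (hpow _)
          · have hlt : dep v % h < h := Nat.mod_lt _ (by omega)
            have he : ∀ c ∈ ch v, (j + h - dep v % h) % h = (j + h - dep c % h) % h + 1 := by
              intro c hc
              obtain ⟨_, _, h1, h2⟩ := hch v c hc
              rw [hdep c h1, h2, Nat.add_mod]
              by_cases hh1 : h = 1
              · subst hh1; omega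
              rw [Nat.mod_eq_of_lt (a := 1) (by omega)]
              exact mod_step h j _ hj hlt hcut
            set e := (j + h - dep v % h) % h with hedef
            have hcs : ∑ c ∈ ch v, w c ≤ Δ * ((B0 + 1) * (Δ + 1) ^ (e - 1)) := by
              calc ∑ c ∈ ch v, w c ≤ ∑ c ∈ ch v, (B0 + 1) * (Δ + 1) ^ (e - 1) := by
                    apply Finset.sum_le_sum
                    intro c hc
                    rw [he c hc, Nat.add_sub_cancel]
                    exact (ihc c hc).2
                _ = (ch v).card * ((B0 + 1) * (Δ + 1) ^ (e - 1)) := by simp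
                _ ≤ _ := Nat.mul_le_mul_right _ (P.hch v)
            have he1 : 1 ≤ e := mod_pos h j _ hj hlt hcut
            have e3 : (B0 + 1) * (Δ + 1) ^ e = (Δ + 1) * ((B0 + 1) * (Δ + 1) ^ (e - 1)) := by
              conv_lhs => rw [← Nat.sub_add_cancel he1, pow_succ]
              ring
            rw [e3, add_mul]
            have := hpow (e - 1)
            omega
  refine ⟨sp, rt, fun v hv => hv.1, fun v hv => (hrt v).2 hv, hle, ?_, ?_⟩
  · intro r
    have hsub : (Finset.range P.m).filter (fun v => rt v = r) ⊆ ds r := by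
      have hup : ∀ v, v < P.m → ds v ⊆ ds (rt v) := by
        intro v
        induction v using Nat.strong_induction_on with
        | _ v ih =>
          intro hm
          by_cases hv : v = 0 ∨ sp (P.p v)
          · rw [(hrt v).1 hv]
          · have h1 : 1 ≤ v := by
              by_contra hc
              exact hv (Or.inl (by omega))
            have h2 := P.hp v h1
            rw [(hrt v).2 hv]
            refine Finset.Subset.trans ?_ (ih _ h2 (by omega))
            rw [hds' (P.p v), if_neg (fun h' => hv (Or.inr h'))]
            refine Finset.Subset.trans ?_ (Finset.subset_insert _ _)
            apply Finset.subset_biUnion_of_mem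
            simp only [ch, Finset.mem_filter, Finset.mem_range]
            exact ⟨hm, h1, trivial⟩
      intro v hv
      simp only [Finset.mem_filter, Finset.mem_range] at hv
      rw [← hv.2]
      apply hup v hv.1
      rw [hds' v]
      exact Finset.mem_insert_self _ _
    refine le_trans (Finset.card_le_card hsub) ?_
    have h1 := hdown _ r rfl
    refine le_trans (le_trans h1.1 h1.2) ?_
    gcongr
    · omega
    · exact (Nat.mod_lt _ (by omega)).le
  · intro S hS hsp
    have hfib : ∀ f : ℕ → ℕ, ∑ v ∈ Finset.range P.m, ∑ c ∈ ch v, f c = ∑ c ∈ (Finset.range P.m).filter (fun c => 1 ≤ c), f c := by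
      intro f
      rw [← Finset.sum_fiberwise_of_maps_to (s := (Finset.range P.m).filter (fun c => 1 ≤ c)) (t := Finset.range P.m) (g := P.p)]
      · apply Finset.sum_congr rfl
        intro v _
        rw [Finset.filter_filter]
      · intro c hc
        simp only [Finset.mem_filter, Finset.mem_range] at hc ⊢
        have := P.hp c hc.2
        omega
    have htot : ∑ v ∈ Finset.range P.m, w v + ∑ v ∈ Finset.range P.m, (if sp v then ∑ c ∈ ch v, w c else 0) =
        P.m + ∑ v ∈ Finset.range P.m, ∑ c ∈ ch v, w c := by
      rw [← Finset.sum_add_distrib]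
      have : P.m + ∑ v ∈ Finset.range P.m, ∑ c ∈ ch v, w c =
          ∑ v ∈ Finset.range P.m, (1 + ∑ c ∈ ch v, w c) := by
        rw [Finset.sum_add_distrib]; simp
      rw [this]
      apply Finset.sum_congr rfl
      intro v _
      rw [hw' v]
      by_cases hs : dep v % h = j ∧ B0 ≤ ∑ c ∈ ch v, w c
      · have hs' : sp v := hs
        rw [if_pos hs, if_pos hs', add_zero]
      · have hs' : ¬ sp v := hs
        rw [if_neg hs, if_neg hs', add_zero]
    rw [hfib w] at htot
    have hle2 : ∑ c ∈ (Finset.range P.m).filter (fun c => 1 ≤ c), w c ≤ ∑ v ∈ Finset.range P.m, w v :=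
      Finset.sum_le_sum_of_subset (Finset.filter_subset _ _)
    have h3 : S.card * B0 ≤ ∑ v ∈ S, (if sp v then ∑ c ∈ ch v, w c else 0) := by
      rw [← smul_eq_mul]
      apply Finset.card_nsmul_le_sum
      intro v hv
      rw [if_pos (hsp v hv)]
      exact (hsp v hv).2
    have h4 : ∑ v ∈ S, (if sp v then ∑ c ∈ ch v, w c else 0) ≤
        ∑ v ∈ Finset.range P.m, (if sp v then ∑ c ∈ ch v, w c else 0) :=
      Finset.sum_le_sum_of_subset hS
    omega

theorem side_aux1 (oo : Bool) (p : Prop) [Decidable p] :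
    (if oo then decide p else decide (¬ p)) = oo ↔ p := by
  cases oo <;> simp

theorem side_aux2 (oo : Bool) (p : Prop) [Decidable p] :
    (if !oo then decide p else decide (¬ p)) = oo ↔ ¬ p := by
  cases oo <;> simp

open Classical in
theorem exists_td {Δ : ℕ} (P : PTree Δ) (h B0 : ℕ) (hh : 2 ≤ h)
    (𝔹 : Type) [Fintype 𝔹] [DecidableEq 𝔹] (cap scap B : ℕ) (hB : B = (B0 + 1) * (Δ + 1) ^ h)
    (hcap : P.m * scap * (h - 1) + P.m * cap < Fintype.card 𝔹 * (cap * scap) * (h - 1)) :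
    ∃ D : TD P ((Δ + 1) ^ h) 𝔹,
      (∀ b o, 2 * ((Finset.range P.m).filter (fun v => ¬ D.cut v ∧ D.bin v = b ∧ D.side v = o)).card
        ≤ cap + 2 * B) ∧
      (∀ b, ((Finset.range P.m).filter (fun v => D.cut v ∧ D.bin v = b)).card ≤ scap + B) ∧
      ((Finset.range P.m).filter (fun v => D.spc v)).card * B0 ≤ P.m ∧
      ((Finset.range P.m).filter (fun v => D.cut v)).card * (h - 1) ≤ P.m := by
  obtain ⟨dep, hdep0, hdep⟩ := exists_dep P
  -- choose j
  obtain ⟨j, hj1, hjh, hjc⟩ : ∃ j, 1 ≤ j ∧ j < h ∧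
      ((Finset.range P.m).filter (fun v => dep v % h = j)).card * (h - 1) ≤ P.m := by
    obtain ⟨j, hj, hc⟩ := exists_residue P.m (h - 1) (fun v => dep v % h - 1)
      ((Finset.range P.m).filter (fun v => dep v % h ≠ 0))
      (fun v hv => by
        have := (Finset.mem_filter.mp hv).2
        have : dep v % h < h := Nat.mod_lt _ (by omega)
        omega) (le_trans (Finset.card_filter_le _ _) (by simp)) (by omega)
    refine ⟨j + 1, by omega, by omega, ?_⟩
    rw [Finset.filter_filter] at hc
    convert hc using 3
    apply Finset.filter_congr
    intro v _
    constructor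
    · intro h'; omega
    · intro h'; omega
  obtain ⟨tp, ad, t1, t2, t3, t4, t5, t6, t7⟩ := exists_split P dep hdep h j hjh
  obtain ⟨sp, rt, hsp, r2, r6, hcomp', hsc⟩ := exists_special P dep hdep h j hjh B0
  have hcomp : ∀ r, ((Finset.range P.m).filter (fun v => rt v = r)).card ≤ B := by
    intro r
    rw [hB]
    exact hcomp' r
  let x : ℕ → ℕ := fun r => ((Finset.range P.m).filter (fun v => rt v = r ∧ ¬ dep v % h = j ∧ dep v % 2 = 0)).card
  let y : ℕ → ℕ := fun r => ((Finset.range P.m).filter (fun v => rt v = r ∧ ¬ dep v % h = j ∧ ¬ dep v % 2 = 0)).card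
  let c : ℕ → ℕ := fun r => ((Finset.range P.m).filter (fun v => rt v = r ∧ dep v % h = j)).card
  have hxy : ∀ r, x r + y r = ((Finset.range P.m).filter (fun v => rt v = r ∧ ¬ dep v % h = j)).card := by
    intro r
    simp only [x, y]
    rw [← Finset.card_filter_add_card_filter_not (s := (Finset.range P.m).filter (fun v => rt v = r ∧ ¬ dep v % h = j))
      (fun v => dep v % 2 = 0), Finset.filter_filter, Finset.filter_filter]
    simp only [and_assoc]
  have hmaps : ∀ (q : ℕ → Prop) [DecidablePred q], ((Finset.range P.m).filter q).card =
      ∑ r ∈ Finset.range P.m, ((Finset.range P.m).filter (fun v => rt v = r ∧ q v)).card := by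
    intro q _
    rw [Finset.card_eq_sum_card_fiberwise (f := rt) (t := Finset.range P.m)]
    · apply Finset.sum_congr rfl
      intro r _
      rw [Finset.filter_filter]
      congr 1
      apply Finset.filter_congr
      intro v _
      tauto
    · intro v hv
      simp only [Finset.coe_filter, Finset.mem_range, Set.mem_ofPred_eq] at hv
      have := r6 v
      simp only [Finset.coe_range, Set.mem_Iio]
      omega
  obtain ⟨β, o, hbin⟩ := binning (𝔹 := 𝔹) x y c B cap scap (Finset.range P.m) (fun r _ => by
      rw [hxy r]
      refine ⟨le_trans (Finset.card_le_card ?_) (hcomp r), le_trans (Finset.card_le_card ?_) (hcomp r)⟩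
      · intro v hv
        simp only [Finset.mem_filter] at hv ⊢
        exact ⟨hv.1, hv.2.1⟩
      · intro v hv
        simp only [Finset.mem_filter] at hv ⊢
        exact ⟨hv.1, hv.2.1⟩) (by
      have e1 : ∑ r ∈ Finset.range P.m, (x r + y r) ≤ P.m := by
        rw [Finset.sum_congr rfl (fun r _ => hxy r), ← hmaps (fun v => ¬ dep v % h = j)]
        exact le_trans (Finset.card_filter_le _ _) (by simp)
      have e2 : (∑ r ∈ Finset.range P.m, c r) * (h - 1) ≤ P.m := by
        simp only [c]
        rw [← hmaps (fun v => dep v % h = j)]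
        exact hjc
      have e3 : 0 < h - 1 := by omega
      apply Nat.lt_of_mul_lt_mul_right (a := h - 1)
      calc ((∑ r ∈ Finset.range P.m, (x r + y r)) * scap + (∑ r ∈ Finset.range P.m, c r) * cap) * (h - 1)
          = (∑ r ∈ Finset.range P.m, (x r + y r)) * scap * (h - 1) + ((∑ r ∈ Finset.range P.m, c r) * (h - 1)) * cap := by ring
        _ ≤ P.m * scap * (h - 1) + P.m * cap := by gcongr
        _ < _ := hcap)
  have hload : ∀ (b : 𝔹) (q : ℕ → Prop) [DecidablePred q], ((Finset.range P.m).filter (fun v => q v ∧ β (rt v) = b)).card =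
      ∑ r ∈ (Finset.range P.m).filter (fun r => β r = b), ((Finset.range P.m).filter (fun v => rt v = r ∧ q v)).card := by
    intro b q _
    rw [hmaps, Finset.sum_filter]
    apply Finset.sum_congr rfl
    intro r _
    split_ifs with hb
    · congr 1
      apply Finset.filter_congr
      intro v _
      constructor
      · rintro ⟨h1, h2, h3⟩; exact ⟨h1, h2⟩
      · rintro ⟨h1, h2⟩; exact ⟨h1, h2, by rw [h1, hb]⟩
    · rw [Finset.card_eq_zero]
      apply Finset.filter_eq_empty_iff.mpr
      rintro v _ ⟨h1, h2, h3⟩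
      apply hb
      rw [← h1, h3]
  have hroot : ∀ v, 1 ≤ v → ¬ (dep (P.p v) % h = j) → ¬ (v = 0 ∨ dep (P.p v) % h = j) := by
    rintro v hv hc (h' | h')
    · omega
    · exact hc h'
  refine ⟨⟨fun v => dep v % h = j, sp, tp, ad, fun v => β (rt v),
    fun v => if o (rt v) then decide (dep v % 2 = 0) else decide (¬ dep v % 2 = 0),
    ?_, ?_, ?_, t1, fun v hv hc => t2 v (hroot v hv hc), fun v hv hm hc => t3 v hm (hroot v hv hc), t4, t5, t6,
    ?_, ?_, ?_⟩, ?_, ?_, ?_, by convert hjc⟩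
  · rw [hdep0]; simp; omega
  · intro v hv hc hc'
    rw [hdep v hv, Nat.add_mod, hc', Nat.mod_eq_of_lt (a := 1) (by omega)] at hc
    by_cases hlt : j + 1 < h
    · rw [Nat.mod_eq_of_lt hlt] at hc; omega
    · have : j + 1 = h := by omega
      rw [this, Nat.mod_self] at hc; omega
  · exact hsp
  · intro v
    by_contra hc
    have h1 := t2 (tp v) hc
    rw [t7] at h1
    have h2 := t6 (P.p (tp v))
    have h3 : 1 ≤ tp v := by
      by_contra h'
      exact hc (Or.inl (by omega))
    have := P.hp (tp v) h3
    omega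
  · intro v hv hc
    have : ¬ (v = 0 ∨ sp (P.p v)) := by
      rintro (h' | h')
      · omega
      · exact hc h'
    simp only [r2 v this]
  · intro v hv hc
    have : ¬ (v = 0 ∨ sp (P.p v)) := by
      rintro (h' | h')
      · omega
      · exact hc h'
    simp only [r2 v this, hdep v hv]
    rcases Nat.mod_two_eq_zero_or_one (dep (P.p v)) with e | e
    · have e' : (dep (P.p v) + 1) % 2 = 1 := by omega
      rw [e, e']; cases o (rt (P.p v)) <;> simp
    · have e' : (dep (P.p v) + 1) % 2 = 0 := by omega
      rw [e, e']; cases o (rt (P.p v)) <;> simp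
  · intro b oo
    have key : ∀ oo' : Bool, ((Finset.range P.m).filter (fun v => ¬ dep v % h = j ∧ β (rt v) = b ∧
        (if o (rt v) then decide (dep v % 2 = 0) else decide (¬ dep v % 2 = 0)) = oo')).card =
        ∑ r ∈ (Finset.range P.m).filter (fun r => β r = b), (if o r = oo' then x r else y r) := by
      intro oo'
      have e1 := hload b (fun v => ¬ dep v % h = j ∧
        (if o (rt v) then decide (dep v % 2 = 0) else decide (¬ dep v % 2 = 0)) = oo')
      have e2 : ((Finset.range P.m).filter (fun v => ¬ dep v % h = j ∧ β (rt v) = b ∧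
        (if o (rt v) then decide (dep v % 2 = 0) else decide (¬ dep v % 2 = 0)) = oo')) =
        ((Finset.range P.m).filter (fun v => (¬ dep v % h = j ∧
        (if o (rt v) then decide (dep v % 2 = 0) else decide (¬ dep v % 2 = 0)) = oo') ∧ β (rt v) = b)) := by
        apply Finset.filter_congr
        intro v _
        tauto
      rw [e2, e1]
      apply Finset.sum_congr rfl
      intro r _
      by_cases ho : o r = oo'
      · rw [if_pos ho]
        simp only [x]
        congr 1
        apply Finset.filter_congr
        intro v _
        constructor
        · rintro ⟨h1, h2, h3⟩
          rw [h1, ho, side_aux1] at h3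
          exact ⟨h1, h2, h3⟩
        · rintro ⟨h1, h2, h3⟩
          refine ⟨h1, h2, ?_⟩
          rw [h1, ho, side_aux1]
          exact h3
      · rw [if_neg ho]
        simp only [y]
        congr 1
        apply Finset.filter_congr
        intro v _
        have ho' : o r = !oo' := Bool.eq_not_of_ne ho
        constructor
        · rintro ⟨h1, h2, h3⟩
          rw [h1, ho', side_aux2] at h3
          exact ⟨h1, h2, h3⟩
        · rintro ⟨h1, h2, h3⟩
          refine ⟨h1, h2, ?_⟩
          rw [h1, ho', side_aux2]
          exact h3
    have h1 := (hbin b).1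
    have h2 := (hbin b).2.1
    simp only
    rw [key oo]
    cases oo
    · convert h2 using 2
      apply Finset.sum_congr rfl
      intro r _
      cases o r <;> simp
    · exact h1
  · intro b
    have h3 := (hbin b).2.2
    have e1 := hload b (fun v => dep v % h = j)
    simp only
    rw [e1]
    exact h3
  · apply hsc _ (Finset.filter_subset _ _)
    intro v hv
    exact (Finset.mem_filter.mp hv).2

end

section

theorem sdr {ι α : Type*} [DecidableEq α] [Nonempty α] (I : Finset ι) (S : ι → Finset α)
    (h : ∀ i ∈ I, I.card ≤ (S i).card) :
    ∃ f : ι → α, (∀ i ∈ I, f i ∈ S i) ∧ ∀ i ∈ I, ∀ j ∈ I, f i = f j → i = j := by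
  classical
  have key := (Finset.all_card_le_biUnion_card_iff_exists_injective (fun i : I => S i.1)).mp ?_
  · obtain ⟨f, hf, hf2⟩ := key
    by_cases hI : I.Nonempty
    · obtain ⟨i0, hi0⟩ := hI
      refine ⟨fun i => if hi : i ∈ I then f ⟨i, hi⟩ else f ⟨i0, hi0⟩, ?_, ?_⟩
      · intro i hi
        simp only [hi, dif_pos]
        exact hf2 ⟨i, hi⟩
      · intro i hi j hj hij
        simp only [hi, hj, dif_pos] at hij
        exact congrArg Subtype.val (hf hij)
    · have hI' : I = ∅ := Finset.not_nonempty_iff_eq_empty.mp hI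
      subst hI'
      exact ⟨fun _ => Classical.arbitrary α, by simp, by simp⟩
  · intro s
    rcases s.eq_empty_or_nonempty with rfl | ⟨i, hi⟩
    · simp
    · calc s.card ≤ (Finset.univ : Finset I).card := Finset.card_le_univ _
        _ = I.card := by simp
        _ ≤ (S i.1).card := h i.1 i.2
        _ ≤ _ := Finset.card_le_card (Finset.subset_biUnion_of_mem (fun i : I => S i.1) hi)


open Classical in
theorem one_tree {Δ K : ℕ} {𝔹 V Ty κ : Type} (P : PTree Δ) (D : TD P K 𝔹)
    (G : SimpleGraph V) (Us : V → V → Prop) (W0 : Finset V) (Z : κ → Finset V) (cl : ℕ → κ)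
    (ty : ℕ → Ty) (Cop : Ty → Finset (ℕ → V)) (c0 bd occ slack w0 r0 : ℕ)
    (hf0 : ∀ c, ∀ f ∈ Cop c, ∀ f' ∈ Cop c, f 0 = f' 0 → f = f')
    (hW : W0.card ≤ w0)
    (hocc : ∀ b, ((Finset.range P.m).filter (fun s => D.cut s ∧ cl s = b)).card ≤ occ)
    (hZ : ∀ b b' z, z ∈ Z b → z ∈ Z b' → b = b')
    (hcop : ∀ t < P.m, (t = 0 ∨ D.cut (P.p t)) →
      ((Finset.range P.m).filter (fun t' => (t' = 0 ∨ D.cut (P.p t')) ∧ ty t' = ty t)).card + slack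
        ≤ (Cop (ty t)).card)
    (hsl : w0 + r0 ≤ slack)
    (H1 : ∀ s < P.m, D.cut s → ∀ f ∈ Cop (ty (D.tp (P.p s))),
      c0 ≤ ((Z (cl s)).filter (fun z => G.Adj (f (D.ad (P.p s))) z ∧
        ¬ Us (f (D.ad (P.p s))) z)).card)
    (H2 : ∀ s < P.m, D.cut s → ∀ t < P.m, 1 ≤ t → P.p t = s → ∀ R : Finset V,
      (∀ y ∈ R, ∃ f ∈ Cop (ty t), f 0 = y) → r0 ≤ R.card →
      ((Z (cl s)).filter (fun z => (R.filter (fun y => G.Adj y z ∧ ¬ Us y z)).card ≤ Δ)).card ≤ bd)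
    (H4 : occ + w0 + Δ * bd < c0) :
    ∃ (F : ℕ → ℕ → V) (zf : ℕ → V),
      (∀ t < P.m, (t = 0 ∨ D.cut (P.p t)) → F t ∈ Cop (ty t)) ∧
      (∀ t < P.m, (t = 0 ∨ D.cut (P.p t)) → ∀ t' < P.m, (t' = 0 ∨ D.cut (P.p t')) →
        ty t = ty t' → F t = F t' → t = t') ∧
      (∀ s < P.m, D.cut s → zf s ∈ Z (cl s) ∧ zf s ∉ W0 ∧
        G.Adj (F (D.tp (P.p s)) (D.ad (P.p s))) (zf s) ∧
        ¬ Us (F (D.tp (P.p s)) (D.ad (P.p s))) (zf s)) ∧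
      (∀ s < P.m, D.cut s → ∀ s' < P.m, D.cut s' → zf s = zf s' → s = s') ∧
      (∀ t < P.m, 1 ≤ t → D.cut (P.p t) → F t 0 ∉ W0 ∧ G.Adj (F t 0) (zf (P.p t)) ∧
        ¬ Us (F t 0) (zf (P.p t))) := by
  have hm := P.hm
  have hroot : ∃ f, f ∈ Cop (ty 0) := by
    have h1 := hcop 0 (by omega) (Or.inl rfl)
    have h2 : 0 < ((Finset.range P.m).filter
        (fun t' => (t' = 0 ∨ D.cut (P.p t')) ∧ ty t' = ty 0)).card :=
      Finset.card_pos.mpr ⟨0, by simp; omega⟩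
    exact Finset.card_pos.mp (by omega)
  obtain ⟨f0, hf0r⟩ := hroot
  haveI : Nonempty (ℕ → V) := ⟨f0⟩
  -- main induction
  have main : ∀ j : ℕ, ∃ (F : ℕ → ℕ → V) (zf : ℕ → V),
      (∀ t < P.m, (t = 0 ∨ (D.cut (P.p t) ∧ P.p t < j)) → F t ∈ Cop (ty t)) ∧
      (∀ t < P.m, (t = 0 ∨ (D.cut (P.p t) ∧ P.p t < j)) → ∀ t' < P.m,
        (t' = 0 ∨ (D.cut (P.p t') ∧ P.p t' < j)) → ty t = ty t' → F t = F t' → t = t') ∧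
      (∀ s < P.m, s < j → D.cut s → zf s ∈ Z (cl s) ∧ zf s ∉ W0 ∧
        G.Adj (F (D.tp (P.p s)) (D.ad (P.p s))) (zf s) ∧
        ¬ Us (F (D.tp (P.p s)) (D.ad (P.p s))) (zf s)) ∧
      (∀ s < P.m, s < j → D.cut s → ∀ s' < P.m, s' < j → D.cut s' → zf s = zf s' → s = s') ∧
      (∀ t < P.m, 1 ≤ t → D.cut (P.p t) → P.p t < j → F t 0 ∉ W0 ∧ G.Adj (F t 0) (zf (P.p t)) ∧
        ¬ Us (F t 0) (zf (P.p t))) := by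
    intro j
    induction j with
    | zero =>
      refine ⟨fun _ => f0, fun _ => f0 0, ?_, ?_, ?_, ?_, ?_⟩
      · rintro t - (rfl | ⟨-, h⟩)
        · exact hf0r
        · omega
      · rintro t - (rfl | ⟨-, h⟩) t' - (rfl | ⟨-, h'⟩) <;> first | (intros; rfl) | omega
      · intro s _ h; omega
      · intro s _ h; omega
      · intro t _ _ _ h; omega
    | succ j ih =>
      obtain ⟨F, zf, i1, i2, i3, i4, i5⟩ := ih
      by_cases hj : j < P.m ∧ D.cut j
      swap
      · -- nothing to do
        have hcutlt : ∀ s < P.m, s < j + 1 → D.cut s → s < j := by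
          intro s h1 h2 h3
          rcases Nat.lt_or_ge s j with h | h
          · exact h
          · have : s = j := by omega
            subst this
            exact absurd ⟨h1, h3⟩ hj
        have hpl : ∀ t < P.m, (t = 0 ∨ (D.cut (P.p t) ∧ P.p t < j + 1)) →
            (t = 0 ∨ (D.cut (P.p t) ∧ P.p t < j)) := by
          rintro t ht (h | ⟨h1, h2⟩)
          · exact Or.inl h
          · rcases Nat.eq_zero_or_pos t with h0 | h0
            · exact Or.inl h0
            · have := P.hp t h0
              exact Or.inr ⟨h1, hcutlt _ (by omega) h2 h1⟩
        refine ⟨F, zf, ?_, ?_, ?_, ?_, ?_⟩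
        · exact fun t ht h => i1 t ht (hpl t ht h)
        · exact fun t ht h t' ht' h' => i2 t ht (hpl t ht h) t' ht' (hpl t' ht' h')
        · exact fun s hs h h' => i3 s hs (hcutlt s hs h h') h'
        · exact fun s hs h h' s' hs' k k' =>
            i4 s hs (hcutlt s hs h h') h' s' hs' (hcutlt s' hs' k k') k'
        · intro t ht h1 h2 h3
          have := P.hp t h1
          exact i5 t ht h1 h2 (hcutlt _ (by omega) h3 h2)
      obtain ⟨hjm, hjc⟩ := hj
      have hj1 : 1 ≤ j := by
        rcases Nat.eq_zero_or_pos j with h | h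
        · subst h; exact absurd hjc D.cut0
        · exact h
      -- the position of the parent
      set q := P.p j with hq
      have hqj : q < j := P.hp j hj1
      set t0 := D.tp q with ht0
      have ht0q : t0 ≤ q := D.tp_le q
      have ht0p : t0 = 0 ∨ (D.cut (P.p t0) ∧ P.p t0 < j) := by
        rcases D.tp_top q with h | h
        · exact Or.inl h
        · rcases Nat.eq_zero_or_pos t0 with h0 | h0
          · exact Or.inl h0
          · have := P.hp t0 h0
            exact Or.inr ⟨h, by omega⟩
      have hFt0 : F t0 ∈ Cop (ty t0) := i1 t0 (by omega) ht0p
      set x := F t0 (D.ad q) with hx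
      -- children
      set Ch := (Finset.range P.m).filter (fun t => 1 ≤ t ∧ P.p t = j) with hCh
      have hChc : Ch.card ≤ Δ := P.hch j
      -- unused copies
      let Un : ℕ → Finset (ℕ → V) := fun t => (Cop (ty t)).filter (fun f =>
        f 0 ∉ W0 ∧ ∀ t' < P.m, (t' = 0 ∨ (D.cut (P.p t') ∧ P.p t' < j)) → ty t' = ty t → F t' ≠ f)
      let R : ℕ → Finset V := fun t => (Un t).image (fun f => f 0)
      have hinjR : ∀ t, Set.InjOn (fun f : ℕ → V => f 0) (Cop (ty t)) := by
        intro t f hf f' hf' h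
        exact hf0 _ f hf f' hf' h
      have hRc : ∀ t ∈ Ch, r0 ≤ (R t).card := by
        intro t ht
        obtain ⟨ht1, ht2, ht3⟩ : t < P.m ∧ 1 ≤ t ∧ P.p t = j := by simpa [hCh] using ht
        have hRU : (R t).card = (Un t).card := by
          apply Finset.card_image_of_injOn
          exact (hinjR t).mono (by intro f hf; exact (Finset.mem_filter.mp hf).1)
        rw [hRU]
        have hc := hcop t ht1 (Or.inr (by rw [ht3]; exact hjc))
        set Tops := (Finset.range P.m).filter (fun t' => (t' = 0 ∨ D.cut (P.p t')) ∧ ty t' = ty t)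
        have hsub : Cop (ty t) ⊆ Un t ∪ ((Cop (ty t)).filter (fun f => f 0 ∈ W0) ∪ Tops.image F) := by
          intro f hf
          by_cases hu : f ∈ Un t
          · exact Finset.mem_union_left _ hu
          · apply Finset.mem_union_right
            by_cases hw : f 0 ∈ W0
            · exact Finset.mem_union_left _ (Finset.mem_filter.mpr ⟨hf, hw⟩)
            · apply Finset.mem_union_right
              have : ¬ (∀ t' < P.m, (t' = 0 ∨ (D.cut (P.p t') ∧ P.p t' < j)) →
                  ty t' = ty t → F t' ≠ f) := by
                intro h
                exact hu (Finset.mem_filter.mpr ⟨hf, hw, h⟩)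
              push Not at this
              obtain ⟨t', h1, h2, h3, h4⟩ := this
              refine Finset.mem_image.mpr ⟨t', ?_, h4⟩
              refine Finset.mem_filter.mpr ⟨Finset.mem_range.mpr h1, ?_, h3⟩
              rcases h2 with h2 | h2
              · exact Or.inl h2
              · exact Or.inr h2.1
        have hW' : ((Cop (ty t)).filter (fun f => f 0 ∈ W0)).card ≤ W0.card := by
          apply Finset.card_le_card_of_injOn (fun f => f 0)
          · intro f hf
            exact (Finset.mem_filter.mp hf).2
          · exact (hinjR t).mono (by intro f hf; exact (Finset.mem_filter.mp hf).1)
        have k1 := Finset.card_le_card hsub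
        have k2 := Finset.card_union_le (Un t)
          ((Cop (ty t)).filter (fun f => f 0 ∈ W0) ∪ Tops.image F)
        have k3 := Finset.card_union_le ((Cop (ty t)).filter (fun f => f 0 ∈ W0)) (Tops.image F)
        have k4 : (Tops.image F).card ≤ Tops.card := Finset.card_image_le
        omega
      -- choose z
      let Bad : ℕ → Finset V := fun t => (Z (cl j)).filter
        (fun z => ((R t).filter (fun y => G.Adj y z ∧ ¬ Us y z)).card ≤ Δ)
      have hBad : ∀ t ∈ Ch, (Bad t).card ≤ bd := by
        intro t ht
        obtain ⟨ht1, ht2, ht3⟩ : t < P.m ∧ 1 ≤ t ∧ P.p t = j := by simpa [hCh] using ht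
        refine H2 j hjm hjc t ht1 ht2 ht3 (R t) ?_ (hRc t ht)
        intro y hy
        obtain ⟨f, hf, rfl⟩ := Finset.mem_image.mp hy
        exact ⟨f, (Finset.mem_filter.mp hf).1, rfl⟩
      set Cz := (Z (cl j)).filter (fun z => G.Adj x z ∧ ¬ Us x z) with hCz
      have hCzc : c0 ≤ Cz.card := H1 j hjm hjc (F t0) hFt0
      set Occ := ((Finset.range P.m).filter (fun s => D.cut s ∧ cl s = cl j)).image zf with hOcc
      have hOccc : Occ.card ≤ occ := le_trans Finset.card_image_le (hocc _)
      have hz : ∃ z ∈ Cz, z ∉ Occ ∪ (W0 ∪ Ch.biUnion Bad) := by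
        by_contra hcon
        push Not at hcon
        have k1 := Finset.card_le_card hcon
        have k2 := Finset.card_union_le Occ (W0 ∪ Ch.biUnion Bad)
        have k3 := Finset.card_union_le W0 (Ch.biUnion Bad)
        have k4 : (Ch.biUnion Bad).card ≤ Ch.card * bd := Finset.card_biUnion_le_card_mul _ _ _ hBad
        have k5 : Ch.card * bd ≤ Δ * bd := Nat.mul_le_mul_right _ hChc
        omega
      obtain ⟨z, hzC, hzN⟩ := hz
      obtain ⟨hzZ, hzA, hzU⟩ := Finset.mem_filter.mp hzC
      simp only [Finset.mem_union, not_or] at hzN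
      obtain ⟨hzO, hzW, hzB⟩ := hzN
      -- choose copies
      obtain ⟨g, hg1, hg2⟩ := sdr Ch (fun t => (Un t).filter
        (fun f => G.Adj (f 0) z ∧ ¬ Us (f 0) z)) (by
          intro t ht
          have hnb : z ∉ Bad t := fun h => hzB (Finset.mem_biUnion.mpr ⟨t, ht, h⟩)
          have h1 : ¬ ((R t).filter (fun y => G.Adj y z ∧ ¬ Us y z)).card ≤ Δ := by
            intro h
            exact hnb (Finset.mem_filter.mpr ⟨hzZ, h⟩)
          have h2 : ((R t).filter (fun y => G.Adj y z ∧ ¬ Us y z)).card ≤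
              ((Un t).filter (fun f => G.Adj (f 0) z ∧ ¬ Us (f 0) z)).card := by
            rw [Finset.filter_image]
            exact Finset.card_image_le
          omega)
      have hgU : ∀ t ∈ Ch, g t ∈ Cop (ty t) ∧ g t 0 ∉ W0 ∧ (∀ t' < P.m,
          (t' = 0 ∨ (D.cut (P.p t') ∧ P.p t' < j)) → ty t' = ty t → F t' ≠ g t) ∧
          G.Adj (g t 0) z ∧ ¬ Us (g t 0) z := by
        intro t ht
        obtain ⟨h1, h2⟩ := Finset.mem_filter.mp (hg1 t ht)
        obtain ⟨h3, h4, h5⟩ := Finset.mem_filter.mp h1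
        exact ⟨h3, h4, h5, h2⟩
      have hnotCh : ∀ t, (t = 0 ∨ (D.cut (P.p t) ∧ P.p t < j)) → t ∉ Ch := by
        intro t h ht
        obtain ⟨ht1, ht2, ht3⟩ : t < P.m ∧ 1 ≤ t ∧ P.p t = j := by simpa [hCh] using ht
        rcases h with h | h <;> omega
      have hsplit : ∀ t < P.m, (t = 0 ∨ (D.cut (P.p t) ∧ P.p t < j + 1)) →
          t ∈ Ch ∨ (t ∉ Ch ∧ (t = 0 ∨ (D.cut (P.p t) ∧ P.p t < j))) := by
        intro t ht h
        by_cases hc : t ∈ Ch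
        · exact Or.inl hc
        · refine Or.inr ⟨hc, ?_⟩
          rcases h with h | ⟨h1, h2⟩
          · exact Or.inl h
          · rcases Nat.eq_zero_or_pos t with h0 | h0
            · exact Or.inl h0
            · have : P.p t ≠ j := fun h3 => hc (by simp [hCh]; omega)
              exact Or.inr ⟨h1, by omega⟩
      have hFold : ∀ s < P.m, 1 ≤ s → s < j + 1 → D.tp (P.p s) ∉ Ch := by
        intro s hs hs1 hsj
        apply hnotCh
        have hps := P.hp s hs1
        have hle := D.tp_le (P.p s)
        rcases Nat.eq_zero_or_pos (D.tp (P.p s)) with h0 | h0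
        · exact Or.inl h0
        · have := P.hp _ h0
          rcases D.tp_top (P.p s) with h | h
          · exact Or.inl h
          · exact Or.inr ⟨h, by omega⟩
      have hpos : ∀ s, D.cut s → 1 ≤ s := by
        intro s hs
        rcases Nat.eq_zero_or_pos s with h | h
        · subst h; exact absurd hs D.cut0
        · exact h
      have hocc' : ∀ s < P.m, s < j → D.cut s → zf s ≠ z := by
        intro s h1 h2 h3 h4
        have hzs := (i3 s h1 h2 h3).1
        rw [h4] at hzs
        have := hZ _ _ z hzs hzZ
        exact hzO (Finset.mem_image.mpr ⟨s, by simp [h1, h3, this], h4⟩)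
      refine ⟨fun t => if t ∈ Ch then g t else F t, fun s => if s = j then z else zf s,
        ?_, ?_, ?_, ?_, ?_⟩
      · intro t ht h
        rcases hsplit t ht h with hc | ⟨hc, h'⟩
        · simp only [hc, if_true]; exact (hgU t hc).1
        · simp only [hc, if_false]; exact i1 t ht h'
      · intro t ht h t' ht' h' hty heq
        rcases hsplit t ht h with hc | ⟨hc, k⟩ <;> rcases hsplit t' ht' h' with hc' | ⟨hc', k'⟩ <;>
          simp only [hc, hc', if_true, if_false] at heq
        · exact hg2 t hc t' hc' heq
        · exact absurd heq.symm ((hgU t hc).2.2.1 t' ht' k' hty.symm)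
        · exact absurd heq ((hgU t' hc').2.2.1 t ht k hty)
        · exact i2 t ht k t' ht' k' hty heq
      · intro s hs hsj hc
        have hFo := hFold s hs (hpos s hc) hsj
        simp only [hFo, if_false]
        by_cases hsj' : s = j
        · subst hsj'
          simp only [if_true]
          exact ⟨hzZ, hzW, hzA, hzU⟩
        · simp only [hsj', if_false]
          exact i3 s hs (by omega) hc
      · intro s hs hsj hc s' hs' hsj' hc' heq
        by_cases h1 : s = j <;> by_cases h2 : s' = j <;>
          simp only [h1, h2, if_true, if_false] at heq
        · omega
        · exact absurd heq.symm (hocc' s' hs' (by omega) hc')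
        · exact absurd heq (hocc' s hs (by omega) hc)
        · exact i4 s hs (by omega) hc s' hs' (by omega) hc' heq
      · intro t ht h1 h2 h3
        by_cases hc : t ∈ Ch
        · have hpj : P.p t = j := (by simpa [hCh] using hc : t < P.m ∧ 1 ≤ t ∧ P.p t = j).2.2
          simp only [hc, hpj, if_true]
          exact ⟨(hgU t hc).2.1, (hgU t hc).2.2.2⟩
        · have : P.p t ≠ j := fun h3 => hc (by simp [hCh]; omega)
          simp only [hc, this, if_false]
          exact i5 t ht h1 h2 (by omega)
  obtain ⟨F, zf, i1, i2, i3, i4, i5⟩ := main P.m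
  have hpl : ∀ t < P.m, (t = 0 ∨ D.cut (P.p t)) → (t = 0 ∨ (D.cut (P.p t) ∧ P.p t < P.m)) := by
    rintro t ht (h | h)
    · exact Or.inl h
    · rcases Nat.eq_zero_or_pos t with h0 | h0
      · exact Or.inl h0
      · have := P.hp t h0
        exact Or.inr ⟨h, by omega⟩
  refine ⟨F, zf, ?_, ?_, ?_, ?_, ?_⟩
  · exact fun t ht h => i1 t ht (hpl t ht h)
  · exact fun t ht h t' ht' h' => i2 t ht (hpl t ht h) t' ht' (hpl t' ht' h')
  · exact fun s hs h => i3 s hs hs h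
  · exact fun s hs h s' hs' h' => i4 s hs hs h s' hs' hs' h'
  · intro t ht h1 h2
    have := P.hp t h1
    exact i5 t ht h1 h2 (by omega)

end

section

/-- The vertex `v` of the tree is incident with a link edge (or the root). -/
def Mkd {Δ K : ℕ} {𝔹 : Type} {P : PTree Δ} (D : TD P K 𝔹) (v : ℕ) : Prop :=
  (v = 0 ∨ D.cut (P.p v)) ∨ ∃ s < P.m, 1 ≤ s ∧ D.cut s ∧ P.p s = v

open Classical in
/-- Interface for the sequential greedy embedding. -/
structure AL {Δ K τ : ℕ} {𝔹 V Ty κ : Type} [Fintype V] (P : Fin τ → PTree Δ)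
    (D : ∀ i, TD (P i) K 𝔹) (G : SimpleGraph V) (Z Cell : κ → Finset V) (gd : κ → κ → Prop)
    (A : Fin τ → Bool → 𝔹 → κ) (ty : Fin τ → ℕ → Ty) (Cop : Fin τ → Ty → Finset (ℕ → V))
    (ty0 slack capm t0 q : ℕ) : Prop where
  Zd : ∀ b b' z, z ∈ Z b → z ∈ Z b' → b = b'
  Cd : ∀ b b' z, z ∈ Cell b → z ∈ Cell b' → b = b'
  CZ : ∀ b b' z, z ∈ Cell b → z ∉ Z b'
  Ainj : ∀ i o, Function.Injective (A i o)
  gdA : ∀ i o β, gd (A i o β) (A i (!o) β)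
  a1 : ∀ i v, v < (P i).m → ¬ (D i).cut v → ∀ f ∈ Cop i (ty i ((D i).tp v)),
    f ((D i).ad v) ∈ Cell (A i ((D i).side v) ((D i).bin v))
  a2 : ∀ i v v', v < (P i).m → ¬ (D i).cut v → v' < (P i).m → ¬ (D i).cut v' →
    ∀ f ∈ Cop i (ty i ((D i).tp v)), ∀ f' ∈ Cop i (ty i ((D i).tp v')),
    f ((D i).ad v) = f' ((D i).ad v') →
      ty i ((D i).tp v) = ty i ((D i).tp v') ∧ f = f' ∧ (D i).ad v = (D i).ad v'
  a2' : ∀ i c, ∀ f ∈ Cop i c, ∀ f' ∈ Cop i c, f 0 = f' 0 → f = f'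
  a3 : ∀ i v, 1 ≤ v → v < (P i).m → ¬ (D i).cut v → ¬ (D i).cut ((P i).p v) →
    ∀ f ∈ Cop i (ty i ((D i).tp v)), G.Adj (f ((D i).ad ((P i).p v))) (f ((D i).ad v))
  a4 : ∀ i s, s < (P i).m → (D i).cut s → ∀ f ∈ Cop i (ty i ((D i).tp ((P i).p s))),
    ty0 ≤ ((Z (A i ((D i).side s) ((D i).bin s))).filter
      (fun z => G.Adj (f ((D i).ad ((P i).p s))) z)).card
  a5 : ∀ i, ∀ t < (P i).m, (t = 0 ∨ (D i).cut ((P i).p t)) →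
      ((Finset.range (P i).m).filter
        (fun t' => (t' = 0 ∨ (D i).cut ((P i).p t')) ∧ ty i t' = ty i t)).card + slack
        ≤ (Cop i (ty i t)).card
  a6 : ∀ i i', i ≠ i' → ∀ v v', 1 ≤ v → v < (P i).m → ¬ (D i).cut v → ¬ (D i).cut ((P i).p v) →
    1 ≤ v' → v' < (P i').m → ¬ (D i').cut v' → ¬ (D i').cut ((P i').p v') →
    ∀ f ∈ Cop i (ty i ((D i).tp v)), ∀ f' ∈ Cop i' (ty i' ((D i').tp v')),
    s(f ((D i).ad ((P i).p v)), f ((D i).ad v)) ≠ s(f' ((D i').ad ((P i').p v')), f' ((D i').ad v'))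
  a7 : ∀ y b, (Finset.univ.filter (fun i => ∃ v < (P i).m, ¬ (D i).cut v ∧ Mkd (D i) v ∧
    A i (!(D i).side v) ((D i).bin v) = b ∧
    ∃ f ∈ Cop i (ty i ((D i).tp v)), f ((D i).ad v) = y)).card ≤ capm
  dens : ∀ a b, gd a b → ∀ C ⊆ Z b, ∀ R ⊆ Cell a, t0 ≤ C.card → t0 ≤ R.card →
    C.card * R.card ≤ q * ∑ z ∈ C, (R.filter (fun y => G.Adj y z)).card

/-- Nonspecial link edges. -/
def NLk {Δ K : ℕ} {𝔹 V : Type} {P : PTree Δ} (D : TD P K 𝔹) (ψ : ℕ → V) (y z : V) : Prop :=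
  ∃ v < P.m, ¬ D.cut v ∧ y = ψ v ∧ ((∃ s < P.m, 1 ≤ s ∧ P.p s = v ∧ D.cut s ∧ z = ψ s) ∨
    (1 ≤ v ∧ D.cut (P.p v) ∧ ¬ D.spc (P.p v) ∧ z = ψ (P.p v)))

/-- Special link edges. -/
def SLk {Δ K : ℕ} {𝔹 V : Type} {P : PTree Δ} (D : TD P K 𝔹) (ψ : ℕ → V) (y z : V) : Prop :=
  ∃ t < P.m, 1 ≤ t ∧ D.spc (P.p t) ∧ y = ψ t ∧ z = ψ (P.p t)

open Classical in
/-- number of special links at `x`. -/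
noncomputable def spd {Δ K : ℕ} {𝔹 V : Type} {P : PTree Δ} (D : TD P K 𝔹) (ψ : ℕ → V) (x : V) : ℕ :=
  ((Finset.range P.m).filter (fun t => 1 ≤ t ∧ D.spc (P.p t) ∧ (ψ t = x ∨ ψ (P.p t) = x))).card

/-- A valid embedding of one tree. -/
structure Emb {Δ K : ℕ} {𝔹 V Ty κ : Type} (P : PTree Δ) (D : TD P K 𝔹) (G : SimpleGraph V)
    (Z : κ → Finset V) (A : Bool → 𝔹 → κ) (ty : ℕ → Ty) (Cop : Ty → Finset (ℕ → V))
    (ψ : ℕ → V) : Prop where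
  fn : ∃ F : ℕ → ℕ → V, ∀ v < P.m, ¬ D.cut v → F (D.tp v) ∈ Cop (ty (D.tp v)) ∧
    ψ v = F (D.tp v) (D.ad v)
  z : ∀ s < P.m, D.cut s → ψ s ∈ Z (A (D.side s) (D.bin s))
  inj : ∀ v < P.m, ∀ v' < P.m, ψ v = ψ v' → v = v'
  adj : ∀ v < P.m, 1 ≤ v → G.Adj (ψ (P.p v)) (ψ v)

section
variable {Δ K : ℕ} {𝔹 V Ty κ : Type} [Fintype V] {P : PTree Δ} {D : TD P K 𝔹} {ψ : ℕ → V}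

theorem spd_le (hΔ : 1 ≤ Δ) (hinj : ∀ v < P.m, ∀ v' < P.m, ψ v = ψ v' → v = v') (x : V) :
    spd D ψ x ≤ Δ := by
  classical
  unfold spd
  by_cases hx : ∃ v < P.m, ψ v = x
  · obtain ⟨v, hv, rfl⟩ := hx
    by_cases hc : D.cut v
    · refine le_trans (Finset.card_le_card ?_) (P.hch v)
      intro t ht
      simp only [Finset.mem_filter, Finset.mem_range] at ht ⊢
      obtain ⟨h1, h2, h3, h4⟩ := ht
      have hp := P.hp t h2
      refine ⟨h1, h2, ?_⟩
      rcases h4 with h4 | h4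
      · have := hinj _ h1 _ hv h4
        subst this
        exact absurd (D.spc_cut _ h3) (D.cutp _ h2 hc)
      · exact hinj _ (by omega) _ hv h4
    · refine le_trans (Finset.card_le_one.mpr ?_) hΔ
      have key : ∀ t ∈ (Finset.range P.m).filter
          (fun t => 1 ≤ t ∧ D.spc (P.p t) ∧ (ψ t = ψ v ∨ ψ (P.p t) = ψ v)), t = v := by
        intro t ht
        simp only [Finset.mem_filter, Finset.mem_range] at ht
        obtain ⟨h1, h2, h3, h4⟩ := ht
        have hp := P.hp t h2
        rcases h4 with h4 | h4
        · exact hinj _ h1 _ hv h4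
        · have := hinj _ (by omega) _ hv h4
          rw [this] at h3
          exact absurd (D.spc_cut _ h3) hc
      intro a ha b hb
      rw [key a ha, key b hb]
  · rw [Finset.card_eq_zero.mpr]
    · omega
    · apply Finset.filter_eq_empty_iff.mpr
      intro t ht ⟨h1, _, h3⟩
      have ht := Finset.mem_range.mp ht
      have hp := P.hp t h1
      rcases h3 with h3 | h3
      · exact hx ⟨t, ht, h3⟩
      · exact hx ⟨_, by omega, h3⟩

open Classical in
theorem spd_sum (M : ℕ) (hM : ((Finset.range P.m).filter (fun v => D.spc v)).card ≤ M) :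
    ∑ x, spd D ψ x ≤ 2 * (M * Δ) := by
  set S := (Finset.range P.m).filter (fun t => 1 ≤ t ∧ D.spc (P.p t)) with hS
  have h1 : S.card ≤ M * Δ := by
    have hsub : S ⊆ ((Finset.range P.m).filter (fun v => D.spc v)).biUnion
        (fun u => (Finset.range P.m).filter (fun v => 1 ≤ v ∧ P.p v = u)) := by
      intro t ht
      simp only [hS, Finset.mem_filter, Finset.mem_range] at ht
      have hp := P.hp t ht.2.1
      simp only [Finset.mem_biUnion, Finset.mem_filter, Finset.mem_range]
      exact ⟨P.p t, ⟨by omega, ht.2.2⟩, ht.1, ht.2.1, rfl⟩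
    calc S.card ≤ _ := Finset.card_le_card hsub
      _ ≤ _ * Δ := Finset.card_biUnion_le_card_mul _ _ Δ (fun u _ => P.hch u)
      _ ≤ M * Δ := Nat.mul_le_mul_right _ hM
  have h2 : ∀ x, spd D ψ x ≤ ∑ t ∈ S, ((if ψ t = x then 1 else 0) + (if ψ (P.p t) = x then 1 else 0)) := by
    intro x
    unfold spd
    have : ((Finset.range P.m).filter (fun t => 1 ≤ t ∧ D.spc (P.p t) ∧ (ψ t = x ∨ ψ (P.p t) = x)))
        = S.filter (fun t => ψ t = x ∨ ψ (P.p t) = x) := by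
      rw [hS, Finset.filter_filter]
      apply Finset.filter_congr
      intro t _
      tauto
    rw [this, Finset.card_filter]
    apply Finset.sum_le_sum
    intro t _
    split_ifs <;> first | omega | tauto
  calc ∑ x, spd D ψ x ≤ ∑ x, ∑ t ∈ S, ((if ψ t = x then 1 else 0) + (if ψ (P.p t) = x then 1 else 0)) :=
        Finset.sum_le_sum (fun x _ => h2 x)
    _ = ∑ t ∈ S, ∑ x, ((if ψ t = x then 1 else 0) + (if ψ (P.p t) = x then 1 else 0)) :=
        Finset.sum_comm
    _ = ∑ t ∈ S, 2 := by
        apply Finset.sum_congr rfl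
        intro t _
        rw [Finset.sum_add_distrib]
        simp
    _ = 2 * S.card := by simp [mul_comm]
    _ ≤ _ := by omega

open Classical in
theorem slk_card_z (y : V) : (Finset.univ.filter (fun z => SLk D ψ y z)).card ≤ spd D ψ y := by
  unfold spd
  refine le_trans (Finset.card_le_card ?_) (Finset.card_image_le (f := fun t => ψ (P.p t)))
  intro z hz
  obtain ⟨t, h1, h2, h3, h4, h5⟩ := (Finset.mem_filter.mp hz).2
  exact Finset.mem_image.mpr ⟨t, by simp [h1, h2, h3, h4], h5.symm⟩

open Classical in
theorem slk_card_y (z : V) : (Finset.univ.filter (fun y => SLk D ψ y z)).card ≤ spd D ψ z := by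
  unfold spd
  refine le_trans (Finset.card_le_card ?_) (Finset.card_image_le (f := fun t => ψ t))
  intro y hy
  obtain ⟨t, h1, h2, h3, h4, h5⟩ := (Finset.mem_filter.mp hy).2
  exact Finset.mem_image.mpr ⟨t, by simp [h1, h2, h3, h5], h4.symm⟩

open Classical in
theorem nlk_card (hinj : ∀ v < P.m, ∀ v' < P.m, ψ v = ψ v' → v = v') (y : V) :
    (Finset.univ.filter (fun z => NLk D ψ y z)).card ≤ Δ + 1 := by
  by_cases hx : ∃ v < P.m, ψ v = y
  · obtain ⟨v, hv, rfl⟩ := hx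
    have hsub : (Finset.univ.filter (fun z => NLk D ψ (ψ v) z)) ⊆
        insert (ψ (P.p v)) (((Finset.range P.m).filter (fun s => 1 ≤ s ∧ P.p s = v)).image ψ) := by
      intro z hz
      obtain ⟨u, hu, hc, huv, h⟩ := (Finset.mem_filter.mp hz).2
      have := hinj _ hv _ hu huv
      subst this
      rcases h with ⟨s, h1, h2, h3, h4, h5⟩ | ⟨h1, h2, h3, h4⟩
      · exact Finset.mem_insert_of_mem (Finset.mem_image.mpr ⟨s, by simp [h1, h2, h3], h5.symm⟩)
      · rw [h4]; exact Finset.mem_insert_self _ _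
    refine le_trans (Finset.card_le_card hsub) (le_trans (Finset.card_insert_le _ _) ?_)
    have := le_trans (Finset.card_image_le (s := (Finset.range P.m).filter
      (fun s => 1 ≤ s ∧ P.p s = v)) (f := ψ)) (P.hch v)
    omega
  · rw [Finset.card_eq_zero.mpr]
    · omega
    · apply Finset.filter_eq_empty_iff.mpr
      rintro z - ⟨u, hu, hc, huv, h⟩
      exact hx ⟨u, hu, huv.symm⟩

end

end

section

/-- used links -/
def UsI {Δ K τ : ℕ} {𝔹 V : Type} {P : Fin τ → PTree Δ} (D : ∀ i, TD (P i) K 𝔹) (I : Finset (Fin τ))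
    (φ : Fin τ → ℕ → V) (y z : V) : Prop :=
  ∃ i ∈ I, NLk (D i) (φ i) y z ∨ SLk (D i) (φ i) y z

section
variable {Δ K τ : ℕ} {𝔹 V Ty κ : Type} [Fintype V] {P : Fin τ → PTree Δ}
    {D : ∀ i, TD (P i) K 𝔹} {G : SimpleGraph V} {Z Cell : κ → Finset V} {gd : κ → κ → Prop}
    {A : Fin τ → Bool → 𝔹 → κ} {ty : Fin τ → ℕ → Ty} {Cop : Fin τ → Ty → Finset (ℕ → V)}
    {ty0 slack capm t0 q : ℕ}

/-- facts about a nonspecial link of a valid embedding -/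
theorem nlk_facts (al : AL P D G Z Cell gd A ty Cop ty0 slack capm t0 q) (i : Fin τ) (ψ : ℕ → V)
    (he : Emb (P i) (D i) G Z (A i) (ty i) (Cop i) ψ) (y z : V) (h : NLk (D i) ψ y z) :
    ∃ v < (P i).m, ¬ (D i).cut v ∧ Mkd (D i) v ∧
      z ∈ Z (A i (!(D i).side v) ((D i).bin v)) ∧ y ∈ Cell (A i ((D i).side v) ((D i).bin v)) ∧
      ∃ f ∈ Cop i (ty i ((D i).tp v)), f ((D i).ad v) = y := by
  obtain ⟨v, hv, hc, rfl, h⟩ := h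
  obtain ⟨F, hF⟩ := he.fn
  obtain ⟨hF1, hF2⟩ := hF v hv hc
  have hcell : ψ v ∈ Cell (A i ((D i).side v) ((D i).bin v)) := by
    rw [hF2]; exact al.a1 i v hv hc _ hF1
  refine ⟨v, hv, hc, ?_, ?_, hcell, ⟨_, hF1, hF2.symm⟩⟩
  · rcases h with ⟨s, h1, h2, h3, h4, h5⟩ | ⟨h1, h2, h3, h4⟩
    · exact Or.inr ⟨s, h1, h2, h4, h3⟩
    · exact Or.inl (Or.inr h2)
  · rcases h with ⟨s, h1, h2, h3, h4, rfl⟩ | ⟨h1, h2, h3, rfl⟩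
    · have hns : ¬ (D i).spc ((P i).p s) := by
        rw [h3]; exact fun h => hc ((D i).spc_cut _ h)
      have e1 := (D i).bin_eq s h2 hns
      have e2 := (D i).side_eq s h2 hns
      have := he.z s h1 h4
      rw [e1, e2, h3] at this
      exact this
    · have e1 := (D i).bin_eq v h1 h3
      have e2 := (D i).side_eq v h1 h3
      have hp := (P i).hp v h1
      have := he.z _ (by omega) h2
      rw [e1, e2, Bool.not_not]
      exact this

open Classical in
theorem al_usage (al : AL P D G Z Cell gd A ty Cop ty0 slack capm t0 q) (I : Finset (Fin τ))
    (φ : Fin τ → ℕ → V)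
    (he : ∀ i ∈ I, Emb (P i) (D i) G Z (A i) (ty i) (Cop i) (φ i)) (y : V) (b : κ) :
    ((Z b).filter (fun z => ∃ i ∈ I, NLk (D i) (φ i) y z)).card ≤ (Δ + 1) * capm := by
  set J := I.filter (fun i => ∃ z ∈ Z b, NLk (D i) (φ i) y z) with hJ
  have hsub : ((Z b).filter (fun z => ∃ i ∈ I, NLk (D i) (φ i) y z)) ⊆
      J.biUnion (fun i => Finset.univ.filter (fun z => NLk (D i) (φ i) y z)) := by
    intro z hz
    obtain ⟨hz, i, hi, h⟩ := Finset.mem_filter.mp hz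
    exact Finset.mem_biUnion.mpr ⟨i, Finset.mem_filter.mpr ⟨hi, z, hz, h⟩, by simpa using h⟩
  have h1 := Finset.card_biUnion_le_card_mul J
    (fun i => Finset.univ.filter (fun z => NLk (D i) (φ i) y z)) (Δ + 1) (by
      intro i hi
      exact nlk_card (he i (Finset.mem_filter.mp hi).1).inj y)
  have h2 : J.card ≤ capm := by
    refine le_trans (Finset.card_le_card ?_) (al.a7 y b)
    intro i hi
    obtain ⟨hi, z, hz, h⟩ := Finset.mem_filter.mp hi
    obtain ⟨v, k1, k2, k3, k4, k5, k6⟩ := nlk_facts al i (φ i) (he i hi) y z h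
    exact Finset.mem_filter.mpr ⟨Finset.mem_univ _, v, k1, k2, k3, al.Zd _ _ z k4 hz, k6⟩
  calc _ ≤ _ := Finset.card_le_card hsub
    _ ≤ J.card * (Δ + 1) := h1
    _ ≤ capm * (Δ + 1) := Nat.mul_le_mul_right _ h2
    _ = _ := mul_comm _ _

open Classical in
theorem al_special (I : Finset (Fin τ)) (φ : Fin τ → ℕ → V) (x : V) (S : Finset V) :
    (S.filter (fun z => ∃ i ∈ I, SLk (D i) (φ i) x z)).card ≤ ∑ i ∈ I, spd (D i) (φ i) x ∧
    (S.filter (fun y => ∃ i ∈ I, SLk (D i) (φ i) y x)).card ≤ ∑ i ∈ I, spd (D i) (φ i) x := by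
  constructor
  · refine le_trans (Finset.card_le_card (t := I.biUnion
      (fun i => Finset.univ.filter (fun z => SLk (D i) (φ i) x z))) ?_) ?_
    · intro z hz
      obtain ⟨-, i, hi, h⟩ := Finset.mem_filter.mp hz
      exact Finset.mem_biUnion.mpr ⟨i, hi, by simpa using h⟩
    · exact le_trans Finset.card_biUnion_le (Finset.sum_le_sum (fun i _ => slk_card_z x))
  · refine le_trans (Finset.card_le_card (t := I.biUnion
      (fun i => Finset.univ.filter (fun y => SLk (D i) (φ i) y x))) ?_) ?_
    · intro z hz
      obtain ⟨-, i, hi, h⟩ := Finset.mem_filter.mp hz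
      exact Finset.mem_biUnion.mpr ⟨i, hi, by simpa using h⟩
    · exact le_trans Finset.card_biUnion_le (Finset.sum_le_sum (fun i _ => slk_card_y x))

open Classical in
/-- bad vertices are few -/
theorem al_bad (al : AL P D G Z Cell gd A ty Cop ty0 slack capm t0 q) (I : Finset (Fin τ))
    (φ : Fin τ → ℕ → V)
    (he : ∀ i ∈ I, Emb (P i) (D i) G Z (A i) (ty i) (Cop i) (φ i)) (D2 r r0 bd : ℕ)
    (hsp : ∀ x, ∑ i ∈ I, spd (D i) (φ i) x ≤ D2)
    (hole : ∀ S T : Finset V, Disjoint S T → S.card = r → T.card = r → ∃ a ∈ S, ∃ b ∈ T, G.Adj a b)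
    (hr0 : 1 ≤ r0) (hr1 : t0 ≤ r0) (hr2 : 2 * q * (Δ + D2) ≤ r0) (hr3 : r * (Δ + D2 + 1) ≤ r0)
    (hb1 : t0 ≤ bd) (hb2 : 2 * q * ((Δ + 1) * capm) ≤ bd) (hb3 : r ≤ bd)
    (a b : κ) (R : Finset V) (hR : R ⊆ Cell a) (hRc : r0 ≤ R.card) :
    ((Z b).filter (fun z => (R.filter (fun y => G.Adj y z ∧
      ¬ UsI D I φ y z)).card ≤ Δ)).card ≤ bd := by
  set C := ((Z b).filter (fun z => (R.filter (fun y => G.Adj y z ∧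
      ¬ UsI D I φ y z)).card ≤ Δ)) with hC
  have hCZ : C ⊆ Z b := Finset.filter_subset _ _
  have hsplit : ∀ z ∈ C, (R.filter (fun y => G.Adj y z)).card ≤
      Δ + D2 + (R.filter (fun y => ∃ i ∈ I, NLk (D i) (φ i) y z)).card := by
    intro z hz
    have h1 := (Finset.mem_filter.mp hz).2
    have hsub : R.filter (fun y => G.Adj y z) ⊆ (R.filter (fun y => G.Adj y z ∧
      ¬ UsI D I φ y z)) ∪
      ((R.filter (fun y => ∃ i ∈ I, SLk (D i) (φ i) y z)) ∪
      (R.filter (fun y => ∃ i ∈ I, NLk (D i) (φ i) y z))) := by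
      intro y hy
      obtain ⟨hy1, hy2⟩ := Finset.mem_filter.mp hy
      simp only [Finset.mem_union, Finset.mem_filter, hy1, hy2, true_and]
      by_cases hn : ∃ i ∈ I, NLk (D i) (φ i) y z
      · exact Or.inr (Or.inr hn)
      · by_cases hs : ∃ i ∈ I, SLk (D i) (φ i) y z
        · exact Or.inr (Or.inl hs)
        · refine Or.inl ?_
          rintro ⟨i, hi, h | h⟩
          · exact hn ⟨i, hi, h⟩
          · exact hs ⟨i, hi, h⟩
    have k1 := Finset.card_le_card hsub
    have k2 := Finset.card_union_le (R.filter (fun y => G.Adj y z ∧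
      ¬ UsI D I φ y z))
      ((R.filter (fun y => ∃ i ∈ I, SLk (D i) (φ i) y z)) ∪
      (R.filter (fun y => ∃ i ∈ I, NLk (D i) (φ i) y z)))
    have k3 := Finset.card_union_le (R.filter (fun y => ∃ i ∈ I, SLk (D i) (φ i) y z))
      (R.filter (fun y => ∃ i ∈ I, NLk (D i) (φ i) y z))
    have k4 := (al_special (D := D) I φ z R).2
    have k5 := hsp z
    omega
  by_cases hg : gd a b
  · by_contra hcon
    push Not at hcon
    have hd := al.dens a b hg C hCZ R hR (by omega) (by omega)
    have hs1 : ∑ z ∈ C, (R.filter (fun y => G.Adj y z)).card ≤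
        C.card * (Δ + D2) + ∑ z ∈ C, (R.filter (fun y => ∃ i ∈ I, NLk (D i) (φ i) y z)).card := by
      calc _ ≤ ∑ z ∈ C, (Δ + D2 + (R.filter (fun y => ∃ i ∈ I, NLk (D i) (φ i) y z)).card) :=
            Finset.sum_le_sum hsplit
        _ = _ := by rw [Finset.sum_add_distrib, Finset.sum_const, smul_eq_mul]
    have hs2 : ∑ z ∈ C, (R.filter (fun y => ∃ i ∈ I, NLk (D i) (φ i) y z)).card ≤
        R.card * ((Δ + 1) * capm) := by
      have e : ∑ z ∈ C, (R.filter (fun y => ∃ i ∈ I, NLk (D i) (φ i) y z)).card =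
          ∑ y ∈ R, (C.filter (fun z => ∃ i ∈ I, NLk (D i) (φ i) y z)).card := by
        simp only [Finset.card_filter]
        exact Finset.sum_comm
      rw [e]
      calc _ ≤ ∑ y ∈ R, (Δ + 1) * capm := by
            apply Finset.sum_le_sum
            intro y _
            exact le_trans (Finset.card_le_card (Finset.filter_subset_filter _ hCZ))
              (al_usage al I φ he y b)
        _ = _ := by rw [Finset.sum_const, smul_eq_mul]
    set c := C.card
    set s := R.card
    have h1 : 2 * (c * s) ≤ 2 * (q * (c * (Δ + D2) + s * ((Δ + 1) * capm))) := by
      have : q * ∑ z ∈ C, (R.filter (fun y => G.Adj y z)).card ≤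
        q * (c * (Δ + D2) + s * ((Δ + 1) * capm)) := Nat.mul_le_mul_left _ (by omega)
      omega
    have h2 : c * (2 * q * (Δ + D2)) ≤ c * s := Nat.mul_le_mul_left _ (by omega)
    have h3 : s * (2 * q * ((Δ + 1) * capm)) ≤ s * bd := Nat.mul_le_mul_left _ hb2
    have h4 : s * bd < s * c := Nat.mul_lt_mul_of_pos_left hcon (by omega)
    have h5 : 2 * (q * (c * (Δ + D2) + s * ((Δ + 1) * capm))) =
      c * (2 * q * (Δ + D2)) + s * (2 * q * ((Δ + 1) * capm)) := by ring
    have h6 : s * c = c * s := mul_comm _ _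
    omega
  · by_contra hcon
    push Not at hcon
    obtain ⟨C', hC', hC'c⟩ := Finset.exists_subset_card_eq (show r ≤ C.card by omega)
    have hnone : ∀ z ∈ C, (R.filter (fun y => G.Adj y z)).card ≤ Δ + D2 := by
      intro z hz
      have h1 := hsplit z hz
      have h2 : (R.filter (fun y => ∃ i ∈ I, NLk (D i) (φ i) y z)).card = 0 := by
        rw [Finset.card_eq_zero]
        apply Finset.filter_eq_empty_iff.mpr
        rintro y hy ⟨i, hi, h⟩
        obtain ⟨v, k1, k2, k3, k4, k5, k6⟩ := nlk_facts al i (φ i) (he i hi) y z h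
        have e1 := al.Zd _ _ z k4 (hCZ hz)
        have e2 := al.Cd _ _ y k5 (hR hy)
        have := al.gdA i ((D i).side v) ((D i).bin v)
        rw [e1, e2] at this
        exact hg this
      omega
    set Nb := C'.biUnion (fun z => R.filter (fun y => G.Adj y z)) with hNb
    have hNbc : Nb.card ≤ r * (Δ + D2) := by
      rw [← hC'c]
      exact Finset.card_biUnion_le_card_mul _ _ _ (fun z hz => hnone z (hC' hz))
    have hR' : r ≤ (R \ Nb).card := by
      have := Finset.le_card_sdiff Nb R
      have e : r * (Δ + D2 + 1) = r * (Δ + D2) + r := by ring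
      omega
    obtain ⟨R', hR', hR'c⟩ := Finset.exists_subset_card_eq hR'
    obtain ⟨z, hz, y, hy, hadj⟩ := hole C' R' (by
      rw [Finset.disjoint_left]
      intro x h1 h2
      exact al.CZ a b x (hR (Finset.mem_sdiff.mp (hR' h2)).1) (hCZ (hC' h1))) hC'c hR'c
    have hy' := Finset.mem_sdiff.mp (hR' hy)
    exact hy'.2 (Finset.mem_biUnion.mpr ⟨z, hz, Finset.mem_filter.mpr ⟨hy'.1, hadj.symm⟩⟩)

end

end

section

section
variable {Δ K τ : ℕ} {𝔹 V Ty κ : Type} [Fintype V] {P : Fin τ → PTree Δ}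
    {D : ∀ i, TD (P i) K 𝔹} {G : SimpleGraph V} {Z Cell : κ → Finset V} {gd : κ → κ → Prop}
    {A : Fin τ → Bool → 𝔹 → κ} {ty : Fin τ → ℕ → Ty} {Cop : Fin τ → Ty → Finset (ℕ → V)}
    {ty0 slack capm t0 q : ℕ}

open Classical in
theorem al_step (al : AL P D G Z Cell gd A ty Cop ty0 slack capm t0 q) (I : Finset (Fin τ))
    (φ : Fin τ → ℕ → V)
    (he : ∀ i ∈ I, Emb (P i) (D i) G Z (A i) (ty i) (Cop i) (φ i)) (D1 r r0 bd w0 occ1 M : ℕ)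
    (hΔ : 1 ≤ Δ)
    (hsp : ∀ x, ∑ i ∈ I, spd (D i) (φ i) x ≤ D1 + Δ)
    (hole : ∀ S T : Finset V, Disjoint S T → S.card = r → T.card = r → ∃ a ∈ S, ∃ b ∈ T, G.Adj a b)
    (hM : ∀ i, ((Finset.range (P i).m).filter (fun v => (D i).spc v)).card ≤ M)
    (hocc : ∀ i β, ((Finset.range (P i).m).filter
      (fun v => (D i).cut v ∧ (D i).bin v = β)).card ≤ occ1)
    (hw0 : 2 * τ * (M * Δ) < (w0 + 1) * (D1 + 1))
    (hr0 : 1 ≤ r0) (hr1 : t0 ≤ r0) (hr2 : 2 * q * (Δ + (D1 + Δ)) ≤ r0)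
    (hr3 : r * (Δ + (D1 + Δ) + 1) ≤ r0)
    (hb1 : t0 ≤ bd) (hb2 : 2 * q * ((Δ + 1) * capm) ≤ bd) (hb3 : r ≤ bd)
    (hsl : w0 + r0 ≤ slack)
    (hbig : 2 * occ1 + w0 + Δ * bd + (Δ + 1) * capm + (D1 + Δ) < ty0) (i : Fin τ) :
    ∃ ψ : ℕ → V, Emb (P i) (D i) G Z (A i) (ty i) (Cop i) ψ ∧
      (∀ y z, (NLk (D i) ψ y z ∨ SLk (D i) ψ y z) →
        ¬ UsI D I φ y z) ∧
      ∀ x, (∑ i ∈ I, spd (D i) (φ i) x) + spd (D i) ψ x ≤ D1 + Δ := by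
  set W0 : Finset V := Finset.univ.filter (fun x => D1 < ∑ i ∈ I, spd (D i) (φ i) x) with hW0
  have hW0c : W0.card ≤ w0 := by
    have h1 : W0.card * (D1 + 1) ≤ ∑ x ∈ W0, ∑ i ∈ I, spd (D i) (φ i) x := by
      rw [← smul_eq_mul, ← Finset.sum_const]
      apply Finset.sum_le_sum
      intro x hx
      exact (Finset.mem_filter.mp hx).2
    have h2 : ∑ x ∈ W0, ∑ i ∈ I, spd (D i) (φ i) x ≤ ∑ x, ∑ i ∈ I, spd (D i) (φ i) x :=
      Finset.sum_le_sum_of_subset (Finset.subset_univ _)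
    have h3 : ∑ x, ∑ i ∈ I, spd (D i) (φ i) x ≤ I.card * (2 * (M * Δ)) := by
      rw [Finset.sum_comm, ← smul_eq_mul, ← Finset.sum_const]
      apply Finset.sum_le_sum
      intro j _
      exact spd_sum M (hM j)
    have h4 : I.card * (2 * (M * Δ)) ≤ τ * (2 * (M * Δ)) := by
      apply Nat.mul_le_mul_right
      simpa using Finset.card_le_univ I
    have h5 : τ * (2 * (M * Δ)) = 2 * τ * (M * Δ) := by ring
    by_contra hc
    push Not at hc
    have : (w0 + 1) * (D1 + 1) ≤ W0.card * (D1 + 1) := Nat.mul_le_mul_right _ hc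
    omega
  obtain ⟨F, zf, o1, o2, o3, o4, o5⟩ := one_tree (P i) (D i) G
    (UsI D I φ) W0 Z
    (fun s => A i ((D i).side s) ((D i).bin s)) (ty i) (Cop i)
    (ty0 - (Δ + 1) * capm - (D1 + Δ)) bd (2 * occ1) slack w0 r0 (al.a2' i) hW0c
    (by
      intro b
      have hone : ∀ o, ((Finset.range (P i).m).filter (fun s => (D i).cut s ∧ (D i).side s = o ∧
          A i o ((D i).bin s) = b)).card ≤ occ1 := by
        intro o
        by_cases hx : ∃ β, A i o β = b
        · obtain ⟨β, rfl⟩ := hx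
          refine le_trans (Finset.card_le_card ?_) (hocc i β)
          intro s hs
          simp only [Finset.mem_filter] at hs ⊢
          exact ⟨hs.1, hs.2.1, al.Ainj i o hs.2.2.2⟩
        · rw [Finset.card_eq_zero.mpr]
          · omega
          · apply Finset.filter_eq_empty_iff.mpr
            rintro s - ⟨-, -, h⟩
            exact hx ⟨_, h⟩
      have hsub : ((Finset.range (P i).m).filter (fun s => (D i).cut s ∧
          A i ((D i).side s) ((D i).bin s) = b)) ⊆
          ((Finset.range (P i).m).filter (fun s => (D i).cut s ∧ (D i).side s = true ∧
          A i true ((D i).bin s) = b)) ∪ ((Finset.range (P i).m).filter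
          (fun s => (D i).cut s ∧ (D i).side s = false ∧ A i false ((D i).bin s) = b)) := by
        intro s hs
        obtain ⟨h1, h2, h3⟩ := Finset.mem_filter.mp hs
        cases ho : (D i).side s <;> rw [ho] at h3
        · exact Finset.mem_union_right _ (Finset.mem_filter.mpr ⟨h1, h2, ho, h3⟩)
        · exact Finset.mem_union_left _ (Finset.mem_filter.mpr ⟨h1, h2, ho, h3⟩)
      have k1 := Finset.card_le_card hsub
      have k2 := Finset.card_union_le ((Finset.range (P i).m).filter
          (fun s => (D i).cut s ∧ (D i).side s = true ∧ A i true ((D i).bin s) = b))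
          ((Finset.range (P i).m).filter
          (fun s => (D i).cut s ∧ (D i).side s = false ∧ A i false ((D i).bin s) = b))
      have k3 := hone true
      have k4 := hone false
      omega)
    al.Zd (al.a5 i) hsl
    (by
      intro s hs hc f hf
      have k1 := al.a4 i s hs hc f hf
      set x := f ((D i).ad ((P i).p s))
      set b := A i ((D i).side s) ((D i).bin s)
      have hsub : (Z b).filter (fun z => G.Adj x z) ⊆ ((Z b).filter (fun z => G.Adj x z ∧
          ¬ UsI D I φ x z)) ∪
          (((Z b).filter (fun z => ∃ i ∈ I, NLk (D i) (φ i) x z)) ∪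
          ((Z b).filter (fun z => ∃ i ∈ I, SLk (D i) (φ i) x z))) := by
        intro z hz
        obtain ⟨hy1, hy2⟩ := Finset.mem_filter.mp hz
        simp only [Finset.mem_union, Finset.mem_filter, hy1, hy2, true_and]
        by_cases hn : ∃ i ∈ I, NLk (D i) (φ i) x z
        · exact Or.inr (Or.inl hn)
        · by_cases hs : ∃ i ∈ I, SLk (D i) (φ i) x z
          · exact Or.inr (Or.inr hs)
          · refine Or.inl ?_
            rintro ⟨i, hi, h | h⟩
            · exact hn ⟨i, hi, h⟩
            · exact hs ⟨i, hi, h⟩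
      have k2 := Finset.card_le_card hsub
      have k3 := Finset.card_union_le ((Z b).filter (fun z => G.Adj x z ∧
          ¬ UsI D I φ x z))
          (((Z b).filter (fun z => ∃ i ∈ I, NLk (D i) (φ i) x z)) ∪
          ((Z b).filter (fun z => ∃ i ∈ I, SLk (D i) (φ i) x z)))
      have k4 := Finset.card_union_le ((Z b).filter (fun z => ∃ i ∈ I, NLk (D i) (φ i) x z))
          ((Z b).filter (fun z => ∃ i ∈ I, SLk (D i) (φ i) x z))
      have k5 := al_usage al I φ he x b
      have k6 := (al_special (D := D) I φ x (Z b)).1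
      have k7 := hsp x
      omega)
    (by
      intro s hs hc t ht ht1 hts R hR hRc
      have htc : ¬ (D i).cut t := by
        intro h
        have := (D i).cutp t ht1 h
        rw [hts] at this
        exact this hc
      have htop := (D i).top t (Or.inr (by rw [hts]; exact hc))
      refine al_bad al I φ he (D1 + Δ) r r0 bd hsp hole hr0 hr1 hr2 hr3 hb1 hb2 hb3
        (A i ((D i).side t) ((D i).bin t)) _ R ?_ hRc
      intro y hy
      obtain ⟨f, hf, rfl⟩ := hR y hy
      have := al.a1 i t ht htc f (by rw [htop.1]; exact hf)
      rw [htop.2] at this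
      exact this)
    (by omega)
  set ψ : ℕ → V := fun v => if (D i).cut v then zf v else F ((D i).tp v) ((D i).ad v) with hψ
  have htt : ∀ v, (D i).tp v = 0 ∨ (D i).cut ((P i).p ((D i).tp v)) := (D i).tp_top
  have hFm : ∀ v < (P i).m, F ((D i).tp v) ∈ Cop i (ty i ((D i).tp v)) := by
    intro v hv
    have := (D i).tp_le v
    exact o1 _ (by omega) (htt v)
  have hψc : ∀ v, (D i).cut v → ψ v = zf v := by
    intro v h; simp only [hψ, h, if_true]
  have hψn : ∀ v, ¬ (D i).cut v → ψ v = F ((D i).tp v) ((D i).ad v) := by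
    intro v h; simp only [hψ, h, if_false]
  have hpos : ∀ s, (D i).cut s → 1 ≤ s := by
    intro s hs
    rcases Nat.eq_zero_or_pos s with h | h
    · subst h; exact absurd hs (D i).cut0
    · exact h
  have hinj : ∀ v < (P i).m, ∀ v' < (P i).m, ψ v = ψ v' → v = v' := by
    intro v hv v' hv' heq
    by_cases hc : (D i).cut v <;> by_cases hc' : (D i).cut v'
    · rw [hψc v hc, hψc v' hc'] at heq
      exact o4 v hv hc v' hv' hc' heq
    · rw [hψc v hc, hψn v' hc'] at heq
      exact absurd (heq ▸ (o3 v hv hc).1) (al.CZ _ _ _ (al.a1 i v' hv' hc' _ (hFm v' hv')))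
    · rw [hψn v hc, hψc v' hc'] at heq
      exact absurd (heq ▸ (o3 v' hv' hc').1) (al.CZ _ _ _ (al.a1 i v hv hc _ (hFm v hv)))
    · rw [hψn v hc, hψn v' hc'] at heq
      obtain ⟨e1, e2, e3⟩ := al.a2 i v v' hv hc hv' hc' _ (hFm v hv) _ (hFm v' hv') heq
      have h1 := (D i).tp_le v
      have h2 := (D i).tp_le v'
      have := o2 _ (by omega) (htt v) _ (by omega) (htt v') e1 e2
      exact (D i).inj v v' hv hv' this e3
  have hlink1 : ∀ s < (P i).m, 1 ≤ s → (D i).cut s →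
      ψ ((P i).p s) = F ((D i).tp ((P i).p s)) ((D i).ad ((P i).p s)) :=
    fun s hs h1 hc => hψn _ ((D i).cutp s h1 hc)
  have hnc : ∀ t, 1 ≤ t → (D i).cut ((P i).p t) → ¬ (D i).cut t :=
    fun t h1 hc h => (D i).cutp t h1 h hc
  have hlink2 : ∀ t < (P i).m, 1 ≤ t → (D i).cut ((P i).p t) → ψ t = F t 0 := by
    intro t ht h1 hc
    have htop := (D i).top t (Or.inr hc)
    rw [hψn t (hnc t h1 hc), htop.1, htop.2]
  refine ⟨ψ, ⟨⟨F, fun v hv hc => ⟨hFm v hv, hψn v hc⟩⟩, ?_, hinj, ?_⟩, ?_, ?_⟩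
  · intro s hs hc
    rw [hψc s hc]
    exact (o3 s hs hc).1
  · intro v hv h1
    by_cases hc : (D i).cut v
    · rw [hlink1 v hv h1 hc, hψc v hc]
      exact (o3 v hv hc).2.2.1
    · by_cases hc' : (D i).cut ((P i).p v)
      · rw [hlink2 v hv h1 hc', hψc _ hc']
        exact (o5 v hv h1 hc').2.1.symm
      · rw [hψn v hc, hψn _ hc', ← (D i).ntop_tp v h1 hc']
        exact al.a3 i v h1 hv hc hc' _ (hFm v hv)
  · rintro y z (⟨v, hv, hc, rfl, ⟨s, h1, h2, rfl, h4, rfl⟩ | ⟨h1, h2, h3, rfl⟩⟩ | ⟨t, ht, h1, h2, rfl, rfl⟩)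
    · rw [hlink1 s h1 h2 h4, hψc s h4]
      exact (o3 s h1 h4).2.2.2
    · rw [hlink2 v hv h1 h2, hψc _ h2]
      exact (o5 v hv h1 h2).2.2
    · have h2 := (D i).spc_cut _ h2
      rw [hlink2 t ht h1 h2, hψc _ h2]
      exact (o5 t ht h1 h2).2.2
  · intro x
    by_cases h0 : spd (D i) ψ x = 0
    · have := hsp x
      omega
    · have h1 := spd_le hΔ hinj x (D := D i)
      have hxW : x ∉ W0 := by
        obtain ⟨t, ht⟩ := Finset.card_pos.mp (Nat.pos_of_ne_zero h0)
        simp only [Finset.mem_filter, Finset.mem_range] at ht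
        obtain ⟨k1, k2, k3, k4⟩ := ht
        have hpt := (P i).hp t k2
        have k3 := (D i).spc_cut _ k3
        rcases k4 with rfl | rfl
        · rw [hlink2 t k1 k2 k3]
          exact (o5 t k1 k2 k3).1
        · rw [hψc _ k3]
          exact (o3 _ (by omega) k3).2.1
      have : ¬ D1 < ∑ i ∈ I, spd (D i) (φ i) x := fun h => hxW (by simp [hW0, h])
      omega

open Classical in
theorem al_pack (al : AL P D G Z Cell gd A ty Cop ty0 slack capm t0 q) (D1 r r0 bd w0 occ1 M : ℕ)
    (hΔ : 1 ≤ Δ)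
    (hole : ∀ S T : Finset V, Disjoint S T → S.card = r → T.card = r → ∃ a ∈ S, ∃ b ∈ T, G.Adj a b)
    (hM : ∀ i, ((Finset.range (P i).m).filter (fun v => (D i).spc v)).card ≤ M)
    (hocc : ∀ i β, ((Finset.range (P i).m).filter
      (fun v => (D i).cut v ∧ (D i).bin v = β)).card ≤ occ1)
    (hw0 : 2 * τ * (M * Δ) < (w0 + 1) * (D1 + 1))
    (hr0 : 1 ≤ r0) (hr1 : t0 ≤ r0) (hr2 : 2 * q * (Δ + (D1 + Δ)) ≤ r0)
    (hr3 : r * (Δ + (D1 + Δ) + 1) ≤ r0)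
    (hb1 : t0 ≤ bd) (hb2 : 2 * q * ((Δ + 1) * capm) ≤ bd) (hb3 : r ≤ bd)
    (hsl : w0 + r0 ≤ slack)
    (hbig : 2 * occ1 + w0 + Δ * bd + (Δ + 1) * capm + (D1 + Δ) < ty0) [Nonempty V] :
    ∃ φ : Fin τ → ℕ → V, (∀ i, ∀ v < (P i).m, ∀ v' < (P i).m, φ i v = φ i v' → v = v') ∧
      (∀ i, ∀ v < (P i).m, 1 ≤ v → G.Adj (φ i ((P i).p v)) (φ i v)) ∧
      (∀ i i', i ≠ i' → ∀ v < (P i).m, 1 ≤ v → ∀ v' < (P i').m, 1 ≤ v' →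
        s(φ i ((P i).p v), φ i v) ≠ s(φ i' ((P i').p v'), φ i' v')) := by
  have main : ∀ I : Finset (Fin τ), ∃ φ : Fin τ → ℕ → V,
      (∀ i ∈ I, Emb (P i) (D i) G Z (A i) (ty i) (Cop i) (φ i)) ∧
      (∀ i ∈ I, ∀ i' ∈ I, i ≠ i' → ∀ y z, (NLk (D i) (φ i) y z ∨ SLk (D i) (φ i) y z) →
        ¬ (NLk (D i') (φ i') y z ∨ SLk (D i') (φ i') y z)) ∧
      ∀ x, ∑ i ∈ I, spd (D i) (φ i) x ≤ D1 + Δ := by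
    intro I
    induction I using Finset.induction_on with
    | empty => exact ⟨fun _ _ => Classical.arbitrary V, by simp, by simp, by simp⟩
    | insert i I hi ih =>
      obtain ⟨φ, h1, h2, h3⟩ := ih
      obtain ⟨ψ, k1, k2, k3⟩ := al_step al I φ h1 D1 r r0 bd w0 occ1 M hΔ h3 hole hM hocc hw0 hr0 hr1
        hr2 hr3 hb1 hb2 hb3 hsl hbig i
      have hne : ∀ j ∈ I, j ≠ i := fun j hj h => hi (h ▸ hj)
      have hu : ∀ j ∈ I, Function.update φ i ψ j = φ j :=
        fun j hj => Function.update_of_ne (hne j hj) _ _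
      have hs : Function.update φ i ψ i = ψ := Function.update_self _ _ _
      refine ⟨Function.update φ i ψ, ?_, ?_, ?_⟩
      · intro j hj
        rcases Finset.mem_insert.mp hj with rfl | hj
        · rw [hs]; exact k1
        · rw [hu j hj]; exact h1 j hj
      · intro j hj j' hj' hjj
        rcases Finset.mem_insert.mp hj with rfl | hj1 <;>
          rcases Finset.mem_insert.mp hj' with rfl | hj1'
        · exact absurd rfl hjj
        · rw [hs, hu _ hj1']
          exact fun y z h h' => k2 y z h ⟨j', hj1', h'⟩
        · rw [hs, hu _ hj1]
          exact fun y z h h' => k2 y z h' ⟨j, hj1, h⟩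
        · rw [hu _ hj1, hu _ hj1']
          exact h2 j hj1 j' hj1' hjj
      · intro x
        rw [Finset.sum_insert hi, hs, add_comm]
        have : ∑ j ∈ I, spd (D j) (Function.update φ i ψ j) x = ∑ j ∈ I, spd (D j) (φ j) x :=
          Finset.sum_congr rfl (fun j hj => by rw [hu j hj])
        rw [this]
        exact k3 x
  obtain ⟨φ, h1, h2, -⟩ := main Finset.univ
  have he : ∀ i, Emb (P i) (D i) G Z (A i) (ty i) (Cop i) (φ i) := fun i => h1 i (Finset.mem_univ _)
  -- classification of edges
  have hcls : ∀ i, ∀ v < (P i).m, 1 ≤ v →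
      (¬ (D i).cut v ∧ ¬ (D i).cut ((P i).p v)) ∨
      ∃ y z, s(φ i ((P i).p v), φ i v) = s(y, z) ∧ (∃ a, y ∈ Cell a) ∧ (∃ b, z ∈ Z b) ∧
        (NLk (D i) (φ i) y z ∨ SLk (D i) (φ i) y z) := by
    intro i v hv h1
    have hp := (P i).hp v h1
    obtain ⟨F, hF⟩ := (he i).fn
    have hcell : ∀ u < (P i).m, ¬ (D i).cut u → ∃ a, φ i u ∈ Cell a := by
      intro u hu hc
      obtain ⟨k1, k2⟩ := hF u hu hc
      exact ⟨_, by rw [k2]; exact al.a1 i u hu hc _ k1⟩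
    by_cases hc : (D i).cut v
    · right
      have hpc := (D i).cutp v h1 hc
      exact ⟨φ i ((P i).p v), φ i v, rfl, hcell _ (by omega) hpc, ⟨_, (he i).z v hv hc⟩,
        Or.inl ⟨_, by omega, hpc, rfl, Or.inl ⟨v, hv, h1, rfl, hc, rfl⟩⟩⟩
    · by_cases hc' : (D i).cut ((P i).p v)
      · right
        refine ⟨φ i v, φ i ((P i).p v), Sym2.eq_swap, hcell _ hv hc, ⟨_, (he i).z _ (by omega) hc'⟩, ?_⟩
        by_cases hsp : (D i).spc ((P i).p v)
        · exact Or.inr ⟨v, hv, h1, hsp, rfl, rfl⟩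
        · exact Or.inl ⟨v, hv, hc, rfl, Or.inr ⟨h1, hc', hsp, rfl⟩⟩
      · exact Or.inl ⟨hc, hc'⟩
  have hcc : ∀ i, ∀ v < (P i).m, 1 ≤ v → ¬ (D i).cut v → ¬ (D i).cut ((P i).p v) →
      (∃ f ∈ Cop i (ty i ((D i).tp v)), φ i v = f ((D i).ad v) ∧
        φ i ((P i).p v) = f ((D i).ad ((P i).p v))) ∧
      (∃ a, φ i v ∈ Cell a) ∧ (∃ a, φ i ((P i).p v) ∈ Cell a) := by
    intro i v hv h1 hc hc'
    have hp := (P i).hp v h1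
    obtain ⟨F, hF⟩ := (he i).fn
    obtain ⟨k1, k2⟩ := hF v hv hc
    obtain ⟨l1, l2⟩ := hF ((P i).p v) (by omega) hc'
    have e := (D i).ntop_tp v h1 hc'
    refine ⟨⟨F ((D i).tp v), k1, k2, by rw [l2, e]⟩, ⟨_, by rw [k2]; exact al.a1 i v hv hc _ k1⟩,
      ⟨_, by rw [l2]; exact al.a1 i _ (by omega) hc' _ l1⟩⟩
  refine ⟨φ, fun i => (he i).inj, fun i => (he i).adj, ?_⟩
  intro i i' hii v hv hv1 v' hv' hv1' heq
  rcases hcls i v hv hv1 with ⟨c1, c2⟩ | ⟨y, z, e, ⟨a, ha⟩, ⟨b, hb⟩, hl⟩ <;>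
    rcases hcls i' v' hv' hv1' with ⟨c1', c2'⟩ | ⟨y', z', e', ⟨a', ha'⟩, ⟨b', hb'⟩, hl'⟩
  · obtain ⟨⟨f, hf, f1, f2⟩, -⟩ := hcc i v hv hv1 c1 c2
    obtain ⟨⟨f', hf', f1', f2'⟩, -⟩ := hcc i' v' hv' hv1' c1' c2'
    rw [f1, f2, f1', f2'] at heq
    exact al.a6 i i' hii v v' hv1 hv c1 c2 hv1' hv' c1' c2' f hf f' hf' heq
  · obtain ⟨-, ⟨a, ha⟩, ⟨a2, ha2⟩⟩ := hcc i v hv hv1 c1 c2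
    rw [e', Sym2.eq_iff] at heq
    rcases heq with ⟨-, h⟩ | ⟨h, -⟩
    · rw [h] at ha; exact al.CZ _ _ _ ha hb'
    · rw [h] at ha2; exact al.CZ _ _ _ ha2 hb'
  · obtain ⟨-, ⟨a, ha⟩, ⟨a2, ha2⟩⟩ := hcc i' v' hv' hv1' c1' c2'
    rw [e, eq_comm, Sym2.eq_iff] at heq
    rcases heq with ⟨-, h⟩ | ⟨h, -⟩
    · rw [h] at ha; exact al.CZ _ _ _ ha hb
    · rw [h] at ha2; exact al.CZ _ _ _ ha2 hb
  · rw [e, e', Sym2.eq_iff] at heq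
    rcases heq with ⟨rfl, rfl⟩ | ⟨rfl, rfl⟩
    · exact h2 i (Finset.mem_univ _) i' (Finset.mem_univ _) hii _ _ hl hl'
    · exact al.CZ _ _ _ ha hb'

end

end

section

theorem equid_aux {ι Θ Γ : Type} [DecidableEq ι] [DecidableEq Θ] [DecidableEq Γ] [Fintype Γ] [Nonempty Γ]
    (θ : ι → Θ) (I : Finset ι) :
    ∃ γ : ι → Γ, ∀ t g, (I.filter (fun i => θ i = t ∧ γ i = g)).card * Fintype.card Γ ≤
      (I.filter (fun i => θ i = t)).card + Fintype.card Γ := by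
  induction I using Finset.induction_on with
  | empty => exact ⟨fun _ => Classical.arbitrary Γ, by simp⟩
  | insert i I hi ih =>
    obtain ⟨γ, hγ⟩ := ih
    obtain ⟨g0, -, hg0⟩ := Finset.exists_min_image (Finset.univ : Finset Γ)
      (fun g => (I.filter (fun j => θ j = θ i ∧ γ j = g)).card) Finset.univ_nonempty
    have hsum : ∑ g : Γ, (I.filter (fun j => θ j = θ i ∧ γ j = g)).card =
        (I.filter (fun j => θ j = θ i)).card := by
      rw [Finset.card_eq_sum_card_fiberwise (f := γ) (t := Finset.univ) (by simp)]
      simp only [Finset.filter_filter]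
    have hmin : (I.filter (fun j => θ j = θ i ∧ γ j = g0)).card * Fintype.card Γ ≤
        (I.filter (fun j => θ j = θ i)).card := by
      rw [← hsum, mul_comm, ← smul_eq_mul, Fintype.card, ← Finset.sum_const]
      exact Finset.sum_le_sum (fun g hg => hg0 g hg)
    refine ⟨Function.update γ i g0, ?_⟩
    intro t g
    have hup : ∀ j ∈ I, Function.update γ i g0 j = γ j :=
      fun j hj => Function.update_of_ne (show j ≠ i from fun h => hi (h ▸ hj)) _ _
    have e1 : (I.filter (fun j => θ j = t ∧ Function.update γ i g0 j = g)) =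
        I.filter (fun j => θ j = t ∧ γ j = g) :=
      Finset.filter_congr (fun j hj => by rw [hup j hj])
    rw [Finset.filter_insert, Finset.filter_insert, e1, Function.update_self]
    have hni : i ∉ I.filter (fun j => θ j = t ∧ γ j = g) := fun h => hi (Finset.mem_filter.mp h).1
    have hni' : i ∉ I.filter (fun j => θ j = t) := fun h => hi (Finset.mem_filter.mp h).1
    by_cases h1 : θ i = t
    · subst h1
      rw [if_pos rfl, Finset.card_insert_of_notMem hni']
      by_cases h2 : g0 = g
      · subst h2
        rw [if_pos ⟨rfl, rfl⟩, Finset.card_insert_of_notMem hni, add_mul]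
        omega
      · rw [if_neg (fun h => h2 h.2)]
        have := hγ (θ i) g
        omega
    · rw [if_neg (fun h => h1 h.1), if_neg h1]
      exact hγ t g

theorem equid {ι Θ Γ : Type} [Fintype ι] [Fintype Θ] [Fintype Γ] [Nonempty Γ] (θ : ι → Θ) :
    ∃ γ : ι → Γ, ∀ f : Θ → Γ → ℕ, (∀ t g, f t g ≤ 1) →
      Fintype.card Γ * ∑ i, f (θ i) (γ i) ≤
        ∑ i, ∑ g, f (θ i) g + Fintype.card Θ * Fintype.card Γ * Fintype.card Γ := by
  classical
  obtain ⟨γ, hγ⟩ := equid_aux (Γ := Γ) θ Finset.univ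
  refine ⟨γ, fun f hf => ?_⟩
  have h1 : ∑ i, f (θ i) (γ i) =
      ∑ t, ∑ g, (Finset.univ.filter (fun i => θ i = t ∧ γ i = g)).card * f t g := by
    rw [← Finset.sum_product', ← Finset.sum_fiberwise (s := Finset.univ) (g := fun i => (θ i, γ i))]
    apply Finset.sum_congr (by ext; simp)
    rintro ⟨t, g⟩ -
    rw [← smul_eq_mul, ← Finset.sum_const]
    apply Finset.sum_congr
    · ext i; simp
    · intro i hi
      simp only [Finset.mem_filter] at hi
      rw [hi.2.1, hi.2.2]
  have h2 : ∑ i, ∑ g, f (θ i) g = ∑ t, ∑ g, (Finset.univ.filter (fun i => θ i = t)).card * f t g := by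
    rw [← Finset.sum_fiberwise (s := Finset.univ) (g := θ)]
    apply Finset.sum_congr rfl
    intro t _
    rw [← Finset.mul_sum, ← smul_eq_mul, ← Finset.sum_const]
    apply Finset.sum_congr rfl
    intro i hi
    rw [(Finset.mem_filter.mp hi).2]
  have h3 : Fintype.card Θ * Fintype.card Γ * Fintype.card Γ = ∑ t : Θ, ∑ g : Γ, Fintype.card Γ := by
    simp [mul_assoc]
  rw [h1, h2, h3, ← Finset.sum_add_distrib, Finset.mul_sum]
  apply Finset.sum_le_sum
  intro t _
  rw [← Finset.sum_add_distrib, Finset.mul_sum]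
  apply Finset.sum_le_sum
  intro g _
  have a1 := hγ t g
  have a2 := hf t g
  rcases Nat.le_one_iff_eq_zero_or_eq_one.mp a2 with h | h
  · rw [h]; simp
  · rw [h, mul_one, mul_one, mul_comm]; exact a1

/-- number of functions with one prescribed value -/
theorem count_one {κ Λ : Type} [Fintype κ] [Fintype Λ] [DecidableEq κ] [DecidableEq Λ] (a : κ) (x : Λ) :
    (Finset.univ.filter (fun s : κ → Λ => s a = x)).card * Fintype.card Λ =
      Fintype.card Λ ^ Fintype.card κ := by
  have e : (Finset.univ.filter (fun s : κ → Λ => s a = x)) =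
      Fintype.piFinset (fun c => if c = a then {x} else Finset.univ) := by
    ext s
    simp only [Finset.mem_filter, Finset.mem_univ, true_and, Fintype.mem_piFinset]
    constructor
    · intro h c
      by_cases hc : c = a
      · subst hc; simp [h]
      · simp [hc]
    · intro h; simpa using h a
  rw [e, Fintype.card_piFinset, ← Finset.mul_prod_erase _ _ (Finset.mem_univ a), if_pos rfl,
    Finset.card_singleton, one_mul, Finset.prod_congr rfl (g := fun _ => Fintype.card Λ), Finset.prod_const,
    Finset.card_erase_of_mem (Finset.mem_univ a), Finset.card_univ, ← pow_succ]
  · congr 1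
    have : 0 < Fintype.card κ := Fintype.card_pos_iff.mpr ⟨a⟩
    omega
  · intro c hc
    rw [if_neg (Finset.ne_of_mem_erase hc), Finset.card_univ]

theorem count_two {κ Λ : Type} [Fintype κ] [Fintype Λ] [DecidableEq κ] [DecidableEq Λ] (a b : κ)
    (hab : a ≠ b) (x y : Λ) :
    (Finset.univ.filter (fun s : κ → Λ => s a = x ∧ s b = y)).card *
      (Fintype.card Λ * Fintype.card Λ) = Fintype.card Λ ^ Fintype.card κ := by
  have e : (Finset.univ.filter (fun s : κ → Λ => s a = x ∧ s b = y)) =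
      Fintype.piFinset (fun c => if c = a then {x} else if c = b then {y} else Finset.univ) := by
    ext s
    simp only [Finset.mem_filter, Finset.mem_univ, true_and, Fintype.mem_piFinset]
    constructor
    · intro h c
      by_cases hc : c = a
      · subst hc; simp [h.1]
      · by_cases hc2 : c = b
        · subst hc2; simp [hc, h.2]
        · simp [hc, hc2]
    · intro h
      refine ⟨by simpa using h a, ?_⟩
      have := h b
      simpa [hab.symm] using this
  have hb : b ∈ Finset.univ.erase a := Finset.mem_erase.mpr ⟨hab.symm, Finset.mem_univ b⟩
  rw [e, Fintype.card_piFinset, ← Finset.mul_prod_erase _ _ (Finset.mem_univ a), if_pos rfl,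
    Finset.card_singleton, one_mul, ← Finset.mul_prod_erase _ _ hb, if_neg hab.symm, if_pos rfl,
    Finset.card_singleton, one_mul,
    Finset.prod_congr rfl (g := fun _ => Fintype.card Λ), Finset.prod_const,
    Finset.card_erase_of_mem hb, Finset.card_erase_of_mem (Finset.mem_univ a), Finset.card_univ,
    ← mul_assoc, ← pow_succ, ← pow_succ]
  · congr 1
    have : 1 < Fintype.card κ := Fintype.one_lt_card_iff.mpr ⟨a, b, hab⟩
    omega
  · intro c hc
    rw [if_neg (Finset.ne_of_mem_erase (Finset.mem_of_mem_erase hc)), if_neg (Finset.ne_of_mem_erase hc), Finset.card_univ]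

end

section

set_option linter.unusedSectionVars false

/-- class `c` contains the ordered cluster pair `a, b`. -/
def APr {κ 𝒞 𝔹 : Type} (A : 𝒞 → Bool → 𝔹 → κ) (a b : κ) (c : 𝒞) : Prop :=
  ∃ β, A c true β = a ∧ A c false β = b

open Classical in
/-- Host structure: clusters, cells, reserved sets, almost perfect matchings. -/
structure Host {V κ Λ 𝒞 𝔹 : Type} [Fintype 𝒞] (G : SimpleGraph V) (N capo fk ty0 t0 q : ℕ)
    (vx : κ × Λ → Fin N → V) (Z : κ → Finset V) (w : κ → κ → ℕ) (A : 𝒞 → Bool → 𝔹 → κ)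
    (Q : κ × Λ → κ × Λ → ℕ → Equiv.Perm (Fin N)) (Rl : κ × Λ → κ × Λ → ℕ → Finset (Fin N)) :
    Prop where
  vinj : ∀ X x X' x', vx X x = vx X' x' → X = X' ∧ x = x'
  Zd : ∀ b b' z, z ∈ Z b → z ∈ Z b' → b = b'
  vZ : ∀ X x b, vx X x ∉ Z b
  wsym : ∀ a b, w a b = w b a
  wdiag : ∀ a, w a a = 0
  Ainj : ∀ c o, Function.Injective (A c o)
  Apos : ∀ c β, 0 < w (A c true β) (A c false β)
  Acnt : ∀ a b, (Finset.univ.filter (fun c => APr A a b c)).card ≤ w a b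
  Qadj : ∀ X Y j, j < w X.1 Y.1 * capo → ∀ x ∈ Rl X Y j, G.Adj (vx X x) (vx Y (Q X Y j x))
  Qdis : ∀ X Y j j', j < w X.1 Y.1 * capo → j' < w X.1 Y.1 * capo → ∀ x, x ∈ Rl X Y j →
    x ∈ Rl X Y j' → Q X Y j x = Q X Y j' x → j = j'
  Qdis2 : ∀ X Y j j', j < w X.1 Y.1 * capo → j' < w X.1 Y.1 * capo → ∀ x y, x ∈ Rl X Y j →
    y ∈ Rl Y X j' → Q X Y j x = y → Q Y X j' y = x → False
  Qfk : ∀ X Y j, j < w X.1 Y.1 * capo → N ≤ (Rl X Y j).card + fk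
  typ : ∀ a b l, 0 < w a b → (Finset.univ.filter (fun x =>
    ((Z b).filter (fun z => G.Adj (vx (a, l) x) z)).card < ty0)).card ≤ fk
  dens : ∀ a b, 0 < w a b → ∀ C ⊆ Z b, ∀ R : Finset V, (∀ y ∈ R, ∃ l x, y = vx (a, l) x) →
    t0 ≤ C.card → t0 ≤ R.card →
    C.card * R.card ≤ q * ∑ z ∈ C, (R.filter (fun y => G.Adj y z)).card

/-- Cell used by slot `l` of bin `β`. -/
def cellOf {κ Λ 𝒞 𝔹 : Type} [Add Λ] [Add 𝔹] (A : 𝒞 → Bool → 𝔹 → κ) (sd : Λ → Bool)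
    (g : 𝒞 × 𝔹 × (κ → Λ)) (β : 𝔹) (l : Λ) : κ × Λ :=
  (A g.1 (sd l) (β + g.2.1), l + g.2.2 (A g.1 (sd l) (β + g.2.1)))

def trS {Λ : Type} (sd : Λ → Bool) (l m : Λ) : Λ := if sd l then l else m
def flS {Λ : Type} (sd : Λ → Bool) (l m : Λ) : Λ := if sd l then m else l

/-- The template uses the ordered cell pair. -/
def UE {κ Λ 𝒞 𝔹 : Type} [Add Λ] [Add 𝔹] (A : 𝒞 → Bool → 𝔹 → κ) (sd : Λ → Bool)
    (θ : 𝔹 → Λ → Option Λ × Bool) (g : 𝒞 × 𝔹 × (κ → Λ)) (X Y : κ × Λ) : Prop :=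
  ∃ β l m, (θ β l).1 = some m ∧ sd m = (!sd l) ∧ cellOf A sd g β (trS sd l m) = X ∧
    cellOf A sd g β (flS sd l m) = Y

/-- The template has a marked slot in the cell, with partner cluster `b`. -/
def UM {κ Λ 𝒞 𝔹 : Type} [Add Λ] [Add 𝔹] (A : 𝒞 → Bool → 𝔹 → κ) (sd : Λ → Bool)
    (θ : 𝔹 → Λ → Option Λ × Bool) (g : 𝒞 × 𝔹 × (κ → Λ)) (X : κ × Λ) (b : κ) : Prop :=
  ∃ β l, (θ β l).2 = true ∧ cellOf A sd g β l = X ∧ A g.1 (!sd l) (β + g.2.1) = b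

/-- number of template edges -/
def eT {Λ 𝔹 : Type} [Fintype Λ] [Fintype 𝔹] (θ : 𝔹 → Λ → Option Λ × Bool) : ℕ :=
  ((Finset.univ : Finset (𝔹 × Λ)).filter (fun z => (θ z.1 z.2).1.isSome)).card

/-- number of template marks -/
def mT {Λ 𝔹 : Type} [Fintype Λ] [Fintype 𝔹] (θ : 𝔹 → Λ → Option Λ × Bool) : ℕ :=
  ((Finset.univ : Finset (𝔹 × Λ)).filter (fun z => (θ z.1 z.2).2 = true)).card

section
variable {V κ Λ 𝒞 𝔹 : Type} [Fintype 𝒞] [Fintype κ] [Fintype Λ] [Fintype 𝔹] [AddCommGroup Λ]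
  [AddCommGroup 𝔹] {G : SimpleGraph V} {N capo fk ty0 t0 q : ℕ}
  {vx : κ × Λ → Fin N → V} {Z : κ → Finset V} {w : κ → κ → ℕ} {A : 𝒞 → Bool → 𝔹 → κ}
  {Q : κ × Λ → κ × Λ → ℕ → Equiv.Perm (Fin N)} {Rl : κ × Λ → κ × Λ → ℕ → Finset (Fin N)}

theorem trS_sd (sd : Λ → Bool) {l m : Λ} (h : sd m = (!sd l)) : sd (trS sd l m) = true := by
  unfold trS; split_ifs with h1 <;> simp_all
theorem flS_sd (sd : Λ → Bool) {l m : Λ} (h : sd m = (!sd l)) : sd (flS sd l m) = false := by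
  unfold flS; split_ifs with h1 <;> simp_all

theorem cellOf_inj (H : Host G N capo fk ty0 t0 q vx Z w A Q Rl) (sd : Λ → Bool)
    (g : 𝒞 × 𝔹 × (κ → Λ)) {β β' : 𝔹} {l l' : Λ} (h : cellOf A sd g β l = cellOf A sd g β' l') :
    β = β' ∧ l = l' := by
  unfold cellOf at h
  rw [Prod.mk.injEq] at h
  obtain ⟨h1, h2⟩ := h
  rw [h1] at h2
  have h3 := add_right_cancel h2
  subst h3
  exact ⟨add_right_cancel (H.Ainj _ _ h1), rfl⟩

open Classical in
theorem cnt_ct (H : Host G N capo fk ty0 t0 q vx Z w A Q Rl) (β : 𝔹) (a b : κ) :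
    ((Finset.univ : Finset (𝒞 × 𝔹)).filter (fun z => A z.1 true (β + z.2) = a ∧
      A z.1 false (β + z.2) = b)).card ≤ w a b := by
  refine le_trans ?_ (H.Acnt a b)
  refine Finset.card_le_card_of_injOn Prod.fst ?_ ?_
  · intro z hz
    have hz := (Finset.mem_filter.mp hz).2
    exact Finset.mem_filter.mpr ⟨Finset.mem_univ _, _, hz⟩
  · rintro ⟨c, t⟩ hz ⟨c', t'⟩ hz' (h : c = c')
    subst h
    have hz := (Finset.mem_filter.mp hz).2.1
    have hz' := (Finset.mem_filter.mp hz').2.1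
    have := H.Ainj c true (hz.trans hz'.symm)
    exact congrArg _ (add_left_cancel this)

open Classical in
theorem cnt_UE (H : Host G N capo fk ty0 t0 q vx Z w A Q Rl) (sd : Λ → Bool)
    (θ : 𝔹 → Λ → Option Λ × Bool) (X Y : κ × Λ) :
    ((Finset.univ : Finset (𝒞 × 𝔹 × (κ → Λ))).filter (fun g => UE A sd θ g X Y)).card *
      (Fintype.card Λ * Fintype.card Λ) ≤
      eT θ * (w X.1 Y.1 * Fintype.card Λ ^ Fintype.card κ) := by
  by_cases hXY : X.1 = Y.1
  · rw [Finset.card_eq_zero.mpr]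
    · simp
    · apply Finset.filter_eq_empty_iff.mpr
      rintro ⟨c, t, s⟩ - ⟨β, l, m, h1, h2, h3, h4⟩
      have e3 := congrArg Prod.fst h3
      have e4 := congrArg Prod.fst h4
      simp only [cellOf, trS_sd sd h2, flS_sd sd h2] at e3 e4
      have := H.Apos c (β + t)
      rw [e3, e4, hXY, H.wdiag] at this
      omega
  · let F : 𝔹 × Λ → Finset (𝒞 × 𝔹 × (κ → Λ)) := fun z => Finset.univ.filter (fun g =>
      ∃ m, (θ z.1 z.2).1 = some m ∧ sd m = (!sd z.2) ∧ cellOf A sd g z.1 (trS sd z.2 m) = X ∧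
        cellOf A sd g z.1 (flS sd z.2 m) = Y)
    have hF : ∀ z, (F z).card * (Fintype.card Λ * Fintype.card Λ) ≤
        w X.1 Y.1 * Fintype.card Λ ^ Fintype.card κ := by
      rintro ⟨β, l⟩
      by_cases hm : ∃ m, (θ β l).1 = some m ∧ sd m = (!sd l)
      · obtain ⟨m, hm, hs⟩ := hm
        have hsub : (F (β, l)) ⊆ (((Finset.univ : Finset (𝒞 × 𝔹)).filter (fun z =>
            A z.1 true (β + z.2) = X.1 ∧ A z.1 false (β + z.2) = Y.1)) ×ˢ
            ((Finset.univ : Finset (κ → Λ)).filter (fun s => s X.1 = X.2 - trS sd l m ∧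
              s Y.1 = Y.2 - flS sd l m))).image (fun z => (z.1.1, z.1.2, z.2)) := by
          rintro ⟨c, t, s⟩ hg
          obtain ⟨m', h1, h2, h3, h4⟩ := (Finset.mem_filter.mp hg).2
          have : m' = m := by
            have := hm.symm.trans h1
            exact (Option.some.inj this).symm
          subst this
          have e3 := congrArg Prod.fst h3
          have e4 := congrArg Prod.fst h4
          have e5 := congrArg Prod.snd h3
          have e6 := congrArg Prod.snd h4
          simp only [cellOf, trS_sd sd h2, flS_sd sd h2] at e3 e4 e5 e6
          rw [e3] at e5
          rw [e4] at e6
          refine Finset.mem_image.mpr ⟨((c, t), s), ?_, rfl⟩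
          refine Finset.mem_product.mpr ⟨Finset.mem_filter.mpr ⟨Finset.mem_univ _, e3, e4⟩,
            Finset.mem_filter.mpr ⟨Finset.mem_univ _, ?_, ?_⟩⟩
          · exact eq_sub_of_add_eq' e5
          · exact eq_sub_of_add_eq' e6
        have h1 := (Finset.card_le_card hsub).trans Finset.card_image_le
        rw [Finset.card_product] at h1
        have h2 := cnt_ct H β X.1 Y.1
        have h3 := count_two X.1 Y.1 hXY (X.2 - trS sd l m) (Y.2 - flS sd l m)
        calc _ ≤ _ := Nat.mul_le_mul_right _ h1
          _ = _ := mul_assoc _ _ _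
          _ ≤ _ := Nat.mul_le_mul h2 (le_of_eq ?_)
        convert h3
      · have : F (β, l) = ∅ := by
          apply Finset.filter_eq_empty_iff.mpr
          rintro g - ⟨m, h1, h2, -⟩
          exact hm ⟨m, h1, h2⟩
        rw [this]; simp
    have hsub : ((Finset.univ : Finset (𝒞 × 𝔹 × (κ → Λ))).filter (fun g => UE A sd θ g X Y)) ⊆
        ((Finset.univ : Finset (𝔹 × Λ)).filter (fun z => (θ z.1 z.2).1.isSome)).biUnion F := by
      intro g hg
      obtain ⟨β, l, m, h1, h2, h3, h4⟩ := (Finset.mem_filter.mp hg).2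
      refine Finset.mem_biUnion.mpr ⟨(β, l), ?_, ?_⟩
      · simp [h1]
      · exact Finset.mem_filter.mpr ⟨Finset.mem_univ _, m, h1, h2, h3, h4⟩
    calc _ ≤ _ := Nat.mul_le_mul_right _ ((Finset.card_le_card hsub).trans Finset.card_biUnion_le)
      _ = _ := Finset.sum_mul _ _ _
      _ ≤ _ := Finset.sum_le_sum (fun z _ => hF z)
      _ = _ := by rw [Finset.sum_const, smul_eq_mul, eT]

open Classical in
theorem cnt_UM (H : Host G N capo fk ty0 t0 q vx Z w A Q Rl) (sd : Λ → Bool)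
    (θ : 𝔹 → Λ → Option Λ × Bool) (X : κ × Λ) (b : κ) :
    ((Finset.univ : Finset (𝒞 × 𝔹 × (κ → Λ))).filter (fun g => UM A sd θ g X b)).card *
      (Fintype.card Λ) ≤ mT θ * (w X.1 b * Fintype.card Λ ^ Fintype.card κ) := by
  let F : 𝔹 × Λ → Finset (𝒞 × 𝔹 × (κ → Λ)) := fun z => Finset.univ.filter (fun g =>
    cellOf A sd g z.1 z.2 = X ∧ A g.1 (!sd z.2) (z.1 + g.2.1) = b)
  have hF : ∀ z, (F z).card * (Fintype.card Λ) ≤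
      w X.1 b * Fintype.card Λ ^ Fintype.card κ := by
    rintro ⟨β, l⟩
    have hct : ((Finset.univ : Finset (𝒞 × 𝔹)).filter (fun z =>
            A z.1 (sd l) (β + z.2) = X.1 ∧ A z.1 (!sd l) (β + z.2) = b)).card ≤ w X.1 b := by
      cases sd l
      · rw [H.wsym]
        refine le_trans (Finset.card_le_card ?_) (cnt_ct H β b X.1)
        intro z hz
        have hz := (Finset.mem_filter.mp hz).2
        exact Finset.mem_filter.mpr ⟨Finset.mem_univ _, hz.2, hz.1⟩
      · exact cnt_ct H β X.1 b
    have hsub : (F (β, l)) ⊆ (((Finset.univ : Finset (𝒞 × 𝔹)).filter (fun z =>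
            A z.1 (sd l) (β + z.2) = X.1 ∧ A z.1 (!sd l) (β + z.2) = b)) ×ˢ
            ((Finset.univ : Finset (κ → Λ)).filter (fun s => s X.1 = X.2 - l))).image
            (fun z => (z.1.1, z.1.2, z.2)) := by
      rintro ⟨c, t, s⟩ hg
      obtain ⟨h3, h4⟩ := (Finset.mem_filter.mp hg).2
      have e3 := congrArg Prod.fst h3
      have e5 := congrArg Prod.snd h3
      simp only [cellOf] at e3 e5
      rw [e3] at e5
      refine Finset.mem_image.mpr ⟨((c, t), s), ?_, rfl⟩
      refine Finset.mem_product.mpr ⟨Finset.mem_filter.mpr ⟨Finset.mem_univ _, e3, h4⟩,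
        Finset.mem_filter.mpr ⟨Finset.mem_univ _, ?_⟩⟩
      exact eq_sub_of_add_eq' e5
    have h1 := (Finset.card_le_card hsub).trans Finset.card_image_le
    rw [Finset.card_product] at h1
    have h3 := count_one X.1 (X.2 - l)
    calc _ ≤ _ := Nat.mul_le_mul_right _ h1
      _ = _ := mul_assoc _ _ _
      _ ≤ _ := Nat.mul_le_mul hct (le_of_eq ?_)
    convert h3
  have hsub : ((Finset.univ : Finset (𝒞 × 𝔹 × (κ → Λ))).filter (fun g => UM A sd θ g X b)) ⊆
      ((Finset.univ : Finset (𝔹 × Λ)).filter (fun z => (θ z.1 z.2).2 = true)).biUnion F := by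
    intro g hg
    obtain ⟨β, l, h1, h2, h3⟩ := (Finset.mem_filter.mp hg).2
    refine Finset.mem_biUnion.mpr ⟨(β, l), ?_, ?_⟩
    · simp [h1]
    · exact Finset.mem_filter.mpr ⟨Finset.mem_univ _, h2, h3⟩
  calc _ ≤ _ := Nat.mul_le_mul_right _ ((Finset.card_le_card hsub).trans Finset.card_biUnion_le)
    _ = _ := Finset.sum_mul _ _ _
    _ ≤ _ := Finset.sum_le_sum (fun z _ => hF z)
    _ = _ := by rw [Finset.sum_const, smul_eq_mul, mT]

end

end

section

set_option linter.unusedSectionVars false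

theorem exists_par {Λ X : Type} (par : Λ → Option Λ) (rk : Λ → ℕ)
    (hrk : ∀ l m, par l = some m → rk m < rk l) (base : X) (step : Λ → Λ → X → X) :
    ∃ f : Λ → X, ∀ l, (par l = none → f l = base) ∧ ∀ m, par l = some m → f l = step l m (f m) := by
  classical
  let F : ∀ l : Λ, (∀ m : Λ, rk m < rk l → X) → X := fun l ih =>
    if h : ∃ m, par l = some m then step l h.choose (ih h.choose (hrk _ _ h.choose_spec)) else base
  let wf : WellFounded (fun a b : Λ => rk a < rk b) := (measure rk).wf
  refine ⟨wf.fix F, fun l => ⟨fun h => ?_, fun m hm => ?_⟩⟩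
  · rw [wf.fix_eq]
    simp [F, h]
  · rw [wf.fix_eq]
    have h : ∃ m, par l = some m := ⟨m, hm⟩
    have e : h.choose = m := Option.some.inj (h.choose_spec.symm.trans hm)
    simp only [F, dif_pos h]
    rw [e]

section
variable {V κ Λ 𝒞 𝔹 : Type} [Fintype 𝒞] [Fintype κ] [Fintype Λ] [Fintype 𝔹] [AddCommGroup Λ]
  [AddCommGroup 𝔹] {G : SimpleGraph V} {N capo fk ty0 t0 q : ℕ}
  {vx : κ × Λ → Fin N → V} {Z : κ → Finset V} {w : κ → κ → ℕ} {A : 𝒞 → Bool → 𝔹 → κ}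
  {Q : κ × Λ → κ × Λ → ℕ → Equiv.Perm (Fin N)} {Rl : κ × Λ → κ × Λ → ℕ → Finset (Fin N)}

theorem arith_use (a b l lk u S w cap R : ℕ) (hlk : 0 < lk) (ha : 0 < a * b * l)
    (hu : 0 < u → 0 < w)
    (h : (a * (b * lk)) * u * l ≤ S * (w * lk) + R * (a * (b * lk)) * l)
    (I : S + R * (a * b * l) ≤ a * b * l * cap) : u ≤ w * cap := by
  rcases Nat.eq_zero_or_pos u with h0 | h0
  · omega
  have hw := hu h0
  have h1 : lk * (a * b * l * u) ≤ lk * (S * w + R * (a * b * l)) := by nlinarith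
  have h2 := Nat.le_of_mul_le_mul_left h1 hlk
  have h3 : S * w + R * (a * b * l) ≤ w * (S + R * (a * b * l)) := by
    have : R * (a * b * l) ≤ w * (R * (a * b * l)) := Nat.le_mul_of_pos_left _ hw
    nlinarith
  have h4 : a * b * l * u ≤ a * b * l * (w * cap) := by
    calc _ ≤ _ := h2
      _ ≤ _ := h3
      _ ≤ w * (a * b * l * cap) := Nat.mul_le_mul_left _ I
      _ = _ := by ring
  exact Nat.le_of_mul_le_mul_left h4 ha

open Classical in
theorem core_use (H : Host G N capo fk ty0 t0 q vx Z w A Q Rl) (sd : Λ → Bool) [Nonempty 𝒞]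
    {τ : ℕ} (θ : Fin τ → 𝔹 → Λ → Option Λ × Bool) (capm wmax R : ℕ) (hw : ∀ a b, w a b ≤ wmax)
    (hR : R = Fintype.card (𝔹 → Λ → Option Λ × Bool) * Fintype.card (𝒞 × 𝔹 × (κ → Λ)))
    (I2 : ∑ i, eT (θ i) + R * (Fintype.card 𝒞 * Fintype.card 𝔹 * (Fintype.card Λ * Fintype.card Λ)) ≤
      Fintype.card 𝒞 * Fintype.card 𝔹 * (Fintype.card Λ * Fintype.card Λ) * capo)
    (I3 : wmax * ∑ i, mT (θ i) + R * (Fintype.card 𝒞 * Fintype.card 𝔹 * Fintype.card Λ) ≤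
      Fintype.card 𝒞 * Fintype.card 𝔹 * Fintype.card Λ * capm) :
    ∃ γ : Fin τ → 𝒞 × 𝔹 × (κ → Λ),
      (∀ X Y, (Finset.univ.filter (fun i => UE A sd (θ i) (γ i) X Y)).card ≤ w X.1 Y.1 * capo) ∧
      (∀ X b, (Finset.univ.filter (fun i => UM A sd (θ i) (γ i) X b)).card ≤ capm) := by
  obtain ⟨γ, hγ⟩ := equid (Γ := 𝒞 × 𝔹 × (κ → Λ)) θ
  have hΛ : 0 < Fintype.card Λ := Fintype.card_pos
  have hB : 0 < Fintype.card 𝔹 := Fintype.card_pos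
  have hC : 0 < Fintype.card 𝒞 := Fintype.card_pos
  have cG : Fintype.card (𝒞 × 𝔹 × (κ → Λ)) = Fintype.card 𝒞 * (Fintype.card 𝔹 *
      Fintype.card Λ ^ Fintype.card κ) := by simp
  have hpos : 0 < Fintype.card Λ ^ Fintype.card κ := by positivity
  refine ⟨γ, fun X Y => ?_, fun X b => ?_⟩
  · have h1 := hγ (fun t g => if UE A sd t g X Y then 1 else 0) (fun t g => by split_ifs <;> simp)
    simp only [← Finset.card_filter] at h1
    rw [← hR] at h1
    refine arith_use _ _ _ _ _ (∑ i, eT (θ i)) _ _ R hpos (by positivity : 0 < Fintype.card 𝒞 *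
      Fintype.card 𝔹 * (Fintype.card Λ * Fintype.card Λ)) ?_ ?_ I2
    · intro hu
      obtain ⟨i, hi⟩ := Finset.card_pos.mp hu
      obtain ⟨β, l, m, -, h2, h3, h4⟩ := (Finset.mem_filter.mp hi).2
      rw [← h3, ← h4]
      simp only [cellOf, trS_sd sd h2, flS_sd sd h2]
      exact H.Apos _ _
    · rw [← cG]
      calc _ ≤ _ := Nat.mul_le_mul_right _ h1
        _ = _ := by rw [add_mul, Finset.sum_mul]
        _ ≤ _ := Nat.add_le_add_right (Finset.sum_le_sum (fun i _ => cnt_UE H sd (θ i) X Y)) _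
        _ = _ := by rw [Finset.sum_mul]
  · have h1 := hγ (fun t g => if UM A sd t g X b then 1 else 0) (fun t g => by split_ifs <;> simp)
    simp only [← Finset.card_filter] at h1
    rw [← hR] at h1
    have := arith_use (Fintype.card 𝒞) (Fintype.card 𝔹) (Fintype.card Λ)
      (Fintype.card Λ ^ Fintype.card κ)
      (Finset.univ.filter (fun i => UM A sd (θ i) (γ i) X b)).card (wmax * ∑ i, mT (θ i)) 1 capm R hpos
      (by positivity) (by simp) ?_ I3
    · simpa using this
    · rw [← cG]
      calc _ ≤ _ := Nat.mul_le_mul_right _ h1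
        _ = _ := by rw [add_mul, Finset.sum_mul]
        _ ≤ _ := Nat.add_le_add_right (Finset.sum_le_sum (fun i _ => cnt_UM H sd (θ i) X b)) _
        _ ≤ _ := by
          apply Nat.add_le_add_right
          rw [← Finset.sum_mul, ← mul_assoc, ← mul_assoc, mul_one]
          apply Nat.mul_le_mul_right
          rw [mul_comm]
          exact Nat.mul_le_mul_right _ (hw _ _)

open Classical in
theorem rank_lt {τ : ℕ} (p : Fin τ → Prop) (i : Fin τ) (hi : p i) :
    (Finset.univ.filter (fun j => p j ∧ j < i)).card < (Finset.univ.filter (fun j => p j)).card := by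
  apply Finset.card_lt_card
  refine ⟨fun j hj => ?_, fun h => ?_⟩
  · simp only [Finset.mem_filter] at hj ⊢; exact ⟨hj.1, hj.2.1⟩
  · have := h (Finset.mem_filter.mpr ⟨Finset.mem_univ i, hi⟩)
    exact lt_irrefl _ (Finset.mem_filter.mp this).2.2

open Classical in
theorem rank_inj {τ : ℕ} (p : Fin τ → Prop) (i i' : Fin τ) (hi : p i) (hi' : p i')
    (h : (Finset.univ.filter (fun j => p j ∧ j < i)).card =
      (Finset.univ.filter (fun j => p j ∧ j < i')).card) : i = i' := by
  have key : ∀ i i', p i → i < i' → (Finset.univ.filter (fun j => p j ∧ j < i)).card <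
      (Finset.univ.filter (fun j => p j ∧ j < i')).card := by
    intro i i' hi hlt
    apply Finset.card_lt_card
    refine ⟨fun j hj => ?_, fun h => ?_⟩
    · simp only [Finset.mem_filter] at hj ⊢; exact ⟨hj.1, hj.2.1, hj.2.2.trans hlt⟩
    · have := h (Finset.mem_filter.mpr ⟨Finset.mem_univ i, hi, hlt⟩)
      exact lt_irrefl _ (Finset.mem_filter.mp this).2.2
  rcases lt_trichotomy i i' with h1 | h1 | h1
  · have := key _ _ hi h1; omega
  · exact h1
  · have := key _ _ hi' h1; omega

open Classical in
theorem core (H : Host G N capo fk ty0 t0 q vx Z w A Q Rl) (sd : Λ → Bool) [Nonempty 𝒞]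
    {τ : ℕ} (θ : Fin τ → 𝔹 → Λ → Option Λ × Bool)
    (hsd : ∀ i β l m, (θ i β l).1 = some m → sd m = (!sd l))
    (rk : Fin τ → 𝔹 → Λ → ℕ) (hrk : ∀ i β l m, (θ i β l).1 = some m → rk i β m < rk i β l)
    (capm wmax R : ℕ) (hw : ∀ a b, w a b ≤ wmax)
    (hR : R = Fintype.card (𝔹 → Λ → Option Λ × Bool) * Fintype.card (𝒞 × 𝔹 × (κ → Λ)))
    (I2 : ∑ i, eT (θ i) + R * (Fintype.card 𝒞 * Fintype.card 𝔹 * (Fintype.card Λ * Fintype.card Λ)) ≤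
      Fintype.card 𝒞 * Fintype.card 𝔹 * (Fintype.card Λ * Fintype.card Λ) * capo)
    (I3 : wmax * ∑ i, mT (θ i) + R * (Fintype.card 𝒞 * Fintype.card 𝔹 * Fintype.card Λ) ≤
      Fintype.card 𝒞 * Fintype.card 𝔹 * Fintype.card Λ * capm) :
    ∃ (cl : Fin τ → 𝒞) (sh : Fin τ → 𝔹) (place : Fin τ → 𝔹 → Λ → Fin N → V)
      (bad : Fin τ → 𝔹 → Λ → Finset (Fin N)),
      (∀ i β l x, ∃ l' x', place i β l x = vx (A (cl i) (sd l) (β + sh i), l') x') ∧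
      (∀ i β l x β' l' x', place i β l x = place i β' l' x' → β = β' ∧ l = l' ∧ x = x') ∧
      (∀ i β l m x, (θ i β l).1 = some m → x ∉ bad i β l →
        G.Adj (place i β m x) (place i β l x)) ∧
      (∀ i β l x, x ∉ bad i β l → ty0 ≤ ((Z (A (cl i) (!sd l) (β + sh i))).filter
        (fun z => G.Adj (place i β l x) z)).card) ∧
      (∀ i β l, (bad i β l).card ≤ 2 * fk) ∧
      (∀ i i', i ≠ i' → ∀ β l m x β' l' m' x', (θ i β l).1 = some m → x ∉ bad i β l →
        (θ i' β' l').1 = some m' → x' ∉ bad i' β' l' →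
        s(place i β m x, place i β l x) ≠ s(place i' β' m' x', place i' β' l' x')) ∧
      (∀ y b, (Finset.univ.filter (fun i => ∃ β l, (θ i β l).2 = true ∧
        A (cl i) (!sd l) (β + sh i) = b ∧ ∃ x, place i β l x = y)).card ≤ capm) := by
  obtain ⟨γ, hE, hM⟩ := core_use H sd θ capm wmax R hw hR I2 I3
  let J : Fin τ → κ × Λ → κ × Λ → ℕ := fun i X Y =>
    (Finset.univ.filter (fun j => UE A sd (θ j) (γ j) X Y ∧ j < i)).card
  let ce : Fin τ → 𝔹 → Λ → κ × Λ := fun i β l => cellOf A sd (γ i) β l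
  let qq : Fin τ → 𝔹 → Λ → Λ → Equiv.Perm (Fin N) := fun i β l m =>
    Q (ce i β (trS sd l m)) (ce i β (flS sd l m)) (J i (ce i β (trS sd l m)) (ce i β (flS sd l m)))
  have hP : ∀ i β, ∃ f : Λ → Equiv.Perm (Fin N), ∀ l, ((θ i β l).1 = none → f l = 1) ∧
      ∀ m, (θ i β l).1 = some m → f l = (if sd l then (qq i β l m)⁻¹ * f m else qq i β l m * f m) :=
    fun i β => exists_par (fun l => (θ i β l).1) (rk i β) (hrk i β) 1
      (fun l m g => if sd l then (qq i β l m)⁻¹ * g else qq i β l m * g)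
  choose Pm hPm using hP
  have hq : ∀ i β l m x, (θ i β l).1 = some m →
      Pm i β (flS sd l m) x = qq i β l m (Pm i β (trS sd l m) x) := by
    intro i β l m x h
    have h1 := (hPm i β l).2 m h
    unfold trS flS
    cases hs : sd l
    · rw [hs] at h1
      simp only [Bool.false_eq_true, if_false] at h1 ⊢
      rw [h1]; rfl
    · rw [hs] at h1
      simp only [if_true] at h1 ⊢
      rw [h1]; simp
  have hue : ∀ i β l m, (θ i β l).1 = some m →
      UE A sd (θ i) (γ i) (ce i β (trS sd l m)) (ce i β (flS sd l m)) :=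
    fun i β l m h => ⟨β, l, m, h, hsd _ _ _ _ h, rfl, rfl⟩
  have hJ : ∀ i β l m, (θ i β l).1 = some m →
      J i (ce i β (trS sd l m)) (ce i β (flS sd l m)) <
        w (ce i β (trS sd l m)).1 (ce i β (flS sd l m)).1 * capo := by
    intro i β l m h
    exact lt_of_lt_of_le (rank_lt (fun j => UE A sd (θ j) (γ j) (ce i β (trS sd l m))
      (ce i β (flS sd l m))) i (hue i β l m h)) (hE _ _)
  let RR : Fin τ → 𝔹 → Λ → Λ → Finset (Fin N) := fun i β l m =>
    Rl (ce i β (trS sd l m)) (ce i β (flS sd l m)) (J i (ce i β (trS sd l m)) (ce i β (flS sd l m)))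
  let place : Fin τ → 𝔹 → Λ → Fin N → V := fun i β l x => vx (ce i β l) (Pm i β l x)
  let bad1 : Fin τ → 𝔹 → Λ → Finset (Fin N) := fun i β l => Finset.univ.filter (fun x =>
    ∃ m, (θ i β l).1 = some m ∧ Pm i β (trS sd l m) x ∉ RR i β l m)
  let bad2 : Fin τ → 𝔹 → Λ → Finset (Fin N) := fun i β l => Finset.univ.filter (fun x =>
    ((Z (A (γ i).1 (!sd l) (β + (γ i).2.1))).filter (fun z => G.Adj (place i β l x) z)).card < ty0)
  have hgood : ∀ i β l m x, (θ i β l).1 = some m → x ∉ bad1 i β l ∪ bad2 i β l →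
      Pm i β (trS sd l m) x ∈ RR i β l m := by
    intro i β l m x h hx
    by_contra hc
    exact hx (Finset.mem_union_left _ (Finset.mem_filter.mpr ⟨Finset.mem_univ _, m, h, hc⟩))
  have hsym : ∀ i β l m x, s(place i β m x, place i β l x) =
      s(place i β (trS sd l m) x, place i β (flS sd l m) x) := by
    intro i β l m x
    unfold trS flS
    split_ifs
    · exact Sym2.eq_swap
    · rfl
  have hadj : ∀ i β l m x, (θ i β l).1 = some m → x ∉ bad1 i β l ∪ bad2 i β l →
      G.Adj (place i β (trS sd l m) x) (place i β (flS sd l m) x) := by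
    intro i β l m x h hx
    have h1 := H.Qadj _ _ _ (hJ i β l m h) _ (hgood i β l m x h hx)
    simp only [place]
    rw [hq i β l m x h]
    exact h1
  refine ⟨fun i => (γ i).1, fun i => (γ i).2.1, place, fun i β l => bad1 i β l ∪ bad2 i β l,
    ?_, ?_, ?_, ?_, ?_, ?_, ?_⟩
  · intro i β l x
    exact ⟨_, _, rfl⟩
  · intro i β l x β' l' x' h
    have h1 := H.vinj _ _ _ _ h
    obtain ⟨h2, h3⟩ := cellOf_inj H sd (γ i) h1.1
    subst h2; subst h3
    exact ⟨rfl, rfl, (Pm i β l).injective h1.2⟩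
  · intro i β l m x h hx
    have h1 := hadj i β l m x h hx
    rw [← SimpleGraph.mem_edgeSet, hsym, SimpleGraph.mem_edgeSet]
    exact h1
  · intro i β l x hx
    by_contra hc
    push Not at hc
    exact hx (Finset.mem_union_right _ (Finset.mem_filter.mpr ⟨Finset.mem_univ _, hc⟩))
  · intro i β l
    refine le_trans (Finset.card_union_le _ _) ?_
    have e1 : (bad1 i β l).card ≤ fk := by
      by_cases hm : ∃ m, (θ i β l).1 = some m
      · obtain ⟨m, hm⟩ := hm
        have h1 := H.Qfk _ _ _ (hJ i β l m hm)
        have h2 : (bad1 i β l).card ≤ (RR i β l m)ᶜ.card := by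
          refine Finset.card_le_card_of_injOn (Pm i β (trS sd l m)) ?_
            ((Pm i β (trS sd l m)).injective.injOn)
          intro x hx
          obtain ⟨m', hm', hx⟩ := (Finset.mem_filter.mp hx).2
          have : m' = m := Option.some.inj (hm'.symm.trans hm)
          subst this
          simpa using hx
        rw [Finset.card_compl, Fintype.card_fin] at h2
        simp only [RR] at h2
        omega
      · have : bad1 i β l = ∅ := by
          apply Finset.filter_eq_empty_iff.mpr
          rintro x - ⟨m, h, -⟩
          exact hm ⟨m, h⟩
        rw [this]; simp
    have e2 : (bad2 i β l).card ≤ fk := by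
      have hpos : 0 < w (A (γ i).1 (sd l) (β + (γ i).2.1)) (A (γ i).1 (!sd l) (β + (γ i).2.1)) := by
        cases sd l
        · rw [H.wsym]; exact H.Apos _ _
        · exact H.Apos _ _
      refine le_trans ?_ (H.typ _ _ (ce i β l).2 hpos)
      refine Finset.card_le_card_of_injOn (Pm i β l) ?_ ((Pm i β l).injective.injOn)
      intro x hx
      have hx := (Finset.mem_filter.mp hx).2
      exact Finset.mem_coe.mpr (Finset.mem_filter.mpr ⟨Finset.mem_univ _, hx⟩)
    omega
  · intro i i' hne β l m x β' l' m' x' h hx h' hx' heq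
    rw [hsym i β l m x, hsym i' β' l' m' x', Sym2.eq_iff] at heq
    have r1 := hgood i β l m x h hx
    have r2 := hgood i' β' l' m' x' h' hx'
    have q1 := hq i β l m x h
    have q2 := hq i' β' l' m' x' h'
    rcases heq with ⟨e1, e2⟩ | ⟨e1, e2⟩
    · obtain ⟨c1, v1⟩ := H.vinj _ _ _ _ e1
      obtain ⟨c2, v2⟩ := H.vinj _ _ _ _ e2
      have j1 := hJ i β l m h
      have j2 := hJ i' β' l' m' h'
      have u1 := hue i β l m h
      have u2 := hue i' β' l' m' h'
      simp only [RR, qq] at r1 r2 q1 q2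
      rw [← c1, ← c2] at r2 q2 j2 u2
      rw [q1, q2, ← v1] at v2
      rw [← v1] at r2
      have := H.Qdis _ _ _ _ j1 j2 _ r1 r2 v2
      exact hne (rank_inj (fun j => UE A sd (θ j) (γ j) (ce i β (trS sd l m))
        (ce i β (flS sd l m))) i i' u1 u2 this)
    · obtain ⟨c1, v1⟩ := H.vinj _ _ _ _ e1
      obtain ⟨c2, v2⟩ := H.vinj _ _ _ _ e2
      have j1 := hJ i β l m h
      have j2 := hJ i' β' l' m' h'
      simp only [RR, qq] at r1 r2 q1 q2
      rw [← c1, ← c2] at r2 q2 j2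
      rw [H.wsym] at j2
      refine H.Qdis2 _ _ _ _ j1 j2 _ _ r1 r2 ?_ ?_
      · rw [← q1, v2]
      · rw [← q2, v1]
  · intro y b
    by_cases hy : ∃ X x, y = vx X x
    · obtain ⟨X, x0, rfl⟩ := hy
      refine le_trans (Finset.card_le_card ?_) (hM X b)
      intro i hi
      obtain ⟨β, l, h1, h2, x, h3⟩ := (Finset.mem_filter.mp hi).2
      exact Finset.mem_filter.mpr ⟨Finset.mem_univ _, β, l, h1, (H.vinj _ _ _ _ h3).1, h2⟩
    · rw [Finset.card_eq_zero.mpr]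
      · omega
      · apply Finset.filter_eq_empty_iff.mpr
        rintro i - ⟨β, l, -, -, x, h3⟩
        exact hy ⟨_, _, h3.symm⟩

end

end

section

set_option linter.unusedSectionVars false

/-- code entry with side `o`. -/
def IsO (o : Bool) (z : Option (Bool × Bool)) : Prop := ∃ b, z = some (o, b)

abbrev Code (K : ℕ) := Fin K → Option (Bool × Bool)

section
variable {Δ K : ℕ} {𝔹 Λ : Type} {P : PTree Δ} (D : TD P K 𝔹)

open Classical in
/-- The shape of the piece with top `t`. -/
noncomputable def codeOf (t : ℕ) : Code K := fun u =>
  if h : ∃ v, v < P.m ∧ ¬ D.cut v ∧ D.tp v = t ∧ D.ad v = u.1 then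
    some (D.side h.choose, decide (Mkd D h.choose)) else none

open Classical in
theorem codeOf_eq (v : ℕ) (hv : v < P.m) (hc : ¬ D.cut v) (u : Fin K) (hu : u.1 = D.ad v) :
    codeOf D (D.tp v) u = some (D.side v, decide (Mkd D v)) := by
  have h : ∃ v', v' < P.m ∧ ¬ D.cut v' ∧ D.tp v' = D.tp v ∧ D.ad v' = u.1 :=
    ⟨v, hv, hc, rfl, hu.symm⟩
  have e : h.choose = v := by
    have := h.choose_spec
    exact D.inj _ _ this.1 hv this.2.2.1 (this.2.2.2.trans hu)
  unfold codeOf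
  rw [dif_pos h, e]

theorem codeOf_some (t : ℕ) (u : Fin K) (z : Bool × Bool) (h : codeOf D t u = some z) :
    ∃ v, v < P.m ∧ ¬ D.cut v ∧ D.tp v = t ∧ D.ad v = u.1 := by
  by_contra hc
  unfold codeOf at h
  rw [dif_neg hc] at h
  exact absurd h (by simp)

theorem bin_tp (v : ℕ) (hv : v < P.m) (hc : ¬ D.cut v) : D.bin (D.tp v) = D.bin v := by
  induction v using Nat.strong_induction_on with
  | _ v ih =>
    by_cases ht : v = 0 ∨ D.cut (P.p v)
    · rw [(D.top v ht).1]
    · push Not at ht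
      have h1 : 1 ≤ v := by omega
      have hp := P.hp v h1
      rw [D.ntop_tp v h1 ht.2, ih _ hp (by omega) ht.2]
      exact (D.bin_eq v h1 (fun h => ht.2 (D.spc_cut _ h))).symm

theorem top_ncut (t : ℕ) (ht : t = 0 ∨ D.cut (P.p t)) : ¬ D.cut t := by
  rcases Nat.eq_zero_or_pos t with h | h
  · rw [h]; exact D.cut0
  · rcases ht with h' | h'
    · omega
    · exact fun hc => D.cutp t h hc h'

open Classical in
/-- Tops with given bin and code. -/
noncomputable def tops (β : 𝔹) (c : Code K) : Finset ℕ :=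
  (Finset.range P.m).filter (fun t => (t = 0 ∨ D.cut (P.p t)) ∧ (D.bin t, codeOf D t) = (β, c))

/-- Number of copies of the piece. -/
noncomputable def cnt (N1 : ℕ) (β : 𝔹) (c : Code K) : ℕ :=
  if (tops D β c).card = 0 then 0 else (tops D β c).card / N1 + 2

open Classical in
theorem tops_sum (Φ : Fin K → Option (Bool × Bool) → Prop) (hΦ : ∀ u, ¬ Φ u none) (β : 𝔹) :
    ∑ c, (tops D β c).card * (Finset.univ.filter (fun u => Φ u (c u))).card ≤
    ((Finset.range P.m).filter (fun v => (¬ D.cut v ∧ D.bin v = β) ∧ ∃ u : Fin K, u.1 = D.ad v ∧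
      Φ u (some (D.side v, decide (Mkd D v))))).card := by
  rw [show ∑ c, (tops D β c).card * (Finset.univ.filter (fun u => Φ u (c u))).card =
    (Finset.univ.sigma (fun c => tops D β c ×ˢ (Finset.univ.filter (fun u => Φ u (c u))))).card by
    rw [Finset.card_sigma]; simp only [Finset.card_product]]
  have hex : ∀ z : (Σ _ : Code K, ℕ × Fin K), z ∈ (Finset.univ.sigma (fun c => tops D β c ×ˢ
      (Finset.univ.filter (fun u => Φ u (c u))))) → ∃ v, v < P.m ∧ ¬ D.cut v ∧ D.tp v = z.2.1 ∧
      D.ad v = z.2.2.1 ∧ D.bin v = β ∧ z.1 = codeOf D z.2.1 ∧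
      Φ z.2.2 (some (D.side v, decide (Mkd D v))) := by
    rintro ⟨c, t, u⟩ hz
    simp only [Finset.mem_sigma, Finset.mem_univ, true_and, Finset.mem_product, Finset.mem_filter,
      tops, Prod.mk.injEq, Finset.mem_range] at hz
    obtain ⟨⟨h1, h2, h3, h4⟩, h5⟩ := hz
    subst h4
    cases hcu : codeOf D t u with
    | none => rw [hcu] at h5; exact absurd h5 (hΦ u)
    | some z =>
      obtain ⟨v, v1, v2, v3, v4⟩ := codeOf_some D t u z hcu
      refine ⟨v, v1, v2, v3, v4, ?_, rfl, ?_⟩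
      · rw [← bin_tp D v v1 v2, v3, h3]
      · have := codeOf_eq D v v1 v2 u v4.symm
        rw [v3] at this
        rw [this] at h5
        exact h5
  choose! g hg using hex
  refine Finset.card_le_card_of_injOn g ?_ ?_
  · intro z hz
    obtain ⟨h1, h2, h3, h4, h5, -, h6⟩ := hg z hz
    exact Finset.mem_coe.mpr (Finset.mem_filter.mpr ⟨Finset.mem_range.mpr h1, ⟨h2, h5⟩, _, h4.symm, h6⟩)
  · intro z hz z' hz' he
    obtain ⟨h1, h2, h3, h4, h5, h7, h6⟩ := hg z hz
    obtain ⟨k1, k2, k3, k4, k5, k7, k6⟩ := hg z' hz'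
    rw [he] at h3 h4
    obtain ⟨c, t, u⟩ := z
    obtain ⟨c', t', u'⟩ := z'
    simp only at *
    have e1 : t = t' := h3.symm.trans k3
    have e2 : u = u' := Fin.ext (h4.symm.trans k4)
    subst e1; subst e2
    rw [h7, k7]

open Classical in
theorem cnt_sum (N1 : ℕ) (Φ : Fin K → Option (Bool × Bool) → Prop) (hΦ : ∀ u, ¬ Φ u none)
    (β : 𝔹) :
    N1 * ∑ c, cnt D N1 β c * (Finset.univ.filter (fun u => Φ u (c u))).card ≤
    ((Finset.range P.m).filter (fun v => (¬ D.cut v ∧ D.bin v = β) ∧ ∃ u : Fin K, u.1 = D.ad v ∧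
      Φ u (some (D.side v, decide (Mkd D v))))).card + 2 * N1 * K * Fintype.card (Code K) := by
  have h1 := tops_sum D Φ hΦ β
  have h2 : ∀ c : Code K, N1 * (cnt D N1 β c * (Finset.univ.filter (fun u => Φ u (c u))).card) ≤
      (tops D β c).card * (Finset.univ.filter (fun u => Φ u (c u))).card + 2 * N1 * K := by
    intro c
    have hr : (Finset.univ.filter (fun u => Φ u (c u))).card ≤ K := by
      refine (Finset.card_le_univ _).trans (by simp)
    unfold cnt
    split_ifs with h
    · simp
    · have h3 : N1 * ((tops D β c).card / N1) ≤ (tops D β c).card := Nat.mul_div_le _ _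
      calc _ = (N1 * ((tops D β c).card / N1)) * (Finset.univ.filter (fun u => Φ u (c u))).card +
          2 * N1 * (Finset.univ.filter (fun u => Φ u (c u))).card := by ring
        _ ≤ _ := Nat.add_le_add (Nat.mul_le_mul_right _ h3) (Nat.mul_le_mul_left _ hr)
  rw [Finset.mul_sum]
  calc _ ≤ _ := Finset.sum_le_sum (fun c _ => h2 c)
    _ = _ := Finset.sum_add_distrib
    _ ≤ _ := Nat.add_le_add h1 (le_of_eq ?_)
  rw [Finset.sum_const, Finset.card_univ, smul_eq_mul, mul_comm]

open Classical in
theorem tmpl [Fintype 𝔹] [Fintype Λ] [Nonempty Λ] (sd : Λ → Bool) (N1 ℓ : ℕ)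
    (hN1 : 0 < N1) (hℓ : ∀ o, ℓ ≤ (Finset.univ.filter (fun l => sd l = o)).card)
    (I1 : ∀ β o, ((Finset.range P.m).filter (fun v => ¬ D.cut v ∧ D.bin v = β ∧ D.side v = o)).card
      + 2 * N1 * K * Fintype.card (Code K) ≤ N1 * ℓ) :
    ∃ (θ : 𝔹 → Λ → Option Λ × Bool) (rk : 𝔹 → Λ → ℕ) (ci : 𝔹 → Code K → ℕ → Fin K → Λ),
      (∀ β l m, (θ β l).1 = some m → sd m = (!sd l)) ∧
      (∀ β l m, (θ β l).1 = some m → rk β m < rk β l) ∧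
      (∀ β c j u z c' j' u' z', j < cnt D N1 β c → c u = some z → j' < cnt D N1 β c' →
        c' u' = some z' → ci β c j u = ci β c' j' u' → c = c' ∧ j = j' ∧ u = u') ∧
      (∀ β c j u z, j < cnt D N1 β c → c u = some z → sd (ci β c j u) = z.1 ∧
        (θ β (ci β c j u)).2 = z.2) ∧
      (∀ β c j u z u' z', j < cnt D N1 β c → c u = some z → c u' = some z' → 1 ≤ u.1 →
        (u.1 - 1) / Δ = u'.1 → z.1 = (!z'.1) → (θ β (ci β c j u)).1 = some (ci β c j u')) ∧
      N1 * eT θ ≤ (P.m - 1) + Fintype.card 𝔹 * (2 * N1 * K * Fintype.card (Code K)) ∧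
      N1 * mT θ ≤ ((Finset.range P.m).filter (fun v => ¬ D.cut v ∧ Mkd D v)).card +
        Fintype.card 𝔹 * (2 * N1 * K * Fintype.card (Code K)) := by
  -- slots
  let I : 𝔹 → Bool → Finset (Σ _ : Code K, ℕ × Fin K) := fun β o => Finset.univ.sigma (fun c =>
    Finset.range (cnt D N1 β c) ×ˢ (Finset.univ.filter (fun u => IsO o (c u))))
  have hI : ∀ β o, (I β o).card ≤ ℓ := by
    intro β o
    have h1 := cnt_sum D N1 (fun _ z => IsO o z) (by simp [IsO]) β
    have h2 : (I β o).card = ∑ c, cnt D N1 β c *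
        (Finset.univ.filter (fun u => IsO o (c u))).card := by
      rw [Finset.card_sigma]; simp only [Finset.card_product, Finset.card_range]
    rw [h2]
    refine Nat.le_of_mul_le_mul_left (le_trans h1 (le_trans ?_ (I1 β o))) hN1
    apply Nat.add_le_add_right
    apply Finset.card_le_card
    intro v hv
    simp only [Finset.mem_filter, IsO, Option.some.injEq, Prod.mk.injEq] at hv ⊢
    obtain ⟨h3, ⟨h4, h5⟩, u, -, b, h6, -⟩ := hv
    exact ⟨h3, h4, h5, h6⟩
  have hf : ∀ β o, ∃ f : (Σ _ : Code K, ℕ × Fin K) → Λ, (∀ i ∈ I β o, f i ∈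
      Finset.univ.filter (fun l => sd l = o)) ∧ ∀ i ∈ I β o, ∀ j ∈ I β o, f i = f j → i = j :=
    fun β o => sdr (I β o) (fun _ => Finset.univ.filter (fun l => sd l = o))
      (fun i _ => (hI β o).trans (hℓ o))
  choose f hf1 hf2 using hf
  let ci : 𝔹 → Code K → ℕ → Fin K → Λ := fun β c j u =>
    f β (match c u with | some z => z.1 | none => true) ⟨c, j, u⟩
  have hmem : ∀ β c j u z, j < cnt D N1 β c → c u = some z →
      (⟨c, j, u⟩ : Σ _ : Code K, ℕ × Fin K) ∈ I β z.1 := by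
    intro β c j u z h1 h2
    simp only [I, Finset.mem_sigma, Finset.mem_univ, true_and, Finset.mem_product,
      Finset.mem_range, Finset.mem_filter]
    exact ⟨h1, z.2, h2⟩
  have hci : ∀ β c j u z, c u = some z → ci β c j u = f β z.1 ⟨c, j, u⟩ := by
    intro β c j u z h
    simp only [ci, h]
  have hcsd : ∀ β c j u z, j < cnt D N1 β c → c u = some z → sd (ci β c j u) = z.1 := by
    intro β c j u z h1 h2
    rw [hci β c j u z h2]
    exact (Finset.mem_filter.mp (hf1 β z.1 _ (hmem β c j u z h1 h2))).2
  have hinj : ∀ β c j u z c' j' u' z', j < cnt D N1 β c → c u = some z → j' < cnt D N1 β c' →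
        c' u' = some z' → ci β c j u = ci β c' j' u' → c = c' ∧ j = j' ∧ u = u' := by
    intro β c j u z c' j' u' z' h1 h2 h3 h4 h5
    have s1 := hcsd β c j u z h1 h2
    have s2 := hcsd β c' j' u' z' h3 h4
    rw [h5, s2] at s1
    rw [hci β c j u z h2, hci β c' j' u' z' h4, s1] at h5
    have m2 := hmem β c' j' u' z' h3 h4
    rw [s1] at m2
    have := hf2 β z.1 _ (hmem β c j u z h1 h2) _ m2 h5
    injection this with e1 e2
    rw [Prod.mk.injEq] at e2
    exact ⟨e1, e2.1, e2.2⟩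
  -- decoding
  let Dec : 𝔹 → Λ → (Code K × ℕ × Fin K) → Prop := fun β l r =>
    r.2.1 < cnt D N1 β r.1 ∧ (r.1 r.2.2).isSome ∧ ci β r.1 r.2.1 r.2.2 = l
  have hdu : ∀ β l r r', Dec β l r → Dec β l r' → r = r' := by
    rintro β l ⟨c, j, u⟩ ⟨c', j', u'⟩ ⟨h1, h2, h3⟩ ⟨h4, h5, h6⟩
    obtain ⟨z, hz⟩ := Option.isSome_iff_exists.mp h2
    obtain ⟨z', hz'⟩ := Option.isSome_iff_exists.mp h5
    obtain ⟨e1, e2, e3⟩ := hinj β c j u z c' j' u' z' h1 hz h4 hz' (h3.trans h6.symm)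
    rw [e1, e2, e3]
  let Pr : 𝔹 → Λ → Λ → Prop := fun β l m => ∃ r, Dec β l r ∧ ∃ r', Dec β m r' ∧ r.1 = r'.1 ∧
    r.2.1 = r'.2.1 ∧ 1 ≤ r.2.2.1 ∧ (r.2.2.1 - 1) / Δ = r'.2.2.1 ∧ sd m = (!sd l)
  have hPr : ∀ β l m m', Pr β l m → Pr β l m' → m = m' := by
    rintro β l m m' ⟨⟨c, j, u⟩, h1, ⟨c', j', u'⟩, h2, h3, h4, h5, h6, h7⟩
      ⟨r, k1, ⟨d', i', t'⟩, k2, k3, k4, k5, k6, k7⟩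
    have := hdu β l _ _ h1 k1
    subst this
    simp only at h3 h4 h5 h6 k3 k4 k5 k6
    have e : u' = t' := Fin.ext (h6.symm.trans k6)
    subst e; subst h3; subst h4; subst k3; subst k4
    exact h2.2.2.symm.trans k2.2.2
  let θ : 𝔹 → Λ → Option Λ × Bool := fun β l =>
    (if h : ∃ m, Pr β l m then some h.choose else none,
      decide (∃ r, Dec β l r ∧ ∃ o, r.1 r.2.2 = some (o, true)))
  have hθ : ∀ β l m, (θ β l).1 = some m ↔ Pr β l m := by
    intro β l m
    simp only [θ]
    constructor
    · intro h
      split_ifs at h with h1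
      · rw [← Option.some.inj h]; exact h1.choose_spec
    · intro h
      have h1 : ∃ m, Pr β l m := ⟨m, h⟩
      rw [dif_pos h1, hPr β l _ _ h1.choose_spec h]
  let rk : 𝔹 → Λ → ℕ := fun β l => if h : ∃ r, Dec β l r then h.choose.2.2.1 else 0
  have hrk : ∀ β l r, Dec β l r → rk β l = r.2.2.1 := by
    intro β l r h
    have h1 : ∃ r, Dec β l r := ⟨r, h⟩
    simp only [rk, dif_pos h1]
    rw [hdu β l _ _ h1.choose_spec h]
  have hsumB : ∀ (Φ : Fin K → Option (Bool × Bool) → Prop) (_ : ∀ u, ¬ Φ u none)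
      (S : Finset (𝔹 × Λ)) (_ : ∀ z ∈ S, ∃ r, Dec z.1 z.2 r ∧ Φ r.2.2 (r.1 r.2.2)),
      N1 * S.card ≤ ((Finset.range P.m).filter (fun v => ¬ D.cut v ∧ ∃ u : Fin K, u.1 = D.ad v ∧
        Φ u (some (D.side v, decide (Mkd D v))))).card +
        Fintype.card 𝔹 * (2 * N1 * K * Fintype.card (Code K)) := by
    intro Φ hΦ S hS
    haveI : Nonempty (Code K × ℕ × Fin K) := ⟨(fun _ => none, 0, ⟨D.ad 0, D.ad_lt 0 P.hm⟩)⟩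
    choose! g hg using hS
    have c1 : S.card ≤ ∑ β, ∑ c, cnt D N1 β c * (Finset.univ.filter (fun u => Φ u (c u))).card := by
      have : ∑ β, ∑ c, cnt D N1 β c * (Finset.univ.filter (fun u => Φ u (c u))).card =
        (Finset.univ.sigma (fun β => Finset.univ.sigma (fun c : Code K => Finset.range (cnt D N1 β c)
          ×ˢ (Finset.univ.filter (fun u => Φ u (c u)))))).card := by
        rw [Finset.card_sigma]
        simp only [Finset.card_sigma, Finset.card_product, Finset.card_range]
      rw [this]
      refine Finset.card_le_card_of_injOn (fun z => ⟨z.1, (g z).1, (g z).2.1, (g z).2.2⟩) ?_ ?_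
      · intro z hz
        have := hg z hz
        simp only [Finset.coe_sigma, Set.mem_sigma_iff, Finset.mem_coe, Finset.mem_univ, true_and,
          Finset.mem_product, Finset.mem_range, Finset.mem_filter]
        exact ⟨this.1.1, this.2⟩
      · intro z hz z' hz' h
        have h1 := (hg z hz).1
        have h2 := (hg z' hz').1
        simp only [Sigma.mk.injEq] at h
        obtain ⟨e1, e2⟩ := h
        obtain ⟨β, l⟩ := z
        obtain ⟨β', l'⟩ := z'
        simp only at e1
        subst e1
        have e2 := eq_of_heq e2
        simp only [Sigma.mk.injEq] at e2
        have e3 : g (β, l) = g (β, l') := Prod.ext e2.1 (eq_of_heq e2.2)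
        rw [e3] at h1
        exact congrArg _ (h1.2.2.symm.trans h2.2.2)
    calc N1 * S.card ≤ _ := Nat.mul_le_mul_left _ c1
      _ = _ := Finset.mul_sum _ _ _
      _ ≤ _ := Finset.sum_le_sum (fun β _ => cnt_sum D N1 Φ hΦ β)
      _ = _ := Finset.sum_add_distrib
      _ ≤ _ := Nat.add_le_add ?_ (le_of_eq (by rw [Finset.sum_const, Finset.card_univ, smul_eq_mul]))
    rw [Finset.card_eq_sum_card_fiberwise (f := D.bin) (t := Finset.univ) (by simp)]
    apply Finset.sum_le_sum
    intro β _
    apply Finset.card_le_card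
    intro v hv
    simp only [Finset.mem_filter] at hv ⊢
    exact ⟨⟨hv.1, hv.2.1.1, hv.2.2⟩, hv.2.1.2⟩
  refine ⟨θ, rk, ci, ?_, ?_, hinj, ?_, ?_, ?_, ?_⟩
  · intro β l m h
    obtain ⟨r, -, r', -, -, -, -, -, h7⟩ := (hθ β l m).mp h
    exact h7
  · intro β l m h
    obtain ⟨r, h1, r', h2, -, -, h5, h6, -⟩ := (hθ β l m).mp h
    rw [hrk β l r h1, hrk β m r' h2, ← h6]
    exact lt_of_le_of_lt (Nat.div_le_self _ _) (by omega)
  · intro β c j u z h1 h2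
    refine ⟨hcsd β c j u z h1 h2, ?_⟩
    have hd : Dec β (ci β c j u) (c, j, u) := ⟨h1, by simp [h2], rfl⟩
    simp only [θ]
    cases hz : z.2
    · apply decide_eq_false
      rintro ⟨r, h3, o, h4⟩
      have := hdu _ _ _ _ h3 hd
      subst this
      simp only at h4
      rw [h2, Option.some.injEq] at h4
      rw [h4] at hz
      exact absurd hz (by simp)
    · apply decide_eq_true
      refine ⟨_, hd, z.1, ?_⟩
      simp only
      rw [h2, ← hz]
  · intro β c j u z u' z' h1 h2 h3 h4 h5 h6
    refine (hθ _ _ _).mpr ⟨(c, j, u), ⟨h1, by simp [h2], rfl⟩, (c, j, u'), ⟨h1, by simp [h3], rfl⟩,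
      rfl, rfl, h4, h5, ?_⟩
    rw [hcsd β c j u z h1 h2, hcsd β c j u' z' h1 h3, h6, Bool.not_not]
  · refine le_trans (hsumB (fun u z => 1 ≤ u.1 ∧ z.isSome) (by simp) _ ?_) ?_
    · rintro ⟨β, l⟩ hz
      obtain ⟨m, hm⟩ := Option.isSome_iff_exists.mp (Finset.mem_filter.mp hz).2
      obtain ⟨r, h1, r', -, -, -, h5, -⟩ := (hθ β l m).mp hm
      exact ⟨r, h1, h5, h1.2.1⟩
    · apply Nat.add_le_add_right
      refine (Finset.card_le_card (t := (Finset.range P.m).erase 0) ?_).trans ?_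
      · intro v hv
        simp only [Finset.mem_filter] at hv
        obtain ⟨h1, h2, u, h3, h4, -⟩ := hv
        refine Finset.mem_erase.mpr ⟨?_, h1⟩
        rintro rfl
        have := (D.top 0 (Or.inl rfl)).2
        omega
      · rw [Finset.card_erase_of_mem (Finset.mem_range.mpr P.hm), Finset.card_range]
  · refine le_trans (hsumB (fun u z => ∃ o, z = some (o, true)) (by simp) _ ?_) ?_
    · rintro ⟨β, l⟩ hz
      have hz := (Finset.mem_filter.mp hz).2
      simp only [θ, decide_eq_true_eq] at hz
      exact hz
    · apply Nat.add_le_add_right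
      apply Finset.card_le_card
      intro v hv
      simp only [Finset.mem_filter, Option.some.injEq, Prod.mk.injEq, decide_eq_true_eq] at hv ⊢
      obtain ⟨h1, h2, u, h3, o, -, h4⟩ := hv
      exact ⟨h1, h2, h4⟩

end

end

section

set_option linter.unusedSectionVars false

theorem memf {α : Type*} {p : α → Prop} {i : DecidablePred p} {s : Finset α} {a : α} :
    a ∈ @Finset.filter α p i s ↔ a ∈ s ∧ p a := @Finset.mem_filter α p i s a

section
variable {V κ Λ 𝒞 𝔹 : Type} [Fintype V] [Fintype 𝒞] [Fintype κ] [Fintype Λ] [Fintype 𝔹] [AddCommGroup Λ]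
  [AddCommGroup 𝔹] {G : SimpleGraph V} {N capo fk ty0 t0 q : ℕ}
  {vx : κ × Λ → Fin N → V} {Z : κ → Finset V} {w : κ → κ → ℕ} {A : 𝒞 → Bool → 𝔹 → κ}
  {Q : κ × Λ → κ × Λ → ℕ → Equiv.Perm (Fin N)} {Rl : κ × Λ → κ × Λ → ℕ → Finset (Fin N)}

open Classical in
theorem trees_AL (H : Host G N capo fk ty0 t0 q vx Z w A Q Rl) (sd : Λ → Bool) [Nonempty 𝒞]
    {τ Δ K : ℕ} (P : Fin τ → PTree Δ) (D : ∀ i, TD (P i) K 𝔹) (N1 ℓ : ℕ)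
    (hN1 : 0 < N1) (hℓ : ∀ o, ℓ ≤ (Finset.univ.filter (fun l => sd l = o)).card)
    (hN : N1 + K * (2 * fk) ≤ N)
    (I1 : ∀ i β o, ((Finset.range (P i).m).filter (fun v => ¬ (D i).cut v ∧ (D i).bin v = β ∧
      (D i).side v = o)).card + 2 * N1 * K * Fintype.card (Code K) ≤ N1 * ℓ)
    (capm wmax R E Mk : ℕ) (hw : ∀ a b, w a b ≤ wmax)
    (hR : R = Fintype.card (𝔹 → Λ → Option Λ × Bool) * Fintype.card (𝒞 × 𝔹 × (κ → Λ)))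
    (hE : ∑ i, ((P i).m - 1) + τ * (Fintype.card 𝔹 * (2 * N1 * K * Fintype.card (Code K))) ≤ N1 * E)
    (hMk : ∑ i, ((Finset.range (P i).m).filter (fun v => ¬ (D i).cut v ∧ Mkd (D i) v)).card +
      τ * (Fintype.card 𝔹 * (2 * N1 * K * Fintype.card (Code K))) ≤ N1 * Mk)
    (I2 : E + R * (Fintype.card 𝒞 * Fintype.card 𝔹 * (Fintype.card Λ * Fintype.card Λ)) ≤
      Fintype.card 𝒞 * Fintype.card 𝔹 * (Fintype.card Λ * Fintype.card Λ) * capo)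
    (I3 : wmax * Mk + R * (Fintype.card 𝒞 * Fintype.card 𝔹 * Fintype.card Λ) ≤
      Fintype.card 𝒞 * Fintype.card 𝔹 * Fintype.card Λ * capm) :
    ∃ (Cell : κ → Finset V) (A' : Fin τ → Bool → 𝔹 → κ) (ty : Fin τ → ℕ → 𝔹 × Code K)
      (Cop : Fin τ → 𝔹 × Code K → Finset (ℕ → V)),
      AL P D G Z Cell (fun a b => 0 < w a b) A' ty Cop ty0 N1 capm t0 q := by
  have hT := fun i => tmpl (D i) sd N1 ℓ hN1 hℓ (I1 i)
  choose θ rk ci hsd hrk hci1 hci2 hci3 heT hmT using hT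
  have sumE : ∑ i, eT (θ i) ≤ E := by
    refine Nat.le_of_mul_le_mul_left (le_trans ?_ hE) hN1
    rw [Finset.mul_sum]
    refine (Finset.sum_le_sum (fun i _ => heT i)).trans (le_of_eq ?_)
    rw [Finset.sum_add_distrib, Finset.sum_const, Finset.card_univ, Fintype.card_fin, smul_eq_mul]
  have sumM : ∑ i, mT (θ i) ≤ Mk := by
    refine Nat.le_of_mul_le_mul_left (le_trans ?_ hMk) hN1
    rw [Finset.mul_sum]
    refine (Finset.sum_le_sum (fun i _ => hmT i)).trans (le_of_eq ?_)
    rw [Finset.sum_add_distrib, Finset.sum_const, Finset.card_univ, Fintype.card_fin, smul_eq_mul]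
  obtain ⟨cl, sh, place, bad, p1, p2, p3, p4, p5, p6, p7⟩ := core H sd θ hsd rk hrk capm wmax R hw hR
    (le_trans (Nat.add_le_add_right sumE _) I2)
    (le_trans (Nat.add_le_add_right (Nat.mul_le_mul_left _ sumM) _) I3)
  let Cell : κ → Finset V := fun a => Finset.univ.filter (fun y => ∃ l x, y = vx (a, l) x)
  let mk : Fin τ → 𝔹 → Code K → ℕ → Fin N → ℕ → V := fun i β c j x u =>
    if h : ∃ hu : u < K, (c ⟨u, hu⟩).isSome then place i β (ci i β c j ⟨u, h.choose⟩) x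
    else if h0 : 0 < K then place i β (ci i β c j ⟨0, h0⟩) x else vx (cellOf A sd (Classical.arbitrary 𝒞,0,0) 0 0) x
  have hmk : ∀ i β c j x (u : Fin K) z, c u = some z →
      mk i β c j x u.1 = place i β (ci i β c j u) x := by
    intro i β c j x u z h
    have h' : ∃ hu : u.1 < K, (c ⟨u.1, hu⟩).isSome := ⟨u.2, by simp [h]⟩
    simp only [mk, dif_pos h']
  let OK : Fin τ → 𝔹 → Code K → ℕ → Fin N → Prop := fun i β c j x =>
    (∃ h0 : 0 < K, (c ⟨0, h0⟩).isSome) ∧ ∀ u, (c u).isSome → x ∉ bad i β (ci i β c j u)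
  let Cop : Fin τ → 𝔹 × Code K → Finset (ℕ → V) := fun i bc =>
    ((Finset.range (cnt (D i) N1 bc.1 bc.2) ×ˢ (Finset.univ : Finset (Fin N))).filter
      (fun z => OK i bc.1 bc.2 z.1 z.2)).image (fun z => mk i bc.1 bc.2 z.1 z.2)
  let ty : Fin τ → ℕ → 𝔹 × Code K := fun i t => ((D i).bin t, codeOf (D i) t)
  have hCop : ∀ i bc f, f ∈ Cop i bc → ∃ j x, j < cnt (D i) N1 bc.1 bc.2 ∧ OK i bc.1 bc.2 j x ∧
      f = mk i bc.1 bc.2 j x := by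
    intro i bc f hf
    obtain ⟨z, hz, rfl⟩ := Finset.mem_image.mp hf
    obtain ⟨hz1, hz2⟩ := Finset.mem_filter.mp hz
    exact ⟨z.1, z.2, Finset.mem_range.mp (Finset.mem_product.mp hz1).1, hz2, rfl⟩
  -- value at a tree vertex
  have hval : ∀ i v, (hv : v < (P i).m) → ¬ (D i).cut v → ∀ f ∈ Cop i (ty i ((D i).tp v)),
      ∃ j x, j < cnt (D i) N1 ((D i).bin v) (codeOf (D i) ((D i).tp v)) ∧
        OK i ((D i).bin v) (codeOf (D i) ((D i).tp v)) j x ∧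
        f = mk i ((D i).bin v) (codeOf (D i) ((D i).tp v)) j x ∧
        f ((D i).ad v) = place i ((D i).bin v) (ci i ((D i).bin v) (codeOf (D i) ((D i).tp v)) j
          ⟨(D i).ad v, (D i).ad_lt v hv⟩) x := by
    intro i v hv hc f hf
    obtain ⟨j, x, h1, h2, h3⟩ := hCop i _ f hf
    simp only [ty] at h1 h2 h3
    rw [bin_tp (D i) v hv hc] at h1 h2 h3
    refine ⟨j, x, h1, h2, h3, ?_⟩
    rw [h3]
    exact hmk i _ _ j x ⟨(D i).ad v, (D i).ad_lt v hv⟩ _ (codeOf_eq (D i) v hv hc _ rfl)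
  have hcode : ∀ i v (hv : v < (P i).m), ¬ (D i).cut v →
      codeOf (D i) ((D i).tp v) ⟨(D i).ad v, (D i).ad_lt v hv⟩ =
        some ((D i).side v, decide (Mkd (D i) v)) :=
    fun i v hv hc => codeOf_eq (D i) v hv hc _ rfl
  have hpar : ∀ i v (hv : v < (P i).m) (hp : (P i).p v < (P i).m) (_ : 1 ≤ v) (_ : ¬ (D i).cut v)
      (_ : ¬ (D i).cut ((P i).p v)) j,
      j < cnt (D i) N1 ((D i).bin v) (codeOf (D i) ((D i).tp v)) →
      (θ i ((D i).bin v) (ci i ((D i).bin v) (codeOf (D i) ((D i).tp v)) j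
          ⟨(D i).ad v, (D i).ad_lt v hv⟩)).1 = some (ci i ((D i).bin v) (codeOf (D i) ((D i).tp v)) j
          ⟨(D i).ad ((P i).p v), (D i).ad_lt _ hp⟩) := by
    intro i v hv hp h1 hc hcp j hj
    have e2 := hcode i _ hp hcp
    rw [← (D i).ntop_tp v h1 hcp] at e2
    have ha := (D i).ntop_ad v h1 hv hcp
    refine hci3 i _ _ j _ _ _ _ hj (hcode i v hv hc) e2 ha.1 ha.2 ?_
    exact (D i).side_eq v h1 (fun h => hcp ((D i).spc_cut _ h))
  have hbinp : ∀ i v, 1 ≤ v → ¬ (D i).cut ((P i).p v) → (D i).bin v = (D i).bin ((P i).p v) :=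
    fun i v h1 hcp => (D i).bin_eq v h1 (fun h => hcp ((D i).spc_cut _ h))
  have hedge : ∀ i v, 1 ≤ v → v < (P i).m → ¬ (D i).cut v → ¬ (D i).cut ((P i).p v) →
      ∀ f ∈ Cop i (ty i ((D i).tp v)), ∃ β l m x, (θ i β l).1 = some m ∧ x ∉ bad i β l ∧
        f ((D i).ad ((P i).p v)) = place i β m x ∧ f ((D i).ad v) = place i β l x := by
    intro i v h1 hv hc hcp f hf
    have hp : (P i).p v < (P i).m := by have := (P i).hp v h1; omega
    obtain ⟨j, x, hj, hok, hf1, hf2⟩ := hval i v hv hc f hf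
    refine ⟨_, _, _, x, hpar i v hv hp h1 hc hcp j hj, hok.2 _ (by rw [hcode i v hv hc]; rfl), ?_, hf2⟩
    rw [hf1]
    have e2 := hcode i _ hp hcp
    rw [← (D i).ntop_tp v h1 hcp] at e2
    exact hmk i _ _ j x ⟨(D i).ad ((P i).p v), (D i).ad_lt _ hp⟩ _ e2
  refine ⟨Cell, fun i o β => A (cl i) o (β + sh i), ty, Cop, ?_⟩
  refine ⟨H.Zd, ?_, ?_, ?_, ?_, ?_, ?_, ?_, ?_, ?_, ?_, ?_, ?_, ?_⟩
  · intro b b' z h h'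
    obtain ⟨l, x, rfl⟩ := (Finset.mem_filter.mp h).2
    obtain ⟨l', x', h2⟩ := (Finset.mem_filter.mp h').2
    exact congrArg Prod.fst (H.vinj _ _ _ _ h2).1
  · intro b b' z h
    obtain ⟨l, x, rfl⟩ := (Finset.mem_filter.mp h).2
    exact H.vZ _ _ _
  · intro i o β β' h
    exact add_right_cancel (H.Ainj _ _ h)
  · intro i o β
    cases o
    · simp only [Bool.not_false]
      rw [H.wsym]; exact H.Apos _ _
    · exact H.Apos _ _
  · -- a1
    intro i v hv hc f hf
    obtain ⟨j, x, hj, hok, hf1, hf2⟩ := hval i v hv hc f hf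
    rw [hf2]
    refine Finset.mem_filter.mpr ⟨Finset.mem_univ _, ?_⟩
    obtain ⟨l', x', h⟩ := p1 i ((D i).bin v) (ci i ((D i).bin v) (codeOf (D i) ((D i).tp v)) j
          ⟨(D i).ad v, (D i).ad_lt v hv⟩) x
    rw [(hci2 i _ _ j _ _ hj (hcode i v hv hc)).1] at h
    exact ⟨l', x', h⟩
  · intro i v v' hv hc hv' hc' f hf f' hf' he
    obtain ⟨j, x, hj, hok, hf1, hf2⟩ := hval i v hv hc f hf
    obtain ⟨j', x', hj', hok', hf1', hf2'⟩ := hval i v' hv' hc' f' hf'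
    have hb := bin_tp (D i) v hv hc
    have hb' := bin_tp (D i) v' hv' hc'
    rw [hf2, hf2'] at he
    obtain ⟨e1, e2, e3⟩ := p2 _ _ _ _ _ _ _ he
    have c1 := hcode i v hv hc
    have c2 := hcode i v' hv' hc'
    rw [← e1] at e2 hj' hf1' hb'
    obtain ⟨g1, g2, g3⟩ := hci1 i _ _ _ _ _ _ _ _ _ hj c1 hj' c2 e2
    refine ⟨?_, ?_, ?_⟩
    · simp only [ty]
      rw [hb, hb', g1]
    · rw [hf1, hf1', g1, g2, e3]
    · exact congrArg Fin.val g3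
  · -- a2'
    intro i c f hf f' hf' he
    obtain ⟨j, x, hj, hok, hf1⟩ := hCop i c f hf
    obtain ⟨j', x', hj', hok', hf1'⟩ := hCop i c f' hf'
    obtain ⟨h0, hs⟩ := hok.1
    obtain ⟨z, hz⟩ := Option.isSome_iff_exists.mp hs
    rw [hf1, hf1', hmk i c.1 c.2 j x ⟨0, h0⟩ z hz, hmk i c.1 c.2 j' x' ⟨0, h0⟩ z hz] at he
    obtain ⟨e1, e2, e3⟩ := p2 _ _ _ _ _ _ _ he
    obtain ⟨g1, g2, g3⟩ := hci1 i _ _ _ _ _ _ _ _ _ hj hz hj' hz e2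
    rw [hf1, hf1', g2, e3]
  · -- a3
    intro i v h1 hv hc hcp f hf
    obtain ⟨β, l, m, x, t1, t2, t3, t4⟩ := hedge i v h1 hv hc hcp f hf
    rw [t3, t4]
    exact p3 i β l m x t1 t2
  · -- a4
    intro i s hs hcs f hf
    have h1 : 1 ≤ s := by
      rcases Nat.eq_zero_or_pos s with h | h
      · rw [h] at hcs; exact absurd hcs (D i).cut0
      · exact h
    have hcp := (D i).cutp s h1 hcs
    have hp : (P i).p s < (P i).m := by have := (P i).hp s h1; omega
    obtain ⟨j, x, hj, hok, hf1, hf2⟩ := hval i _ hp hcp f hf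
    rw [hf2]
    have := p4 i _ _ x (hok.2 _ (by rw [hcode i _ hp hcp]; rfl))
    rw [(hci2 i _ _ j _ _ hj (hcode i _ hp hcp)).1] at this
    rw [hbinp i s h1 hcp, (D i).side_eq s h1 (fun h => hcp ((D i).spc_cut _ h))]
    exact this
  · -- a5
    intro i t ht htop
    have hc := top_ncut (D i) t htop
    obtain ⟨k1, k2⟩ := (D i).top t htop
    have hc0 := hcode i t ht hc
    have hK : 0 < K := by have := (D i).ad_lt t ht; omega
    rw [k1] at hc0
    have e0 : (⟨(D i).ad t, (D i).ad_lt t ht⟩ : Fin K) = ⟨0, hK⟩ := Fin.ext k2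
    rw [e0] at hc0
    set β := (D i).bin t with hβ
    set c := codeOf (D i) t with hcc
    refine le_trans (Nat.add_le_add_right (Finset.card_le_card (t := tops (D i) β c) ?_) N1) ?_
    · intro t' ht'
      have h1 := memf.mp ht'
      unfold tops
      exact memf.mpr h1
    have hn : (tops (D i) β c).card ≠ 0 := by
      apply Finset.card_ne_zero_of_mem (a := t)
      exact Finset.mem_filter.mpr ⟨Finset.mem_range.mpr ht, htop, rfl⟩
    have hcnt : cnt (D i) N1 β c = (tops (D i) β c).card / N1 + 2 := by
      unfold cnt; rw [if_neg hn]
    have hcard : cnt (D i) N1 β c * N1 ≤ (Cop i (β, c)).card := by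
      have hin : Set.InjOn (fun z : ℕ × Fin N => mk i β c z.1 z.2)
          (((Finset.range (cnt (D i) N1 β c) ×ˢ (Finset.univ : Finset (Fin N))).filter
          (fun z => OK i β c z.1 z.2)) : Finset (ℕ × Fin N)) := by
        rintro ⟨j, x⟩ hz ⟨j', x'⟩ hz' he
        have hj := Finset.mem_range.mp (Finset.mem_product.mp (Finset.mem_filter.mp hz).1).1
        have hj' := Finset.mem_range.mp (Finset.mem_product.mp (Finset.mem_filter.mp hz').1).1
        have he := congrFun he 0
        simp only at he hj hj'
        rw [hmk i β c j x ⟨0, hK⟩ _ hc0, hmk i β c j' x' ⟨0, hK⟩ _ hc0] at he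
        obtain ⟨e1, e2, e3⟩ := p2 _ _ _ _ _ _ _ he
        obtain ⟨g1, g2, g3⟩ := hci1 i _ _ _ _ _ _ _ _ _ hj hc0 hj' hc0 e2
        rw [g2, e3]
      simp only [Cop]
      rw [Finset.card_image_of_injOn hin, Finset.card_filter, Finset.sum_product]
      rw [← smul_eq_mul, ← Finset.card_range (cnt (D i) N1 β c), ← Finset.sum_const,
        Finset.card_range]
      apply Finset.sum_le_sum
      intro j hj
      have hbad : (Finset.univ.filter (fun x => ¬ OK i β c j x)).card ≤ K * (2 * fk) := by
        have hsub : (Finset.univ.filter (fun x => ¬ OK i β c j x)) ⊆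
            (Finset.univ : Finset (Fin K)).biUnion (fun u => bad i β (ci i β c j u)) := by
          intro x hx
          have hx := (Finset.mem_filter.mp hx).2
          simp only [OK, not_and_or, not_forall] at hx
          rcases hx with hx | ⟨u, hu, hx⟩
          · exact absurd ⟨hK, by rw [hc0]; rfl⟩ hx
          · exact Finset.mem_biUnion.mpr ⟨u, Finset.mem_univ _, not_not.mp hx⟩
        refine (Finset.card_le_card hsub).trans (Finset.card_biUnion_le.trans ?_)
        refine (Finset.sum_le_sum (fun u _ => p5 i β _)).trans (le_of_eq ?_)
        rw [Finset.sum_const, Finset.card_univ, Fintype.card_fin, smul_eq_mul]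
      have hsplit := Finset.card_filter_add_card_filter_not (s := (Finset.univ : Finset (Fin N)))
        (fun x => OK i β c j x)
      rw [Finset.card_univ, Fintype.card_fin] at hsplit
      simp only
      rw [← Finset.card_filter]
      omega
    have hdm := Nat.div_add_mod (tops (D i) β c).card N1
    have hml := Nat.mod_lt (tops (D i) β c).card hN1
    refine le_trans ?_ hcard
    rw [hcnt]
    have : ((tops (D i) β c).card / N1 + 2) * N1 = N1 * ((tops (D i) β c).card / N1) + 2 * N1 := by
      ring
    omega
  · -- a6
    intro i i' hne v v' h1 hv hc hcp h1' hv' hc' hcp' f hf f' hf'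
    obtain ⟨β, l, m, x, t1, t2, t3, t4⟩ := hedge i v h1 hv hc hcp f hf
    obtain ⟨β', l', m', x', t1', t2', t3', t4'⟩ := hedge i' v' h1' hv' hc' hcp' f' hf'
    rw [t3, t4, t3', t4']
    exact p6 i i' hne _ _ _ _ _ _ _ _ t1 t2 t1' t2'
  · intro y b
    refine le_trans (Finset.card_le_card ?_) (p7 y b)
    intro i hi
    obtain ⟨v, hv, hc, hm, hA, f, hf, hfy⟩ := (Finset.mem_filter.mp hi).2
    obtain ⟨j, x, hj, hok, hf1, hf2⟩ := hval i v hv hc f hf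
    have hcc := hci2 i _ _ j _ _ hj (hcode i v hv hc)
    refine Finset.mem_filter.mpr ⟨Finset.mem_univ _, _, _, ?_, ?_, x, hf2.symm.trans hfy⟩
    · rw [hcc.2]; simpa using hm
    · rw [hcc.1]; exact hA
  · -- dens
    intro a b hab C hC R hR' h1 h2
    refine H.dens a b hab C hC R ?_ h1 h2
    intro y hy
    exact (Finset.mem_filter.mp (hR' hy)).2

end

end

section

set_option linter.unusedSectionVars false

theorem konig_good {N D : ℕ} (M : Fin N → Fin N → ℕ) (hr : ∀ x, ∑ y, M x y ≤ D)
    (hc : ∀ y, ∑ x, M x y ≤ D) (fk F : ℕ) (hF : D * N ≤ (∑ x, ∑ y, M x y) + F) :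
    ∃ (c : ℕ) (σ : Fin c → Equiv.Perm (Fin N)) (R : Fin c → Finset (Fin N)),
      (∀ x y, (Finset.univ.filter (fun j => x ∈ R j ∧ σ j x = y)).card ≤ M x y) ∧
      (∀ j, N ≤ (R j).card + fk) ∧ D * (fk + 1) ≤ c * (fk + 1) + F ∧ c ≤ D := by
  classical
  obtain ⟨σ, R, h⟩ := konig D M hr hc
  have hs := konig_fakes h
  let S : Finset (Fin D) := Finset.univ.filter (fun j => N ≤ (R j).card + fk)
  let e := S.equivFin.symm
  refine ⟨S.card, fun j => σ (e j).1, fun j => R (e j).1, ?_, ?_, ?_,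
    (Finset.card_le_univ _).trans (by simp)⟩
  · intro x y
    rw [← h x y]
    refine Finset.card_le_card_of_injOn (fun j => (e j).1) ?_ ?_
    · intro j hj
      have := (Finset.mem_filter.mp hj).2
      exact Finset.mem_coe.mpr (Finset.mem_filter.mpr ⟨Finset.mem_univ _, this⟩)
    · intro j _ j' _ he
      exact e.injective (Subtype.ext he)
  · intro j
    exact (Finset.mem_filter.mp (e j).2).2
  · have h1 : ∑ j, ((R j).card + (if N ≤ (R j).card + fk then 0 else fk + 1)) ≤ ∑ _j : Fin D, N := by
      apply Finset.sum_le_sum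
      intro j _
      have : (R j).card ≤ N := (Finset.card_le_univ _).trans (by simp)
      split_ifs with h2 <;> omega
    rw [Finset.sum_add_distrib, hs, Finset.sum_const, Finset.card_univ, Fintype.card_fin,
      smul_eq_mul] at h1
    have h2 : ∑ j : Fin D, (if N ≤ (R j).card + fk then 0 else fk + 1) = (D - S.card) * (fk + 1) := by
      rw [Finset.sum_ite, Finset.sum_const_zero, zero_add, Finset.sum_const, smul_eq_mul]
      congr 1
      have := Finset.card_filter_add_card_filter_not (s := (Finset.univ : Finset (Fin D)))
        (fun j => N ≤ (R j).card + fk)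
      rw [Finset.card_univ, Fintype.card_fin] at this
      simp only [S]
      omega
    rw [h2] at h1
    have h3 : S.card ≤ D := (Finset.card_le_univ _).trans (by simp)
    obtain ⟨d, hd⟩ := Nat.exists_eq_add_of_le h3
    have h4 : D - S.card = d := by omega
    rw [h4] at h1
    have : D * (fk + 1) = S.card * (fk + 1) + d * (fk + 1) := by rw [← add_mul, ← hd]
    omega

/-- A family of almost perfect matchings. -/
theorem pool {N D : ℕ} (E : Fin N → Fin N → Prop) (M : Fin N → Fin N → ℕ)
    (hM1 : ∀ x y, M x y ≤ 1) (hME : ∀ x y, M x y ≠ 0 → E x y)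
    (hr : ∀ x, ∑ y, M x y ≤ D)
    (hc : ∀ y, ∑ x, M x y ≤ D) (fk F W : ℕ) (hF : D * N ≤ (∑ x, ∑ y, M x y) + F)
    (hW : W * (fk + 1) + F ≤ D * (fk + 1)) :
    ∃ (Q : ℕ → Equiv.Perm (Fin N)) (R : ℕ → Finset (Fin N)), ∀ j < W,
      (∀ x ∈ R j, E x (Q j x)) ∧ N ≤ (R j).card + fk ∧
      ∀ j' < W, ∀ x, x ∈ R j → x ∈ R j' → Q j x = Q j' x → j = j' := by
  classical
  obtain ⟨c, σ, R, h1, h2, h3, _⟩ := konig_good M hr hc fk F hF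
  have hcW : W ≤ c := by
    have : W * (fk + 1) ≤ c * (fk + 1) := by omega
    exact Nat.le_of_mul_le_mul_right this (by omega)
  refine ⟨fun j => if h : j < c then σ ⟨j, h⟩ else 1, fun j => if h : j < c then R ⟨j, h⟩ else ∅, ?_⟩
  intro j hj
  have hj : j < c := by omega
  simp only [dif_pos hj]
  refine ⟨?_, h2 _, ?_⟩
  · intro x hx
    apply hME
    have := h1 x (σ ⟨j, hj⟩ x)
    have hp : 0 < (Finset.univ.filter (fun i => x ∈ R i ∧ σ i x = σ ⟨j, hj⟩ x)).card :=
      Finset.card_pos.mpr ⟨⟨j, hj⟩, Finset.mem_filter.mpr ⟨Finset.mem_univ _, hx, rfl⟩⟩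
    omega
  · intro j' hj' x hx hx' he
    have hj' : j' < c := by omega
    simp only [dif_pos hj'] at hx' he
    have := Finset.card_le_one.mp ((h1 x (σ ⟨j, hj⟩ x)).trans (hM1 _ _)) ⟨j, hj⟩
      (Finset.mem_filter.mpr ⟨Finset.mem_univ _, hx, rfl⟩) ⟨j', hj'⟩
      (Finset.mem_filter.mpr ⟨Finset.mem_univ _, hx', he.symm⟩)
    exact congrArg Fin.val this

/-- Symmetric system of matchings for all ordered pairs of cells. -/
theorem pools {N fk capo : ℕ} {C : Type} [Fintype C] (E : C → C → Fin N → Fin N → Prop)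
    (hE : ∀ X Y x y, E X Y x y → E Y X y x) (W : C → C → ℕ) (hWs : ∀ X Y, W X Y = W Y X)
    (hW0 : ∀ X, W X X = 0)
    (hp : ∀ X Y, 0 < W X Y → ∃ (Q : ℕ → Equiv.Perm (Fin N)) (R : ℕ → Finset (Fin N)),
      ∀ j < 2 * (W X Y * capo), (∀ x ∈ R j, E X Y x (Q j x)) ∧ N ≤ (R j).card + fk ∧
      ∀ j' < 2 * (W X Y * capo), ∀ x, x ∈ R j → x ∈ R j' → Q j x = Q j' x → j = j') :
    ∃ (Q : C → C → ℕ → Equiv.Perm (Fin N)) (Rl : C → C → ℕ → Finset (Fin N)),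
      (∀ X Y j, j < W X Y * capo → ∀ x ∈ Rl X Y j, E X Y x (Q X Y j x)) ∧
      (∀ X Y j j', j < W X Y * capo → j' < W X Y * capo → ∀ x, x ∈ Rl X Y j →
        x ∈ Rl X Y j' → Q X Y j x = Q X Y j' x → j = j') ∧
      (∀ X Y j j', j < W X Y * capo → j' < W X Y * capo → ∀ x y, x ∈ Rl X Y j →
        y ∈ Rl Y X j' → Q X Y j x = y → Q Y X j' y = x → False) ∧
      (∀ X Y j, j < W X Y * capo → N ≤ (Rl X Y j).card + fk) := by
  classical
  have hp' : ∀ X Y, ∃ (Q : ℕ → Equiv.Perm (Fin N)) (R : ℕ → Finset (Fin N)),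
      ∀ j < 2 * (W X Y * capo), (∀ x ∈ R j, E X Y x (Q j x)) ∧ N ≤ (R j).card + fk ∧
      ∀ j' < 2 * (W X Y * capo), ∀ x, x ∈ R j → x ∈ R j' → Q j x = Q j' x → j = j' := by
    intro X Y
    rcases Nat.eq_zero_or_pos (W X Y) with h | h
    · exact ⟨fun _ => 1, fun _ => ∅, fun j hj => by rw [h] at hj; omega⟩
    · exact hp X Y h
  choose Q0 R0 h0 using hp'
  let o := Fintype.equivFin C
  let Q : C → C → ℕ → Equiv.Perm (Fin N) := fun X Y j =>
    if o X < o Y then Q0 X Y j else (Q0 Y X (W X Y * capo + j))⁻¹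
  let Rl : C → C → ℕ → Finset (Fin N) := fun X Y j =>
    if o X < o Y then R0 X Y j else (R0 Y X (W X Y * capo + j)).map (Q0 Y X (W X Y * capo + j)).toEmbedding
  have cases : ∀ X Y j, j < W X Y * capo → o X < o Y ∨ o Y < o X := by
    intro X Y j hj
    rcases lt_trichotomy (o X) (o Y) with h | h | h
    · exact Or.inl h
    · have := o.injective h
      subst this
      rw [hW0] at hj; omega
    · exact Or.inr h
  have hlt : ∀ X Y, o X < o Y → (∀ j, Q X Y j = Q0 X Y j) ∧ (∀ j, Rl X Y j = R0 X Y j) := by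
    intro X Y h
    exact ⟨fun j => if_pos h, fun j => if_pos h⟩
  have hgt : ∀ X Y, o Y < o X → (∀ j, Q X Y j = (Q0 Y X (W Y X * capo + j))⁻¹) ∧
      (∀ j x, x ∈ Rl X Y j ↔ (Q0 Y X (W Y X * capo + j))⁻¹ x ∈ R0 Y X (W Y X * capo + j)) ∧
      (∀ j, (Rl X Y j).card = (R0 Y X (W Y X * capo + j)).card) := by
    intro X Y h
    refine ⟨fun j => ?_, fun j x => ?_, fun j => ?_⟩
    · simp only [Q]; rw [if_neg (not_lt.mpr h.le), hWs X Y]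
    · simp only [Rl]; rw [if_neg (not_lt.mpr h.le), hWs X Y, Finset.mem_map_equiv]; rfl
    · simp only [Rl]; rw [if_neg (not_lt.mpr h.le), hWs X Y, Finset.card_map]
  refine ⟨Q, Rl, ?_, ?_, ?_, ?_⟩
  · intro X Y j hj x hx
    rcases cases X Y j hj with h | h
    · rw [(hlt X Y h).2] at hx
      rw [(hlt X Y h).1]
      exact (h0 X Y j (by omega)).1 x hx
    · rw [(hgt X Y h).2.1] at hx
      rw [(hgt X Y h).1]
      rw [hWs] at hj
      have := (h0 Y X (W Y X * capo + j) (by omega)).1 _ hx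
      apply hE
      simpa using this
  · intro X Y j j' hj hj' x hx hx' he
    rcases cases X Y j hj with h | h
    · rw [(hlt X Y h).2] at hx hx'
      rw [(hlt X Y h).1, (hlt X Y h).1] at he
      exact (h0 X Y j (by omega)).2.2 j' (by omega) x hx hx' he
    · rw [(hgt X Y h).2.1] at hx hx'
      rw [(hgt X Y h).1, (hgt X Y h).1] at he
      rw [hWs] at hj hj'
      rw [← he] at hx'
      have := (h0 Y X (W Y X * capo + j) (by omega)).2.2 (W Y X * capo + j') (by omega) _ hx hx' (by
        conv_rhs => rw [he]
        simp)
      omega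
  · have main : ∀ X Y j j', o X < o Y → j < W X Y * capo → j' < W X Y * capo → ∀ x y,
        x ∈ Rl X Y j → y ∈ Rl Y X j' → Q X Y j x = y → Q Y X j' y = x → False := by
      intro X Y j j' h hj hj' x y hx hy h1 h2
      rw [(hlt X Y h).2] at hx
      rw [(hlt X Y h).1] at h1
      rw [(hgt Y X h).2.1] at hy
      rw [(hgt Y X h).1] at h2
      rw [h2] at hy
      have := (h0 X Y j (by omega)).2.2 (W X Y * capo + j') (by omega) x hx hy (by
        rw [h1, ← h2]; simp)
      omega
    intro X Y j j' hj hj' x y hx hy h1 h2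
    rcases cases X Y j hj with h | h
    · exact main X Y j j' h hj hj' x y hx hy h1 h2
    · exact main Y X j' j h (by rw [hWs]; exact hj') (by rw [hWs]; exact hj) y x hy hx h2 h1
  · intro X Y j hj
    rcases cases X Y j hj with h | h
    · rw [(hlt X Y h).2]
      exact (h0 X Y j (by omega)).2.1
    · rw [(hgt X Y h).2.2]
      rw [hWs] at hj
      exact (h0 Y X (W Y X * capo + j) (by omega)).2.1

/-- Classes of almost perfect matchings of the reduced graph. -/
theorem classes {k D : ℕ} (w : Fin k → Fin k → ℕ) (hr : ∀ x, ∑ y, w x y ≤ D)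
    (hc : ∀ y, ∑ x, w x y ≤ D) (fk F kb : ℕ) (hF : D * k ≤ (∑ x, ∑ y, w x y) + F)
    (hkb : kb + fk ≤ k) [NeZero kb] :
    ∃ (c : ℕ) (A : Fin c → Bool → ZMod kb → Fin k),
      (∀ c o, Function.Injective (A c o)) ∧
      (∀ c β, 0 < w (A c true β) (A c false β)) ∧
      (∀ a b (S : Finset (Fin c)), (∀ c ∈ S, ∃ β, A c true β = a ∧ A c false β = b) → S.card ≤ w a b) ∧
      D * (fk + 1) ≤ c * (fk + 1) + F ∧ c ≤ D := by
  classical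
  obtain ⟨c, σ, R, h1, h2, h3⟩ := konig_good w hr hc fk F hF
  have he : ∀ j, ∃ f : ZMod kb → Fin k, Function.Injective f ∧ ∀ β, f β ∈ R j := by
    intro j
    have : Fintype.card (ZMod kb) ≤ Fintype.card (R j) := by
      rw [ZMod.card, Fintype.card_coe]
      have := h2 j
      omega
    obtain ⟨f⟩ := Function.Embedding.nonempty_of_card_le this
    exact ⟨fun β => (f β).1, fun a b h => f.injective (Subtype.ext h), fun β => (f β).2⟩
  choose f hf1 hf2 using he
  refine ⟨c, fun j o β => if o then f j β else σ j (f j β), ?_, ?_, ?_, h3⟩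
  · intro j o
    cases o
    · intro a b h
      exact hf1 j ((σ j).injective (by simpa using h))
    · intro a b h
      exact hf1 j (by simpa using h)
  · intro j β
    simp only [if_true, Bool.false_eq_true, if_false]
    refine lt_of_lt_of_le ?_ (h1 _ _)
    exact Finset.card_pos.mpr ⟨j, Finset.mem_filter.mpr ⟨Finset.mem_univ _, hf2 j β, rfl⟩⟩
  · intro a b S hS
    refine le_trans (Finset.card_le_card ?_) (h1 a b)
    intro j hj
    obtain ⟨β, hb1, hb2⟩ := hS j hj
    simp only [if_true, Bool.false_eq_true, if_false] at hb1 hb2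
    refine Finset.mem_filter.mpr ⟨Finset.mem_univ _, ?_, ?_⟩
    · rw [← hb1]; exact hf2 j β
    · rw [← hb1]; exact hb2

end

section

set_option linter.unusedSectionVars false

open Classical in
theorem inter_sum {V : Type} (G : SimpleGraph V) (S T : Finset V) :
    ((G.interedges S T).card : ℝ) = ∑ s ∈ S, ((T.filter (fun t => G.Adj s t)).card : ℝ) := by
  rw [SimpleGraph.interedges, Rel.interedges, Finset.card_filter, Finset.sum_product]
  push_cast
  apply Finset.sum_congr rfl
  intro s _
  rw [Finset.card_filter]
  push_cast
  rfl

open Classical in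
theorem dens_mul {V : Type} (G : SimpleGraph V) (S T : Finset V) :
    ((G.edgeDensity S T : ℚ) : ℝ) * (S.card * T.card) = (G.interedges S T).card := by
  rw [SimpleGraph.edgeDensity, Rel.edgeDensity]
  push_cast
  rcases Nat.eq_zero_or_pos S.card with h | h
  · have : (G.interedges S T).card = 0 := by
      rw [Finset.card_eq_zero.mp h]; simp [SimpleGraph.interedges, Rel.interedges]
    simp [h, this]
  rcases Nat.eq_zero_or_pos T.card with h' | h'
  · have : (G.interedges S T).card = 0 := by
      rw [Finset.card_eq_zero.mp h']; simp [SimpleGraph.interedges, Rel.interedges]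
    simp [h', this]
  have h1 : (0:ℝ) < S.card := by exact_mod_cast h
  have h2 : (0:ℝ) < T.card := by exact_mod_cast h'
  exact div_mul_cancel₀ _ (by positivity)

open Classical in
/-- subpairs of uniform pairs have about the right number of edges. -/
theorem uni_sub {V : Type} {G : SimpleGraph V} {ε : ℝ} {U W S T : Finset V}
    (h : G.IsUniform ε U W) (hS : S ⊆ U) (hT : T ⊆ W) (h1 : U.card * ε ≤ S.card)
    (h2 : W.card * ε ≤ T.card) (p1 : 0 < S.card) (p2 : 0 < T.card) :
    (((G.edgeDensity U W : ℚ) : ℝ) - ε) * (S.card * T.card) <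
      ∑ s ∈ S, ((T.filter (fun t => G.Adj s t)).card : ℝ) ∧
    ∑ s ∈ S, ((T.filter (fun t => G.Adj s t)).card : ℝ) <
      (((G.edgeDensity U W : ℚ) : ℝ) + ε) * (S.card * T.card) := by
  have := h hS hT h1 h2
  rw [abs_lt] at this
  rw [← inter_sum, ← dens_mul]
  have h1 : (0:ℝ) < S.card := by exact_mod_cast p1
  have h2 : (0:ℝ) < T.card := by exact_mod_cast p2
  have h3 : (0:ℝ) < S.card * T.card := by positivity
  constructor <;> apply mul_lt_mul_of_pos_right _ h3 <;> linarith

open Classical in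
theorem uni_high {V : Type} {G : SimpleGraph V} {ε : ℝ} {U W S T : Finset V}
    (h : G.IsUniform ε U W) (hS : S ⊆ U) (hT : T ⊆ W) 
    (h2 : W.card * ε ≤ T.card) (p2 : 0 < T.card) (p1 : 0 < U.card * ε)
    (hh : ∀ s ∈ S, (((G.edgeDensity U W : ℚ) : ℝ) + ε) * T.card ≤ (T.filter (fun t => G.Adj s t)).card) :
    (S.card : ℝ) ≤ U.card * ε := by
  by_contra hc
  push Not at hc
  have hp : 0 < S.card := by
    have : (0:ℝ) < S.card := by linarith
    exact_mod_cast this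
  have h3 := (uni_sub h hS hT hc.le h2 hp p2).2
  have h4 := Finset.sum_le_sum hh
  rw [Finset.sum_const, nsmul_eq_mul] at h4
  linarith

open Classical in
theorem uni_low {V : Type} {G : SimpleGraph V} {ε : ℝ} {U W S T : Finset V}
    (h : G.IsUniform ε U W) (hS : S ⊆ U) (hT : T ⊆ W) 
    (h2 : W.card * ε ≤ T.card) (p2 : 0 < T.card) (p1 : 0 < U.card * ε)
    (hh : ∀ s ∈ S, ((T.filter (fun t => G.Adj s t)).card : ℝ) ≤ (((G.edgeDensity U W : ℚ) : ℝ) - ε) * T.card ) :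
    (S.card : ℝ) ≤ U.card * ε := by
  by_contra hc
  push Not at hc
  have hp : 0 < S.card := by
    have : (0:ℝ) < S.card := by linarith
    exact_mod_cast this
  have h3 := (uni_sub h hS hT hc.le h2 hp p2).1
  have h4 := Finset.sum_le_sum hh
  rw [Finset.sum_const, nsmul_eq_mul] at h4
  linarith

open Classical in
theorem pool_pair {V : Type} {G : SimpleGraph V} {ε : ℝ} {U W : Finset V} {N : ℕ}
    (hN : 0 < N) (hε : 0 < ε)
    (h : G.IsUniform ε U W) (X Y : Fin N → V) (hX : Function.Injective X)
    (hY : Function.Injective Y) (hXU : ∀ x, X x ∈ U) (hYW : ∀ y, Y y ∈ W) (u : ℝ)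
    (hU : (U.card : ℝ) ≤ u) (hW : (W.card : ℝ) ≤ u) (hu : ε * u ≤ N) (fk m : ℕ)
    (hnum : (m : ℝ) * (fk + 1) + (2 * ε * N * N + N + 2 * (ε * u) * N) ≤
      ((G.edgeDensity U W : ℚ) : ℝ) * N * (fk + 1)) :
    ∃ (Q : ℕ → Equiv.Perm (Fin N)) (R : ℕ → Finset (Fin N)), ∀ j < m,
      (∀ x ∈ R j, G.Adj (X x) (Y (Q j x))) ∧ N ≤ (R j).card + fk ∧
      ∀ j' < m, ∀ x, x ∈ R j → x ∈ R j' → Q j x = Q j' x → j = j' := by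
  set d : ℝ := ((G.edgeDensity U W : ℚ) : ℝ) with hd
  have hd0 : 0 ≤ d := by rw [hd]; exact_mod_cast G.edgeDensity_nonneg U W
  have hds : ((G.edgeDensity W U : ℚ) : ℝ) = d := by rw [G.edgeDensity_comm]
  let SX := Finset.univ.image X
  let SY := Finset.univ.image Y
  have cX : SX.card = N := by simp [SX, Finset.card_image_of_injective _ hX]
  have cY : SY.card = N := by simp [SY, Finset.card_image_of_injective _ hY]
  have sX : SX ⊆ U := by
    intro v hv; obtain ⟨x, _, rfl⟩ := Finset.mem_image.mp hv; exact hXU x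
  have sY : SY ⊆ W := by
    intro v hv; obtain ⟨x, _, rfl⟩ := Finset.mem_image.mp hv; exact hYW x
  have dX : ∀ v, (SX.filter (fun t => G.Adj v t)).card =
      (Finset.univ.filter (fun x => G.Adj (X x) v)).card := by
    intro v
    simp only [SX]
    rw [Finset.filter_image, Finset.card_image_of_injective _ hX]
    simp only [G.adj_comm]
  have dY : ∀ v, (SY.filter (fun t => G.Adj v t)).card =
      (Finset.univ.filter (fun y => G.Adj v (Y y))).card := by
    intro v
    simp only [SY]
    rw [Finset.filter_image, Finset.card_image_of_injective _ hY]
  have hNr : (0:ℝ) < N := by exact_mod_cast hN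
  have uU : (U.card : ℝ) * ε ≤ N := by nlinarith
  have uW : (W.card : ℝ) * ε ≤ N := by nlinarith
  have pU : 0 < (U.card : ℝ) * ε := by
    have : N ≤ U.card := cX ▸ Finset.card_le_card sX
    have : (N:ℝ) ≤ U.card := by exact_mod_cast this
    have : (0:ℝ) < U.card := by linarith
    positivity
  have pW : 0 < (W.card : ℝ) * ε := by
    have : N ≤ W.card := cY ▸ Finset.card_le_card sY
    have : (N:ℝ) ≤ W.card := by exact_mod_cast this
    have : (0:ℝ) < W.card := by linarith
    positivity
  let D := ⌈(d + ε) * N⌉₊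
  let eX : Finset (Fin N) := Finset.univ.filter (fun x => D < (Finset.univ.filter (fun y => G.Adj (X x) (Y y))).card)
  let eY : Finset (Fin N) := Finset.univ.filter (fun y => D < (Finset.univ.filter (fun x => G.Adj (X x) (Y y))).card)
  have cEX : (eX.card : ℝ) ≤ ε * u := by
    have := uni_high (S := eX.image X) (T := SY) h (by
      intro v hv; obtain ⟨x, _, rfl⟩ := Finset.mem_image.mp hv; exact hXU x) sY (by rw [cY]; exact uW)
      (by omega) pU (by
        intro s hs
        obtain ⟨x, hx, rfl⟩ := Finset.mem_image.mp hs
        have hx := (Finset.mem_filter.mp hx).2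
        rw [dY, cY]
        refine (Nat.le_ceil _).trans ?_
        exact_mod_cast hx.le)
    rw [Finset.card_image_of_injective _ hX] at this
    nlinarith
  have cEY : (eY.card : ℝ) ≤ ε * u := by
    have := uni_high (S := eY.image Y) (T := SX) h.symm (by
      intro v hv; obtain ⟨x, _, rfl⟩ := Finset.mem_image.mp hv; exact hYW x) sX (by rw [cX]; exact uU)
      (by omega) pW (by
        intro s hs
        obtain ⟨x, hx, rfl⟩ := Finset.mem_image.mp hs
        have hx := (Finset.mem_filter.mp hx).2
        rw [dX, cX, hds]
        refine (Nat.le_ceil _).trans ?_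
        exact_mod_cast hx.le)
    rw [Finset.card_image_of_injective _ hY] at this
    nlinarith
  let M : Fin N → Fin N → ℕ := fun x y => if G.Adj (X x) (Y y) ∧ x ∉ eX ∧ y ∉ eY then 1 else 0
  have tot : (d - ε) * (N * N) ≤ ∑ x, ∑ y, (if G.Adj (X x) (Y y) then (1:ℝ) else 0) := by
    have := (uni_sub h sX sY (by rw [cX]; exact uU) (by rw [cY]; exact uW) (by omega) (by omega)).1
    rw [cX, cY] at this
    refine this.le.trans (le_of_eq ?_)
    simp only [SX]
    rw [Finset.sum_image (fun a _ b _ hab => hX hab)]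
    apply Finset.sum_congr rfl
    intro x _
    rw [dY, Finset.card_filter]
    push_cast
    rfl
  have totM : (d - ε) * (N * N) ≤ (∑ x, ∑ y, (M x y : ℝ)) + 2 * (ε * u) * N := by
    refine tot.trans ?_
    have h1 : ∑ x, ∑ y, (if G.Adj (X x) (Y y) then (1:ℝ) else 0) ≤
        ∑ x, ∑ y, ((M x y : ℝ) + (if x ∈ eX then 1 else 0) + (if y ∈ eY then 1 else 0)) := by
      apply Finset.sum_le_sum; intro x _
      apply Finset.sum_le_sum; intro y _
      simp only [M]
      by_cases a : G.Adj (X x) (Y y) <;> by_cases b : x ∈ eX <;> by_cases c : y ∈ eY <;> simp [a, b, c]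
    refine h1.trans ?_
    simp only [Finset.sum_add_distrib]
    have h2 : ∑ x : Fin N, ∑ _y : Fin N, (if x ∈ eX then (1:ℝ) else 0) = eX.card * N := by
      simp [Finset.sum_const, mul_comm]
    have h3 : ∑ _x : Fin N, ∑ y : Fin N, (if y ∈ eY then (1:ℝ) else 0) = eY.card * N := by
      simp [Finset.sum_const, mul_comm]
    rw [h2, h3]
    nlinarith
  have hD1 : (D : ℝ) ≤ (d + ε) * N + 1 := (Nat.ceil_lt_add_one (by positivity)).le
  have hD2 : d * N ≤ D := by
    have := Nat.le_ceil ((d + ε) * N)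
    have h2 : 0 ≤ ε * N := by positivity
    have : (d + ε) * N ≤ D := this
    linarith
  refine pool (fun x y => G.Adj (X x) (Y y)) M (D := D) ?_ ?_ ?_ ?_ fk
    (D * N - ∑ x, ∑ y, M x y) m (by omega) ?_
  · intro x y; simp only [M]; split_ifs <;> omega
  · intro x y hxy
    simp only [M] at hxy
    by_contra hc
    simp [hc] at hxy
  · intro x
    by_cases hx : x ∈ eX
    · simp [M, hx]
    · have : ¬ D < (Finset.univ.filter (fun y => G.Adj (X x) (Y y))).card := fun h' =>
        hx (Finset.mem_filter.mpr ⟨Finset.mem_univ _, h'⟩)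
      rw [Finset.card_filter] at this
      refine le_trans (Finset.sum_le_sum ?_) (not_lt.mp this)
      intro y _
      simp only [M]
      by_cases a : G.Adj (X x) (Y y) <;> simp [a]
      split_ifs <;> omega
  · intro y
    by_cases hx : y ∈ eY
    · simp [M, hx]
    · have : ¬ D < (Finset.univ.filter (fun x => G.Adj (X x) (Y y))).card := fun h' =>
        hx (Finset.mem_filter.mpr ⟨Finset.mem_univ _, h'⟩)
      rw [Finset.card_filter] at this
      refine le_trans (Finset.sum_le_sum ?_) (not_lt.mp this)
      intro x _
      simp only [M]
      by_cases a : G.Adj (X x) (Y y) <;> simp [a]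
      split_ifs <;> omega
  · have hle : (m : ℝ) * (fk + 1) + (D * N - ∑ x, ∑ y, (M x y : ℝ)) ≤ D * (fk + 1) := by
      have e1 : d * N * (fk + 1) ≤ D * (fk + 1) := mul_le_mul_of_nonneg_right hD2 (by positivity)
      have e2 : (D:ℝ) * N ≤ ((d + ε) * N + 1) * N := mul_le_mul_of_nonneg_right hD1 hNr.le
      nlinarith
    by_cases hs : D * N ≤ ∑ x, ∑ y, M x y
    · rw [Nat.sub_eq_zero_of_le hs, add_zero]
      have e1 : d * N * (fk + 1) ≤ D * (fk + 1) := mul_le_mul_of_nonneg_right hD2 (by positivity)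
      have e3 : 0 ≤ 2 * (ε * u) * N := by
        have : 0 ≤ u := (Nat.cast_nonneg _).trans hU
        positivity
      have : (m : ℝ) * (fk + 1) ≤ D * (fk + 1) := by
        have : 0 ≤ 2 * ε * N * N + N := by positivity
        linarith
      exact_mod_cast this
    · have hs' := (not_le.mp hs).le
      have : ((m * (fk + 1) + (D * N - ∑ x, ∑ y, M x y) : ℕ) : ℝ) ≤ ((D * (fk + 1) : ℕ) : ℝ) := by
        push_cast [Nat.cast_sub hs']
        exact hle
      exact_mod_cast this

end

section

set_option linter.unusedSectionVars false

set_option maxHeartbeats 1000000 in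
open Classical in
theorem host_of {V Λ 𝒞 𝔹 : Type} [Fintype 𝒞] [Fintype Λ] {G' G : SimpleGraph V} (hG : G' ≤ G) {k : ℕ}
    (Pt : Fin k → Finset V) (hPd : ∀ a b v, v ∈ Pt a → v ∈ Pt b → a = b)
    (m0 : ℕ) (u ε d0 : ℝ) (hε : 0 < ε) (hm0 : ∀ a, m0 ≤ (Pt a).card)
    (hu : ∀ a, ((Pt a).card : ℝ) ≤ u)
    (w : Fin k → Fin k → ℕ) (wsym : ∀ a b, w a b = w b a) (wdiag : ∀ a, w a a = 0)
    (hw : ∀ a b, 0 < w a b → G'.IsUniform ε (Pt a) (Pt b) ∧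
      (w a b : ℝ) * d0 ≤ ((G'.edgeDensity (Pt a) (Pt b) : ℚ) : ℝ))
    (A : 𝒞 → Bool → 𝔹 → Fin k) (hA1 : ∀ c o, Function.Injective (A c o))
    (hA2 : ∀ c β, 0 < w (A c true β) (A c false β))
    (hA3 : ∀ a b (S : Finset 𝒞), (∀ c ∈ S, ∃ β, A c true β = a ∧ A c false β = b) → S.card ≤ w a b)
    (N z capo fk ty0 t0 q : ℕ) (hN : 0 < N) (hz : 0 < z) (ht0 : 0 < t0)
    (hm : Fintype.card Λ * N + z ≤ m0)
    (n1 : ε * u ≤ N) (n2 : ε * u ≤ z) (n3 : ε * u ≤ fk) (n4 : ε * u ≤ t0)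
    (n5 : (ty0 : ℝ) ≤ (d0 - ε) * z) (n6 : 1 ≤ (d0 - ε) * q)
    (n7 : 2 * (capo : ℝ) * (fk + 1) + (2 * ε * N * N + N + 2 * (ε * u) * N) ≤ d0 * N * (fk + 1)) :
    ∃ vx Z Q Rl, Host (κ := Fin k) (Λ := Λ) G N capo fk ty0 t0 q vx Z w A Q Rl := by
  have hemb : ∀ a, ∃ f : Λ × Fin N → V, Function.Injective f ∧ ∀ x, f x ∈ Pt a := by
    intro a
    have : Fintype.card (Λ × Fin N) ≤ Fintype.card (Pt a) := by
      rw [Fintype.card_prod, Fintype.card_fin, Fintype.card_coe]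
      have := hm0 a
      omega
    obtain ⟨f⟩ := Function.Embedding.nonempty_of_card_le this
    exact ⟨fun x => (f x).1, fun x y h => f.injective (Subtype.ext h), fun x => (f x).2⟩
  choose f hf1 hf2 using hemb
  let vx : Fin k × Λ → Fin N → V := fun X x => f X.1 (X.2, x)
  let Z : Fin k → Finset V := fun b => Pt b \ Finset.univ.image (f b)
  have hZs : ∀ b, Z b ⊆ Pt b := fun b => Finset.sdiff_subset
  have hZc : ∀ b, z ≤ (Z b).card := by
    intro b
    have h1 := Finset.le_card_sdiff (Finset.univ.image (f b)) (Pt b)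
    have h2 : (Finset.univ.image (f b)).card = Fintype.card Λ * N := by
      rw [Finset.card_image_of_injective _ (hf1 b)]; simp
    have := hm0 b
    simp only [Z]
    omega
  have vin : ∀ X x, vx X x ∈ Pt X.1 := fun X x => hf2 _ _
  have wpos : ∀ a b, 0 < w a b → (1:ℝ) ≤ w a b := fun a b h => by exact_mod_cast h
  have hu0 : ∀ a b, 0 < w a b → 0 ≤ u := fun a b _ => (Nat.cast_nonneg _).trans (hu a)
  have hz' : (0:ℝ) < z := by exact_mod_cast hz
  have hd0 : 0 < d0 - ε := by
    by_contra h
    push Not at h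
    have : (d0 - ε) * q ≤ 0 := mul_nonpos_of_nonpos_of_nonneg h (by positivity)
    linarith
  have dge : ∀ a b, 0 < w a b → d0 ≤ ((G'.edgeDensity (Pt a) (Pt b) : ℚ) : ℝ) := by
    intro a b h
    have := (hw a b h).2
    have := wpos a b h
    nlinarith
  obtain ⟨Q, Rl, q1, q2, q3, q4⟩ := pools (N := N) (fk := fk) (capo := capo)
    (fun (X Y : Fin k × Λ) x y => G'.Adj (vx X x) (vx Y y)) (fun X Y x y h => h.symm)
    (fun X Y => w X.1 Y.1) (fun X Y => wsym _ _) (fun X => wdiag _) (by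
      intro X Y hpos
      refine pool_pair hN hε (hw _ _ hpos).1 (vx X) (vx Y) ?_ ?_ (vin X) (vin Y) u (hu _) (hu _) n1 fk _ ?_
      · intro x y h
        have := hf1 _ h
        simpa using this
      · intro x y h
        have := hf1 _ h
        simpa using this
      · have h1 := (hw _ _ hpos).2
        have h2 := wpos _ _ hpos
        have h3 := hu0 _ _ hpos
        push_cast
        have h4 : (w X.1 Y.1 : ℝ) * (2 * (capo : ℝ) * (fk + 1) + (2 * ε * N * N + N + 2 * (ε * u) * N)) ≤
            (w X.1 Y.1 : ℝ) * (d0 * N * (fk + 1)) := mul_le_mul_of_nonneg_left n7 (by positivity)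
        have h5 : (0:ℝ) ≤ 2 * ε * N * N + N + 2 * (ε * u) * N := by positivity
        have h6 : (w X.1 Y.1 : ℝ) * d0 * (N * (fk + 1)) ≤
          ((G'.edgeDensity (Pt X.1) (Pt Y.1) : ℚ) : ℝ) * (N * (fk + 1)) :=
          mul_le_mul_of_nonneg_right h1 (by positivity)
        nlinarith)
  refine ⟨vx, Z, Q, Rl, ?_⟩
  constructor
  · intro X x X' x' h
    have h1 : X.1 = X'.1 := hPd _ _ _ (vin X x) (h ▸ vin X' x')
    obtain ⟨a, l⟩ := X
    obtain ⟨a', l'⟩ := X'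
    simp only at h1
    subst h1
    have := hf1 _ h
    simp only [Prod.mk.injEq] at this
    exact ⟨by rw [this.1], this.2⟩
  · intro b b' y h h'
    exact hPd _ _ _ (hZs _ h) (hZs _ h')
  · intro X x b h
    have h1 : X.1 = b := hPd _ _ _ (vin X x) (hZs _ h)
    subst h1
    exact (Finset.mem_sdiff.mp h).2 (Finset.mem_image.mpr ⟨_, Finset.mem_univ _, rfl⟩)
  · exact wsym
  · exact wdiag
  · exact hA1
  · exact hA2
  · intro a b
    apply hA3
    intro c hc
    exact (Finset.mem_filter.mp hc).2
  · intro X Y j hj x hx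
    exact hG (q1 X Y j hj x hx)
  · exact q2
  · exact q3
  · exact q4
  · intro a b l hpos
    have hun := (hw a b hpos).1
    let S : Finset (Fin N) := (Finset.univ.filter (fun x =>
      ((Z b).filter (fun z => G.Adj (vx (a, l) x) z)).card < ty0))
    have hinj : Function.Injective (vx (a, l)) := by
      intro x y h
      have := hf1 _ h
      simpa using this
    have h0 : 0 < (Pt a).card := by have := hm0 a; omega
    have := uni_low (S := S.image (vx (a, l))) (T := Z b) hun (by
      intro v hv; obtain ⟨x, _, rfl⟩ := Finset.mem_image.mp hv; exact vin _ x) (hZs b) (by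
        have h1 := hu b
        have h2 : (z:ℝ) ≤ (Z b).card := by exact_mod_cast hZc b
        nlinarith) (lt_of_lt_of_le hz (hZc b)) (by positivity) (by
        intro s hs
        obtain ⟨x, hx, rfl⟩ := Finset.mem_image.mp hs
        have hx := (Finset.mem_filter.mp hx).2
        have h1 : ((Z b).filter (fun z => G'.Adj (vx (a, l) x) z)).card ≤ ty0 :=
          (Finset.card_le_card (Finset.monotone_filter_right _ (fun v _ hv => hG hv))).trans hx.le
        have h1 : (((Z b).filter (fun z => G'.Adj (vx (a, l) x) z)).card : ℝ) ≤ ty0 := by exact_mod_cast h1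
        have h2 : (z:ℝ) ≤ (Z b).card := by exact_mod_cast hZc b
        have h3 := dge a b hpos
        have h4 : (d0 - ε) * z ≤ (((G'.edgeDensity (Pt a) (Pt b) : ℚ) : ℝ) - ε) * (Z b).card :=
          mul_le_mul (by linarith) h2 hz'.le (by linarith)
        linarith)
    rw [Finset.card_image_of_injective _ hinj] at this
    have h1 := hu a
    have : (S.card : ℝ) ≤ fk := by nlinarith
    exact_mod_cast this
  · intro a b hpos C hC R hR hCt hRt
    have hun := (hw a b hpos).1
    have hC1 : (t0:ℝ) ≤ C.card := by exact_mod_cast hCt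
    have hR1 : (t0:ℝ) ≤ R.card := by exact_mod_cast hRt
    have := (uni_sub (S := C) (T := R) hun.symm (hC.trans (hZs b)) (by
      intro y hy
      obtain ⟨l, x, rfl⟩ := hR y hy
      exact vin (a, l) x) (by have := hu b; nlinarith) (by have := hu a; nlinarith) (by omega) (by omega)).1
    rw [G'.edgeDensity_comm] at this
    have h3 := dge a b hpos
    have h4 : ∑ s ∈ C, ((R.filter (fun t => G'.Adj s t)).card : ℝ) ≤
        ∑ s ∈ C, ((R.filter (fun t => G.Adj t s)).card : ℝ) := by
      apply Finset.sum_le_sum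
      intro s _
      have : (R.filter (fun t => G'.Adj s t)).card ≤ (R.filter (fun t => G.Adj t s)).card :=
        Finset.card_le_card (Finset.monotone_filter_right _ (fun v _ hv => (hG hv).symm))
      exact_mod_cast this
    have h5 : (d0 - ε) * (C.card * R.card) ≤
      (((G'.edgeDensity (Pt a) (Pt b) : ℚ) : ℝ) - ε) * (C.card * R.card) :=
      mul_le_mul_of_nonneg_right (by linarith) (by positivity)
    have h6 : (C.card : ℝ) * R.card ≤ q * ∑ s ∈ C, ((R.filter (fun t => G.Adj t s)).card : ℝ) := by
      have e1 : (d0 - ε) * (C.card * R.card) ≤ ∑ s ∈ C, ((R.filter (fun t => G.Adj t s)).card : ℝ) := by linarith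
      have e2 : (q:ℝ) * ((d0 - ε) * (C.card * R.card)) ≤ q * ∑ s ∈ C, ((R.filter (fun t => G.Adj t s)).card : ℝ) :=
        mul_le_mul_of_nonneg_left e1 (by positivity)
      have e3 : 1 * ((C.card : ℝ) * R.card) ≤ ((d0 - ε) * q) * (C.card * R.card) :=
        mul_le_mul_of_nonneg_right n6 (by positivity)
      linarith
    exact_mod_cast h6

end

section

set_option linter.unusedSectionVars false

open Classical in
noncomputable def dg {V : Type} [Fintype V] (G : SimpleGraph V) (v : V) : ℕ :=
  (Finset.univ.filter (fun u => G.Adj v u)).card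

open Classical in
theorem trim {n : ℕ} (G : SimpleGraph (Fin n)) (α ξ : ℝ) (hξ : 0 ≤ ξ) (h2 : 2 * ξ ≤ α) (h1 : α ≤ 1)
    (B : Finset (Fin n)) (hB : (B.card : ℝ) ≤ ξ * n)
    (hb : ∀ v, v ∉ B → (α - ξ) * n ≤ dg G v ∧ (dg G v : ℝ) ≤ (α + ξ) * n) :
    ∃ G' ≤ G, (∀ v, (dg G' v : ℝ) ≤ (α + ξ) * n) ∧ (α - 3 * ξ) * (n * n) ≤ ∑ v, (dg G' v : ℝ) := by
  obtain ⟨G', hG'⟩ : ∃ G' : SimpleGraph (Fin n), ∀ u v, G'.Adj u v ↔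
      (G.Adj u v ∧ (dg G u : ℝ) ≤ (α + ξ) * n ∧ (dg G v : ℝ) ≤ (α + ξ) * n) :=
    ⟨{ Adj := fun u v => G.Adj u v ∧ (dg G u : ℝ) ≤ (α + ξ) * n ∧ (dg G v : ℝ) ≤ (α + ξ) * n
       symm := ⟨fun u v h => ⟨h.1.symm, h.2.2, h.2.1⟩⟩
       loopless := ⟨fun v h => G.loopless.irrefl v h.1⟩ }, fun _ _ => Iff.rfl⟩
  refine ⟨G', fun u v h => ((hG' u v).mp h).1, ?_, ?_⟩
  · intro v
    by_cases hv : (dg G v : ℝ) ≤ (α + ξ) * n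
    · refine le_trans ?_ hv
      have : dg G' v ≤ dg G v := Finset.card_le_card (Finset.monotone_filter_right _ (fun u _ h => ((hG' v u).mp h).1))
      exact_mod_cast this
    · have : dg G' v = 0 := by
        unfold dg
        rw [Finset.card_eq_zero, Finset.filter_eq_empty_iff]
        intro u _ h
        exact hv ((hG' v u).mp h).2.1
      rw [this]
      simp only [Nat.cast_zero]
      have : 0 ≤ α := by linarith
      positivity
  · have hn : (0:ℝ) ≤ n := Nat.cast_nonneg n
    have key : ∀ v, v ∉ B → (α - 2 * ξ) * n ≤ dg G' v := by
      intro v hv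
      have hs : (Finset.univ.filter (fun u => G.Adj v u)) ⊆ (Finset.univ.filter (fun u => G'.Adj v u)) ∪ B := by
        intro u hu
        have hu := (Finset.mem_filter.mp hu).2
        by_cases hub : u ∈ B
        · exact Finset.mem_union_right _ hub
        · exact Finset.mem_union_left _ (Finset.mem_filter.mpr ⟨Finset.mem_univ _, (hG' v u).mpr ⟨hu, (hb v hv).2, (hb u hub).2⟩⟩)
      have h3 : dg G v ≤ dg G' v + B.card := (Finset.card_le_card hs).trans (Finset.card_union_le _ _)
      have h3 : (dg G v : ℝ) ≤ dg G' v + B.card := by exact_mod_cast h3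
      have := (hb v hv).1
      linarith
    have h3 : ∑ v ∈ Bᶜ, (α - 2 * ξ) * (n:ℝ) ≤ ∑ v ∈ Bᶜ, (dg G' v : ℝ) :=
      Finset.sum_le_sum (fun v hv => key v (Finset.mem_compl.mp hv))
    have h4 : ∑ v ∈ Bᶜ, (dg G' v : ℝ) ≤ ∑ v, (dg G' v : ℝ) :=
      Finset.sum_le_sum_of_subset_of_nonneg (Finset.subset_univ _) (fun _ _ _ => Nat.cast_nonneg _)
    rw [Finset.sum_const, nsmul_eq_mul] at h3
    have h5 : ((Bᶜ.card : ℕ) : ℝ) = n - B.card := by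
      rw [Finset.card_compl, Fintype.card_fin, Nat.cast_sub]
      exact (Finset.card_le_univ _).trans (by simp)
    rw [h5] at h3
    have h6 : (1 - ξ) * n * ((α - 2 * ξ) * n) ≤ (n - B.card) * ((α - 2 * ξ) * n) :=
      mul_le_mul_of_nonneg_right (by linarith) (mul_nonneg (by linarith) hn)
    have h7 : (α - 3 * ξ) * (n * n) ≤ (1 - ξ) * n * ((α - 2 * ξ) * n) := by
      have : (1 - ξ) * n * ((α - 2 * ξ) * n) - (α - 3 * ξ) * (n * n) = (ξ * (1 - α) + 2 * ξ * ξ) * (n * n) := by ring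
      have h8 : 0 ≤ (ξ * (1 - α) + 2 * ξ * ξ) * (n * n) := by
        apply mul_nonneg _ (by positivity)
        have : 0 ≤ ξ * (1 - α) := mul_nonneg hξ (by linarith)
        positivity
      linarith
    linarith

open Classical in
/-- double counting in a partition -/
theorem part_sum {V : Type} [Fintype V] (G : SimpleGraph V) {k : ℕ} (Pt : Fin k → Finset V)
    (hPd : ∀ a b v, v ∈ Pt a → v ∈ Pt b → a = b) (hPc : ∀ v, ∃ a, v ∈ Pt a) (S : Finset V) :
    ∑ b, ((G.edgeDensity S (Pt b) : ℚ) : ℝ) * (S.card * (Pt b).card) = ∑ v ∈ S, (dg G v : ℝ) := by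
  simp_rw [dens_mul, inter_sum]
  rw [Finset.sum_comm]
  apply Finset.sum_congr rfl
  intro v _
  have : dg G v = ∑ b, ((Pt b).filter (fun t => G.Adj v t)).card := by
    unfold dg
    rw [← Finset.card_biUnion]
    · congr 1
      ext t
      simp only [Finset.mem_filter, Finset.mem_univ, true_and, Finset.mem_biUnion]
      constructor
      · intro h
        obtain ⟨a, ha⟩ := hPc t
        exact ⟨a, ha, h⟩
      · rintro ⟨a, _, h⟩; exact h
    · intro a _ b _ hab
      rw [Function.onFun, Finset.disjoint_left]
      intro v h1 h2
      exact hab (hPd a b v (Finset.mem_filter.mp h1).1 (Finset.mem_filter.mp h2).1)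
  rw [this]
  push_cast
  rfl

open Classical in
/-- Weighted reduced graph. -/
theorem weights {n : ℕ} (G : SimpleGraph (Fin n)) {k : ℕ} (Pt : Fin k → Finset (Fin n))
    (hPd : ∀ a b v, v ∈ Pt a → v ∈ Pt b → a = b) (hPc : ∀ v, ∃ a, v ∈ Pt a)
    (m0 : ℕ) (hs : ∀ a, m0 ≤ (Pt a).card ∧ (Pt a).card ≤ m0 + 1)
    (α ξ ε d0 : ℝ) (hξ : 0 < ξ) (hα : 3 * ξ ≤ α) (hα1 : α ≤ 1) (hd0 : 0 < d0)
    (hξd : ξ ≤ d0) (hεd : ε ≤ d0) (hkd : 1 ≤ d0 * k) (hm0 : 1 ≤ ξ * m0)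
    (hn1 : k * m0 ≤ n) (hn2 : n ≤ k * (m0 + 1))
    (hdeg : ∀ v, (dg G v : ℝ) ≤ (α + ξ) * n) (htot : (α - 3 * ξ) * (n * n) ≤ ∑ v, (dg G v : ℝ))
    (NU : Finset (Fin k × Fin k)) (hNU : (NU.card : ℝ) ≤ ε * (k * k))
    (hNU2 : ∀ a b, a ≠ b → (a, b) ∉ NU → G.IsUniform ε (Pt a) (Pt b)) :
    ∃ (w : Fin k → Fin k → ℕ) (D0 : ℕ), (∀ a b, w a b = w b a) ∧ (∀ a, w a a = 0) ∧
      (∀ a b, 0 < w a b → G.IsUniform ε (Pt a) (Pt b) ∧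
        (w a b : ℝ) * d0 ≤ ((G.edgeDensity (Pt a) (Pt b) : ℚ) : ℝ)) ∧
      (∀ a, ∑ b, w a b ≤ D0) ∧ D0 * k ≤ (∑ a, ∑ b, w a b) + 11 * (k * k) ∧
      (D0 : ℝ) * d0 ≤ (α + 3 * ξ) * k ∧ (α + 3 * ξ) * k ≤ ((D0 : ℝ) + 1) * d0 := by
  let d : Fin k → Fin k → ℝ := fun a b => ((G.edgeDensity (Pt a) (Pt b) : ℚ) : ℝ)
  have d0' : ∀ a b, 0 ≤ d a b := fun a b => by
    simp only [d]; exact_mod_cast G.edgeDensity_nonneg _ _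
  have d1 : ∀ a b, d a b ≤ 1 := fun a b => by
    simp only [d]; exact_mod_cast G.edgeDensity_le_one _ _
  have ds : ∀ a b, d a b = d b a := fun a b => by simp only [d]; rw [G.edgeDensity_comm]
  let w : Fin k → Fin k → ℕ := fun a b => if a ≠ b ∧ G.IsUniform ε (Pt a) (Pt b) then ⌊d a b / d0⌋₊ else 0
  have hm0p : (0:ℝ) < m0 := by
    by_contra h
    push Not at h
    have : ξ * m0 ≤ 0 := mul_nonpos_of_nonneg_of_nonpos hξ.le h
    linarith
  have wle : ∀ a b, (w a b : ℝ) * d0 ≤ d a b := by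
    intro a b
    simp only [w]
    split_ifs
    · have := Nat.floor_le (div_nonneg (d0' a b) hd0.le)
      rw [le_div_iff₀ hd0] at this
      exact this
    · simpa using d0' a b
  have wge : ∀ a b, d a b ≤ (w a b : ℝ) * d0 + d0 + (if a = b then 1 else 0) + (if (a, b) ∈ NU then 1 else 0) := by
    intro a b
    have h1 := d1 a b
    have h2 : 0 ≤ (w a b : ℝ) * d0 := by positivity
    by_cases h : a = b
    · simp only [h, if_true]; rw [h] at h1 h2
      split_ifs <;> linarith
    by_cases h' : (a, b) ∈ NU
    · simp only [h, h', if_true, if_false]; linarith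
    · simp only [h, h', if_false]
      have : w a b = ⌊d a b / d0⌋₊ := if_pos ⟨h, hNU2 a b h h'⟩
      rw [this]
      have := (Nat.lt_floor_add_one (d a b / d0)).le
      rw [div_le_iff₀ hd0] at this
      linarith
  have hn1' : (k:ℝ) * m0 ≤ n := by exact_mod_cast hn1
  have hn2' : (n:ℝ) ≤ k * (m0 + 1) := by exact_mod_cast hn2
  have hs1 : ∀ a, (m0:ℝ) ≤ (Pt a).card := fun a => by exact_mod_cast (hs a).1
  have hs2 : ∀ a, ((Pt a).card:ℝ) ≤ m0 + 1 := fun a => by exact_mod_cast (hs a).2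
  have hk0 : (0:ℝ) ≤ k := Nat.cast_nonneg k
  have hα0 : 0 < α := by linarith
  -- rows
  have row : ∀ a, ∑ b, d a b ≤ (α + 3 * ξ) * k := by
    intro a
    have h1 := part_sum G Pt hPd hPc (Pt a)
    have hpa : (0:ℝ) < (Pt a).card := lt_of_lt_of_le hm0p (hs1 a)
    have h2 : ∑ v ∈ Pt a, (dg G v : ℝ) ≤ (Pt a).card * ((α + ξ) * n) := by
      have := Finset.sum_le_sum (s := Pt a) (fun v _ => hdeg v)
      rwa [Finset.sum_const, nsmul_eq_mul] at this
    have h3 : (∑ b, d a b) * ((Pt a).card * m0) ≤ ∑ b, d a b * ((Pt a).card * (Pt b).card) := by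
      rw [Finset.sum_mul]
      apply Finset.sum_le_sum
      intro b _
      exact mul_le_mul_of_nonneg_left (mul_le_mul_of_nonneg_left (hs1 b) hpa.le) (d0' a b)
    have h4 : (∑ b, d a b) * m0 ≤ (α + ξ) * n := by
      have : (Pt a).card * ((∑ b, d a b) * m0) ≤ (Pt a).card * ((α + ξ) * n) := by
        calc _ = (∑ b, d a b) * ((Pt a).card * m0) := by ring
          _ ≤ _ := h3.trans (h1.le.trans h2)
      exact le_of_mul_le_mul_left this hpa
    have h5 : (α + ξ) * n ≤ ((α + 3 * ξ) * k) * m0 := by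
      have e1 : (α + ξ) * n ≤ (α + ξ) * (k * (m0 + 1)) := mul_le_mul_of_nonneg_left hn2' (by linarith)
      have e2 : (α + ξ) * k ≤ 2 * ξ * m0 * k := by
        apply mul_le_mul_of_nonneg_right _ hk0
        linarith
      nlinarith
    exact le_of_mul_le_mul_right (h4.trans h5) hm0p
  have tot : (α - 5 * ξ) * (k * k) ≤ ∑ a, ∑ b, d a b := by
    have h1 : ∑ a, ∑ v ∈ Pt a, (dg G v : ℝ) = ∑ v, (dg G v : ℝ) := by
      rw [← Finset.sum_biUnion]
      · apply Finset.sum_congr _ (fun _ _ => rfl)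
        ext v; simpa using hPc v
      · intro a _ b _ hab
        rw [Function.onFun, Finset.disjoint_left]
        intro v h1 h2
        exact hab (hPd a b v h1 h2)
    have h2 : ∑ v, (dg G v : ℝ) ≤ (∑ a, ∑ b, d a b) * ((m0 + 1) * (m0 + 1)) := by
      rw [← h1, Finset.sum_mul]
      apply Finset.sum_le_sum
      intro a _
      rw [← part_sum G Pt hPd hPc (Pt a), Finset.sum_mul]
      apply Finset.sum_le_sum
      intro b _
      apply mul_le_mul_of_nonneg_left _ (d0' a b)
      exact mul_le_mul (hs2 a) (hs2 b) (Nat.cast_nonneg _) (by positivity)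
    have h3 : (α - 3 * ξ) * ((k * m0) * (k * m0)) ≤ (α - 3 * ξ) * (n * n) := by
      apply mul_le_mul_of_nonneg_left _ (by linarith)
      exact mul_le_mul hn1' hn1' (by positivity) (by positivity)
    have h4 : ((α - 5 * ξ) * (k * k)) * ((m0 + 1) * (m0 + 1)) ≤ (α - 3 * ξ) * ((k * m0) * (k * m0)) := by
      have : (α - 5 * ξ) * ((m0 + 1) * (m0 + 1)) ≤ (α - 3 * ξ) * (m0 * m0) := by
        have : (α - 3 * ξ) * (m0 * m0) - (α - 5 * ξ) * ((m0 + 1) * (m0 + 1))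
          = 2 * ξ * (m0 * m0) - (α - 5 * ξ) * (2 * m0 + 1) := by ring
        have h5 : 1 * m0 ≤ ξ * m0 * m0 := mul_le_mul_of_nonneg_right hm0 hm0p.le
        nlinarith
      calc _ = (k * k : ℝ) * ((α - 5 * ξ) * ((m0 + 1) * (m0 + 1))) := by ring
        _ ≤ (k * k : ℝ) * ((α - 3 * ξ) * (m0 * m0)) := mul_le_mul_of_nonneg_left this (by positivity)
        _ = _ := by ring
    have h6 := h4.trans (h3.trans (htot.trans h2))
    exact le_of_mul_le_mul_right h6 (by positivity)
  have totw : (α - 5 * ξ) * (k * k) ≤ (∑ a, ∑ b, (w a b : ℝ)) * d0 + d0 * (k * k) + k + ε * (k * k) := by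
    refine tot.trans ?_
    have h1 : ∑ a, ∑ b, d a b ≤ ∑ a, ∑ b, ((w a b : ℝ) * d0 + d0 + (if a = b then 1 else 0) + (if (a, b) ∈ NU then 1 else 0)) :=
      Finset.sum_le_sum (fun a _ => Finset.sum_le_sum (fun b _ => wge a b))
    refine h1.trans ?_
    simp only [Finset.sum_add_distrib]
    have e1 : ∑ a, ∑ b, (w a b : ℝ) * d0 = (∑ a, ∑ b, (w a b : ℝ)) * d0 := by
      simp only [Finset.sum_mul]
    have e2 : ∑ _a : Fin k, ∑ _b : Fin k, d0 = d0 * (k * k) := by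
      simp only [Finset.sum_const, Finset.card_univ, Fintype.card_fin, nsmul_eq_mul]; ring
    have e3 : ∑ a : Fin k, ∑ b : Fin k, (if a = b then (1:ℝ) else 0) = k := by
      simp
    have e4 : ∑ a : Fin k, ∑ b : Fin k, (if (a, b) ∈ NU then (1:ℝ) else 0) = NU.card := by
      rw [← Finset.sum_product', Finset.univ_product_univ, Finset.sum_ite_mem]
      simp
    rw [e1, e2, e3, e4]
    linarith
  refine ⟨w, ⌊(α + 3 * ξ) * k / d0⌋₊, ?_, ?_, ?_, ?_, ?_, ?_, ?_⟩
  · intro a b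
    simp only [w]
    have : (a ≠ b ∧ G.IsUniform ε (Pt a) (Pt b)) ↔ (b ≠ a ∧ G.IsUniform ε (Pt b) (Pt a)) :=
      ⟨fun h => ⟨h.1.symm, h.2.symm⟩, fun h => ⟨h.1.symm, h.2.symm⟩⟩
    simp only [this, ds a b]
  · intro a; simp [w]
  · intro a b h
    refine ⟨?_, wle a b⟩
    by_contra hc
    have : w a b = 0 := if_neg (fun h => hc h.2)
    omega
  · intro a
    apply Nat.le_floor
    rw [le_div_iff₀ hd0]
    push_cast
    rw [Finset.sum_mul]
    exact (Finset.sum_le_sum (fun b _ => wle a b)).trans (row a)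
  · have h1 : ((⌊(α + 3 * ξ) * k / d0⌋₊ : ℕ) : ℝ) * d0 ≤ (α + 3 * ξ) * k := by
      have := Nat.floor_le (a := (α + 3 * ξ) * k / d0) (by positivity)
      rwa [le_div_iff₀ hd0] at this
    have hk2 : (0:ℝ) ≤ k * k := by positivity
    have hk1 : (k:ℝ) ≤ d0 * (k * k) := by nlinarith
    have hx1 : ξ * (k * k) ≤ d0 * (k * k) := mul_le_mul_of_nonneg_right hξd hk2
    have hx2 : ε * (k * k) ≤ d0 * (k * k) := mul_le_mul_of_nonneg_right hεd hk2
    have h2 : (((⌊(α + 3 * ξ) * k / d0⌋₊ : ℕ) : ℝ) * k) * d0 ≤ ((∑ a, ∑ b, (w a b : ℝ)) + 11 * (k * k)) * d0 := by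
      have : ((⌊(α + 3 * ξ) * k / d0⌋₊ : ℕ) : ℝ) * d0 * k ≤ (α + 3 * ξ) * k * k :=
        mul_le_mul_of_nonneg_right h1 hk0
      linarith
    have h3 := le_of_mul_le_mul_right h2 hd0
    exact_mod_cast h3
  · have := Nat.floor_le (a := (α + 3 * ξ) * k / d0) (by positivity)
    rwa [le_div_iff₀ hd0] at this
  · have := (Nat.lt_floor_add_one ((α + 3 * ξ) * k / d0)).le
    rwa [div_le_iff₀ hd0] at this

end

section

set_option linter.unusedSectionVars false

open Classical in
theorem reduced (α ξ ε d0 ρ : ℝ) (l : ℕ) (hξ : 0 < ξ) (hα : 3 * ξ ≤ α) (hα1 : α ≤ 1)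
    (hξd : ξ ≤ d0) (hε : 0 < ε) (hεd : ε ≤ d0) (hd0 : d0 ≤ 1) (hl : 1 ≤ d0 * l) (hρ : 0 < ρ) (hρ1 : ρ < 1)
    {n : ℕ} (hn : SzemerediRegularity.bound ε l * ⌈1 / ξ⌉₊ ≤ n)
    (hln : l ≤ n) (G : SimpleGraph (Fin n))
    (B : Finset (Fin n)) (hB : (B.card : ℝ) ≤ ξ * n)
    (hb : ∀ v, v ∉ B → (α - ξ) * n ≤ dg G v ∧ (dg G v : ℝ) ≤ (α + ξ) * n) :
    ∃ G' ≤ G, ∃ k, l ≤ k ∧ 1 ≤ k ∧ k ≤ SzemerediRegularity.bound ε l ∧ ∃ Pt : Fin k → Finset (Fin n),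
      (∀ a b v, v ∈ Pt a → v ∈ Pt b → a = b) ∧
      (∀ a, n / k ≤ (Pt a).card ∧ (Pt a).card ≤ n / k + 1) ∧
      ∃ w : Fin k → Fin k → ℕ, (∀ a b, w a b = w b a) ∧ (∀ a, w a a = 0) ∧
      (∀ a b, 0 < w a b → G'.IsUniform ε (Pt a) (Pt b) ∧
        (w a b : ℝ) * d0 ≤ ((G'.edgeDensity (Pt a) (Pt b) : ℚ) : ℝ)) ∧
      ∃ (kb : ℕ) (_ : NeZero kb) (c : ℕ) (A : Fin c → Bool → ZMod kb → Fin k),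
      (∀ c o, Function.Injective (A c o)) ∧
      (∀ c β, 0 < w (A c true β) (A c false β)) ∧
      (∀ a b (S : Finset (Fin c)), (∀ c ∈ S, ∃ β, A c true β = a ∧ A c false β = b) → S.card ≤ w a b) ∧
      (1 - ρ) * k ≤ kb ∧ kb ≤ k ∧ α * k ≤ (c + 12 * k / ρ) * d0 ∧ (c : ℝ) * d0 ≤ 4 * k := by
  have hd0p : 0 < d0 := by linarith
  obtain ⟨G', hG', hdeg, htot⟩ := trim G α ξ hξ.le (by linarith) hα1 B hB hb
  refine ⟨G', hG', ?_⟩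
  obtain ⟨P, P1, P2, P3, P4⟩ := szemeredi_regularity G' hε (l := l) (by simpa using hln)
  have hl1 : 1 ≤ l := by
    rcases Nat.eq_zero_or_pos l with h | h
    · subst h; norm_num at hl
    · exact h
  obtain ⟨k, hk⟩ : ∃ k, k = P.parts.card := ⟨_, rfl⟩
  let e : Fin k ≃ P.parts := (finCongr hk).trans P.parts.equivFin.symm
  rw [← hk] at P2 P3
  have hk1 : 1 ≤ k := hl1.trans P2
  have hlk : (l : ℝ) ≤ k := by exact_mod_cast P2
  have hsize : ∀ a, n / k ≤ (e a).1.card ∧ (e a).1.card ≤ n / k + 1 := by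
    intro a
    have := P1.card_parts_eq_average (e a).2
    simp only [Finset.card_univ, Fintype.card_fin, ← hk] at this
    omega
  have hdis : ∀ a b v, v ∈ (e a).1 → v ∈ (e b).1 → a = b := by
    intro a b v h1 h2
    have := P.eq_of_mem_parts (e a).2 (e b).2 h1 h2
    exact e.injective (Subtype.ext this)
  have hcov : ∀ v, ∃ a, v ∈ (e a).1 := by
    intro v
    obtain ⟨t, ht, hv⟩ := P.exists_mem (Finset.mem_univ v)
    exact ⟨e.symm ⟨t, ht⟩, by simpa using hv⟩
  have hm0 : ⌈1 / ξ⌉₊ ≤ n / k := by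
    rw [Nat.le_div_iff_mul_le hk1, mul_comm]
    exact (Nat.mul_le_mul_right _ P3).trans hn
  have hm0' : 1 ≤ ξ * ((n / k : ℕ) : ℝ) := by
    have h1 : (1 / ξ : ℝ) ≤ ((n / k : ℕ) : ℝ) := (Nat.le_ceil _).trans (by exact_mod_cast hm0)
    rw [div_le_iff₀ hξ] at h1
    linarith
  let NU : Finset (Fin k × Fin k) :=
    Finset.univ.filter (fun z => z.1 ≠ z.2 ∧ ¬ G'.IsUniform ε (e z.1).1 (e z.2).1)
  have hNU : (NU.card : ℝ) ≤ ε * (k * k) := by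
    have h1 : NU.card ≤ (P.nonUniforms G' ε).card := by
      refine Finset.card_le_card_of_injOn (fun z => ((e z.1).1, (e z.2).1)) ?_ ?_
      · intro z hz
        have hz := (Finset.mem_filter.mp hz).2
        refine Finset.mem_coe.mpr ((Finpartition.mk_mem_nonUniforms (P := P) (G := G')).mpr ⟨(e z.1).2, (e z.2).2, ?_, hz.2⟩)
        intro h
        exact hz.1 (e.injective (Subtype.ext h))
      · intro z _ z' _ h
        simp only [Prod.mk.injEq] at h
        exact Prod.ext (e.injective (Subtype.ext h.1)) (e.injective (Subtype.ext h.2))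
    have h2 : ((P.nonUniforms G' ε).card : ℝ) ≤ _ := P4
    rw [← hk] at h2
    have h3 : (NU.card : ℝ) ≤ (P.nonUniforms G' ε).card := by exact_mod_cast h1
    have h4 : ((k * (k - 1) : ℕ) : ℝ) ≤ k * k := by
      have : k * (k - 1) ≤ k * k := Nat.mul_le_mul_left _ (by omega)
      exact_mod_cast this
    have h5 := mul_le_mul_of_nonneg_right h4 hε.le
    linarith
  obtain ⟨w, D0, w1, w2, w3, w4, w5, w6, w7⟩ := weights G' (fun a => (e a).1) hdis hcov (n / k) hsize α ξ ε d0 hξ hα hα1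
    hd0p hξd hεd (by nlinarith) hm0' (Nat.mul_div_le _ _) (Nat.lt_mul_div_succ n hk1).le hdeg htot NU hNU (by
      intro a b hab h
      by_contra hc
      exact h (Finset.mem_filter.mpr ⟨Finset.mem_univ _, hab, hc⟩))
  have hkr : (1:ℝ) ≤ k := by exact_mod_cast hk1
  let fk := ⌊ρ * k⌋₊
  have hfk1 : (fk : ℝ) ≤ ρ * k := Nat.floor_le (by positivity)
  have hfk2 : ρ * k ≤ (fk : ℝ) + 1 := (Nat.lt_floor_add_one _).le
  have hfkk : fk < k := by
    have : (fk : ℝ) < k := by nlinarith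
    exact_mod_cast this
  have : NeZero (k - fk) := ⟨by omega⟩
  obtain ⟨c, A, A1, A2, A3, A4, A5⟩ := classes w w4 (fun b => by
    simp_rw [w1 _ b]; exact w4 b) fk (11 * (k * k)) (k - fk) w5 (by omega)
  refine ⟨k, P2, hk1, P3, fun a => (e a).1, hdis, hsize, w, w1, w2, w3, k - fk, inferInstance, c, A, A1, A2, A3, ?_, by omega, ?_, ?_⟩
  · rw [Nat.cast_sub hfkk.le]; linarith
  · have h1 : (D0 : ℝ) * (fk + 1) ≤ c * (fk + 1) + 11 * (k * k) := by exact_mod_cast A4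
    have h2 : (D0 : ℝ) ≤ c + 11 * k / ρ := by
      by_contra hc
      push Not at hc
      have h3 : (c + 11 * k / ρ) * (fk + 1) < D0 * (fk + 1) := mul_lt_mul_of_pos_right hc (by positivity)
      have h4 : 11 * k / ρ * (ρ * k) ≤ 11 * k / ρ * (fk + 1) := mul_le_mul_of_nonneg_left hfk2 (by positivity)
      have h5 : 11 * k / ρ * (ρ * k) = 11 * (k * k) := by field_simp
      linarith
    have h3 : 1 ≤ k / ρ := by rw [le_div_iff₀ hρ]; linarith
    have h4 : (D0 : ℝ) + 1 ≤ c + 12 * k / ρ := by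
      have : 12 * (k:ℝ) / ρ = 11 * k / ρ + k / ρ := by ring
      linarith
    have h5 : ((D0 : ℝ) + 1) * d0 ≤ (c + 12 * k / ρ) * d0 := mul_le_mul_of_nonneg_right h4 hd0p.le
    have : 0 ≤ 3 * ξ * k := by positivity
    linarith
  · have h1 : (c : ℝ) ≤ D0 := by exact_mod_cast A5
    have h2 : (c : ℝ) * d0 ≤ D0 * d0 := mul_le_mul_of_nonneg_right h1 hd0p.le
    nlinarith

end

section

set_option linter.unusedSectionVars false

theorem flr {a : ℝ} (ha : 0 ≤ a) : (⌊a⌋₊ : ℝ) ≤ a ∧ a ≤ (⌊a⌋₊ : ℝ) + 1 :=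
  ⟨Nat.floor_le ha, (Nat.lt_floor_add_one a).le⟩

set_option maxHeartbeats 1000000 in
/-- sizes of the cells -/
theorem nums1 (ζ d0 ε ε₁ δ : ℝ) (L K m0 : ℕ) (hL : 1 ≤ L) (hζ : 0 < ζ) (hζ1 : 40 * ζ ≤ 1) (hd0 : 0 < d0)
    (hd1 : d0 ≤ 1) (hε : 0 < ε) (hε₁ : 0 < ε₁) (hK : 2 * K * ε₁ ≤ ζ) (hx : 1 ≤ δ * m0) (hδ : 0 < δ)
    (c1 : 2 * (L * δ) ≤ ζ * d0) (c2 : 2 * (L * δ) ≤ ε₁) (c3 : 4 * (L * ε) ≤ ε₁) (c3' : ε₁ ≤ 1)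
    (c4 : (6 * ε + δ) * L ≤ ζ * d0 * ε₁) (c5 : 2 * ε ≤ ζ) (c6 : 2 * ε ≤ d0) :
    ∃ N fk N1 z t0 ty0 capo : ℕ, 0 < N ∧ 0 < z ∧ 0 < t0 ∧ L * N + z ≤ m0 ∧ N1 + K * (2 * fk) ≤ N ∧ 0 < N1 ∧
      ε * (m0 + 1) ≤ N ∧ ε * (m0 + 1) ≤ z ∧ ε * (m0 + 1) ≤ fk ∧ ε * (m0 + 1) ≤ t0 ∧
      (ty0 : ℝ) ≤ (d0 - ε) * z ∧
      2 * (capo : ℝ) * (fk + 1) + (2 * ε * N * N + N + 2 * (ε * (m0 + 1)) * N) ≤ d0 * N * (fk + 1) ∧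
      (1 - 3 * ζ) * m0 ≤ L * N1 ∧ (L : ℝ) * N1 ≤ m0 ∧ (t0 : ℝ) ≤ (2 * ε + δ) * m0 ∧
      (d0 * ζ / 2 - δ) * m0 ≤ ty0 ∧ (1 - 4 * ζ) * d0 * m0 ≤ 2 * (L * capo) := by
  set x : ℝ := (m0 : ℝ) with hxd
  have hx0 : 0 < x := by
    by_contra h; push Not at h
    have := mul_nonpos_of_nonneg_of_nonpos hδ.le h
    linarith
  have hLr : (1:ℝ) ≤ L := by exact_mod_cast hL
  have hL0 : (0:ℝ) < L := by linarith
  have hζd : ζ * d0 ≤ ζ := by nlinarith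
  have hLδ : (L:ℝ) * 1 ≤ L * (δ * x) := mul_le_mul_of_nonneg_left hx hL0.le
  have hLx : 2 * (L:ℝ) ≤ ζ * d0 * x := by
    have := mul_le_mul_of_nonneg_right c1 hx0.le
    linarith
  have hLx2 : 2 * (L:ℝ) ≤ ε₁ * x := by
    have := mul_le_mul_of_nonneg_right c2 hx0.le
    linarith
  have hLx3 : 2 * (L:ℝ) ≤ ζ * x := by
    have := mul_le_mul_of_nonneg_right hζd hx0.le
    linarith
  have hζx : 40 * (ζ * x) ≤ x := by
    have := mul_le_mul_of_nonneg_right hζ1 hx0.le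
    linarith
  have hζx0 : 0 < ζ * x := by positivity
  obtain ⟨N, hN⟩ : ∃ N, N = ⌊(1 - ζ) * x / L⌋₊ := ⟨_, rfl⟩
  have N_1 : (L:ℝ) * N ≤ (1 - ζ) * x := by
    have := (flr (a := (1 - ζ) * x / L) (by apply div_nonneg (mul_nonneg (by linarith) hx0.le) hL0.le)).1
    rw [← hN, le_div_iff₀ hL0] at this
    linarith
  have N_2 : (1 - 2 * ζ) * x ≤ L * N := by
    have := (flr (a := (1 - ζ) * x / L) (by apply div_nonneg (mul_nonneg (by linarith) hx0.le) hL0.le)).2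
    rw [← hN, div_le_iff₀ hL0] at this
    linarith
  obtain ⟨fk, hfk⟩ : ∃ N, N = ⌊ε₁ * x / L⌋₊ := ⟨_, rfl⟩
  have f_1 : (L:ℝ) * fk ≤ ε₁ * x := by
    have := (flr (a := ε₁ * x / L) (by positivity)).1
    rw [← hfk, le_div_iff₀ hL0] at this
    linarith
  have f_2 : ε₁ * x ≤ L * (fk + 1) := by
    have := (flr (a := ε₁ * x / L) (by positivity)).2
    rw [← hfk, div_le_iff₀ hL0] at this
    linarith
  have kf : (L:ℝ) * (K * (2 * fk)) ≤ ζ * x := by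
    calc (L:ℝ) * (K * (2 * fk)) = (2 * K) * (L * fk) := by ring
      _ ≤ (2 * K) * (ε₁ * x) := mul_le_mul_of_nonneg_left f_1 (by positivity)
      _ = (2 * K * ε₁) * x := by ring
      _ ≤ _ := mul_le_mul_of_nonneg_right hK hx0.le
  have hle : K * (2 * fk) ≤ N := by
    have : (L:ℝ) * (K * (2 * fk)) ≤ L * N := by linarith
    have := le_of_mul_le_mul_left this hL0
    exact_mod_cast this
  have hzle : L * N ≤ m0 := by
    have : (L:ℝ) * N ≤ m0 := by linarith
    exact_mod_cast this
  have hN0 : (0:ℝ) < N := by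
    by_contra h; push Not at h
    have := mul_nonpos_of_nonneg_of_nonpos hL0.le h
    linarith
  have hNx : (N:ℝ) ≤ x := by
    have : 1 * (N:ℝ) ≤ L * N := mul_le_mul_of_nonneg_right hLr hN0.le
    linarith
  have hδ1 : δ ≤ 1 := by
    have := mul_le_mul_of_nonneg_right hLr hδ.le
    linarith
  have hx1 : 1 ≤ x := by
    have := mul_le_mul_of_nonneg_right hδ1 hx0.le
    linarith
  have eu : ε * (x + 1) ≤ 2 * ε * x := by
    have := mul_le_mul_of_nonneg_left hx1 hε.le
    linarith
  have z1 : ζ * x ≤ ((m0 - L * N : ℕ) : ℝ) := by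
    rw [Nat.cast_sub hzle]; push_cast; linarith
  have N1_1 : (1 - 3 * ζ) * x ≤ L * ((N - K * (2 * fk) : ℕ) : ℝ) := by
    rw [Nat.cast_sub hle]; push_cast; linarith
  obtain ⟨t0, ht0⟩ : ∃ t, t = ⌈ε * (x + 1)⌉₊ := ⟨_, rfl⟩
  obtain ⟨ty0, hty⟩ : ∃ t, t = ⌊d0 * ζ / 2 * x⌋₊ := ⟨_, rfl⟩
  have ty := flr (a := d0 * ζ / 2 * x) (by positivity)
  obtain ⟨capo, hca⟩ : ∃ t, t = ⌊(1 - ζ) * d0 / 2 * N⌋₊ := ⟨_, rfl⟩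
  have ca := flr (a := (1 - ζ) * d0 / 2 * N) (by
    apply mul_nonneg (div_nonneg (mul_nonneg (by linarith) hd0.le) (by norm_num)) hN0.le)
  rw [← hty] at ty
  rw [← hca] at ca
  refine ⟨N, fk, N - K * (2 * fk), m0 - L * N, t0, ty0, capo, by exact_mod_cast hN0, ?_, ?_, by omega, by omega, ?_, ?_, ?_, ?_, ?_, ?_, ?_, N1_1, ?_, ?_, ?_, ?_⟩
  · have : (0:ℝ) < ((m0 - L * N : ℕ) : ℝ) := lt_of_lt_of_le (by positivity) z1
    exact_mod_cast this
  · rw [ht0]; exact Nat.ceil_pos.mpr (by positivity)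
  · have : 0 < (1 - 3 * ζ) * x := mul_pos (by linarith) hx0
    have h2 : (0:ℝ) < L * ((N - K * (2 * fk) : ℕ) : ℝ) := lt_of_lt_of_le this N1_1
    have := pos_of_mul_pos_right h2 hL0.le
    exact_mod_cast this
  · refine eu.trans ?_
    have : L * (2 * ε * x) ≤ (L:ℝ) * N := by
      have : 4 * (L * ε) * x ≤ 1 * x := mul_le_mul_of_nonneg_right (by linarith) hx0.le
      linarith
    exact le_of_mul_le_mul_left this hL0
  · refine eu.trans (le_trans ?_ z1)
    exact mul_le_mul_of_nonneg_right c5 hx0.le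
  · refine eu.trans ?_
    have : L * (2 * ε * x) ≤ (L:ℝ) * fk := by
      have : 4 * (L * ε) * x ≤ ε₁ * x := mul_le_mul_of_nonneg_right c3 hx0.le
      linarith
    exact le_of_mul_le_mul_left this hL0
  · rw [ht0]; exact Nat.le_ceil _
  · refine ty.1.trans ?_
    have : d0 / 2 * (ζ * x) ≤ (d0 - ε) * ((m0 - L * N : ℕ) : ℝ) :=
      mul_le_mul (by linarith) z1 (by positivity) (by linarith)
    linarith
  · have h1 : 2 * (capo:ℝ) * (fk + 1) ≤ (1 - ζ) * d0 * N * (fk + 1) :=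
      mul_le_mul_of_nonneg_right (by linarith [ca.1]) (by positivity)
    have h2 : L * (2 * ε * N + 1 + 2 * (ε * (x + 1))) ≤ L * (ζ * d0 * (fk + 1)) := by
      have e1 : ε * N ≤ ε * x := mul_le_mul_of_nonneg_left hNx hε.le
      have e2 : L * (2 * ε * N + 1 + 2 * (ε * (x + 1))) ≤ L * ((6 * ε + δ) * x) := by
        apply mul_le_mul_of_nonneg_left _ hL0.le
        linarith
      have e3 : (6 * ε + δ) * L * x ≤ ζ * d0 * ε₁ * x := mul_le_mul_of_nonneg_right c4 hx0.le
      have e4 : ζ * d0 * (ε₁ * x) ≤ ζ * d0 * (L * (fk + 1)) := mul_le_mul_of_nonneg_left f_2 (by positivity)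
      linarith
    have h3 := le_of_mul_le_mul_left h2 hL0
    have h4 := mul_le_mul_of_nonneg_right h3 hN0.le
    linarith
  · rw [Nat.cast_sub hle]; push_cast
    have : (0:ℝ) ≤ L * (K * (2 * fk)) := by positivity
    linarith
  · rw [ht0]
    have := (Nat.ceil_lt_add_one (a := ε * (x + 1)) (by positivity)).le
    linarith
  · linarith [ty.2]
  · have h1 : L * ((1 - ζ) * d0 / 2 * N) ≤ L * (capo + 1 : ℝ) := mul_le_mul_of_nonneg_left ca.2 hL0.le
    have h2 : (1 - ζ) * d0 / 2 * ((1 - 2 * ζ) * x) ≤ (1 - ζ) * d0 / 2 * (L * N) :=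
      mul_le_mul_of_nonneg_left N_2 (div_nonneg (mul_nonneg (by linarith) hd0.le) (by norm_num))
    have h3 : 0 ≤ ζ * ζ * d0 * x := by positivity
    linarith

end

section

set_option linter.unusedSectionVars false
set_option linter.unusedVariables false

theorem hcap_num (ζ d0 x k kb m scap cap H : ℝ) (hζ : 0 < ζ) (hζ1 : 40 * ζ ≤ 1) 
    (hd0 : 0 < d0) (hx : 0 < x) (hk : 0 < k) (m0 : 0 ≤ m) (hH : 5 ≤ H * d0 * ζ ^ 2) (hH0 : 0 ≤ H)
    (h1 : m ≤ (1 - 20 * ζ) * (k * x)) (h2 : (1 - ζ) * k ≤ kb) (h3 : (1 - 5 * ζ) * x ≤ cap) (h4 : cap ≤ x)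
    (h5 : d0 * ζ * x ≤ 64 * scap) :
    m * scap * H + m * cap < kb * (cap * scap) * H := by
  have hkx : 0 < k * x := by positivity
  have hs : 0 < scap := by
    have : 0 < d0 * ζ * x := by positivity
    linarith
  have hc0 : 0 < cap := lt_of_lt_of_le (mul_pos (by linarith) hx) h3
  have e1 : ((1 - ζ) * k) * ((1 - 5 * ζ) * x) ≤ kb * cap :=
    mul_le_mul h2 h3 (mul_nonneg (by linarith) hx.le) (le_trans (mul_nonneg (by linarith) hk.le) h2)
  have e2 : m + 14 * ζ * (k * x) ≤ kb * cap := by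
    have : 0 ≤ 5 * ζ * ζ * (k * x) := by positivity
    linarith
  have e3 := mul_le_mul_of_nonneg_right e2 (mul_nonneg hs.le hH0)
  have e4 : m * cap ≤ (k * x) * x := by
    apply mul_le_mul _ h4 hc0.le hkx.le
    have : 0 ≤ 20 * ζ * (k * x) := by positivity
    linarith
  have e5 : x < 14 * ζ * (scap * H) := by
    have a1 : d0 * ζ * x * H * ζ ≤ 64 * scap * H * ζ :=
      mul_le_mul_of_nonneg_right (mul_le_mul_of_nonneg_right h5 hH0) hζ.le
    have a2 : 5 * x ≤ H * d0 * ζ ^ 2 * x := mul_le_mul_of_nonneg_right hH hx.le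
    have : H * d0 * ζ ^ 2 * x = d0 * ζ * x * H * ζ := by ring
    linarith
  have e6 : (k * x) * x < (k * x) * (14 * ζ * (scap * H)) := mul_lt_mul_of_pos_left e5 hkx
  linarith

/-- lower bound for `c * kb` -/
theorem ckb_num (α ζ d0 k kb c : ℝ) (hα : 0 < α) (hζ : 0 < ζ) (hζ1 : 40 * ζ ≤ 1) 
    (hd0 : 0 < d0) (hk : 0 < k) (hd : 12 * d0 ≤ α * ζ ^ 2) (h2 : (1 - ζ) * k ≤ kb)
    (hc : α * k ≤ (c + 12 * k / ζ) * d0) : (1 - 2 * ζ) * (α * (k * k)) ≤ d0 * (c * kb) := by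
  have e1 : 12 * k / ζ * d0 ≤ ζ * α * k := by
    have : 12 * d0 * k ≤ α * ζ ^ 2 * k := mul_le_mul_of_nonneg_right hd hk.le
    have e : 12 * k / ζ * d0 = 12 * d0 * k / ζ := by ring
    rw [e, div_le_iff₀ hζ]
    linarith
  have e2 : (1 - ζ) * (α * k) ≤ d0 * c := by linarith
  have e3 : ((1 - ζ) * (α * k)) * ((1 - ζ) * k) ≤ d0 * c * kb :=
    mul_le_mul e2 h2 (mul_nonneg (by linarith) hk.le) (le_trans (mul_nonneg (by linarith) (by positivity)) e2)
  have : 0 ≤ ζ * ζ * (α * (k * k)) := by positivity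
  linarith

set_option maxHeartbeats 1000000 in
theorem I2_num (α ζ d0 δ x k kb c L N1 E R S τ K cc capo : ℝ) (hα : 0 < α) (hζ : 0 < ζ) (hζ1 : 40 * ζ ≤ 1) 
    (hd0 : 0 < d0) (hx : 0 < x) (hk : 1 ≤ k) (hL1' : 1 ≤ L) (hN1 : 0 < N1) (hK : 0 ≤ K) (hcc : 0 ≤ cc)
    (hc0 : 0 ≤ c) (hkb0 : 0 ≤ kb) (hτ0 : 0 ≤ τ)
    (hδx : 1 ≤ δ * x) (hδ : 2 * δ ≤ ζ * α)
    (hckb : (1 - 2 * ζ) * (α * (k * k)) ≤ d0 * (c * kb)) (hkb : kb ≤ k)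
    (hS : S ≤ (1 - 30 * ζ) * α * (k * k) * (x * x) / 2) (hτ : τ ≤ 6 * (k * x))
    (hL1 : (1 - 3 * ζ) * x ≤ L * N1) (hL2 : L * N1 ≤ x) (hcap : (1 - 4 * ζ) * d0 * x ≤ 2 * (L * capo))
    (hKc : 24 * (K * cc) ≤ 2 * ζ * α * L) (hR : 4 * L * R * δ ≤ ζ * d0) (hR0 : 0 ≤ R)
    (hE : N1 * E ≤ S + τ * (kb * (2 * N1 * K * cc)) + N1) :
    E + R * (c * kb * (L * L)) ≤ c * kb * (L * L) * capo := by
  have hL : 0 < L := by linarith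
  have hkk : 0 < k * k := by positivity
  have hxx : 0 < x * x := by positivity
  have hcapo : d0 * x ≤ 4 * (L * capo) := by
    have : 40 * ζ * (d0 * x) ≤ 1 * (d0 * x) := mul_le_mul_of_nonneg_right hζ1 (by positivity)
    have : 0 ≤ ζ * (d0 * x) := by positivity
    linarith
  have hRc : R ≤ ζ * capo := by
    have a1 : 4 * L * R * (δ * x) ≤ ζ * d0 * x := by
      have := mul_le_mul_of_nonneg_right hR hx.le
      linarith
    have a2 : 4 * L * R * 1 ≤ 4 * L * R * (δ * x) := mul_le_mul_of_nonneg_left hδx (by positivity)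
    have a3 : ζ * (d0 * x) ≤ ζ * (4 * (L * capo)) := mul_le_mul_of_nonneg_left hcapo hζ.le
    have a4 : (4 * L) * R ≤ (4 * L) * (ζ * capo) := by linarith
    exact le_of_mul_le_mul_left a4 (by positivity)
  have hRR : R * (c * kb * (L * L)) ≤ (ζ * capo) * (c * kb * (L * L)) :=
    mul_le_mul_of_nonneg_right hRc (by positivity)
  have main : N1 * E ≤ N1 * ((1 - ζ) * (c * kb * (L * L) * capo)) := by
    have b1 : ((1 - 2 * ζ) * (α * (k * k))) * ((1 - 3 * ζ) * x) ≤ (d0 * (c * kb)) * (L * N1) :=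
      mul_le_mul hckb hL1 (mul_nonneg (by linarith) hx.le) (by positivity)
    have b2 : (((1 - 2 * ζ) * (α * (k * k))) * ((1 - 3 * ζ) * x)) * ((1 - 4 * ζ) * d0 * x) ≤
        ((d0 * (c * kb)) * (L * N1)) * (2 * (L * capo)) :=
      mul_le_mul b1 hcap (mul_nonneg (mul_nonneg (by linarith) hd0.le) hx.le) (by positivity)
    have b3 : d0 * (((1 - 2 * ζ) * (1 - 3 * ζ) * (1 - 4 * ζ)) * (α * (k * k) * (x * x)) / 2) ≤
        d0 * (N1 * (c * kb * (L * L) * capo)) := by linarith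
    have b4 := le_of_mul_le_mul_left b3 hd0
    have b5 : (1 - 9 * ζ) ≤ (1 - 2 * ζ) * (1 - 3 * ζ) * (1 - 4 * ζ) := by
      have : 0 ≤ ζ * ζ * (26 - 24 * ζ) := mul_nonneg (by positivity) (by linarith)
      nlinarith
    have b6 : (1 - 9 * ζ) * (α * (k * k) * (x * x)) ≤
      ((1 - 2 * ζ) * (1 - 3 * ζ) * (1 - 4 * ζ)) * (α * (k * k) * (x * x)) :=
      mul_le_mul_of_nonneg_right b5 (by positivity)
    have b7 : (1 - 9 * ζ) * (α * (k * k) * (x * x)) / 2 ≤ N1 * (c * kb * (L * L) * capo) := by linarith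
    have b8 := mul_le_mul_of_nonneg_left b7 (show 0 ≤ 1 - ζ by linarith)
    have b9 : 0 ≤ ζ * ζ * (α * (k * k) * (x * x)) := by positivity
    -- upper bound
    have u1 : τ * (kb * (2 * N1 * K * cc)) ≤ 6 * (k * x) * (k * (2 * N1 * K * cc)) :=
      mul_le_mul hτ (mul_le_mul_of_nonneg_right hkb (by positivity)) (by positivity) (by positivity)
    have u2 : L * (6 * (k * x) * (k * (2 * N1 * K * cc))) ≤ L * (ζ * α * (k * k) * (x * x)) := by
      have c1 : (12 * (K * cc) * ((k * k) * x)) * (L * N1) ≤ (12 * (K * cc) * ((k * k) * x)) * x :=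
        mul_le_mul_of_nonneg_left hL2 (by positivity)
      have c2 : 24 * (K * cc) * ((k * k) * (x * x)) ≤ 2 * ζ * α * L * ((k * k) * (x * x)) :=
        mul_le_mul_of_nonneg_right hKc (by positivity)
      linarith
    have u3 := le_of_mul_le_mul_left u2 hL
    have u4 : 1 * N1 ≤ L * N1 := mul_le_mul_of_nonneg_right hL1' hN1.le
    have u5 : x ≤ ζ * α / 2 * ((k * k) * (x * x)) := by
      have c1 : 1 * x ≤ (δ * x) * x := mul_le_mul_of_nonneg_right hδx hx.le
      have c2 : 2 * δ * (x * x) ≤ ζ * α * (x * x) := mul_le_mul_of_nonneg_right hδ hxx.le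
      have c3 : 1 * 1 ≤ k * k := mul_le_mul hk hk (by norm_num) (by linarith)
      rw [one_mul] at c3
      have c4 : ζ * α * (x * x) * 1 ≤ ζ * α * (x * x) * (k * k) := mul_le_mul_of_nonneg_left c3 (by positivity)
      linarith
    have u6 : 0 ≤ ζ * (α * (k * k) * (x * x)) := by positivity
    linarith
  have := le_of_mul_le_mul_left main hN1
  linarith

set_option maxHeartbeats 1000000 in
theorem I3_num (α ζ d0 δ χ x k kb c L N1 Mk R W τ K cc capm wmax : ℝ) (hα : 0 < α) (hζ : 0 < ζ)
    (hζ1 : 40 * ζ ≤ 1)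
    (hd0 : 0 < d0) (hx : 0 < x) (hχ : 0 < χ) (hk : 1 ≤ k) (hL1' : 1 ≤ L) (hN1 : 0 < N1) (hK : 0 ≤ K) (hcc : 0 ≤ cc)
    (hc0 : 0 ≤ c) (hkb0 : 0 ≤ kb) (hτ0 : 0 ≤ τ) (hw : d0 * wmax ≤ 1) (hMk0 : 0 ≤ Mk)
    (hδx : 1 ≤ δ * x) (hδ : 12 * δ ≤ α * χ)
    (hckb : (1 - 2 * ζ) * (α * (k * k)) ≤ d0 * (c * kb)) (hkb : kb ≤ k)
    (hW : W ≤ α * χ * (k * k) * (x * x) / 12) (hτ : τ ≤ 6 * (k * x))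
    (hL1 : (1 - 3 * ζ) * x ≤ L * N1) (hL2 : L * N1 ≤ x) (hcap : χ * x ≤ capm)
    (hKc : 144 * (K * cc) ≤ α * χ * L) (hR : 2 * R * δ ≤ χ) (hR0 : 0 ≤ R)
    (hE : N1 * Mk ≤ W + τ * (kb * (2 * N1 * K * cc)) + N1) :
    wmax * Mk + R * (c * kb * L) ≤ c * kb * L * capm := by
  have hL : 0 < L := by linarith
  have hkk : 0 < k * k := by positivity
  have hxx : 0 < x * x := by positivity
  have hRc : R ≤ capm / 2 := by
    have a1 := mul_le_mul_of_nonneg_right hR hx.le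
    have a2 : 2 * R * 1 ≤ 2 * R * (δ * x) := mul_le_mul_of_nonneg_left hδx (by positivity)
    linarith
  have hRR : R * (c * kb * L) ≤ (capm / 2) * (c * kb * L) :=
    mul_le_mul_of_nonneg_right hRc (by positivity)
  have main : (d0 * N1) * (wmax * Mk) ≤ (d0 * N1) * (c * kb * L * capm / 2) := by
    have b1 : ((1 - 2 * ζ) * (α * (k * k))) * ((1 - 3 * ζ) * x) ≤ (d0 * (c * kb)) * (L * N1) :=
      mul_le_mul hckb hL1 (mul_nonneg (by linarith) hx.le) (by positivity)
    have b2 : (((1 - 2 * ζ) * (α * (k * k))) * ((1 - 3 * ζ) * x)) * (χ * x) ≤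
        ((d0 * (c * kb)) * (L * N1)) * capm :=
      mul_le_mul b1 hcap (by positivity) (by positivity)
    have b5 : 1 / 2 ≤ (1 - 2 * ζ) * (1 - 3 * ζ) := by nlinarith [mul_pos hζ hζ]
    have b6 : 1 / 2 * (α * χ * (k * k) * (x * x)) ≤
      ((1 - 2 * ζ) * (1 - 3 * ζ)) * (α * χ * (k * k) * (x * x)) :=
      mul_le_mul_of_nonneg_right b5 (by positivity)
    have u1 : τ * (kb * (2 * N1 * K * cc)) ≤ 6 * (k * x) * (k * (2 * N1 * K * cc)) :=
      mul_le_mul hτ (mul_le_mul_of_nonneg_right hkb (by positivity)) (by positivity) (by positivity)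
    have u2 : L * (6 * (k * x) * (k * (2 * N1 * K * cc))) ≤ L * (α * χ * (k * k) * (x * x) / 12) := by
      have c1 : (12 * (K * cc) * ((k * k) * x)) * (L * N1) ≤ (12 * (K * cc) * ((k * k) * x)) * x :=
        mul_le_mul_of_nonneg_left hL2 (by positivity)
      have c2 : 144 * (K * cc) * ((k * k) * (x * x)) ≤ α * χ * L * ((k * k) * (x * x)) :=
        mul_le_mul_of_nonneg_right hKc (by positivity)
      linarith
    have u3 := le_of_mul_le_mul_left u2 hL
    have u4 : 1 * N1 ≤ L * N1 := mul_le_mul_of_nonneg_right hL1' hN1.le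
    have u5 : x ≤ α * χ / 12 * ((k * k) * (x * x)) := by
      have c1 : 1 * x ≤ (δ * x) * x := mul_le_mul_of_nonneg_right hδx hx.le
      have c2 : 12 * δ * (x * x) ≤ α * χ * (x * x) := mul_le_mul_of_nonneg_right hδ hxx.le
      have c3 : 1 * 1 ≤ k * k := mul_le_mul hk hk (by norm_num) (by linarith)
      rw [one_mul] at c3
      have c4 : α * χ * (x * x) * 1 ≤ α * χ * (x * x) * (k * k) := mul_le_mul_of_nonneg_left c3 (by positivity)
      linarith
    have u7 : (d0 * wmax) * (N1 * Mk) ≤ 1 * (N1 * Mk) := mul_le_mul_of_nonneg_right hw (by positivity)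
    linarith
  have := le_of_mul_le_mul_left main (by positivity)
  linarith

end

section

set_option linter.unusedSectionVars false
set_option linter.unusedVariables false

/-- The hierarchy of constants. -/
structure Cst (α ζ : ℝ) (Δ : ℕ) where
  d0 : ℝ
  χ : ℝ
  ε : ℝ
  ε₁ : ℝ
  ξ : ℝ
  μ : ℝ
  η : ℝ
  δ : ℝ
  H : ℕ
  K : ℕ
  ℓ : ℕ
  l : ℕ
  kmax : ℕ
  M : ℕ
  D1 : ℕ
  Rmax : ℕ
  q : ℕ
  hα : 0 < α
  hα1 : α ≤ 1
  hζ : 0 < ζ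
  hζ1 : 40 * ζ ≤ 1
  hΔ : 1 ≤ Δ
  hd0 : 0 < d0
  hd1 : d0 ≤ 1
  hχ : 0 < χ
  hε : 0 < ε
  hε₁ : 0 < ε₁
  hξ : 0 < ξ
  hμ : 0 < μ
  hη : 0 < η
  hδ : 0 < δ
  hH : 1 ≤ H
  hK : K = (Δ + 1) ^ (H + 1)
  hℓ : 1 ≤ ℓ
  hkmax : kmax = SzemerediRegularity.bound ε l
  hKe : 2 * K * ε₁ ≤ ζ
  c2 : 2 * ((2 * ℓ : ℕ) * δ) ≤ ε₁
  c3 : 4 * ((2 * ℓ : ℕ) * ε) ≤ ε₁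
  c3' : ε₁ ≤ 1
  c1 : 2 * ((2 * ℓ : ℕ) * δ) ≤ ζ * d0
  c4 : (6 * ε + δ) * (2 * ℓ : ℕ) ≤ ζ * d0 * ε₁
  c5 : 2 * ε ≤ ζ
  c6 : 2 * ε ≤ d0
  x1 : 3 * ξ ≤ α
  x2 : 2 * ξ ≤ α * ζ
  x3 : ξ ≤ d0
  hl : 1 ≤ d0 * l
  d12 : 12 * d0 ≤ α * ζ ^ 2
  l1 : 12 * (K * (Fintype.card (Code K) : ℝ)) ≤ ζ * α * (2 * ℓ : ℕ)
  l2 : 144 * (K * (Fintype.card (Code K) : ℝ)) ≤ α * χ * (2 * ℓ : ℕ)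
  R1 : 4 * (2 * ℓ : ℕ) * Rmax * δ ≤ ζ * d0
  R2 : 2 * Rmax * δ ≤ χ
  R3 : ∀ k kb c : ℕ, k ≤ kmax → kb ≤ kmax → (c : ℝ) * d0 ≤ 4 * k →
    (((2 * ℓ + 1) * 2) ^ (2 * ℓ)) ^ kb * (c * (kb * (2 * ℓ) ^ k)) ≤ Rmax
  H1 : 5 ≤ H * d0 * ζ ^ 2
  H2 : 144 * (Δ + 1) ≤ α * χ * H
  e1 : 144 * δ ≤ α * χ
  e2 : 2 * δ ≤ ζ * α
  e3 : δ ≤ ζ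
  e4 : 2 * δ ≤ μ
  e5 : δ ≤ χ
  e6 : 64 * Δ * δ ≤ d0 * ζ
  e7 : 16 * (D1 + Δ) * δ ≤ d0 * ζ
  e8 : 2 * q * (2 * Δ + D1) * (16 * (2 * ℓ : ℕ)) * δ ≤ 1
  m1 : 2 * kmax ≤ μ * M
  m2 : 64 * (μ * K) ≤ d0 * ζ
  D2 : 192 * kmax * M * Δ * (2 * ℓ : ℕ) ≤ D1 * (d0 * ζ)
  q1 : 2 ≤ d0 * q
  q2 : q * d0 ≤ 3
  g1 : 16 * (2 * ℓ : ℕ) * (2 * ε + δ) ≤ 1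
  g2 : 32 * Δ * (2 * ε + δ) ≤ d0 * ζ
  g3 : (2 * η * kmax + δ) * (2 * Δ + D1 + 1) * (16 * (2 * ℓ : ℕ)) ≤ 1
  g4 : (2 * η * kmax + δ) * (32 * Δ) ≤ d0 * ζ
  g5 : 384 * Δ * (Δ + 1) * χ ≤ d0 ^ 2 * ζ

set_option maxHeartbeats 2000000 in
theorem nums2 {α ζ : ℝ} {Δ : ℕ} (C : Cst α ζ Δ) (L x k n τ N1 t0 ty0 r : ℕ) (hL : L = 2 * C.ℓ)
    (hx : 1 ≤ C.δ * x) (hk : k ≤ C.kmax) (hn : (n : ℝ) ≤ (1 + C.δ) * (k * x))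
    (hτ : (τ : ℝ) ≤ 6 * (k * x)) (hr : (r : ℝ) ≤ C.η * n + 1)
    (h1 : (1 - 3 * ζ) * x ≤ L * N1) (h2 : (t0 : ℝ) ≤ (2 * C.ε + C.δ) * x)
    (h3 : (C.d0 * ζ / 2 - C.δ) * x ≤ ty0) :
    ∃ B0 scap capm r0 bd w0 : ℕ, (C.μ * x / 2 ≤ B0 ∧ ((B0 + 1 : ℕ) : ℝ) * C.K ≤ 2 * C.μ * C.K * x) ∧
      (C.d0 * ζ * x ≤ 64 * scap) ∧ C.χ * x ≤ capm ∧
      2 * τ * (C.M * Δ) < (w0 + 1) * (C.D1 + 1) ∧ 1 ≤ r0 ∧ t0 ≤ r0 ∧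
      2 * C.q * (Δ + (C.D1 + Δ)) ≤ r0 ∧ r * (Δ + (C.D1 + Δ) + 1) ≤ r0 ∧ t0 ≤ bd ∧
      2 * C.q * ((Δ + 1) * capm) ≤ bd ∧ r ≤ bd ∧ w0 + r0 ≤ N1 ∧
      2 * (scap + (B0 + 1) * C.K) + w0 + Δ * bd + (Δ + 1) * capm + (C.D1 + Δ) < ty0 := by
  have hxp : (0:ℝ) < x := by
    have := C.hδ
    by_contra h
    have h0 : (x:ℝ) = 0 := le_antisymm (not_lt.1 h) (Nat.cast_nonneg x)
    rw [h0] at hx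
    linarith
  have hLr : (L : ℝ) = (2 * C.ℓ : ℕ) := by rw [hL]
  have hL1 : (1:ℝ) ≤ L := by
    have := C.hℓ
    have : 1 ≤ L := by omega
    exact_mod_cast this
  have hΔ1 : (1:ℝ) ≤ Δ := by exact_mod_cast C.hΔ
  have hd := C.hd0
  have hz := C.hζ
  have hχ := C.hχ
  have hδ := C.hδ
  have hdz : 0 < C.d0 * ζ := by positivity
  -- scaled by x
  have e6 : 64 * Δ * 1 ≤ C.d0 * ζ * x := by
    have := mul_le_mul_of_nonneg_right C.e6 hxp.le
    have := mul_le_mul_of_nonneg_left hx (show (0:ℝ) ≤ 64 * Δ by positivity)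
    linarith
  have hLx : (16 * L : ℝ) ≤ x := by
    have a := mul_le_mul_of_nonneg_right C.g1 hxp.le
    rw [← hLr] at a
    have := mul_le_mul_of_nonneg_left hx (show (0:ℝ) ≤ 16 * L by positivity)
    have : 0 ≤ 16 * L * (2 * C.ε) * (x:ℝ) := by have := C.hε; positivity
    linarith
  obtain ⟨B0, hB0⟩ : ∃ B0, B0 = ⌊C.μ * x⌋₊ := ⟨_, rfl⟩
  obtain ⟨scap, hsc⟩ : ∃ B0, B0 = ⌊C.d0 * ζ * x / 32⌋₊ := ⟨_, rfl⟩
  obtain ⟨capm, hcm⟩ : ∃ B0, B0 = ⌈C.χ * x⌉₊ := ⟨_, rfl⟩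
  obtain ⟨r0, hr0⟩ : ∃ B0, B0 = ⌊(x:ℝ) / (8 * L)⌋₊ := ⟨_, rfl⟩
  obtain ⟨bd, hbd⟩ : ∃ B0, B0 = ⌊C.d0 * ζ * x / (16 * Δ)⌋₊ := ⟨_, rfl⟩
  obtain ⟨w0, hw0⟩ : ∃ B0, B0 = ⌊C.d0 * ζ * x / (16 * L)⌋₊ := ⟨_, rfl⟩
  have fB := flr (show 0 ≤ C.μ * x by have := C.hμ; positivity)
  have fs := flr (show 0 ≤ C.d0 * ζ * x / 32 by positivity)
  have fr := flr (show 0 ≤ (x:ℝ) / (8 * L) by positivity)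
  have fb := flr (show 0 ≤ C.d0 * ζ * x / (16 * Δ) by positivity)
  have fw := flr (show 0 ≤ C.d0 * ζ * x / (16 * L) by positivity)
  have fc1 := Nat.le_ceil (C.χ * x)
  have fc2 := Nat.ceil_lt_add_one (show 0 ≤ C.χ * x by positivity)
  rw [← hB0] at fB; rw [← hsc] at fs; rw [← hr0] at fr; rw [← hbd] at fb; rw [← hw0] at fw
  rw [← hcm] at fc1 fc2
  -- multiplied forms
  have fr1 : 8 * (L * (r0:ℝ)) ≤ x := by
    have := fr.1; rw [le_div_iff₀ (by positivity)] at this; linarith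
  have fr2 : (x:ℝ) ≤ 16 * (L * r0) := by
    have := fr.2; rw [div_le_iff₀ (by positivity)] at this; linarith
  have fb1 : 16 * (Δ * (bd:ℝ)) ≤ C.d0 * ζ * x := by
    have := fb.1; rw [le_div_iff₀ (by positivity)] at this; linarith
  have fb2 : C.d0 * ζ * x ≤ 32 * (Δ * bd) := by
    have := fb.2; rw [div_le_iff₀ (by positivity)] at this; linarith
  have fw1 : 16 * (L * (w0:ℝ)) ≤ C.d0 * ζ * x := by
    have := fw.1; rw [le_div_iff₀ (by positivity)] at this; linarith
  have fw2 : C.d0 * ζ * x ≤ 16 * (L * (w0 + 1)) := by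
    have := fw.2; rw [div_le_iff₀ (by positivity)] at this; linarith
  have hw0' : (w0:ℝ) ≤ L * w0 := le_mul_of_one_le_left (Nat.cast_nonneg _) hL1
  have e5 : (1:ℝ) ≤ C.χ * x := by
    have := mul_le_mul_of_nonneg_right C.e5 hxp.le
    linarith
  have hcapm : (capm:ℝ) ≤ 2 * (C.χ * x) := by linarith
  have rr0 : ∀ y : ℝ, 16 * (L * y) ≤ x → y ≤ r0 := by
    intro y hy
    have : (16 * (L:ℝ)) * y ≤ (16 * L) * r0 := by linarith
    exact le_of_mul_le_mul_left this (by positivity)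
  have bb : ∀ y : ℝ, 32 * (Δ * y) ≤ C.d0 * ζ * x → y ≤ bd := by
    intro y hy
    have : (32 * (Δ:ℝ)) * y ≤ (32 * Δ) * bd := by linarith
    exact le_of_mul_le_mul_left this (by positivity)
  have hrx : (r:ℝ) ≤ (2 * C.η * C.kmax + C.δ) * x := by
    have hη := C.hη
    have a1 : (1 + C.δ) * ((k:ℝ) * x) ≤ 2 * (C.kmax * x) := by
      have b1 : (1 + C.δ) ≤ 2 := by
        have := C.e3; have := C.hζ1; linarith
      have b2 : (k:ℝ) * x ≤ C.kmax * x := mul_le_mul_of_nonneg_right (by exact_mod_cast hk) hxp.le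
      exact mul_le_mul b1 b2 (by positivity) (by norm_num)
    have a2 : C.η * n ≤ C.η * (2 * (C.kmax * x)) := mul_le_mul_of_nonneg_left (by linarith) hη.le
    linarith
  have k4 : (2:ℝ) * τ * (C.M * Δ) < (w0 + 1) * (C.D1 + 1) := by
    have a1 := mul_le_mul_of_nonneg_right C.D2 hxp.le
    rw [← hLr] at a1
    have a2 : (C.D1:ℝ) * (C.d0 * ζ * x) ≤ C.D1 * (16 * (L * (w0 + 1))) :=
      mul_le_mul_of_nonneg_left fw2 (Nat.cast_nonneg _)
    have a3 : (2 * (C.M * Δ) * L : ℝ) * τ ≤ (2 * (C.M * Δ) * L) * (6 * (C.kmax * x)) := by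
      apply mul_le_mul_of_nonneg_left _ (by positivity)
      have b2 : (k:ℝ) * x ≤ C.kmax * x := mul_le_mul_of_nonneg_right (by exact_mod_cast hk) hxp.le
      linarith
    have a4 : (L:ℝ) * (2 * τ * (C.M * Δ)) ≤ L * ((w0 + 1) * C.D1) := by linarith
    have a5 := le_of_mul_le_mul_left a4 (by linarith)
    have : (0:ℝ) ≤ w0 := Nat.cast_nonneg _
    linarith
  have k5 : (1:ℝ) ≤ r0 := rr0 _ (by linarith)
  have k6 : (t0:ℝ) ≤ r0 := by
    apply rr0
    have a1 := mul_le_mul_of_nonneg_right C.g1 hxp.le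
    rw [← hLr] at a1
    have a2 := mul_le_mul_of_nonneg_left h2 (show (0:ℝ) ≤ 16 * L by positivity)
    linarith
  have k7 : (2:ℝ) * C.q * (Δ + (C.D1 + Δ)) ≤ r0 := by
    apply rr0
    have a1 := mul_le_mul_of_nonneg_right C.e8 hxp.le
    rw [← hLr] at a1
    have a2 := mul_le_mul_of_nonneg_left hx (show (0:ℝ) ≤ 2 * C.q * (2 * Δ + C.D1) * (16 * L) by positivity)
    linarith
  have k8 : (r:ℝ) * (Δ + (C.D1 + Δ) + 1) ≤ r0 := by
    apply rr0
    have a1 := mul_le_mul_of_nonneg_right C.g3 hxp.le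
    rw [← hLr] at a1
    have a2 := mul_le_mul_of_nonneg_left hrx (show (0:ℝ) ≤ (2 * Δ + C.D1 + 1) * (16 * L) by positivity)
    linarith
  have k9 : (t0:ℝ) ≤ bd := by
    apply bb
    have a1 := mul_le_mul_of_nonneg_right C.g2 hxp.le
    have a2 := mul_le_mul_of_nonneg_left h2 (show (0:ℝ) ≤ 32 * Δ by positivity)
    linarith
  have k10 : (2:ℝ) * C.q * ((Δ + 1) * capm) ≤ bd := by
    apply bb
    have a1 := mul_le_mul_of_nonneg_right C.g5 hxp.le
    have a2 : (C.d0 * C.q) * ((Δ + 1) * capm) ≤ 3 * ((Δ + 1) * (2 * (C.χ * x))) := by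
      apply mul_le_mul _ _ (by positivity) (by norm_num)
      · have := C.q2; linarith
      · exact mul_le_mul_of_nonneg_left hcapm (by positivity)
    have a3 := mul_le_mul_of_nonneg_left a2 (show (0:ℝ) ≤ 64 * Δ by positivity)
    have a4 : C.d0 * (32 * (Δ * (2 * C.q * ((Δ + 1) * capm)))) ≤ C.d0 * (C.d0 * ζ * x) := by linarith
    exact le_of_mul_le_mul_left a4 hd
  have k11 : (r:ℝ) ≤ bd := by
    apply bb
    have a1 := mul_le_mul_of_nonneg_right C.g4 hxp.le
    have a2 := mul_le_mul_of_nonneg_left hrx (show (0:ℝ) ≤ 32 * Δ by positivity)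
    linarith
  have hζ1 := C.hζ1
  have dz1 : C.d0 * ζ * x ≤ x := by
    have a1 : C.d0 * ζ ≤ 1 * 1 := mul_le_mul C.hd1 (by linarith) hz.le (by norm_num)
    have := mul_le_mul_of_nonneg_right a1 hxp.le
    linarith
  have k12 : (w0:ℝ) + r0 ≤ N1 := by
    have a0 : 40 * ζ * x ≤ 1 * x := mul_le_mul_of_nonneg_right hζ1 hxp.le
    have a1 : (L:ℝ) * (w0 + r0) ≤ L * N1 := by linarith
    exact le_of_mul_le_mul_left a1 (by linarith)
  have e4 : (2:ℝ) ≤ C.μ * x := by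
    have := mul_le_mul_of_nonneg_right C.e4 hxp.le
    linarith
  have kB : ((B0:ℝ) + 1) * C.K ≤ 2 * C.μ * C.K * x := by
    have a1 : (B0:ℝ) + 1 ≤ 2 * (C.μ * x) := by linarith
    have := mul_le_mul_of_nonneg_right a1 (Nat.cast_nonneg C.K)
    linarith
  have k13 : (2:ℝ) * (scap + (B0 + 1) * C.K) + w0 + Δ * bd + (Δ + 1) * capm + (C.D1 + Δ) < ty0 := by
    have a2 := mul_le_mul_of_nonneg_right C.m2 hxp.le
    have a3 : 32 * ((Δ + 1) * (capm:ℝ)) ≤ C.d0 * ζ * x := by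
      have b0 := mul_le_mul_of_nonneg_left hcapm (show (0:ℝ) ≤ 32 * (Δ + 1) by positivity)
      have b1 := mul_le_mul_of_nonneg_right C.g5 hxp.le
      have b2 : C.d0 ^ 2 * ζ * x ≤ C.d0 * ζ * x := by
        have := mul_le_mul_of_nonneg_right C.hd1 (show 0 ≤ C.d0 * ζ * x by positivity)
        linarith
      have b3 : (384 * 1) * ((Δ + 1) * C.χ * x) ≤ 384 * Δ * ((Δ + 1) * C.χ * x) :=
        mul_le_mul_of_nonneg_right (by linarith) (by positivity)
      have b4 : 0 ≤ (Δ + 1) * C.χ * (x:ℝ) := by positivity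
      linarith
    have a4 : 16 * ((C.D1:ℝ) + Δ) ≤ C.d0 * ζ * x := by
      have b1 := mul_le_mul_of_nonneg_right C.e7 hxp.le
      have b2 := mul_le_mul_of_nonneg_left hx (show (0:ℝ) ≤ 16 * (C.D1 + Δ) by positivity)
      linarith
    have a5 : 64 * (C.δ * x) ≤ C.d0 * ζ * x := by
      have b1 := mul_le_mul_of_nonneg_right C.e6 hxp.le
      have b2 := mul_le_mul_of_nonneg_right hΔ1 (show 0 ≤ 64 * (C.δ * x) by positivity)
      linarith
    have a6 : 0 < C.d0 * ζ * x := by positivity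
    linarith
  refine ⟨B0, scap, capm, r0, bd, w0, ⟨by linarith, ?_⟩, by linarith, fc1, ?_, ?_, ?_, ?_, ?_, ?_, ?_, ?_, ?_, ?_⟩
  · push_cast; exact kB
  · exact_mod_cast k4
  · exact_mod_cast k5
  · exact_mod_cast k6
  · exact_mod_cast k7
  · exact_mod_cast k8
  · exact_mod_cast k9
  · exact_mod_cast k10
  · exact_mod_cast k11
  · exact_mod_cast k12
  · exact_mod_cast k13

end

section

set_option linter.unusedSectionVars false
set_option linter.unusedVariables false

open Classical in
theorem mkd_count {Δ K : ℕ} {𝔹 : Type} (P : PTree Δ) (D : TD P K 𝔹) :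
    ((Finset.range P.m).filter (fun v => ¬ D.cut v ∧ Mkd D v)).card ≤
      1 + (Δ + 1) * ((Finset.range P.m).filter (fun v => D.cut v)).card := by
  have hsub : (Finset.range P.m).filter (fun v => ¬ D.cut v ∧ Mkd D v) ⊆
      ({0} : Finset ℕ) ∪ ((((Finset.range P.m).filter (fun v => D.cut v)).biUnion
        (fun u => (Finset.range P.m).filter (fun v => 1 ≤ v ∧ P.p v = u))) ∪
        ((Finset.range P.m).filter (fun v => D.cut v)).image P.p) := by
    intro v hv
    obtain ⟨h1, h2, h3⟩ := Finset.mem_filter.1 hv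
    rw [Finset.mem_union, Finset.mem_union, Finset.mem_singleton]
    have hvm := Finset.mem_range.1 h1
    rcases Nat.eq_zero_or_pos v with h0 | h0
    · exact Or.inl h0
    · right
      rcases h3 with (h3 | h3) | ⟨s, hs, hs1, hs2, hs3⟩
      · omega
      · left
        have := P.hp v h0
        refine Finset.mem_biUnion.2 ⟨P.p v, Finset.mem_filter.2 ⟨Finset.mem_range.2 (by omega), h3⟩,
          Finset.mem_filter.2 ⟨h1, h0, rfl⟩⟩
      · right
        exact Finset.mem_image.2 ⟨s, Finset.mem_filter.2 ⟨Finset.mem_range.2 hs, hs2⟩, hs3⟩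
  refine (Finset.card_le_card hsub).trans ?_
  refine (Finset.card_union_le _ _).trans ?_
  rw [Finset.card_singleton]
  apply Nat.add_le_add_left
  refine (Finset.card_union_le _ _).trans ?_
  have h1 := Finset.card_biUnion_le_card_mul ((Finset.range P.m).filter (fun v => D.cut v))
    (fun u => (Finset.range P.m).filter (fun v => 1 ≤ v ∧ P.p v = u)) Δ (fun u _ => by
      convert P.hch u)
  have h2 := Finset.card_image_le (s := (Finset.range P.m).filter (fun v => D.cut v)) (f := P.p)
  have h3 : (Δ + 1) * ((Finset.range P.m).filter (fun v => D.cut v)).card =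
    ((Finset.range P.m).filter (fun v => D.cut v)).card * Δ +
      ((Finset.range P.m).filter (fun v => D.cut v)).card := by ring
  rw [h3]
  exact Nat.add_le_add h1 h2

theorem side_count (ℓ : ℕ) [NeZero ℓ] (o : Bool) :
    ℓ ≤ (Finset.univ.filter (fun l : ZMod 2 × ZMod ℓ => decide (l.1 = 0) = o)).card := by
  classical
  have h : ((Finset.univ : Finset (ZMod ℓ)).image (fun j => ((if o then (0 : ZMod 2) else 1), j))).card = ℓ := by
    rw [Finset.card_image_of_injective _ (fun a b h => (Prod.mk.inj h).2), Finset.card_univ, ZMod.card]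
  conv_lhs => rw [← h]
  apply Finset.card_le_card
  intro l hl
  obtain ⟨j, -, rfl⟩ := Finset.mem_image.1 hl
  refine Finset.mem_filter.2 ⟨Finset.mem_univ _, ?_⟩
  cases o <;> simp

theorem ceil_mul (a N : ℕ) (hN : 0 < N) : ∃ E, a ≤ N * E ∧ N * E ≤ a + N := by
  refine ⟨a / N + 1, ?_, ?_⟩
  · have := Nat.div_add_mod a N
    have := Nat.mod_lt a hN
    rw [mul_add]; omega
  · have := Nat.div_mul_le_self a N
    rw [mul_add, mul_comm]; omega

end

section

set_option linter.unusedSectionVars false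
set_option linter.unusedVariables false

theorem cap_num (ζ x : ℝ) (N1 ℓ B T : ℕ) (hζ : 0 < ζ) (hζ1 : 40 * ζ ≤ 1) (hx : 0 < x)
    (h1 : (1 - 3 * ζ) * x ≤ (2 * ℓ : ℕ) * (N1:ℝ)) (h2 : (2 * ℓ : ℕ) * (N1:ℝ) ≤ x) (hB : 2 * (B:ℝ) ≤ ζ * x)
    (hT : 2 * (T:ℝ) ≤ ζ * x) :
    ∃ cap : ℕ, cap + 2 * B + 2 * T = 2 * (N1 * ℓ) ∧ (1 - 5 * ζ) * x ≤ cap ∧ (cap:ℝ) ≤ x := by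
  push_cast at h1 h2
  have hle : (B:ℝ) + T ≤ N1 * ℓ := by
    have := mul_le_mul_of_nonneg_right hζ1 hx.le
    linarith
  have hle' : B + T ≤ N1 * ℓ := by exact_mod_cast hle
  obtain ⟨e, he⟩ := Nat.exists_eq_add_of_le hle'
  have he' : (N1:ℝ) * ℓ = B + T + e := by exact_mod_cast he
  refine ⟨2 * e, by omega, ?_, ?_⟩
  · push_cast; linarith
  · push_cast
    have : (0:ℝ) ≤ B := Nat.cast_nonneg _
    have : (0:ℝ) ≤ T := Nat.cast_nonneg _
    linarith

theorem host_bounds {α ζ : ℝ} {Δ : ℕ} (C : Cst α ζ Δ) (k n x : ℕ) (hk1 : 1 ≤ k) (hx : x = n / k)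
    (hδx : 1 ≤ C.δ * x) (S : ℝ) (hS : S ≤ (1 - 40 * ζ) * ((α + 2 * C.ξ) * (n * n) / 2)) :
    (n:ℝ) ≤ (1 + C.δ) * (k * x) ∧ S ≤ (1 - 30 * ζ) * α * (k * k) * (x * x) / 2 ∧
    (∀ m : ℝ, m ≤ (1 - 40 * ζ) * n + 1 → m ≤ (1 - 20 * ζ) * (k * x)) ∧
    (∀ t : ℝ, t ≤ 3 * n → t ≤ 6 * (k * x)) := by
  have hδ := C.hδ
  have hζ := C.hζ
  have hζ1 := C.hζ1
  have e3 := C.e3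
  have hα := C.hα
  have hk : (1:ℝ) ≤ k := by exact_mod_cast hk1
  have hxp : (0:ℝ) ≤ x := Nat.cast_nonneg _
  have hn : (n:ℝ) ≤ (1 + C.δ) * (k * x) := by
    have h1 : n < k * (x + 1) := by
      rw [hx, mul_comm]
      exact Nat.lt_mul_of_div_lt (Nat.lt_succ_self _) (by omega)
    have h2 : (n:ℝ) ≤ k * (x + 1) := by exact_mod_cast h1.le
    have h3 := mul_le_mul_of_nonneg_left hδx (show (0:ℝ) ≤ k by linarith)
    linarith
  obtain ⟨y, hy⟩ : ∃ y : ℝ, y = k * x := ⟨_, rfl⟩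
  have hy0 : 0 ≤ y := by rw [hy]; positivity
  have hδy : 1 ≤ C.δ * y := by
    have := mul_le_mul_of_nonneg_right hk (show 0 ≤ C.δ * x by positivity)
    rw [hy]; linarith
  rw [← hy] at hn ⊢
  have hn2 : (n:ℝ) ≤ (1 + ζ) * y := by
    have := mul_le_mul_of_nonneg_right e3 hy0
    linarith
  have hn0 : (0:ℝ) ≤ n := Nat.cast_nonneg _
  have hζy := mul_le_mul_of_nonneg_right e3 hy0
  refine ⟨hn, ?_, ?_, ?_⟩
  · have a1 : α + 2 * C.ξ ≤ (1 + ζ) * α := by have := C.x2; linarith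
    have a2 : (n:ℝ) * n ≤ ((1 + ζ) * y) * ((1 + ζ) * y) := mul_le_mul hn2 hn2 hn0 (by positivity)
    have a3 : (α + 2 * C.ξ) * (n * n) ≤ ((1 + ζ) * α) * (((1 + ζ) * y) * ((1 + ζ) * y)) :=
      mul_le_mul a1 a2 (by positivity) (by positivity)
    have a4 := mul_le_mul_of_nonneg_left a3 (show 0 ≤ 1 - 40 * ζ by linarith)
    have a5 : (1 - 40 * ζ) * ((1 + ζ) * (1 + ζ) * (1 + ζ)) ≤ 1 - 30 * ζ := by
      have b1 : ζ * (40 * ζ) ≤ ζ * 1 := mul_le_mul_of_nonneg_left hζ1 hζ.le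
      have b2 : 0 ≤ ζ * ζ * ζ := by positivity
      have b3 : 0 ≤ ζ * ζ * ζ * ζ := by positivity
      have b4 : ζ * ζ * (40 * ζ) ≤ ζ * ζ * 1 := mul_le_mul_of_nonneg_left hζ1 (by positivity)
      nlinarith
    have a6 := mul_le_mul_of_nonneg_right a5 (show 0 ≤ α * (y * y) by positivity)
    have a7 : (1 - 30 * ζ) * α * (k * k) * (x * x) / 2 = (1 - 30 * ζ) * (α * (y * y)) / 2 := by
      rw [hy]; ring
    rw [a7]
    linarith
  · intro m hm
    have a1 := mul_le_mul_of_nonneg_left hn2 (show 0 ≤ 1 - 40 * ζ by linarith)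
    have a2 : 0 ≤ ζ * ζ * y := by positivity
    have a3 : 0 ≤ ζ * y := by positivity
    linarith
  · intro t ht
    have := mul_le_mul_of_nonneg_right hζ1 hy0
    have : 0 ≤ ζ * y := by positivity
    linarith

set_option maxHeartbeats 2000000 in
open Classical in
theorem core_pack {α ζ : ℝ} {Δ : ℕ} (C : Cst α ζ Δ) (n : ℕ) (hn1 : 1 ≤ C.δ * (n / C.kmax : ℕ))
    (hn2 : C.kmax * ⌈1 / C.ξ⌉₊ ≤ n) (hn3 : C.l ≤ n) (G : SimpleGraph (Fin n))
    (Bad : Finset (Fin n)) (hB : (Bad.card : ℝ) ≤ C.ξ * n)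
    (hb : ∀ v, v ∉ Bad → (α - C.ξ) * n ≤ dg G v ∧ (dg G v : ℝ) ≤ (α + C.ξ) * n)
    (r : ℕ) (hr : (r:ℝ) ≤ C.η * n + 1)
    (hole : ∀ S T : Finset (Fin n), Disjoint S T → S.card = r → T.card = r → ∃ a ∈ S, ∃ b ∈ T, G.Adj a b)
    {τ : ℕ} (P : Fin τ → PTree Δ) (hτ : (τ : ℝ) ≤ 3 * n)
    (hm : ∀ i, ((P i).m : ℝ) ≤ (1 - 40 * ζ) * n + 1)
    (hS : ((∑ i, ((P i).m - 1) : ℕ) : ℝ) ≤ (1 - 40 * ζ) * ((α + 2 * C.ξ) * (n * n) / 2)) :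
    ∃ φ : Fin τ → ℕ → Fin n, (∀ i, ∀ v < (P i).m, ∀ v' < (P i).m, φ i v = φ i v' → v = v') ∧
      (∀ i, ∀ v < (P i).m, 1 ≤ v → G.Adj (φ i ((P i).p v)) (φ i v)) ∧
      (∀ i i', i ≠ i' → ∀ v < (P i).m, 1 ≤ v → ∀ v' < (P i').m, 1 ≤ v' →
        s(φ i ((P i).p v), φ i v) ≠ s(φ i' ((P i').p v'), φ i' v')) := by
  have hα := C.hα
  have hζ := C.hζ
  have hζ1 := C.hζ1
  have hd0 := C.hd0
  have hδ := C.hδ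
  have hχ := C.hχ
  have hε := C.hε
  have hε2 : C.ε ≤ C.d0 := by have := C.c6; linarith
  have hkm := C.hkmax
  rw [hkm] at hn2
  obtain ⟨G', hG', k, hlk, hk1, hkb, Pt, hPd, hPc, w, wsym, wdiag, hw, kb, hkbz, c, A, A1, A2, A3, hkb1, hkb2,
    hc1, hc2⟩ := reduced α C.ξ C.ε C.d0 ζ C.l C.hξ C.x1 C.hα1 C.x3 hε hε2 C.hd1 C.hl hζ
      (by linarith) hn2 hn3 G Bad hB hb
  rw [← hkm] at hkb
  obtain ⟨x, hx⟩ : ∃ x, x = n / k := ⟨_, rfl⟩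
  rw [← hx] at hPc
  have hδx : 1 ≤ C.δ * (x:ℝ) := by
    have h1 : n / C.kmax ≤ x := by rw [hx]; exact Nat.div_le_div_left hkb (by omega)
    have h2 : ((n / C.kmax : ℕ) : ℝ) ≤ x := by exact_mod_cast h1
    have := mul_le_mul_of_nonneg_left h2 hδ.le
    linarith
  have hxp : (0:ℝ) < x := by
    by_contra h
    have h0 : (x:ℝ) = 0 := le_antisymm (not_lt.1 h) (Nat.cast_nonneg x)
    rw [h0] at hδx
    linarith
  obtain ⟨bn, bS, bm, bτ⟩ := host_bounds C k n x hk1 hx hδx _ hS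
  have bτ := bτ _ hτ
  have bm := fun i => bm _ (hm i)
  have hk1r : (1:ℝ) ≤ k := by exact_mod_cast hk1
  have hkx : (0:ℝ) < k * x := by positivity
  have : NeZero C.ℓ := ⟨by have := C.hℓ; omega⟩
  obtain ⟨L, hL⟩ : ∃ L, L = 2 * C.ℓ := ⟨_, rfl⟩
  have hL1 : 1 ≤ L := by have := C.hℓ; omega
  have hL1r : (1:ℝ) ≤ L := by exact_mod_cast hL1
  have hcL : Fintype.card (ZMod 2 × ZMod C.ℓ) = L := by
    rw [Fintype.card_prod, ZMod.card, ZMod.card, hL]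
  obtain ⟨N, fk, N1, z, t0, ty0, capo, s1, s2, s3, s4, s5, s6, s7, s8, s9, s10, s11, s12, s13, s14, s15,
    s16, s17⟩ := nums1 ζ C.d0 C.ε C.ε₁ C.δ L C.K x hL1 hζ hζ1 hd0 C.hd1 hε C.hε₁ C.hKe hδx hδ
      (by rw [hL]; exact C.c1) (by rw [hL]; exact C.c2) (by rw [hL]; exact C.c3) C.c3'
      (by rw [hL]; exact C.c4) C.c5 C.c6
  obtain ⟨B0, scap, capm, r0, bd, w0, ⟨b1, b2⟩, b3, b4, b5, b6, b7, b8, b9, b10, b11, b12, b13, b14⟩ :=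
    nums2 C L x k n τ N1 t0 ty0 r hL hδx hkb bn bτ hr s13 s15 s16
  have n6 : 1 ≤ (C.d0 - C.ε) * C.q := by
    have h1 := C.q1
    have h2 := mul_le_mul_of_nonneg_right C.c6 (Nat.cast_nonneg (α := ℝ) C.q)
    linarith
  obtain ⟨vx, Z, Q, Rl, hH⟩ := host_of (Λ := ZMod 2 × ZMod C.ℓ) hG' Pt hPd x (x + 1) C.ε C.d0 hε
    (fun a => (hPc a).1) (fun a => by exact_mod_cast (hPc a).2) w wsym wdiag hw A A1 A2 A3 N z capo fk ty0 t0 C.q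
    s1 s2 s3 (by rw [hcL]; exact s4) s7 s8 s9 s10 s11 n6 s12
  have hckb := ckb_num α ζ C.d0 k kb c hα hζ hζ1 hd0 (by linarith) C.d12 hkb1 hc1
  have hc0 : 0 < c := by
    rcases Nat.eq_zero_or_pos c with h | h
    · rw [h] at hckb
      have : 0 < (1 - 2 * ζ) * (α * (k * k)) := mul_pos (by linarith) (by positivity)
      norm_num at hckb
      linarith
    · exact h
  have : Nonempty (Fin c) := ⟨⟨0, hc0⟩⟩
  -- tree decompositions
  obtain ⟨B, hBd⟩ : ∃ B, B = (B0 + 1) * C.K := ⟨_, rfl⟩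
  obtain ⟨T, hT⟩ : ∃ T, T = 2 * N1 * C.K * Fintype.card (Code C.K) := ⟨_, rfl⟩
  have hBr : (B:ℝ) = ((B0 + 1 : ℕ) : ℝ) * C.K := by rw [hBd]; push_cast; ring
  have hB2 : 2 * (B:ℝ) ≤ ζ * x := by
    have a1 := mul_le_mul_of_nonneg_right C.m2 hxp.le
    have a2 : C.d0 * ζ * x ≤ 1 * (ζ * x) := by
      rw [mul_assoc]; exact mul_le_mul_of_nonneg_right C.hd1 (by positivity)
    have a3 : 0 < ζ * x := by positivity
    rw [hBr]
    linarith
  have hcl1 := C.l1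
  rw [← hL] at hcl1
  have hcl2 := C.l2
  rw [← hL] at hcl2
  have hT2 : 2 * (T:ℝ) ≤ ζ * x := by
    have a0 : ζ * α * L ≤ ζ * 1 * L :=
      mul_le_mul_of_nonneg_right (mul_le_mul_of_nonneg_left C.hα1 hζ.le) (by linarith)
    have a1 := mul_le_mul_of_nonneg_right (hcl1.trans a0) (Nat.cast_nonneg (α := ℝ) N1)
    have a2 := mul_le_mul_of_nonneg_left s14 hζ.le
    have a3 : 0 < ζ * x := by positivity
    have : (T:ℝ) = 2 * N1 * C.K * Fintype.card (Code C.K) := by rw [hT]; push_cast; ring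
    rw [this]
    linarith
  obtain ⟨cap, hcap1, hcap2, hcap3⟩ := cap_num ζ x N1 C.ℓ B T hζ hζ1 hxp (by rw [← hL]; exact s13)
    (by rw [← hL]; exact s14) hB2 hT2
  have htd : ∀ i, ∃ D : TD (P i) C.K (ZMod kb),
      (∀ b o, 2 * ((Finset.range (P i).m).filter (fun v => ¬ D.cut v ∧ D.bin v = b ∧ D.side v = o)).card
        ≤ cap + 2 * B) ∧
      (∀ b, ((Finset.range (P i).m).filter (fun v => D.cut v ∧ D.bin v = b)).card ≤ scap + B) ∧
      ((Finset.range (P i).m).filter (fun v => D.spc v)).card * B0 ≤ (P i).m ∧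
      ((Finset.range (P i).m).filter (fun v => D.cut v)).card * C.H ≤ (P i).m := by
    intro i
    have h0 := hcap_num ζ C.d0 x k kb (P i).m scap cap C.H hζ hζ1 hd0 hxp (by linarith)
      (Nat.cast_nonneg _) C.H1 (Nat.cast_nonneg _) (bm i) hkb1 hcap2 hcap3 b3
    have h0' : (P i).m * scap * C.H + (P i).m * cap < kb * (cap * scap) * C.H := by exact_mod_cast h0
    have := exists_td (P i) (C.H + 1) B0 (by have := C.hH; omega) (ZMod kb) cap scap B
      (by rw [hBd, C.hK]) (by rw [ZMod.card, Nat.add_sub_cancel]; exact h0')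
    rw [← C.hK, Nat.add_sub_cancel] at this
    obtain ⟨D, d1, d2, d3, d4⟩ := this
    refine ⟨D, ?_, ?_, d3, d4⟩
    · intro b o; convert d1 b o
    · intro b; convert d2 b
  choose D d1 d2 d3 d4 using htd
  have hMb : ∀ i, ((Finset.range (P i).m).filter (fun v => (D i).spc v)).card ≤ C.M := by
    intro i
    have e1 : (((Finset.range (P i).m).filter (fun v => (D i).spc v)).card : ℝ) * B0 ≤ (P i).m := by
      exact_mod_cast d3 i
    obtain ⟨s, hs⟩ : ∃ s, s = ((Finset.range (P i).m).filter (fun v => (D i).spc v)).card := ⟨_, rfl⟩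
    rw [← hs] at e1 ⊢
    have e2 : (s:ℝ) * (C.μ * x / 2) ≤ s * B0 := mul_le_mul_of_nonneg_left b1 (Nat.cast_nonneg _)
    have e3 : ((P i).m : ℝ) ≤ k * x := by
      have := bm i
      have : 0 ≤ ζ * (k * x) := by positivity
      linarith
    have e4 : (k:ℝ) * x ≤ C.kmax * x := mul_le_mul_of_nonneg_right (by exact_mod_cast hkb) hxp.le
    have e5 := mul_le_mul_of_nonneg_right C.m1 hxp.le
    have hμ := C.hμ
    have e6 : (C.μ * x) * (s:ℝ) ≤ (C.μ * x) * C.M := by linarith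
    exact_mod_cast le_of_mul_le_mul_left e6 (by positivity)
  -- edges
  obtain ⟨S, hSd⟩ : ∃ S, S = ∑ i, ((P i).m - 1) := ⟨_, rfl⟩
  rw [← hSd] at bS
  obtain ⟨W, hW⟩ : ∃ W, W = ∑ i, ((Finset.range (P i).m).filter (fun v => ¬ (D i).cut v ∧ Mkd (D i) v)).card :=
    ⟨_, rfl⟩
  have hWb : (W:ℝ) ≤ α * C.χ * (k * k) * (x * x) / 12 := by
    have hH0 : (0:ℝ) < C.H := by exact_mod_cast C.hH
    have e1 : ∀ i, C.H * ((Finset.range (P i).m).filter (fun v => ¬ (D i).cut v ∧ Mkd (D i) v)).card ≤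
        C.H + (Δ + 1) * (P i).m := by
      intro i
      have f1 := Nat.mul_le_mul_left C.H (mkd_count (P i) (D i))
      have f2 := Nat.mul_le_mul_left (Δ + 1) (d4 i)
      refine f1.trans ?_
      rw [mul_add, mul_one]
      refine Nat.add_le_add_left (le_trans (le_of_eq ?_) f2) _
      ring
    have e2 : (C.H:ℝ) * W ≤ τ * (C.H + (Δ + 1) * (k * x)) := by
      rw [hW]
      push_cast
      rw [Finset.mul_sum]
      have : ∀ i ∈ (Finset.univ : Finset (Fin τ)), (C.H:ℝ) * (((Finset.range (P i).m).filter (fun v => ¬ (D i).cut v ∧ Mkd (D i) v)).card : ℝ) ≤ C.H + (Δ + 1) * (k * x) := by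
        intro i _
        have f1 : (C.H:ℝ) * (((Finset.range (P i).m).filter (fun v => ¬ (D i).cut v ∧ Mkd (D i) v)).card : ℝ) ≤ C.H + (Δ + 1) * (P i).m := by exact_mod_cast e1 i
        have e3 : ((P i).m : ℝ) ≤ k * x := by
          have := bm i
          have : 0 ≤ ζ * (k * x) := by positivity
          linarith
        have := mul_le_mul_of_nonneg_left e3 (show (0:ℝ) ≤ Δ + 1 by positivity)
        linarith
      refine (Finset.sum_le_sum this).trans (le_of_eq ?_)
      rw [Finset.sum_const, Finset.card_univ, Fintype.card_fin, nsmul_eq_mul]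
    have e3 : (τ:ℝ) * (C.H + (Δ + 1) * (k * x)) ≤ 6 * (k * x) * (C.H + (Δ + 1) * (k * x)) :=
      mul_le_mul_of_nonneg_right bτ (by positivity)
    have e4 := mul_le_mul_of_nonneg_right C.H2 (show (0:ℝ) ≤ (k * x) * (k * x) by positivity)
    have e5 : (k * x : ℝ) * 1 ≤ (k * x) * (C.δ * (k * x)) := by
      apply mul_le_mul_of_nonneg_left _ hkx.le
      have := mul_le_mul_of_nonneg_right hk1r (show 0 ≤ C.δ * x by positivity)
      linarith
    have e6 := mul_le_mul_of_nonneg_right C.e1 (show (0:ℝ) ≤ (k * x) * (k * x) by positivity)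
    have e7 := mul_le_mul_of_nonneg_left e5 hH0.le
    have e8 := mul_le_mul_of_nonneg_left e6 hH0.le
    have e9 : (C.H:ℝ) * W ≤ C.H * (α * C.χ * (k * k) * (x * x) / 12) := by linarith
    exact le_of_mul_le_mul_left e9 hH0
  have hcB : Fintype.card (ZMod kb) = kb := ZMod.card kb
  obtain ⟨E, hE1, hE2⟩ := ceil_mul (S + τ * (kb * (2 * N1 * C.K * Fintype.card (Code C.K)))) N1 s6
  obtain ⟨Mk, hM1, hM2⟩ := ceil_mul (W + τ * (kb * (2 * N1 * C.K * Fintype.card (Code C.K)))) N1 s6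
  obtain ⟨R, hR⟩ : ∃ R, R = Fintype.card (ZMod kb → ZMod 2 × ZMod C.ℓ → Option (ZMod 2 × ZMod C.ℓ) × Bool) *
    Fintype.card (Fin c × ZMod kb × (Fin k → ZMod 2 × ZMod C.ℓ)) := ⟨_, rfl⟩
  have hRm : R ≤ C.Rmax := by
    rw [hR]
    simp only [Fintype.card_fun, Fintype.card_prod, Fintype.card_option, Fintype.card_bool,
      Fintype.card_fin, ZMod.card]
    exact C.R3 k kb c hkb (hkb2.trans hkb) hc2
  have hRmr : (R:ℝ) ≤ C.Rmax := by exact_mod_cast hRm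
  have hN1r : (0:ℝ) < N1 := by exact_mod_cast s6
  have hkb2r : (kb:ℝ) ≤ k := by exact_mod_cast hkb2
  have hR1 : 4 * L * R * C.δ ≤ ζ * C.d0 := by
    refine le_trans ?_ C.R1
    rw [← hL]
    exact mul_le_mul_of_nonneg_right (mul_le_mul_of_nonneg_left hRmr (by linarith)) hδ.le
  have hR2 : 2 * R * C.δ ≤ C.χ := by
    refine le_trans ?_ C.R2
    exact mul_le_mul_of_nonneg_right (mul_le_mul_of_nonneg_left hRmr (by norm_num)) hδ.le
  have I2 := I2_num α ζ C.d0 C.δ x k kb c L N1 E R S τ C.K (Fintype.card (Code C.K)) capo hα hζ hζ1 hd0 hxp hk1r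
    hL1r hN1r (Nat.cast_nonneg _) (Nat.cast_nonneg _) (Nat.cast_nonneg _) (Nat.cast_nonneg _)
    (Nat.cast_nonneg _) hδx C.e2 hckb hkb2r bS bτ s13 s14 s17 (by linarith) hR1 (Nat.cast_nonneg _)
    (by exact_mod_cast hE2)
  have I2' : E + R * (c * kb * (L * L)) ≤ c * kb * (L * L) * capo := by exact_mod_cast I2
  obtain ⟨wmax, hwm⟩ : ∃ w, w = ⌊1 / C.d0⌋₊ := ⟨_, rfl⟩
  have hwm1 : C.d0 * wmax ≤ 1 := by
    have := (flr (show 0 ≤ 1 / C.d0 by positivity)).1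
    rw [← hwm, le_div_iff₀ hd0] at this
    linarith
  have hwle : ∀ a b, w a b ≤ wmax := by
    intro a b
    rcases Nat.eq_zero_or_pos (w a b) with h | h
    · omega
    · have h1 := (hw a b h).2
      have h2 : ((G'.edgeDensity (Pt a) (Pt b) : ℚ) : ℝ) ≤ 1 := by
        exact_mod_cast G'.edgeDensity_le_one (Pt a) (Pt b)
      rw [hwm]
      apply Nat.le_floor
      rw [le_div_iff₀ hd0]
      linarith
  have I3 := I3_num α ζ C.d0 C.δ C.χ x k kb c L N1 Mk R W τ C.K (Fintype.card (Code C.K)) capm wmax hα hζ hζ1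
    hd0 hxp hχ hk1r
    hL1r hN1r (Nat.cast_nonneg _) (Nat.cast_nonneg _) (Nat.cast_nonneg _) (Nat.cast_nonneg _)
    (Nat.cast_nonneg _) hwm1 (Nat.cast_nonneg _) hδx (by have := C.e1; linarith) hckb hkb2r hWb bτ s13 s14 b4 hcl2 hR2 (Nat.cast_nonneg _)
    (by exact_mod_cast hM2)
  have I3' : wmax * Mk + R * (c * kb * L) ≤ c * kb * L * capm := by exact_mod_cast I3
  have I1 : ∀ i β o, ((Finset.range (P i).m).filter (fun v => ¬ (D i).cut v ∧ (D i).bin v = β ∧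
      (D i).side v = o)).card + 2 * N1 * C.K * Fintype.card (Code C.K) ≤ N1 * C.ℓ := by
    intro i β o
    have := d1 i β o
    rw [← hT]
    omega
  obtain ⟨Cell, A', ty, Cop, al⟩ := trees_AL hH (fun l => decide (l.1 = 0)) P D N1 C.ℓ s6
    (fun o => by convert side_count C.ℓ o) s5 (fun i β o => by convert I1 i β o) capm wmax R E Mk hwle
    (by rw [hR]; congr!) (by rw [hcB, ← hSd]; exact hE1) (by rw [hcB, ← hW]; exact hM1)
    (by rw [hcB, hcL, Fintype.card_fin]; exact I2') (by rw [hcB, hcL, Fintype.card_fin]; exact I3')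
  have : Nonempty (Fin n) := by
    have : 0 < n := by
      rcases Nat.eq_zero_or_pos n with h | h
      · exfalso
        rw [h, Nat.zero_div] at hx
        rw [hx] at hxp
        norm_num at hxp
      · exact h
    exact ⟨⟨0, this⟩⟩
  exact al_pack al C.D1 r r0 bd w0 (scap + B) C.M C.hΔ hole hMb (fun i β => by convert d2 i β) b5 b6 b7 b8 b9 b10 b11 b12 b13
    (by rw [hBd]; exact b14)

end

section

set_option linter.unusedSectionVars false
set_option linter.unusedVariables false

theorem small_ev (a b : ℝ) (hb : 0 < b) : ∀ᶠ t in nhdsWithin (0:ℝ) (Set.Ioi 0), a * t ≤ b := by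
  have h : Filter.Tendsto (fun t : ℝ => a * t) (nhdsWithin (0:ℝ) (Set.Ioi 0)) (nhds (a * 0)) :=
    ((continuous_const.mul continuous_id).tendsto 0).mono_left nhdsWithin_le_nhds
  rw [mul_zero] at h
  exact (h.eventually (gt_mem_nhds hb)).mono (fun t ht => le_of_lt ht)

theorem small_pos : ∀ᶠ t in nhdsWithin (0:ℝ) (Set.Ioi 0), 0 < t := self_mem_nhdsWithin

theorem big_nat (a b : ℝ) (ha : 0 < a) : ∃ N : ℕ, b ≤ a * N := by
  obtain ⟨N, hN⟩ := exists_nat_ge (b / a)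
  exact ⟨N, by rw [div_le_iff₀ ha] at hN; linarith⟩

set_option maxHeartbeats 2000000 in
theorem exists_cst (α ζ : ℝ) (Δ : ℕ) (hα : 0 < α) (hα1 : α ≤ 1) (hζ : 0 < ζ) (hζ1 : 40 * ζ ≤ 1) (hΔ : 1 ≤ Δ) :
    Nonempty (Cst α ζ Δ) := by
  have hΔr : (1:ℝ) ≤ Δ := by exact_mod_cast hΔ
  obtain ⟨d0, hd⟩ : ∃ d : ℝ, d = α * ζ ^ 2 / 12 := ⟨_, rfl⟩
  have hd0 : 0 < d0 := by rw [hd]; positivity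
  have hd1 : d0 ≤ 1 := by
    have h1 : ζ ^ 2 ≤ 1 := by rw [sq]; exact mul_le_one₀ (by linarith) hζ.le (by linarith)
    have h2 : α * ζ ^ 2 ≤ 1 := mul_le_one₀ hα1 (by positivity) h1
    rw [hd]; linarith
  obtain ⟨χ, hχd⟩ : ∃ d : ℝ, d = d0 ^ 2 * ζ / (384 * Δ * (Δ + 1)) := ⟨_, rfl⟩
  have hχ : 0 < χ := by rw [hχd]; positivity
  obtain ⟨Ha, hHa⟩ := big_nat (d0 * ζ ^ 2) 5 (by positivity)
  obtain ⟨Hb, hHb⟩ := big_nat (α * χ) (144 * (Δ + 1)) (by positivity)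
  obtain ⟨H, hH⟩ : ∃ H : ℕ, H = Ha + Hb + 1 := ⟨_, rfl⟩
  have hHr : (H:ℝ) = Ha + Hb + 1 := by rw [hH]; push_cast; ring
  have hHa0 : (0:ℝ) ≤ Ha := Nat.cast_nonneg _
  have hHb0 : (0:ℝ) ≤ Hb := Nat.cast_nonneg _
  obtain ⟨K, hK⟩ : ∃ K : ℕ, K = (Δ + 1) ^ (H + 1) := ⟨_, rfl⟩
  have hK1 : (1:ℝ) ≤ K := by
    have : 1 ≤ K := by rw [hK]; exact Nat.one_le_pow _ _ (by omega)
    exact_mod_cast this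
  obtain ⟨cc, hcc⟩ : ∃ c : ℝ, c = K * (Fintype.card (Code K) : ℝ) := ⟨_, rfl⟩
  have hcc0 : 0 ≤ cc := by rw [hcc]; positivity
  obtain ⟨ℓa, hℓa⟩ := big_nat (ζ * α) (12 * cc) (by positivity)
  obtain ⟨ℓb, hℓb⟩ := big_nat (α * χ) (144 * cc) (by positivity)
  obtain ⟨ℓ, hℓ⟩ : ∃ H : ℕ, H = ℓa + ℓb + 1 := ⟨_, rfl⟩
  obtain ⟨L, hL⟩ : ∃ L : ℝ, L = ((2 * ℓ : ℕ) : ℝ) := ⟨_, rfl⟩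
  have hLa : (ℓa:ℝ) ≤ L := by rw [hL]; exact_mod_cast (by omega : ℓa ≤ 2 * ℓ)
  have hLb : (ℓb:ℝ) ≤ L := by rw [hL]; exact_mod_cast (by omega : ℓb ≤ 2 * ℓ)
  have hL1 : 1 ≤ L := by rw [hL]; exact_mod_cast (by omega : 1 ≤ 2 * ℓ)
  obtain ⟨ε₁, hε₁d⟩ : ∃ d : ℝ, d = ζ / (2 * K) := ⟨_, rfl⟩
  have hε₁ : 0 < ε₁ := by rw [hε₁d]; positivity
  have hKe : 2 * K * ε₁ ≤ ζ := by rw [hε₁d]; apply le_of_eq; field_simp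
  have hε₁1 : ε₁ ≤ 1 := by
    rw [hε₁d, div_le_one (by positivity)]; linarith
  obtain ⟨q, hq⟩ : ∃ q, q = ⌈2 / d0⌉₊ := ⟨_, rfl⟩
  have q1 : 2 ≤ d0 * q := by
    have := Nat.le_ceil (2 / d0)
    rw [← hq, div_le_iff₀ hd0] at this
    linarith
  have q2 : q * d0 ≤ 3 := by
    have := (Nat.ceil_lt_add_one (show 0 ≤ 2 / d0 by positivity)).le
    rw [← hq] at this
    have := mul_le_mul_of_nonneg_right this hd0.le
    have e : (2 / d0 + 1) * d0 = 2 + d0 := by field_simp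
    linarith
  obtain ⟨ε, hε, a1, a2, a3, a4, a5, a6⟩ := (small_pos.and ((small_ev (4 * L) ε₁ hε₁).and
    ((small_ev (12 * L) (ζ * d0 * ε₁) (by positivity)).and ((small_ev 2 ζ hζ).and ((small_ev 2 d0 hd0).and
    ((small_ev (64 * L) 1 one_pos).and (small_ev (128 * Δ) (d0 * ζ) (by positivity)))))))).exists
  obtain ⟨ξ, hξ, x1, x2, x3⟩ := (small_pos.and ((small_ev 3 α hα).and ((small_ev 2 (α * ζ) (by positivity)).and
    (small_ev 1 d0 hd0)))).exists
  obtain ⟨l, hl⟩ := big_nat d0 1 hd0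
  obtain ⟨kmax, hkmax⟩ : ∃ k, k = SzemerediRegularity.bound ε l := ⟨_, rfl⟩
  obtain ⟨μ, hμd⟩ : ∃ d : ℝ, d = d0 * ζ / (64 * K) := ⟨_, rfl⟩
  have hμ : 0 < μ := by rw [hμd]; positivity
  have m2 : 64 * (μ * K) ≤ d0 * ζ := by rw [hμd]; apply le_of_eq; field_simp
  obtain ⟨M, m1⟩ := big_nat μ (2 * kmax) hμ
  obtain ⟨D1, hD⟩ := big_nat (d0 * ζ) (192 * kmax * M * Δ * L) (by positivity)
  obtain ⟨cm, hcm⟩ := big_nat d0 (4 * kmax) hd0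
  obtain ⟨R, hR⟩ : ∃ R : ℕ, R = (((2 * ℓ + 1) * 2) ^ (2 * ℓ)) ^ kmax * (cm * (kmax * (2 * ℓ) ^ kmax)) := ⟨_, rfl⟩
  obtain ⟨η, hη, y1, y2⟩ := (small_pos.and ((small_ev (4 * kmax * (2 * Δ + D1 + 1) * (16 * L)) 1 one_pos).and
    (small_ev (4 * kmax * (32 * Δ)) (d0 * ζ) (by positivity)))).exists
  obtain ⟨δ, hδ, z1, z2, z3, z4, z5, z6, z7, z8, z9, z10, z11, z12, z13, z14, z15, z16, z17⟩ := (small_pos.and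
    ((small_ev (2 * L) (ζ * d0) (by positivity)).and ((small_ev (2 * L) ε₁ hε₁).and
    ((small_ev (2 * L) (ζ * d0 * ε₁) (by positivity)).and ((small_ev (4 * L * R) (ζ * d0) (by positivity)).and
    ((small_ev (2 * R) χ hχ).and ((small_ev 144 (α * χ) (by positivity)).and
    ((small_ev 2 (ζ * α) (by positivity)).and ((small_ev 1 ζ hζ).and ((small_ev 2 μ hμ).and
    ((small_ev 1 χ hχ).and ((small_ev (64 * Δ) (d0 * ζ) (by positivity)).and
    ((small_ev (16 * (D1 + Δ)) (d0 * ζ) (by positivity)).and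
    ((small_ev (2 * q * (2 * Δ + D1) * (16 * L)) 1 one_pos).and
    ((small_ev (32 * L) 1 one_pos).and ((small_ev (64 * Δ) (d0 * ζ) (by positivity)).and
    ((small_ev (2 * ((2 * Δ + D1 + 1) * (16 * L))) 1 one_pos).and
    (small_ev (64 * Δ) (d0 * ζ) (by positivity))))))))))))))))))).exists
  refine ⟨{
    d0 := d0, χ := χ, ε := ε, ε₁ := ε₁, ξ := ξ, μ := μ, η := η, δ := δ, H := H, K := K, ℓ := ℓ, l := l
    kmax := kmax, M := M, D1 := D1, Rmax := R, q := q, hα := hα, hα1 := hα1, hζ := hζ, hζ1 := hζ1, hΔ := hΔ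
    hd0 := hd0, hd1 := hd1, hχ := hχ, hε := hε, hε₁ := hε₁, hξ := hξ, hμ := hμ, hη := hη, hδ := hδ
    hH := by omega
    hK := hK
    hℓ := by omega
    hkmax := hkmax, hKe := hKe
    c2 := by rw [← hL]; linarith
    c3 := by rw [← hL]; linarith
    c3' := hε₁1
    c1 := by rw [← hL]; linarith
    c4 := by rw [← hL]; linarith
    c5 := a3, c6 := a4, x1 := x1, x2 := x2
    x3 := by linarith
    hl := hl
    d12 := by rw [hd]; linarith
    l1 := by
      rw [← hL, ← hcc]
      exact hℓa.trans (mul_le_mul_of_nonneg_left hLa (by positivity))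
    l2 := by
      rw [← hL, ← hcc]
      exact hℓb.trans (mul_le_mul_of_nonneg_left hLb (by positivity))
    R1 := by rw [← hL]; exact z4
    R2 := z5
    R3 := ?_
    H1 := by
      have := mul_le_mul_of_nonneg_left (show (Ha:ℝ) ≤ H by linarith) (show 0 ≤ d0 * ζ ^ 2 by positivity)
      linarith
    H2 := hHb.trans (mul_le_mul_of_nonneg_left (by linarith) (by positivity))
    e1 := z6
    e2 := z7
    e3 := by linarith
    e4 := z9
    e5 := by linarith
    e6 := z11
    e7 := z12
    e8 := by rw [← hL]; exact z13
    m1 := m1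
    m2 := m2
    D2 := by rw [← hL]; linarith
    q1 := q1
    q2 := q2
    g1 := by rw [← hL]; linarith
    g2 := by linarith
    g3 := by rw [← hL]; linarith
    g4 := by linarith
    g5 := by rw [hχd]; apply le_of_eq; field_simp }⟩
  intro k kb c hk hkb hc
  rw [hR]
  have hc' : c ≤ cm := by
    have h1 : (k:ℝ) ≤ kmax := by exact_mod_cast hk
    have h2 : d0 * (c:ℝ) ≤ d0 * cm := by linarith
    exact_mod_cast le_of_mul_le_mul_left h2 hd0
  apply Nat.mul_le_mul
  · exact Nat.pow_le_pow_right (by positivity) hkb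
  · exact Nat.mul_le_mul hc' (Nat.mul_le_mul hkb (Nat.pow_le_pow_right (by omega) hk))

end

section

set_option linter.unusedSectionVars false
set_option linter.unusedVariables false

theorem deg_eq_dg {n : ℕ} (G : SimpleGraph (Fin n)) (v : Fin n) : deg G v = dg G v := by
  classical
  unfold deg dg
  rw [Set.ncard_eq_toFinset_card']
  congr 1
  ext u
  simp

theorem hole_of {n r : ℕ} (G : SimpleGraph (Fin n)) (h : biIndep G < r) :
    ∀ S T : Finset (Fin n), Disjoint S T → S.card = r → T.card = r → ∃ a ∈ S, ∃ b ∈ T, G.Adj a b := by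
  intro S T hd hS hT
  by_contra hc
  push Not at hc
  have hmem : r ∈ {r : ℕ | ∀ s t : ℕ, s + t = r → HasBipartiteHole G s t} := by
    intro s t hst
    obtain ⟨S', h1, h2⟩ := Finset.exists_subset_card_eq (show s ≤ S.card by omega)
    obtain ⟨T', h3, h4⟩ := Finset.exists_subset_card_eq (show t ≤ T.card by omega)
    exact ⟨S', T', Finset.disjoint_of_subset_left h1 (Finset.disjoint_of_subset_right h3 hd), h2, h4,
      fun a ha b hb => hc a (h1 ha) b (h3 hb)⟩
  have hbd : BddAbove {r : ℕ | ∀ s t : ℕ, s + t = r → HasBipartiteHole G s t} := by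
    refine ⟨n, ?_⟩
    intro r' hr'
    obtain ⟨A, B, _, hA, _, _⟩ := hr' r' 0 (by omega)
    have := Finset.card_le_univ A
    rw [Fintype.card_fin] at this
    omega
  have := le_csSup hbd hmem
  unfold biIndep at h
  omega

theorem tree_edges {m : ℕ} (T : SimpleGraph (Fin m)) (hT : T.IsTree) : T.edgeSet.ncard = m - 1 := by
  classical
  have h := hT.card_edgeFinset
  rw [Set.ncard_eq_toFinset_card']
  rw [Fintype.card_fin] at h
  have : T.edgeSet.toFinset.card = T.edgeFinset.card := by congr!
  omega

open Classical in
theorem edges_le {n : ℕ} (G : SimpleGraph (Fin n)) (α ξ : ℝ) (hξ : 0 ≤ ξ) (hα : 0 ≤ α) (Bad : Finset (Fin n))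
    (hB : (Bad.card : ℝ) ≤ ξ * n) (hb : ∀ v, v ∉ Bad → (dg G v : ℝ) ≤ (α + ξ) * n) :
    (G.edgeSet.ncard : ℝ) ≤ (α + 2 * ξ) * (n * n) / 2 ∧ (G.edgeSet.ncard : ℝ) ≤ (n:ℝ) * n / 2 := by
  have h0 : ∀ v, dg G v = G.degree v := by
    intro v
    rw [← deg_eq_dg]
    unfold deg
    rw [Set.ncard_eq_toFinset_card', ← SimpleGraph.card_neighborFinset_eq_degree]
    congr!
  have h1 : ∑ v, dg G v = 2 * G.edgeSet.ncard := by
    rw [Finset.sum_congr rfl (fun v _ => h0 v), SimpleGraph.sum_degrees_eq_twice_card_edges,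
      Set.ncard_eq_toFinset_card']
    congr!
  have h1r : ∑ v, (dg G v : ℝ) = 2 * G.edgeSet.ncard := by exact_mod_cast h1
  have hn : ∀ v, (dg G v : ℝ) ≤ n := by
    intro v
    have : dg G v ≤ n := by
      rw [h0]
      have := (G.degree_lt_card_verts v).le
      simpa using this
    exact_mod_cast this
  constructor
  · have h2 : ∑ v, (dg G v : ℝ) ≤ ∑ v : Fin n, ((α + ξ) * n + if v ∈ Bad then (n:ℝ) else 0) := by
      apply Finset.sum_le_sum
      intro v _
      by_cases hv : v ∈ Bad
      · rw [if_pos hv]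
        have := hn v
        have : 0 ≤ (α + ξ) * n := by positivity
        linarith
      · rw [if_neg hv]
        have := hb v hv
        linarith
    rw [Finset.sum_add_distrib, Finset.sum_const, Finset.card_univ, Fintype.card_fin, nsmul_eq_mul,
      Finset.sum_ite_mem, Finset.univ_inter, Finset.sum_const, nsmul_eq_mul] at h2
    have h3 := mul_le_mul_of_nonneg_right hB (Nat.cast_nonneg (α := ℝ) n)
    linarith
  · have h2 : ∑ v, (dg G v : ℝ) ≤ ∑ v : Fin n, (n:ℝ) := Finset.sum_le_sum (fun v _ => hn v)
    rw [Finset.sum_const, Finset.card_univ, Fintype.card_fin, nsmul_eq_mul] at h2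
    linarith

theorem pull_back {n Δ τ : ℕ} {m : Fin τ → ℕ} (G : SimpleGraph (Fin n)) (T : ∀ i, SimpleGraph (Fin (m i)))
    (P : Fin τ → PTree Δ) (hPm : ∀ i, (P i).m = m i) (g : ∀ i, Fin (m i) → ℕ)
    (g1 : ∀ i, Function.Injective (g i)) (g2 : ∀ i a, g i a < m i)
    (g3 : ∀ i a b, (T i).Adj a b → (1 ≤ g i a ∧ (P i).p (g i a) = g i b) ∨ (1 ≤ g i b ∧ (P i).p (g i b) = g i a))
    {τ' : ℕ} (P' : Fin τ' → PTree Δ) (gr : Fin τ → Fin τ') (off : Fin τ → ℕ)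
    (o1 : ∀ i, off i + (P i).m ≤ (P' (gr i)).m ∧
      ∀ v, 1 ≤ v → v < (P i).m → (P' (gr i)).p (off i + v) = off i + (P i).p v)
    (o2 : ∀ i i', i ≠ i' → gr i = gr i' → ∀ v, 1 ≤ v → v < (P i).m → ∀ v', 1 ≤ v' → v' < (P i').m →
      off i + v ≠ off i' + v')
    (ψ : Fin τ' → ℕ → Fin n)
    (p1 : ∀ i, ∀ v < (P' i).m, ∀ v' < (P' i).m, ψ i v = ψ i v' → v = v')
    (p2 : ∀ i, ∀ v < (P' i).m, 1 ≤ v → G.Adj (ψ i ((P' i).p v)) (ψ i v))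
    (p3 : ∀ i i', i ≠ i' → ∀ v < (P' i).m, 1 ≤ v → ∀ v' < (P' i').m, 1 ≤ v' →
        s(ψ i ((P' i).p v), ψ i v) ≠ s(ψ i' ((P' i').p v'), ψ i' v')) : PacksInto T G := by
  have hlt : ∀ i a, off i + g i a < (P' (gr i)).m := by
    intro i a
    have h1 := (o1 i).1
    have h2 := g2 i a
    have h3 := hPm i
    omega
  have key : ∀ i a b, (T i).Adj a b → ∃ v, 1 ≤ v ∧ v < (P i).m ∧
      s(ψ (gr i) (off i + g i a), ψ (gr i) (off i + g i b)) =
        s(ψ (gr i) ((P' (gr i)).p (off i + v)), ψ (gr i) (off i + v)) := by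
    intro i a b hab
    rcases g3 i a b hab with ⟨h1, h2⟩ | ⟨h1, h2⟩
    · refine ⟨g i a, h1, by rw [hPm]; exact g2 i a, ?_⟩
      rw [(o1 i).2 _ h1 (by rw [hPm]; exact g2 i a), h2]
      exact Sym2.eq_swap
    · refine ⟨g i b, h1, by rw [hPm]; exact g2 i b, ?_⟩
      rw [(o1 i).2 _ h1 (by rw [hPm]; exact g2 i b), h2]
  refine ⟨fun i a => ψ (gr i) (off i + g i a), ?_, ?_, ?_⟩
  · intro i a b hab
    have := p1 _ _ (hlt i a) _ (hlt i b) hab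
    exact g1 i (by omega)
  · intro i a b hab
    obtain ⟨v, h1, h2, h3⟩ := key i a b hab
    have h4 := p2 (gr i) (off i + v) (by have := (o1 i).1; omega) (by omega)
    rw [← SimpleGraph.mem_edgeSet] at h4 ⊢
    rw [h3]
    exact h4
  · intro i j hij e he f hf
    induction e using Sym2.ind with
    | _ a b =>
    induction f using Sym2.ind with
    | _ c d =>
    rw [SimpleGraph.mem_edgeSet] at he hf
    obtain ⟨v, h1, h2, h3⟩ := key i a b he
    obtain ⟨v', h1', h2', h3'⟩ := key j c d hf
    rw [Sym2.map_mk, Sym2.map_mk]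
    change s(ψ (gr i) (off i + g i a), ψ (gr i) (off i + g i b)) ≠
      s(ψ (gr j) (off j + g j c), ψ (gr j) (off j + g j d))
    rw [h3, h3']
    have hv := (o1 i).1
    have hv' := (o1 j).1
    by_cases hg : gr i = gr j
    · have hne := o2 i j hij hg v h1 h2 v' h1' h2'
      rw [hg] at hv ⊢
      intro heq
      have q1 := (P' (gr j)).hp (off i + v) (by omega)
      have q2 := (P' (gr j)).hp (off j + v') (by omega)
      rcases Sym2.eq_iff.1 heq with ⟨_, k⟩ | ⟨k1, k2⟩
      · exact hne (p1 _ _ (by omega) _ (by omega) k)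
      · have r1 := p1 _ _ (by omega) _ (by omega) k1
        have r2 := p1 _ _ (by omega) _ (by omega) k2
        omega
    · exact p3 _ _ hg _ (by omega) (by omega) _ (by omega) (by omega)

end

/-- Theorem 1 (main theorem): approximate decomposition of almost regular graphs
with small bi-independence number into bounded-degree trees on at most `(1-ν)n`
vertices. -/
theorem almost_regular_tree_packing
    (Δ : ℕ) (α ν : ℝ) (hα0 : 0 < α) (hα1 : α < 1) (hν0 : 0 < ν) (hν1 : ν < 1) :
    ∃ (ξ η : ℝ) (n₀ : ℕ), 0 < ξ ∧ 0 < η ∧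
      ∀ n : ℕ, n₀ ≤ n →
      ∀ G : SimpleGraph (Fin n),
        (({v : Fin n | ¬ ((α - ξ) * n ≤ (deg G v : ℝ) ∧ (deg G v : ℝ) ≤ (α + ξ) * n)}.ncard : ℝ)
          ≤ ξ * n) →
        (biIndep G : ℝ) ≤ η * n →
        ∀ (τ : ℕ) (m : Fin τ → ℕ) (T : ∀ i, SimpleGraph (Fin (m i))),
          (∀ i, (T i).IsTree) →
          (∀ i, (m i : ℝ) ≤ (1 - ν) * n) →
          (∀ i v, deg (T i) v ≤ Δ) →
          ((∑ i, ((T i).edgeSet.ncard) : ℝ) ≤ (1 - ν) * (G.edgeSet.ncard : ℝ)) →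
          PacksInto T G := by
  classical
  obtain ⟨C⟩ := exists_cst α (ν / 40) (Δ + 1) hα0 hα1.le (by positivity) (by linarith) (by omega)
  have hν' : 0 < 1 - ν := by linarith
  obtain ⟨N1, hN1⟩ := big_nat C.δ 1 C.hδ
  obtain ⟨N2, hN2⟩ := big_nat (1 - ν) 2 hν'
  have hkm : 0 < C.kmax := by
    rw [C.hkmax]; exact SzemerediRegularity.bound_pos _ _
  refine ⟨C.ξ, C.η, C.kmax * N1 + C.kmax * ⌈1 / C.ξ⌉₊ + C.l + N2 + 1, C.hξ, C.hη, ?_⟩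
  intro n hn G hbad hbi τ m T hT hTm hTd hTe
  have hn1 : 1 ≤ C.δ * (n / C.kmax : ℕ) := by
    have h1 : N1 ≤ n / C.kmax := by
      rw [Nat.le_div_iff_mul_le hkm, mul_comm]
      omega
    have h2 : (N1 : ℝ) ≤ ((n / C.kmax : ℕ) : ℝ) := by exact_mod_cast h1
    have := mul_le_mul_of_nonneg_left h2 C.hδ.le
    linarith
  have hnpos : (1:ℝ) ≤ n := by
    have : 1 ≤ n := by omega
    exact_mod_cast this
  have hn4 : 2 ≤ (1 - ν) * n := by
    have h1 : N2 ≤ n := by omega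
    have h2 : (N2 : ℝ) ≤ n := by exact_mod_cast h1
    have := mul_le_mul_of_nonneg_left h2 hν'.le
    linarith
  -- bad vertices
  obtain ⟨Bad, hBad⟩ : ∃ B : Finset (Fin n), B = Finset.univ.filter
    (fun v => ¬ ((α - C.ξ) * n ≤ (deg G v : ℝ) ∧ (deg G v : ℝ) ≤ (α + C.ξ) * n)) := ⟨_, rfl⟩
  have hB : (Bad.card : ℝ) ≤ C.ξ * n := by
    refine le_trans (le_of_eq ?_) hbad
    rw [← Set.ncard_coe_finset, hBad]
    simp
  have hb : ∀ v, v ∉ Bad → (α - C.ξ) * n ≤ dg G v ∧ (dg G v : ℝ) ≤ (α + C.ξ) * n := by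
    intro v hv
    rw [← deg_eq_dg]
    by_contra hc
    exact hv (by rw [hBad]; simpa using hc)
  -- holes
  have hηn : 0 ≤ C.η * n := mul_nonneg C.hη.le (by linarith)
  have hfl := flr hηn
  have hlt : biIndep G < ⌊C.η * n⌋₊ + 1 := Nat.lt_succ_of_le (Nat.le_floor hbi)
  have hole := hole_of G hlt
  -- trees
  have hex := fun i => tree_to_pt (Δ := Δ + 1) (T i) (hT i) (fun v => (hTd i v).trans (by omega))
  choose P hPm g g1 g2 g3 using hex
  obtain ⟨q, hq⟩ : ∃ q, q = ⌊(1 - ν) * (n:ℝ)⌋₊ := ⟨_, rfl⟩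
  have hq12 := flr (show 0 ≤ (1 - ν) * (n:ℝ) by linarith)
  rw [← hq] at hq12
  have hPq : ∀ i, (P i).m - 1 ≤ q := by
    intro i
    have : m i ≤ q := by rw [hq]; exact Nat.le_floor (hTm i)
    rw [hPm]; omega
  obtain ⟨τ', P', gr, off, o1, o2, oS, oq, oτ⟩ := grouping P q hPq
  obtain ⟨S, hS⟩ : ∃ S, S = ∑ i, ((P i).m - 1) := ⟨_, rfl⟩
  rw [← hS] at oS oτ
  have hSe : (S : ℝ) ≤ (1 - ν) * (G.edgeSet.ncard : ℝ) := by
    refine le_trans (le_of_eq ?_) hTe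
    rw [hS]
    push_cast
    apply Finset.sum_congr rfl
    intro i _
    rw [tree_edges (T i) (hT i), hPm]
  obtain ⟨e1, e2⟩ := edges_le G α C.ξ C.hξ.le hα0.le Bad hB (fun v hv => (hb v hv).2)
  have f1 := mul_le_mul_of_nonneg_left e1 hν'.le
  have f2 := mul_le_mul_of_nonneg_left e2 hν'.le
  have hτ : (τ' : ℝ) ≤ 3 * n := by
    have h1 : (τ' : ℝ) * q ≤ 2 * S + q := by exact_mod_cast oτ
    have h2 : (τ' : ℝ) * q ≤ (2 * n + 1) * q := by nlinarith
    have h3 : (0:ℝ) < q := by linarith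
    have := le_of_mul_le_mul_right h2 h3
    linarith
  obtain ⟨φ, p1, p2, p3⟩ := core_pack C n hn1 (by omega) (by omega) G Bad hB hb (⌊C.η * n⌋₊ + 1)
    (by push_cast; linarith) hole P' hτ
    (by
      intro j
      have h1 := oq j
      have h2 : (P' j).m ≤ q + 1 := by omega
      have h3 : ((P' j).m : ℝ) ≤ q + 1 := by exact_mod_cast h2
      have h4 : 40 * (ν / 40) = ν := by ring
      rw [h4]; linarith)
    (by
      rw [oS]
      have h4 : 40 * (ν / 40) = ν := by ring
      rw [h4]; linarith)
  exact pull_back G T P hPm g g1 g2 g3 P' gr off o1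
    (fun i i' h h' v a b v' c d => o2 i i' h h' v v' a b c d) φ p1 p2 p3

end ApproxDecomp
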